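/- Let Z ⊂ P^{n+2} be a smooth cubic hypersurface over ℂ with n = 2 or n = 3, and let X = X_d ⊂ Z be a smooth divisor in |O_Z(d)|. If d ≥ 5n − 2, then 2(d − n) + 2 ≤ irr(X) ≤ 2d. -/

import Mathlib

open MvPolynomial

noncomputable section

/-- Points of the complex projective space whose homogeneous coordinates are
indexed by `ι` (so for `ι = Fin (N+1)` this is `ℙ^N`). -/
abbrev PPt (ι : Type) : Type := Projectivization ℂ (ι → ℂ)

/-- A polynomial vanishes at a projective point if it vanishes at every
representative vector of the point. -/
def PVanish {ι : Type} (f : MvPolynomial ι ℂ) (x : PPt ι) : Prop :=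
  ∀ (v : ι → ℂ) (hv : v ≠ 0), Projectivization.mk ℂ v hv = x → eval v f = 0

/-- The zero locus of a polynomial in projective space. -/
def ZeroSet {ι : Type} (f : MvPolynomial ι ℂ) : Set (PPt ι) :=
  {x | PVanish f x}

/-- Zariski-closed subsets of projective space: common zero loci of families of
homogeneous polynomials. -/
def IsZClosed {ι : Type} (Y : Set (PPt ι)) : Prop :=
  ∃ fs : Set (MvPolynomial ι ℂ),
    (∀ f ∈ fs, ∃ e, f.IsHomogeneous e) ∧ Y = {x | ∀ f ∈ fs, PVanish f x}

/-- `U` contains a dense (Zariski-)open subset of `X`: there is a Zariski-closed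
set `Y` not containing `X` with `X \ Y ⊆ U`.  Taking `X = Set.univ` this is the
notion of a set containing "the general point" of the ambient projective space. -/
def ContainsDenseOpenOf {ι : Type} (X U : Set (PPt ι)) : Prop :=
  ∃ Y : Set (PPt ι), IsZClosed Y ∧ ¬ X ⊆ Y ∧ X \ Y ⊆ U

/-- The set of projective points lying in (the projectivization of) a linear
subspace `W`. -/
def LinSet {ι : Type} (W : Submodule ℂ (ι → ℂ)) : Set (PPt ι) :=
  {x | x.submodule ≤ W}

/-- A line in projective space: the projectivization of a 2-dimensional
linear subspace. -/
def IsLine {ι : Type} (L : Set (PPt ι)) : Prop :=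
  ∃ W : Submodule ℂ (ι → ℂ), Module.finrank ℂ W = 2 ∧ L = LinSet W

/-- A smooth plane conic with supporting plane `P(W)`: the zero locus, inside the
projective plane `P(W)`, of a quadric which does not vanish identically on `W`
and whose restriction to `W` has no singular points. -/
def IsConicIn {ι : Type} [Fintype ι] (W : Submodule ℂ (ι → ℂ))
    (C : Set (PPt ι)) : Prop :=
  Module.finrank ℂ W = 3 ∧
  ∃ f : MvPolynomial ι ℂ, f.IsHomogeneous 2 ∧
    C = {x | x.submodule ≤ W ∧ PVanish f x} ∧
    (∃ v ∈ W, eval v f ≠ 0) ∧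
    (∀ v ∈ W, v ≠ 0 → eval v f = 0 →
      ∃ w ∈ W, (∑ i, eval v (pderiv i f) * w i) ≠ 0)

/-- A smooth plane conic in projective space. -/
def IsSmoothConic {ι : Type} [Fintype ι] (C : Set (PPt ι)) : Prop :=
  ∃ W, IsConicIn W C

/-- The Cayley–Bacharach condition `CB(m)`: every degree-`m` hypersurface
containing all points of `S` but one contains all of `S`. -/
def SatisfiesCB {ι : Type} (m : ℕ) (S : Finset (PPt ι)) : Prop :=
  ∀ f : MvPolynomial ι ℂ, f.IsHomogeneous m →
    ∀ p ∈ S, (∀ q ∈ S, q ≠ p → PVanish f q) → PVanish f p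

/-- A smooth projective hypersurface of degree `e`: the partial derivatives of
its (homogeneous) equation have no common nontrivial zero. -/
def IsSmoothHyp {ι : Type} [Fintype ι] (f : MvPolynomial ι ℂ) (e : ℕ) : Prop :=
  f.IsHomogeneous e ∧ f ≠ 0 ∧
    ∀ v : ι → ℂ, v ≠ 0 → ¬ (∀ i, eval v (pderiv i f) = 0)

/-- `{f = g = 0}` is a smooth complete intersection: at every common nontrivial
zero the two gradients are linearly independent. -/
def IsSmoothCI2 {ι : Type} [Fintype ι] (f g : MvPolynomial ι ℂ) : Prop :=
  ∀ v : ι → ℂ, v ≠ 0 → eval v f = 0 → eval v g = 0 →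
    ∀ a b : ℂ, (∀ i, a * eval v (pderiv i f) + b * eval v (pderiv i g) = 0) →
      a = 0 ∧ b = 0

/-- `{f = g = h = 0}` is a smooth complete intersection: at every common
nontrivial zero the three gradients are linearly independent. -/
def IsSmoothCI3 {ι : Type} [Fintype ι] (f g h : MvPolynomial ι ℂ) : Prop :=
  ∀ v : ι → ℂ, v ≠ 0 → eval v f = 0 → eval v g = 0 → eval v h = 0 →
    ∀ a b c : ℂ,
      (∀ i, a * eval v (pderiv i f) + b * eval v (pderiv i g)
        + c * eval v (pderiv i h) = 0) →
      a = 0 ∧ b = 0 ∧ c = 0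

/-- A rational map from (a subvariety of) the projective space with coordinates
`ι` to `ℙ^n`, given by an `(n+1)`-tuple of homogeneous polynomials of a common
degree `e`. -/
structure RatMapTo (ι : Type) (n : ℕ) where
  F : Fin (n + 1) → MvPolynomial ι ℂ
  e : ℕ
  homog : ∀ j, (F j).IsHomogeneous e

namespace RatMapTo

variable {ι : Type} {n : ℕ}

def evalVec (φ : RatMapTo ι n) (v : ι → ℂ) : Fin (n + 1) → ℂ :=
  fun j => eval v (φ.F j)

/-- `φ` is defined at `x` and sends `x` to `y`. -/
def mapsTo (φ : RatMapTo ι n) (x : PPt ι) (y : PPt (Fin (n + 1))) : Prop :=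
  ∀ (v : ι → ℂ) (hv : v ≠ 0), Projectivization.mk ℂ v hv = x →
    ∃ hw : φ.evalVec v ≠ 0, Projectivization.mk ℂ (φ.evalVec v) hw = y

/-- The fiber over `y` of the restriction of `φ` to `X`. -/
def fiber (φ : RatMapTo ι n) (X : Set (PPt ι)) (y : PPt (Fin (n + 1))) :
    Set (PPt ι) :=
  {x ∈ X | φ.mapsTo x y}

/-- The restriction of `φ` to `X` is a dominant rational map of degree `δ`:
the fiber over a general point of `ℙ^n` consists of exactly `δ` points. -/
def DominantOfDegree (φ : RatMapTo ι n) (X : Set (PPt ι)) (δ : ℕ) : Prop :=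
  0 < δ ∧
  ∃ V : Set (PPt (Fin (n + 1))), ContainsDenseOpenOf Set.univ V ∧
    ∀ y ∈ V, (φ.fiber X y).Finite ∧ (φ.fiber X y).ncard = δ

end RatMapTo

/-- The degree of irrationality of `X`: the minimal degree of a dominant
rational map `X ⇢ ℙ^n`. -/
def irr {ι : Type} (n : ℕ) (X : Set (PPt ι)) : ℕ :=
  sInf {δ : ℕ | ∃ φ : RatMapTo ι n, φ.DominantOfDegree X δ}

/-- `ψ` is the linear projection away from the linear subspace `P(W)`:
it is given by linear forms whose common kernel is exactly `W`. -/
def IsLinearProjectionFrom {ι : Type} {n : ℕ} (ψ : RatMapTo ι n)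
    (W : Submodule ℂ (ι → ℂ)) : Prop :=
  ψ.e = 1 ∧ ∀ v : ι → ℂ, ψ.evalVec v = 0 ↔ v ∈ W

/-- The rational maps `φ` and `ψ` on `X` are birationally equivalent: they
differ by composition with a birational automorphism `τ` of the target `ℙ^n`. -/
def BirEquivTo {ι : Type} {n : ℕ} (X : Set (PPt ι)) (φ ψ : RatMapTo ι n) : Prop :=
  ∃ τ : RatMapTo (Fin (n + 1)) n, τ.DominantOfDegree Set.univ 1 ∧
    ∃ U : Set (PPt ι), ContainsDenseOpenOf X U ∧
      ∀ x ∈ U, ∃ y z, φ.mapsTo x y ∧ ψ.mapsTo x z ∧ τ.mapsTo z y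

/-- `A` is contained in a proper Zariski-closed subset of the (projective) space
of degree-`d` forms: it is cut out by a polynomial in the coefficients which is
not identically zero on degree-`d` forms. -/
def CoeffPolyProperClosed {ι : Type} (d : ℕ) (A : Set (MvPolynomial ι ℂ)) : Prop :=
  ∃ (κ : ℕ) (mons : Fin κ → (ι →₀ ℕ)) (Q : MvPolynomial (Fin κ) ℂ),
    (∀ g ∈ A, eval (fun j => coeff (mons j) g) Q = 0) ∧
    (∃ g : MvPolynomial ι ℂ, g.IsHomogeneous d ∧
      eval (fun j => coeff (mons j) g) Q ≠ 0)

end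


open MvPolynomial

/-- weighted Cayley-Bacharach: sums against products of `m` linear forms vanish. -/
def WCB {V : Type*} [AddCommGroup V] [Module ℂ V] (m : ℕ) (S : Finset V) (c : V → ℂ) : Prop :=
  (∀ v ∈ S, c v ≠ 0) ∧ ∀ L : Fin m → (V →ₗ[ℂ] ℂ), ∑ v ∈ S, c v * ∏ i, L i v = 0

open Classical in
theorem WCB.residual {V : Type*} [AddCommGroup V] [Module ℂ V] {m : ℕ} {S : Finset V} {c : V → ℂ}
    (h : WCB (m+1) S c) (H : V →ₗ[ℂ] ℂ) :
    WCB m (S.filter (fun v => H v ≠ 0)) (fun v => c v * H v) := by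
  refine ⟨fun v hv => mul_ne_zero (h.1 v (Finset.mem_filter.1 hv).1) (Finset.mem_filter.1 hv).2, ?_⟩
  intro L
  have := h.2 (Fin.cons H L)
  refine Eq.trans ?_ this
  rw [Finset.sum_filter]
  refine Finset.sum_congr rfl fun v _ => ?_
  simp only [Fin.prod_univ_succ, Fin.cons_zero, Fin.cons_succ]
  split_ifs with h0
  · ring
  · have h0 : H v = 0 := by simpa using h0
    simp [h0]

theorem exists_dual_sep {V : Type*} [AddCommGroup V] [Module ℂ V] (W : Submodule ℂ V) (v : V)
    (hv : v ∉ W) : ∃ H : V →ₗ[ℂ] ℂ, H v ≠ 0 ∧ ∀ w ∈ W, H w = 0 := by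
  obtain ⟨f, hf, hW⟩ := Submodule.exists_dual_map_eq_bot_of_notMem hv inferInstance
  refine ⟨f, hf, fun w hw => ?_⟩
  have : f w ∈ W.map f := Submodule.mem_map_of_mem hw
  rw [hW] at this
  simpa using this

theorem notMem_span_of_lam {V : Type*} [AddCommGroup V] [Module ℂ V] (lam : V →ₗ[ℂ] ℂ) {v w : V}
    (hv : lam v = 1) (hw : lam w = 1) (hne : v ≠ w) : v ∉ Submodule.span ℂ {w} := by
  intro h
  obtain ⟨a, ha⟩ := Submodule.mem_span_singleton.1 h
  have h2 : lam (a • w) = lam v := by rw [ha]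
  rw [map_smul, hw, hv] at h2
  have : a = 1 := by simpa using h2
  exact hne (by rw [← ha, this, one_smul])

open Classical in
theorem WCB.card_ge {V : Type*} [AddCommGroup V] [Module ℂ V] (lam : V →ₗ[ℂ] ℂ) :
    ∀ (m : ℕ) (S : Finset V) (c : V → ℂ), (∀ v ∈ S, lam v = 1) → WCB m S c → S.Nonempty →
      m + 2 ≤ S.card := by
  have key : ∀ (m : ℕ) (S : Finset V) (c : V → ℂ), (∀ v ∈ S, lam v = 1) → WCB m S c →
      S.Nonempty → 2 ≤ S.card := by
    intro m S c hl h hS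
    by_contra hlt
    have h1 : S.card = 1 := by have := hS.card_pos; omega
    obtain ⟨v, rfl⟩ := Finset.card_eq_one.1 h1
    have := h.2 (fun _ => lam)
    have hv := hl v (by simp)
    simp only [Finset.sum_singleton, hv, Finset.prod_const_one, mul_one] at this
    exact h.1 v (by simp) this
  intro m
  induction m with
  | zero => exact fun S c hl h hS => key 0 S c hl h hS
  | succ m ih =>
    intro S c hl h hS
    obtain ⟨v, hv, w, hw, hne⟩ := Finset.one_lt_card.1 (key _ S c hl h hS)
    obtain ⟨H, Hv, Hw⟩ := exists_dual_sep _ v (notMem_span_of_lam lam (hl v hv) (hl w hw) hne)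
    have := ih _ _ (fun x hx => hl x (Finset.mem_filter.1 hx).1) (h.residual H)
      ⟨v, Finset.mem_filter.2 ⟨hv, Hv⟩⟩
    have h3 : (S.filter (fun v => H v ≠ 0)).card < S.card := by
      apply Finset.card_lt_card
      refine Finset.filter_ssubset.2 ⟨w, hw, ?_⟩
      simpa using Hw w (Submodule.mem_span_singleton_self w)
    omega

open Classical in
theorem WCB.collinear {V : Type*} [AddCommGroup V] [Module ℂ V] (lam : V →ₗ[ℂ] ℂ) :
    ∀ (m : ℕ) (S : Finset V) (c : V → ℂ), (∀ v ∈ S, lam v = 1) → WCB m S c →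
      S.card ≤ 2 * m + 1 → ∃ u w : V, ∀ v ∈ S, v ∈ Submodule.span ℂ {u, w} := by
  intro m
  induction m with
  | zero =>
    intro S c hl h hS
    rcases S.eq_empty_or_nonempty with rfl | hne
    · exact ⟨0, 0, by simp⟩
    · have := WCB.card_ge lam 0 S c hl h hne; omega
  | succ m ih =>
    intro S c hl h hS
    rcases S.eq_empty_or_nonempty with rfl | hne
    · exact ⟨0, 0, by simp⟩
    have hc := WCB.card_ge lam _ S c hl h hne
    obtain ⟨v1, hv1, v2, hv2, hne⟩ := Finset.one_lt_card.1 (show 1 < S.card by omega)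
    by_cases hall : ∀ v ∈ S, v ∈ Submodule.span ℂ {v1, v2}
    · exact ⟨v1, v2, hall⟩
    push Not at hall
    obtain ⟨v, hv, hvn⟩ := hall
    obtain ⟨H, Hv, Hw⟩ := exists_dual_sep _ v hvn
    have hsub : S.filter (fun v => H v ≠ 0) ⊆ (S.erase v1).erase v2 := by
      intro x hx
      obtain ⟨hx, hHx⟩ := Finset.mem_filter.1 hx
      simp only [Finset.mem_erase]
      refine ⟨?_, ?_, hx⟩
      · rintro rfl; exact hHx (Hw _ (Submodule.subset_span (by simp)))
      · rintro rfl; exact hHx (Hw _ (Submodule.subset_span (by simp)))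
    have hcard := Finset.card_le_card hsub
    rw [Finset.card_erase_of_mem (Finset.mem_erase.2 ⟨hne.symm, hv2⟩),
      Finset.card_erase_of_mem hv1] at hcard
    have hl' : ∀ (H : V →ₗ[ℂ] ℂ), ∀ x ∈ S.filter (fun v => H v ≠ 0), lam x = 1 :=
      fun H x hx => hl x (Finset.mem_filter.1 hx).1
    obtain ⟨u, w, huw⟩ := ih _ _ (hl' H) (h.residual H) (by omega)
    have hge := WCB.card_ge lam _ _ _ (hl' H) (h.residual H) ⟨v, Finset.mem_filter.2 ⟨hv, Hv⟩⟩
    refine ⟨u, w, ?_⟩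
    by_contra hcon
    push Not at hcon
    obtain ⟨x, hx, hxn⟩ := hcon
    obtain ⟨H', Hx, Hw'⟩ := exists_dual_sep _ x hxn
    have hge' := WCB.card_ge lam _ _ _ (hl' H') (h.residual H')
      ⟨x, Finset.mem_filter.2 ⟨hx, Hx⟩⟩
    have hdisj : Disjoint (S.filter (fun v => H v ≠ 0)) (S.filter (fun v => H' v ≠ 0)) := by
      rw [Finset.disjoint_left]
      intro z hz hz'
      exact (Finset.mem_filter.1 hz').2 (Hw' z (huw z hz))
    have := Finset.card_le_card (Finset.union_subset (Finset.filter_subset (fun v => H v ≠ 0) S)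
      (Finset.filter_subset (fun v => H' v ≠ 0) S))
    rw [Finset.card_union_of_disjoint hdisj] at this
    omega

open MvPolynomial

theorem rename_inl_finitePresentation (σ τ : Type) [Finite σ] [Finite τ] :
    (rename (Sum.inl : σ → σ ⊕ τ) : MvPolynomial σ ℂ →ₐ[ℂ] MvPolynomial (σ ⊕ τ) ℂ).toRingHom.FinitePresentation := by
  rw [← RingHom.FinitePresentation.of_finiteType]
  have h1 : (algebraMap ℂ (MvPolynomial (σ ⊕ τ) ℂ)).FiniteType := by
    rw [RingHom.finiteType_algebraMap]; infer_instance
  refine RingHom.FiniteType.of_comp_finiteType (f := algebraMap ℂ (MvPolynomial σ ℂ)) ?_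
  convert h1
  exact (rename (Sum.inl : σ → σ ⊕ τ) : MvPolynomial σ ℂ →ₐ[ℂ] MvPolynomial (σ ⊕ τ) ℂ).comp_algebraMap

/-- Weak Nullstellensatz. -/
theorem exists_zero_of_prime {σ : Type} [Finite σ] (I : Ideal (MvPolynomial σ ℂ)) (hI : I ≠ ⊤) :
    ∃ x : σ → ℂ, ∀ p ∈ I, eval x p = 0 := by
  obtain ⟨M, hM, hle⟩ := Ideal.exists_le_maximal I hI
  obtain ⟨x, hx⟩ := (isMaximal_iff_eq_vanishingIdeal_singleton (K := ℂ)).1 hM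
  refine ⟨x, fun p hp => ?_⟩
  have := hle hp
  rw [hx, mem_vanishingIdeal_singleton_iff] at this
  simpa [aeval_eq_eval] using this

theorem dichotomy {σ τ : Type} [Finite σ] [Finite τ] (P : Set (MvPolynomial (σ ⊕ τ) ℂ)) :
    ∃ f : MvPolynomial σ ℂ, f ≠ 0 ∧
      ((∀ y : σ → ℂ, (∃ x : τ → ℂ, ∀ p ∈ P, eval (Sum.elim y x) p = 0) → eval y f = 0) ∨
       (∀ y : σ → ℂ, eval y f ≠ 0 → ∃ x : τ → ℂ, ∀ p ∈ P, eval (Sum.elim y x) p = 0)) := by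
  classical
  set φ := (rename (Sum.inl : σ → σ ⊕ τ) : MvPolynomial σ ℂ →ₐ[ℂ] MvPolynomial (σ ⊕ τ) ℂ).toRingHom with hφ
  have hφa : ∀ (y : σ → ℂ) (x : τ → ℂ) (f : MvPolynomial σ ℂ), eval (Sum.elim y x) (φ f) = eval y f := by
    intro y x f
    simp [hφ, eval_rename]
  set I := Ideal.span P with hI
  have hIfin : ∀ y : σ → ℂ, ∀ x : τ → ℂ, (∀ p ∈ P, eval (Sum.elim y x) p = 0) →
      ∀ p ∈ I, eval (Sum.elim y x) p = 0 := by
    intro y x h p hp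
    have : I ≤ RingHom.ker (eval (Sum.elim y x)) := Ideal.span_le.2 fun p hp => h p hp
    exact this hp
  by_cases hinj : ∃ f, f ≠ 0 ∧ φ f ∈ I
  · obtain ⟨f, hf, hfI⟩ := hinj
    refine ⟨f, hf, Or.inl ?_⟩
    rintro y ⟨x, hx⟩
    rw [← hφa y x]
    exact hIfin y x hx _ hfI
  · push Not at hinj
    have hcons : Topology.IsConstructible (PrimeSpectrum.zeroLocus (I : Set (MvPolynomial (σ ⊕ τ) ℂ))) := by
      rw [← Topology.isConstructible_compl]
      refine _root_.IsRetrocompact.isConstructible ?_ ?_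
      · exact (PrimeSpectrum.isClosed_zeroLocus _).isOpen_compl
      · exact PrimeSpectrum.isRetrocompact_zeroLocus_compl_of_fg (IsNoetherian.noetherian I)
    have h2 := PrimeSpectrum.isConstructible_comap_image (rename_inl_finitePresentation σ τ) hcons
    obtain ⟨D, hD⟩ := PrimeSpectrum.exists_constructibleSetData_iff.2 h2
    -- bottom is in the image
    have hbot : (⟨⊥, Ideal.isPrime_bot⟩ : PrimeSpectrum (MvPolynomial σ ℂ)) ∈ D.toSet := by
      rw [hD]
      have hi : Function.Injective ((Ideal.Quotient.mk I).comp φ) := by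
        rw [injective_iff_map_eq_zero]
        intro a ha
        by_contra hne
        exact hinj a hne (Ideal.Quotient.eq_zero_iff_mem.1 ha)
      obtain ⟨p', hp', hc⟩ := Ideal.exists_comap_eq_of_mem_minimalPrimes_of_injective hi
        (⊥ : Ideal (MvPolynomial σ ℂ)) (by rw [IsDomain.minimalPrimes_eq_singleton_bot]; rfl)
      refine ⟨PrimeSpectrum.comap (Ideal.Quotient.mk I) ⟨p', hp'⟩, ?_, ?_⟩
      · intro a ha
        show Ideal.Quotient.mk I a ∈ p'
        rw [Ideal.Quotient.eq_zero_iff_mem.2 ha]; exact p'.zero_mem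
      · ext1
        exact hc
    simp only [PrimeSpectrum.ConstructibleSetData.toSet, Set.mem_iUnion] at hbot
    obtain ⟨C, hC, hCb⟩ := hbot
    obtain ⟨hCg, hCf⟩ := hCb
    have hf : C.f ≠ 0 := by
      intro h
      apply hCf
      rw [PrimeSpectrum.mem_zeroLocus]
      simp [h]
    have hg : ∀ i, C.g i = 0 := by
      intro i
      have := hCg ⟨i, rfl⟩
      simpa using this
    refine ⟨C.f, hf, Or.inr fun y hy => ?_⟩
    set M := vanishingIdeal ℂ ({y} : Set (σ → ℂ)) with hM
    have hMp : M.IsPrime := by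
      rw [hM]; infer_instance
    have hmem : (⟨M, hMp⟩ : PrimeSpectrum (MvPolynomial σ ℂ)) ∈ D.toSet := by
      simp only [PrimeSpectrum.ConstructibleSetData.toSet, Set.mem_iUnion]
      refine ⟨C, hC, ?_, ?_⟩
      · rintro _ ⟨i, rfl⟩
        rw [hg]; exact M.zero_mem
      · intro h
        have : C.f ∈ M := h rfl
        rw [hM, mem_vanishingIdeal_singleton_iff] at this
        exact hy (by simpa [aeval_eq_eval] using this)
    rw [hD] at hmem
    obtain ⟨p', hp', hc⟩ := hmem
    obtain ⟨z, hz⟩ := exists_zero_of_prime p'.asIdeal p'.isPrime.ne_top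
    have hzy : ∀ i, z (Sum.inl i) = y i := by
      intro i
      have : (X i - MvPolynomial.C (y i) : MvPolynomial σ ℂ) ∈ M := by
        rw [hM, mem_vanishingIdeal_singleton_iff]; simp
      have h3 : (PrimeSpectrum.comap φ p').asIdeal = M := by
        have := congrArg PrimeSpectrum.asIdeal hc
        exact this
      rw [← h3] at this
      have h4 := hz _ (show φ (X i - MvPolynomial.C (y i)) ∈ p'.asIdeal from this)
      simpa [hφ, sub_eq_zero] using h4
    have hzz : z = Sum.elim y (fun j => z (Sum.inr j)) := by
      ext k
      rcases k with i | j
      · exact hzy i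
      · rfl
    refine ⟨fun j => z (Sum.inr j), fun p hp => ?_⟩
    rw [← hzz]
    exact hz p (hp' (Ideal.subset_span hp))

open MvPolynomial

noncomputable section

/-- trilinear form with coefficient tensor `c`. -/
def tri {ι : Type} [Fintype ι] {R : Type} [CommRing R] [Algebra ℂ R] (c : ι → ι → ι → ℂ)
    (x y z : ι → R) : R := ∑ i, ∑ j, ∑ k, algebraMap ℂ R (c i j k) * x i * y j * z k

section tri
variable {ι : Type} [Fintype ι] {R : Type} [CommRing R] [Algebra ℂ R] (c : ι → ι → ι → ℂ)

theorem tri_add1 (x x' y z : ι → R) : tri c (x + x') y z = tri c x y z + tri c x' y z := by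
  simp only [tri, ← Finset.sum_add_distrib, Pi.add_apply]
  exact Finset.sum_congr rfl fun i _ => Finset.sum_congr rfl fun j _ => Finset.sum_congr rfl fun k _ => by ring

theorem tri_smul1 (r : R) (x y z : ι → R) : tri c (r • x) y z = r * tri c x y z := by
  simp only [tri, Finset.mul_sum, Pi.smul_apply, smul_eq_mul]
  exact Finset.sum_congr rfl fun i _ => Finset.sum_congr rfl fun j _ => Finset.sum_congr rfl fun k _ => by ring

theorem tri_add2 (x x' y z : ι → R) : tri c y (x + x') z = tri c y x z + tri c y x' z := by
  simp only [tri, ← Finset.sum_add_distrib, Pi.add_apply]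
  exact Finset.sum_congr rfl fun i _ => Finset.sum_congr rfl fun j _ => Finset.sum_congr rfl fun k _ => by ring

theorem tri_smul2 (r : R) (x y z : ι → R) : tri c y (r • x) z = r * tri c y x z := by
  simp only [tri, Finset.mul_sum, Pi.smul_apply, smul_eq_mul]
  exact Finset.sum_congr rfl fun i _ => Finset.sum_congr rfl fun j _ => Finset.sum_congr rfl fun k _ => by ring

theorem tri_add3 (x x' y z : ι → R) : tri c y z (x + x') = tri c y z x + tri c y z x' := by
  simp only [tri, ← Finset.sum_add_distrib, Pi.add_apply]
  exact Finset.sum_congr rfl fun i _ => Finset.sum_congr rfl fun j _ => Finset.sum_congr rfl fun k _ => by ring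

theorem tri_smul3 (r : R) (x y z : ι → R) : tri c y z (r • x) = r * tri c y z x := by
  simp only [tri, Finset.mul_sum, Pi.smul_apply, smul_eq_mul]
  exact Finset.sum_congr rfl fun i _ => Finset.sum_congr rfl fun j _ => Finset.sum_congr rfl fun k _ => by ring

theorem tri_map {S : Type} [CommRing S] [Algebra ℂ S] (f : R →ₐ[ℂ] S) (x y z : ι → R) :
    f (tri c x y z) = tri c (fun i => f (x i)) (fun i => f (y i)) (fun i => f (z i)) := by
  simp only [tri, map_sum, map_mul, AlgHom.commutes]

/-- symmetric tensor -/
def SymT (c : ι → ι → ι → ℂ) : Prop := (∀ i j k, c i j k = c j i k) ∧ (∀ i j k, c i j k = c i k j)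

variable {c}
theorem tri_swap12 (h : SymT c) (x y z : ι → R) : tri c x y z = tri c y x z := by
  unfold tri
  rw [Finset.sum_comm]
  refine Finset.sum_congr rfl fun i _ => Finset.sum_congr rfl fun j _ => Finset.sum_congr rfl fun k _ => ?_
  rw [h.1]; ring

theorem tri_swap23 (h : SymT c) (x y z : ι → R) : tri c x y z = tri c x z y := by
  unfold tri
  refine Finset.sum_congr rfl fun i _ => ?_
  rw [Finset.sum_comm]
  refine Finset.sum_congr rfl fun j _ => Finset.sum_congr rfl fun k _ => ?_
  rw [h.2]; ring

end tri

/-- a line with two first order deformations -/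
structure FO (R : Type) where
  a : Fin 6 → R
  b : Fin 6 → R
  u1 : Fin 6 → R
  v1 : Fin 6 → R
  u2 : Fin 6 → R
  v2 : Fin 6 → R

section alg
variable {R : Type} [CommRing R]

def vol6 (a b w1 w2 x y : Fin 6 → R) : R := Matrix.det (Matrix.of ![a, b, w1, w2, x, y])

theorem det_upd_add {n : ℕ} (M : Fin n → Fin n → R) (i : Fin n) (x y : Fin n → R) :
    Matrix.det (Matrix.of (Function.update M i (x + y))) =
    Matrix.det (Matrix.of (Function.update M i x)) + Matrix.det (Matrix.of (Function.update M i y)) :=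
  Matrix.det_updateRow_add (Matrix.of M) i x y

theorem det_upd_smul {n : ℕ} (M : Fin n → Fin n → R) (i : Fin n) (r : R) (x : Fin n → R) :
    Matrix.det (Matrix.of (Function.update M i (r • x))) =
    r * Matrix.det (Matrix.of (Function.update M i x)) :=
  Matrix.det_updateRow_smul (Matrix.of M) i r x

theorem det_cramer_apply {n : ℕ} (f : (Fin n → R) →ₗ[R] R) (M : Fin n → Fin n → R) (w : Fin n → R) :
    Matrix.det (Matrix.of M) * f w =
      ∑ i, Matrix.det (Matrix.of (Function.update M i w)) * f (M i) := by
  have h := Matrix.mulVec_cramer (Matrix.of M).transpose w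
  have h2 := congrArg f h
  rw [map_smul, Matrix.det_transpose] at h2
  have h3 : (Matrix.of M).transpose.mulVec ((Matrix.of M).transpose.cramer w) =
      ∑ i, ((Matrix.of M).transpose.cramer w) i • (M i) := by
    ext k
    simp [Matrix.mulVec, dotProduct, Finset.sum_apply, mul_comm]
  rw [h3, map_sum] at h2
  simp only [map_smul, smul_eq_mul] at h2
  rw [← h2]
  refine Finset.sum_congr rfl fun i _ => ?_
  rw [Matrix.cramer_transpose_apply]
  rfl

theorem upd6_2 {α : Type} (a b w1 w2 x y w : α) :
    Function.update ![a, b, w1, w2, x, y] 2 w = ![a, b, w, w2, x, y] := by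
  ext i; fin_cases i <;> simp [Function.update]
theorem upd6_3 {α : Type} (a b w1 w2 x y w : α) :
    Function.update ![a, b, w1, w2, x, y] 3 w = ![a, b, w1, w, x, y] := by
  ext i; fin_cases i <;> simp [Function.update]
theorem upd6_0 {α : Type} (a b w1 w2 x y w : α) :
    Function.update ![a, b, w1, w2, x, y] 0 w = ![w, b, w1, w2, x, y] := by
  ext i; fin_cases i <;> simp [Function.update]
theorem upd6_1 {α : Type} (a b w1 w2 x y w : α) :
    Function.update ![a, b, w1, w2, x, y] 1 w = ![a, w, w1, w2, x, y] := by
  ext i; fin_cases i <;> simp [Function.update]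
theorem upd6_4 {α : Type} (a b w1 w2 x y w : α) :
    Function.update ![a, b, w1, w2, x, y] 4 w = ![a, b, w1, w2, w, y] := by
  ext i; fin_cases i <;> simp [Function.update]
theorem upd6_5 {α : Type} (a b w1 w2 x y w : α) :
    Function.update ![a, b, w1, w2, x, y] 5 w = ![a, b, w1, w2, x, w] := by
  ext i; fin_cases i <;> simp [Function.update]

theorem vol6_cramer (f : (Fin 6 → R) →ₗ[R] R) (a b w1 w2 x y w3 : Fin 6 → R)
    (ha : f a = 0) (hb : f b = 0) (hx : f x = 0) (hy : f y = 0) :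
    vol6 a b w1 w2 x y * f w3 = vol6 a b w3 w2 x y * f w1 + vol6 a b w1 w3 x y * f w2 := by
  have h := det_cramer_apply f ![a, b, w1, w2, x, y] w3
  rw [Fin.sum_univ_six, upd6_2, upd6_3] at h
  have e : ∀ i : Fin 6, i ∈ ({0, 1, 4, 5} : Finset (Fin 6)) → f (![a, b, w1, w2, x, y] i) = 0 := by
    intro i hi
    fin_cases hi
    exacts [ha, hb, hx, hy]
  rw [e 0 (by simp), e 1 (by simp), e 4 (by simp), e 5 (by simp)] at h
  simp only [mul_zero, zero_add, add_zero] at h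
  exact h

theorem vol6_add0 (a a' b w1 w2 x y : Fin 6 → R) :
    vol6 (a + a') b w1 w2 x y = vol6 a b w1 w2 x y + vol6 a' b w1 w2 x y := by
  have := det_upd_add ![a, b, w1, w2, x, y] 0 a a'
  simpa only [vol6, upd6_0] using this
theorem vol6_smul0 (r : R) (a b w1 w2 x y : Fin 6 → R) :
    vol6 (r • a) b w1 w2 x y = r * vol6 a b w1 w2 x y := by
  have := det_upd_smul ![a, b, w1, w2, x, y] 0 r a
  simpa only [vol6, upd6_0] using this
theorem vol6_add1 (a b b' w1 w2 x y : Fin 6 → R) :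
    vol6 a (b + b') w1 w2 x y = vol6 a b w1 w2 x y + vol6 a b' w1 w2 x y := by
  have := det_upd_add ![a, b, w1, w2, x, y] 1 b b'
  simpa only [vol6, upd6_1] using this
theorem vol6_smul1 (r : R) (a b w1 w2 x y : Fin 6 → R) :
    vol6 a (r • b) w1 w2 x y = r * vol6 a b w1 w2 x y := by
  have := det_upd_smul ![a, b, w1, w2, x, y] 1 r b
  simpa only [vol6, upd6_1] using this
theorem vol6_add2 (a b w1 w1' w2 x y : Fin 6 → R) :
    vol6 a b (w1 + w1') w2 x y = vol6 a b w1 w2 x y + vol6 a b w1' w2 x y := by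
  have := det_upd_add ![a, b, w1, w2, x, y] 2 w1 w1'
  simpa only [vol6, upd6_2] using this
theorem vol6_smul2 (r : R) (a b w1 w2 x y : Fin 6 → R) :
    vol6 a b (r • w1) w2 x y = r * vol6 a b w1 w2 x y := by
  have := det_upd_smul ![a, b, w1, w2, x, y] 2 r w1
  simpa only [vol6, upd6_2] using this
theorem vol6_add3 (a b w1 w2 w2' x y : Fin 6 → R) :
    vol6 a b w1 (w2 + w2') x y = vol6 a b w1 w2 x y + vol6 a b w1 w2' x y := by
  have := det_upd_add ![a, b, w1, w2, x, y] 3 w2 w2'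
  simpa only [vol6, upd6_3] using this
theorem vol6_smul3 (r : R) (a b w1 w2 x y : Fin 6 → R) :
    vol6 a b w1 (r • w2) x y = r * vol6 a b w1 w2 x y := by
  have := det_upd_smul ![a, b, w1, w2, x, y] 3 r w2
  simpa only [vol6, upd6_3] using this
theorem vol6_add4 (a b w1 w2 x x' y : Fin 6 → R) :
    vol6 a b w1 w2 (x + x') y = vol6 a b w1 w2 x y + vol6 a b w1 w2 x' y := by
  have := det_upd_add ![a, b, w1, w2, x, y] 4 x x'
  simpa only [vol6, upd6_4] using this
theorem vol6_smul4 (r : R) (a b w1 w2 x y : Fin 6 → R) :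
    vol6 a b w1 w2 (r • x) y = r * vol6 a b w1 w2 x y := by
  have := det_upd_smul ![a, b, w1, w2, x, y] 4 r x
  simpa only [vol6, upd6_4] using this
theorem vol6_add5 (a b w1 w2 x y y' : Fin 6 → R) :
    vol6 a b w1 w2 x (y + y') = vol6 a b w1 w2 x y + vol6 a b w1 w2 x y' := by
  have := det_upd_add ![a, b, w1, w2, x, y] 5 y y'
  simpa only [vol6, upd6_5] using this
theorem vol6_smul5 (r : R) (a b w1 w2 x y : Fin 6 → R) :
    vol6 a b w1 w2 x (r • y) = r * vol6 a b w1 w2 x y := by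
  have := det_upd_smul ![a, b, w1, w2, x, y] 5 r y
  simpa only [vol6, upd6_5] using this

theorem vol6_alt (M : Fin 6 → Fin 6 → R) (i j : Fin 6) (hij : i ≠ j) (h : M i = M j) :
    Matrix.det (Matrix.of M) = 0 := Matrix.det_zero_of_row_eq hij h

theorem vol6_00 (a w1 w2 x y : Fin 6 → R) : vol6 a a w1 w2 x y = 0 :=
  vol6_alt _ 0 1 (by decide) rfl
theorem vol6_04 (a b w1 w2 y : Fin 6 → R) : vol6 a b w1 w2 a y = 0 :=
  vol6_alt _ 0 4 (by decide) rfl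
theorem vol6_05 (a b w1 w2 x : Fin 6 → R) : vol6 a b w1 w2 x a = 0 :=
  vol6_alt _ 0 5 (by decide) rfl
theorem vol6_14 (a b w1 w2 y : Fin 6 → R) : vol6 a b w1 w2 b y = 0 :=
  vol6_alt _ 1 4 (by decide) rfl
theorem vol6_15 (a b w1 w2 x : Fin 6 → R) : vol6 a b w1 w2 x b = 0 :=
  vol6_alt _ 1 5 (by decide) rfl
theorem vol6_22 (a b w x y : Fin 6 → R) : vol6 a b w w x y = 0 :=
  vol6_alt _ 2 3 (by decide) rfl

theorem vol6_swap01 (a b w1 w2 x y : Fin 6 → R) : vol6 b a w1 w2 x y = - vol6 a b w1 w2 x y := by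
  have := vol6_00 (a + b) w1 w2 x y
  rw [vol6_add0, vol6_add1, vol6_add1, vol6_00, vol6_00] at this
  linear_combination this
theorem vol6_swap23 (a b w1 w2 x y : Fin 6 → R) : vol6 a b w2 w1 x y = - vol6 a b w1 w2 x y := by
  have := vol6_22 a b (w1 + w2) x y
  rw [vol6_add2, vol6_add3, vol6_add3, vol6_22, vol6_22] at this
  linear_combination this

theorem vol6_map {S : Type} [CommRing S] (f : R →+* S) (a b w1 w2 x y : Fin 6 → R) :
    f (vol6 a b w1 w2 x y) = vol6 (fun i => f (a i)) (fun i => f (b i)) (fun i => f (w1 i))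
      (fun i => f (w2 i)) (fun i => f (x i)) (fun i => f (y i)) := by
  unfold vol6
  rw [RingHom.map_det]
  congr 1
  ext i j
  fin_cases i <;> simp

end alg
end

open MvPolynomial

noncomputable section

section
variable {R : Type} [CommRing R] [Algebra ℂ R] (c : Fin 6 → Fin 6 → Fin 6 → ℂ)

/-- resultant of two binary quadratic forms -/
def res2 (p0 p1 p2 q0 q1 q2 : R) : R :=
  (p0 * q2 - p2 * q0) ^ 2 - (p0 * q1 - p1 * q0) * (p1 * q2 - p2 * q1)

def det3 (p0 p1 p2 q0 q1 q2 n0 n1 n2 : R) : R :=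
  p0 * (q1 * n2 - q2 * n1) - p1 * (q0 * n2 - q2 * n0) + p2 * (q0 * n1 - q1 * n0)

theorem shared_index (p0 p1 p2 q0 q1 q2 r0 r1 r2 n0 n1 n2 m0 m1 m2 l0 l1 l2 : R)
    (E0 : n0 * r0 - m0 * q0 + l0 * p0 = 0)
    (E1 : (n0 * r1 + n1 * r0) - (m0 * q1 + m1 * q0) + (l0 * p1 + l1 * p0) = 0)
    (E2 : (n0 * r2 + n1 * r1 + n2 * r0) - (m0 * q2 + m1 * q1 + m2 * q0) +
      (l0 * p2 + l1 * p1 + l2 * p0) = 0)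
    (E3 : (n1 * r2 + n2 * r1) - (m1 * q2 + m2 * q1) + (l1 * p2 + l2 * p1) = 0)
    (E4 : n2 * r2 - m2 * q2 + l2 * p2 = 0) :
    det3 p0 p1 p2 q0 q1 q2 n0 n1 n2 * res2 p0 p1 p2 r0 r1 r2 =
    det3 p0 p1 p2 r0 r1 r2 m0 m1 m2 * res2 p0 p1 p2 q0 q1 q2 := by
  unfold det3 res2
  linear_combination ((-2)*p0*p1*p2*q2*r2 + (1)*p0*p2*p2*q1*r2 + (1)*p0*p2*p2*q2*r1 + (1)*p1*p1*p1*q2*r2 + (-1)*p1*p1*p2*q1*r2 + (-1)*p1*p1*p2*q2*r1 + (1)*p1*p2*p2*q0*r2 + (1)*p1*p2*p2*q1*r1 + (1)*p1*p2*p2*q2*r0 + (-1)*p2*p2*p2*q0*r1 + (-1)*p2*p2*p2*q1*r0)*E0 + ((1)*p0*p0*p2*q2*r2 + (-1)*p0*p1*p1*q2*r2 + (1)*p0*p1*p2*q1*r2 + (1)*p0*p1*p2*q2*r1 + (-1)*p0*p2*p2*q0*r2 + (-1)*p0*p2*p2*q1*r1 + (-1)*p0*p2*p2*q2*r0 + (1)*p2*p2*p2*q0*r0)*E1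 + ((1)*p0*p0*p1*q2*r2 + (-1)*p0*p0*p2*q1*r2 + (-1)*p0*p0*p2*q2*r1 + (1)*p0*p2*p2*q0*r1 + (1)*p0*p2*p2*q1*r0 + (-1)*p1*p2*p2*q0*r0)*E2 + ((-1)*p0*p0*p0*q2*r2 + (1)*p0*p0*p2*q0*r2 + (1)*p0*p0*p2*q1*r1 + (1)*p0*p0*p2*q2*r0 + (-1)*p0*p1*p2*q0*r1 + (-1)*p0*p1*p2*q1*r0 + (-1)*p0*p2*p2*q0*r0 + (1)*p1*p1*p2*q0*r0)*E3 + ((1)*p0*p0*p0*q1*r2 + (1)*p0*p0*p0*q2*r1 + (-1)*p0*p0*p1*q0*r2 + (-1)*p0*p0*p1*q1*r1 + (-1)*p0*p0*p1*q2*r0 + (-1)*p0*p0*p2*q0*r1 + (-1)*p0*p0*p2*q1*r0 + (1)*p0*p1*p1*q0*r1 + (1)*p0*p1*p1*q1*r0 + (2)*p0*p1*p2*q0*r0 + (-1)*p1*p1*p1*q0*r0)*E4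

namespace FO
variable (F : FO R)

def Q0 (w : Fin 6 → R) : R := tri c F.a F.a w
def Q1 (w : Fin 6 → R) : R := 2 * tri c F.a F.b w
def Q2 (w : Fin 6 → R) : R := tri c F.b F.b w
def N0 (w1 w2 : Fin 6 → R) : R := vol6 F.a F.b w1 w2 F.u1 F.u2
def N1 (w1 w2 : Fin 6 → R) : R := vol6 F.a F.b w1 w2 F.u1 F.v2 + vol6 F.a F.b w1 w2 F.v1 F.u2
def N2 (w1 w2 : Fin 6 → R) : R := vol6 F.a F.b w1 w2 F.v1 F.v2
def den (w1 w2 : Fin 6 → R) : R :=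
  res2 (F.Q0 c w1) (F.Q1 c w1) (F.Q2 c w1) (F.Q0 c w2) (F.Q1 c w2) (F.Q2 c w2)
def num (w1 w2 : Fin 6 → R) : R :=
  det3 (F.Q0 c w1) (F.Q1 c w1) (F.Q2 c w1) (F.Q0 c w2) (F.Q1 c w2) (F.Q2 c w2)
    (F.N0 w1 w2) (F.N1 w1 w2) (F.N2 w1 w2)

/-- the line is in the cubic -/
structure OnLine : Prop where
  aaa : tri c F.a F.a F.a = 0
  aab : tri c F.a F.a F.b = 0
  abb : tri c F.a F.b F.b = 0
  bbb : tri c F.b F.b F.b = 0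

/-- tangency -/
structure Tan (u v : Fin 6 → R) : Prop where
  aau : tri c F.a F.a u = 0
  t1 : tri c F.a F.a v + 2 * tri c F.a F.b u = 0
  t2 : 2 * tri c F.a F.b v + tri c F.b F.b u = 0
  bbv : tri c F.b F.b v = 0

structure Valid : Prop where
  line : F.OnLine c
  t1 : F.Tan c F.u1 F.v1
  t2 : F.Tan c F.u2 F.v2

variable {c F}

/-- the functional `w ↦ T(p,p,w)` -/
def triL (c : Fin 6 → Fin 6 → Fin 6 → ℂ) (p : Fin 6 → R) : (Fin 6 → R) →ₗ[R] R where
  toFun w := tri c p p w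
  map_add' x y := tri_add3 c x y p p
  map_smul' r x := tri_smul3 c r x p p

theorem tri_comb (hs : SymT c) (a b w : Fin 6 → R) (k : R) :
    tri c (a + k • b) (a + k • b) w = tri c a a w + k * (2 * tri c a b w) + k ^ 2 * tri c b b w := by
  simp only [tri_add1, tri_add2, tri_smul1, tri_smul2]
  rw [tri_swap12 hs b a w]
  ring

theorem cocycle_k (hs : SymT c) (h : F.Valid c) (w1 w2 w3 : Fin 6 → R) (k : R) :
    (F.N0 w1 w2 + k * F.N1 w1 w2 + k ^ 2 * F.N2 w1 w2) * (F.Q0 c w3 + k * F.Q1 c w3 + k ^ 2 * F.Q2 c w3)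
    - (F.N0 w1 w3 + k * F.N1 w1 w3 + k ^ 2 * F.N2 w1 w3) * (F.Q0 c w2 + k * F.Q1 c w2 + k ^ 2 * F.Q2 c w2)
    + (F.N0 w2 w3 + k * F.N1 w2 w3 + k ^ 2 * F.N2 w2 w3) * (F.Q0 c w1 + k * F.Q1 c w1 + k ^ 2 * F.Q2 c w1)
     = 0 := by
  have e1 : ∀ w, triL c (F.a + k • F.b) w = F.Q0 c w + k * F.Q1 c w + k ^ 2 * F.Q2 c w :=
    fun w => tri_comb hs _ _ _ _
  have e2 : ∀ w w', vol6 F.a F.b w w' (F.u1 + k • F.v1) (F.u2 + k • F.v2) =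
      F.N0 w w' + k * F.N1 w w' + k ^ 2 * F.N2 w w' := by
    intro w w'
    simp only [vol6_add4, vol6_add5, vol6_smul4, vol6_smul5, N0, N1, N2]
    ring
  have hbaa : tri c F.a F.b F.a = 0 := by rw [tri_swap23 hs]; exact h.line.aab
  have hbba : tri c F.b F.b F.a = 0 := by
    rw [tri_swap23 hs, tri_swap12 hs]; exact h.line.abb
  have := vol6_cramer (triL c (F.a + k • F.b)) F.a F.b w1 w2 (F.u1 + k • F.v1) (F.u2 + k • F.v2) w3
    (by rw [e1]; simp only [Q0, Q1, Q2, h.line.aaa, hbaa, hbba]; ring)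
    (by rw [e1]; simp only [Q0, Q1, Q2, h.line.aab, h.line.abb, h.line.bbb]; ring)
    (by
      rw [e1]; simp only [Q0, Q1, Q2, tri_add3, tri_smul3]
      linear_combination h.t1.aau + k * h.t1.t1 + k ^ 2 * h.t1.t2 + k ^ 3 * h.t1.bbv)
    (by
      rw [e1]; simp only [Q0, Q1, Q2, tri_add3, tri_smul3]
      linear_combination h.t2.aau + k * h.t2.t1 + k ^ 2 * h.t2.t2 + k ^ 3 * h.t2.bbv)
  rw [vol6_swap23 _ _ w2 w3, e2, e2, e2, e1, e1, e1] at this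
  linear_combination this

theorem coef_zero [IsDomain R] [CharZero R] (c0 c1 c2 c3 c4 : R)
    (h : ∀ k : R, c0 + c1 * k + c2 * k ^ 2 + c3 * k ^ 3 + c4 * k ^ 4 = 0) :
    c0 = 0 ∧ c1 = 0 ∧ c2 = 0 ∧ c3 = 0 ∧ c4 = 0 := by
  have h0 := h 0
  have h1 := h 1
  have h2 := h (-1)
  have h3 := h 2
  have h4 := h (-2)
  have n24 : (24 : R) ≠ 0 := by norm_num
  have e0 : c0 = 0 := by linear_combination h0
  have e4 : c4 = 0 := by
    have : 24 * c4 = 0 := by linear_combination h3 + h4 - 4 * (h1 + h2) + 6 * h0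
    exact (mul_eq_zero.1 this).resolve_left n24
  have e3 : c3 = 0 := by
    have : 24 * c3 = 0 := by linear_combination 2 * h3 - 2 * h4 - 4 * (h1 - h2)
    exact (mul_eq_zero.1 this).resolve_left n24
  have e2 : c2 = 0 := by
    have : 24 * c2 = 0 := by linear_combination 12 * (h1 + h2) - 24 * h0 - 24 * e4
    exact (mul_eq_zero.1 this).resolve_left n24
  have e1 : c1 = 0 := by
    have : 24 * c1 = 0 := by linear_combination 12 * (h1 - h2) - 24 * e3
    exact (mul_eq_zero.1 this).resolve_left n24
  exact ⟨e0, e1, e2, e3, e4⟩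

theorem cocycle [IsDomain R] [CharZero R] (hs : SymT c) (h : F.Valid c) (w1 w2 w3 : Fin 6 → R) :
    (F.N0 w1 w2 * F.Q0 c w3 - F.N0 w1 w3 * F.Q0 c w2 + F.N0 w2 w3 * F.Q0 c w1 = 0) ∧
    ((F.N0 w1 w2 * F.Q1 c w3 + F.N1 w1 w2 * F.Q0 c w3) - (F.N0 w1 w3 * F.Q1 c w2 + F.N1 w1 w3 * F.Q0 c w2)
      + (F.N0 w2 w3 * F.Q1 c w1 + F.N1 w2 w3 * F.Q0 c w1) = 0) ∧
    ((F.N0 w1 w2 * F.Q2 c w3 + F.N1 w1 w2 * F.Q1 c w3 + F.N2 w1 w2 * F.Q0 c w3)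
      - (F.N0 w1 w3 * F.Q2 c w2 + F.N1 w1 w3 * F.Q1 c w2 + F.N2 w1 w3 * F.Q0 c w2)
      + (F.N0 w2 w3 * F.Q2 c w1 + F.N1 w2 w3 * F.Q1 c w1 + F.N2 w2 w3 * F.Q0 c w1) = 0) ∧
    ((F.N1 w1 w2 * F.Q2 c w3 + F.N2 w1 w2 * F.Q1 c w3) - (F.N1 w1 w3 * F.Q2 c w2 + F.N2 w1 w3 * F.Q1 c w2)
      + (F.N1 w2 w3 * F.Q2 c w1 + F.N2 w2 w3 * F.Q1 c w1) = 0) ∧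
    (F.N2 w1 w2 * F.Q2 c w3 - F.N2 w1 w3 * F.Q2 c w2 + F.N2 w2 w3 * F.Q2 c w1 = 0) := by
  apply coef_zero
  intro k
  linear_combination cocycle_k hs h w1 w2 w3 k

theorem num_shared [IsDomain R] [CharZero R] (hs : SymT c) (h : F.Valid c) (w1 w2 w3 : Fin 6 → R) :
    F.num c w1 w2 * F.den c w1 w3 = F.num c w1 w3 * F.den c w1 w2 := by
  obtain ⟨E0, E1, E2, E3, E4⟩ := cocycle hs h w1 w2 w3
  exact shared_index _ _ _ _ _ _ _ _ _ _ _ _ _ _ _ _ _ _ E0 E1 E2 E3 E4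

theorem num_comm (w1 w2 : Fin 6 → R) : F.num c w2 w1 = F.num c w1 w2 := by
  have e : ∀ x y : Fin 6 → R, vol6 F.a F.b w2 w1 x y = - vol6 F.a F.b w1 w2 x y :=
    fun x y => vol6_swap23 _ _ _ _ _ _
  simp only [num, N0, N1, N2, e, det3]
  ring

theorem den_comm (w1 w2 : Fin 6 → R) : F.den c w2 w1 = F.den c w1 w2 := by
  simp only [den, res2]; ring

/-- chain through an intermediate vector -/
theorem num_chain [IsDomain R] [CharZero R] (hs : SymT c) (h : F.Valid c) (w1 w2 w3 w4 x : Fin 6 → R)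
    (h1 : F.den c w1 x ≠ 0) (h3 : F.den c w3 x ≠ 0) :
    F.num c w1 w2 * F.den c w3 w4 = F.num c w3 w4 * F.den c w1 w2 := by
  have a1 := num_shared hs h w1 w2 x
  have a2 := num_shared hs h w3 w4 x
  have a3 := num_shared hs h x w1 w3
  rw [num_comm w1 x, den_comm w3 x, num_comm w3 x, den_comm w1 x] at a3
  apply mul_right_cancel₀ (mul_ne_zero h1 h3)
  linear_combination F.den c w3 w4 * F.den c w3 x * a1 - F.den c w1 w2 * F.den c w1 x * a2 + F.den c w1 w2 * F.den c w3 w4 * a3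

/-- change of frame -/
theorem num_den_frame (hs : SymT c) (F G : FO R) (g α β γ δ k1 k2 : R)
    (x1 y1 z1 t1 x2 y2 z2 t2 : R)
    (ha : g • G.a = α • F.a + β • F.b) (hb : g • G.b = γ • F.a + δ • F.b)
    (hu1 : g • G.u1 + k1 • G.a = α • F.u1 + β • F.v1 + (x1 • F.a + y1 • F.b))
    (hv1 : g • G.v1 + k1 • G.b = γ • F.u1 + δ • F.v1 + (z1 • F.a + t1 • F.b))
    (hu2 : g • G.u2 + k2 • G.a = α • F.u2 + β • F.v2 + (x2 • F.a + y2 • F.b))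
    (hv2 : g • G.v2 + k2 • G.b = γ • F.u2 + δ • F.v2 + (z2 • F.a + t2 • F.b))
    (w1 w2 : Fin 6 → R) :
    g ^ 8 * G.num c w1 w2 = (α * δ - β * γ) ^ 4 * F.num c w1 w2 ∧
    g ^ 8 * G.den c w1 w2 = (α * δ - β * γ) ^ 4 * F.den c w1 w2 := by
  have hab : ∀ w, tri c F.b F.a w = tri c F.a F.b w := fun w => tri_swap12 hs _ _ _
  have q0 : ∀ w, g ^ 2 * G.Q0 c w = α ^ 2 * F.Q0 c w + α * β * F.Q1 c w + β ^ 2 * F.Q2 c w := by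
    intro w
    have : tri c (g • G.a) (g • G.a) w = g ^ 2 * G.Q0 c w := by
      rw [tri_smul1, tri_smul2, Q0]; ring
    rw [← this, ha]
    simp only [tri_add1, tri_add2, tri_smul1, tri_smul2, Q0, Q1, Q2, hab]; ring
  have q1 : ∀ w, g ^ 2 * G.Q1 c w = 2 * α * γ * F.Q0 c w + (α * δ + β * γ) * F.Q1 c w
      + 2 * β * δ * F.Q2 c w := by
    intro w
    have : 2 * tri c (g • G.a) (g • G.b) w = g ^ 2 * G.Q1 c w := by
      rw [tri_smul1, tri_smul2, Q1]; ring
    rw [← this, ha, hb]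
    simp only [tri_add1, tri_add2, tri_smul1, tri_smul2, Q0, Q1, Q2, hab]; ring
  have q2 : ∀ w, g ^ 2 * G.Q2 c w = γ ^ 2 * F.Q0 c w + γ * δ * F.Q1 c w + δ ^ 2 * F.Q2 c w := by
    intro w
    have : tri c (g • G.b) (g • G.b) w = g ^ 2 * G.Q2 c w := by
      rw [tri_smul1, tri_smul2, Q2]; ring
    rw [← this, hb]
    simp only [tri_add1, tri_add2, tri_smul1, tri_smul2, Q0, Q1, Q2, hab]; ring
  -- volumes
  have vG : ∀ x y k k' : R, ∀ X Y : Fin 6 → R, ∀ A B : Fin 6 → R, (A = G.a ∨ A = G.b) → (B = G.a ∨ B = G.b) →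
      vol6 (g • G.a) (g • G.b) w1 w2 (g • X + k • A) (g • Y + k' • B)
        = g ^ 4 * vol6 G.a G.b w1 w2 X Y := by
    intro x y k k' X Y A B hA hB
    rcases hA with rfl | rfl <;> rcases hB with rfl | rfl <;>
    · simp only [vol6_add4, vol6_add5, vol6_smul4, vol6_smul5, vol6_smul0, vol6_smul1,
        vol6_04, vol6_05, vol6_14, vol6_15]
      ring
  have vF : ∀ X Y : Fin 6 → R, ∀ x y x' y' : R,
      vol6 (α • F.a + β • F.b) (γ • F.a + δ • F.b) w1 w2 (X + (x • F.a + y • F.b))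
        (Y + (x' • F.a + y' • F.b)) = (α * δ - β * γ) * vol6 F.a F.b w1 w2 X Y := by
    intro X Y x y x' y'
    have sw : ∀ X Y, vol6 F.b F.a w1 w2 X Y = - vol6 F.a F.b w1 w2 X Y :=
      fun X Y => vol6_swap01 _ _ _ _ _ _
    simp only [vol6_add4, vol6_add5, vol6_smul4, vol6_smul5, vol6_smul0, vol6_smul1, vol6_add0,
      vol6_add1, vol6_04, vol6_05, vol6_14, vol6_15, vol6_00, sw]
    ring
  set Δ := α * δ - β * γ with hΔ
  have n0 : g ^ 4 * G.N0 w1 w2 = Δ * (α ^ 2 * F.N0 w1 w2 + α * β * F.N1 w1 w2 + β ^ 2 * F.N2 w1 w2) := by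
    rw [N0, ← vG 0 0 k1 k2 _ _ G.a G.a (Or.inl rfl) (Or.inl rfl), ha, hb, hu1, hu2, vF]
    simp only [vol6_add4, vol6_add5, vol6_smul4, vol6_smul5, N0, N1, N2]; ring
  have n1 : g ^ 4 * G.N1 w1 w2 = Δ * (2 * α * γ * F.N0 w1 w2 + (α * δ + β * γ) * F.N1 w1 w2
      + 2 * β * δ * F.N2 w1 w2) := by
    rw [N1, mul_add, ← vG 0 0 k1 k2 _ _ G.a G.b (Or.inl rfl) (Or.inr rfl),
      ← vG 0 0 k1 k2 _ _ G.b G.a (Or.inr rfl) (Or.inl rfl), ha, hb, hu1, hu2, hv1, hv2, vF, vF]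
    simp only [vol6_add4, vol6_add5, vol6_smul4, vol6_smul5, N0, N1, N2]; ring
  have n2 : g ^ 4 * G.N2 w1 w2 = Δ * (γ ^ 2 * F.N0 w1 w2 + γ * δ * F.N1 w1 w2 + δ ^ 2 * F.N2 w1 w2) := by
    rw [N2, ← vG 0 0 k1 k2 _ _ G.b G.b (Or.inr rfl) (Or.inr rfl), ha, hb, hv1, hv2, vF]
    simp only [vol6_add4, vol6_add5, vol6_smul4, vol6_smul5, N0, N1, N2]; ring
  constructor
  · have : g ^ 8 * G.num c w1 w2 = det3 (g ^ 2 * G.Q0 c w1) (g ^ 2 * G.Q1 c w1) (g ^ 2 * G.Q2 c w1)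
        (g ^ 2 * G.Q0 c w2) (g ^ 2 * G.Q1 c w2) (g ^ 2 * G.Q2 c w2)
        (g ^ 4 * G.N0 w1 w2) (g ^ 4 * G.N1 w1 w2) (g ^ 4 * G.N2 w1 w2) := by
      unfold num det3; ring
    rw [this, q0, q1, q2, q0, q1, q2, n0, n1, n2, hΔ]
    unfold num det3; ring
  · have : g ^ 8 * G.den c w1 w2 = res2 (g ^ 2 * G.Q0 c w1) (g ^ 2 * G.Q1 c w1) (g ^ 2 * G.Q2 c w1)
        (g ^ 2 * G.Q0 c w2) (g ^ 2 * G.Q1 c w2) (g ^ 2 * G.Q2 c w2) := by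
      unfold den res2; ring
    rw [this, q0, q1, q2, q0, q1, q2, hΔ]
    unfold den res2; ring

end FO
end
end

open MvPolynomial

noncomputable section

theorem factor2 (p0 p1 p2 : ℂ) : ∃ r s r' s' : ℂ, p0 = r * r' ∧ p1 = r * s' + s * r' ∧ p2 = s * s' := by
  by_cases h : p0 = 0
  · exact ⟨0, 1, p1, p2, by simp [h], by simp, by simp⟩
  · obtain ⟨e, he⟩ := IsAlgClosed.exists_pow_nat_eq (p1 ^ 2 - 4 * p0 * p2) (n := 2) (by norm_num)
    refine ⟨p0, (p1 + e) / 2, 1, (p1 - e) / (2 * p0), by simp, ?_, ?_⟩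
    · field_simp; ring
    · field_simp; linear_combination (he) / 4 * (4)

theorem res2_factor (r s r' s' q0 q1 q2 : ℂ) :
    res2 (r * r') (r * s' + s * r') (s * s') q0 q1 q2 =
      (q0 * s ^ 2 - q1 * s * r + q2 * r ^ 2) * (q0 * s' ^ 2 - q1 * s' * r' + q2 * r' ^ 2) := by
  unfold res2; ring

namespace FO
variable {c : Fin 6 → Fin 6 → Fin 6 → ℂ}

/-- smoothness along the line -/
def Smooth (c : Fin 6 → Fin 6 → Fin 6 → ℂ) (F : FO ℂ) : Prop :=
  ∀ x y : ℂ, (x ≠ 0 ∨ y ≠ 0) → ∃ w, F.Q0 c w * x ^ 2 + F.Q1 c w * x * y + F.Q2 c w * y ^ 2 ≠ 0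

/-- the functional attached to a point of the line. -/
def QL (c : Fin 6 → Fin 6 → Fin 6 → ℂ) (F : FO ℂ) (x y : ℂ) : (Fin 6 → ℂ) →ₗ[ℂ] ℂ where
  toFun w := F.Q0 c w * x ^ 2 + F.Q1 c w * x * y + F.Q2 c w * y ^ 2
  map_add' u v := by simp only [Q0, Q1, Q2, tri_add3]; ring
  map_smul' r u := by simp only [Q0, Q1, Q2, tri_smul3, RingHom.id_apply, smul_eq_mul]; ring

theorem QL_apply (F : FO ℂ) (x y : ℂ) (w) :
    QL c F x y w = F.Q0 c w * x ^ 2 + F.Q1 c w * x * y + F.Q2 c w * y ^ 2 := rfl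

/-- for every `w` with nonzero quadric there are two functionals, nonvanishing of which ensures goodness -/
theorem exists_two (F : FO ℂ) (w : Fin 6 → ℂ) (hw : ¬ (F.Q0 c w = 0 ∧ F.Q1 c w = 0 ∧ F.Q2 c w = 0)) :
    ∃ x y x' y' : ℂ, (x ≠ 0 ∨ y ≠ 0) ∧ (x' ≠ 0 ∨ y' ≠ 0) ∧
      ∀ w', F.den c w w' = QL c F x y w' * QL c F x' y' w' := by
  obtain ⟨r, s, r', s', h0, h1, h2⟩ := factor2 (F.Q0 c w) (F.Q1 c w) (F.Q2 c w)
  refine ⟨s, -r, s', -r', ?_, ?_, ?_⟩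
  · by_contra hcon
    push Not at hcon
    obtain ⟨rfl, hr⟩ := hcon
    rw [neg_eq_zero] at hr
    subst hr
    exact hw ⟨by simpa using h0, by simpa using h1, by simpa using h2⟩
  · by_contra hcon
    push Not at hcon
    obtain ⟨rfl, hr⟩ := hcon
    rw [neg_eq_zero] at hr
    subst hr
    exact hw ⟨by simpa using h0, by simpa using h1, by simpa using h2⟩
  · intro w'
    rw [den, h0, h1, h2, res2_factor, QL_apply, QL_apply]; ring

theorem avoid {k : ℕ} (L : Fin k → ((Fin 6 → ℂ) →ₗ[ℂ] ℂ)) (h : ∀ i, ∃ w, L i w ≠ 0) :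
    ∃ w, ∀ i, L i w ≠ 0 := Module.Dual.exists_forall_ne_zero_of_forall_exists L h

theorem den_ne_left {F : FO ℂ} {w w' : Fin 6 → ℂ} (h : F.den c w w' ≠ 0) :
    ¬ (F.Q0 c w = 0 ∧ F.Q1 c w = 0 ∧ F.Q2 c w = 0) := by
  rintro ⟨h0, h1, h2⟩
  apply h
  simp [den, res2, h0, h1, h2]

theorem exists_good (F : FO ℂ) (hF : Smooth c F) : ∃ w1 w2, F.den c w1 w2 ≠ 0 := by
  obtain ⟨w, hw⟩ := hF 1 0 (by simp)
  have hw' : ¬ (F.Q0 c w = 0 ∧ F.Q1 c w = 0 ∧ F.Q2 c w = 0) := by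
    rintro ⟨h0, h1, h2⟩
    apply hw; rw [h0, h1, h2]; ring
  obtain ⟨x, y, x', y', h, h', hd⟩ := exists_two F w hw'
  obtain ⟨w2, hw2⟩ := avoid ![QL c F x y, QL c F x' y'] (by
    intro i; fin_cases i
    · exact hF x y h
    · exact hF x' y' h')
  refine ⟨w, w2, ?_⟩
  rw [hd]
  exact mul_ne_zero (hw2 0) (hw2 1)

theorem exists_mid (F : FO ℂ) (w1 w2 w3 w4 : Fin 6 → ℂ) (h1 : F.den c w1 w2 ≠ 0)
    (h3 : F.den c w3 w4 ≠ 0) : ∃ x, F.den c w1 x ≠ 0 ∧ F.den c w3 x ≠ 0 := by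
  obtain ⟨x, y, x', y', -, -, hd⟩ := exists_two F w1 (den_ne_left h1)
  obtain ⟨z, t, z', t', -, -, hd'⟩ := exists_two F w3 (den_ne_left h3)
  rw [hd, mul_ne_zero_iff] at h1
  rw [hd', mul_ne_zero_iff] at h3
  obtain ⟨v, hv⟩ := avoid ![QL c F x y, QL c F x' y', QL c F z t, QL c F z' t'] (by
    intro i; fin_cases i
    · exact ⟨_, h1.1⟩
    · exact ⟨_, h1.2⟩
    · exact ⟨_, h3.1⟩
    · exact ⟨_, h3.2⟩)
  refine ⟨v, ?_, ?_⟩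
  · rw [hd]; exact mul_ne_zero (hv 0) (hv 1)
  · rw [hd']; exact mul_ne_zero (hv 2) (hv 3)

/-- base change -/
def map {R S : Type} (f : R → S) (F : FO R) : FO S :=
  ⟨fun i => f (F.a i), fun i => f (F.b i), fun i => f (F.u1 i), fun i => f (F.v1 i),
    fun i => f (F.u2 i), fun i => f (F.v2 i)⟩

section
variable {R S : Type} [CommRing R] [CommRing S] [Algebra ℂ R] [Algebra ℂ S]

theorem map_den (f : R →ₐ[ℂ] S) (F : FO R) (w1 w2 : Fin 6 → R) :
    f (F.den c w1 w2) = (F.map f).den c (fun i => f (w1 i)) (fun i => f (w2 i)) := by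
  simp only [den, res2, Q0, Q1, Q2, map_sub, map_mul, map_pow, tri_map, map, map_ofNat]

theorem map_num (f : R →ₐ[ℂ] S) (F : FO R) (w1 w2 : Fin 6 → R) :
    f (F.num c w1 w2) = (F.map f).num c (fun i => f (w1 i)) (fun i => f (w2 i)) := by
  have hv : ∀ a b w1 w2 x y : Fin 6 → R, f (vol6 a b w1 w2 x y) = vol6 (fun i => f (a i))
      (fun i => f (b i)) (fun i => f (w1 i)) (fun i => f (w2 i)) (fun i => f (x i)) (fun i => f (y i)) :=
    fun a b w1 w2 x y => vol6_map (f : R →+* S) a b w1 w2 x y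
  simp only [num, det3, Q0, Q1, Q2, N0, N1, N2, map_sub, map_mul, map_add, tri_map, map, map_ofNat, hv]

theorem Valid.map (f : R →ₐ[ℂ] S) {F : FO R} (h : F.Valid c) : (F.map f).Valid c := by
  obtain ⟨⟨a1, a2, a3, a4⟩, ⟨b1, b2, b3, b4⟩, ⟨d1, d2, d3, d4⟩⟩ := h
  have key : ∀ x : R, x = 0 → f x = 0 := by rintro x rfl; exact map_zero f
  refine ⟨⟨?_, ?_, ?_, ?_⟩, ⟨?_, ?_, ?_, ?_⟩, ⟨?_, ?_, ?_, ?_⟩⟩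
  · have := key _ a1; rw [tri_map] at this; exact this
  · have := key _ a2; rw [tri_map] at this; exact this
  · have := key _ a3; rw [tri_map] at this; exact this
  · have := key _ a4; rw [tri_map] at this; exact this
  · have := key _ b1; rw [tri_map] at this; exact this
  · have := key _ b2; simp only [tri_map, map_add, map_mul, map_ofNat] at this; exact this
  · have := key _ b3; simp only [tri_map, map_add, map_mul, map_ofNat] at this; exact this
  · have := key _ b4; rw [tri_map] at this; exact this
  · have := key _ d1; rw [tri_map] at this; exact this
  · have := key _ d2; simp only [tri_map, map_add, map_mul, map_ofNat] at this; exact this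
  · have := key _ d3; simp only [tri_map, map_add, map_mul, map_ofNat] at this; exact this
  · have := key _ d4; rw [tri_map] at this; exact this

/-- constants -/
def cst (R : Type) [CommRing R] [Algebra ℂ R] (w : Fin 6 → ℂ) : Fin 6 → R := fun i => algebraMap ℂ R (w i)

theorem map_den_cst (f : R →ₐ[ℂ] S) (F : FO R) (w1 w2 : Fin 6 → ℂ) :
    f (F.den c (cst R w1) (cst R w2)) = (F.map f).den c (cst S w1) (cst S w2) := by
  rw [map_den]; simp only [cst, AlgHom.commutes]; rfl
theorem map_num_cst (f : R →ₐ[ℂ] S) (F : FO R) (w1 w2 : Fin 6 → ℂ) :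
    f (F.num c (cst R w1) (cst R w2)) = (F.map f).num c (cst S w1) (cst S w2) := by
  rw [map_num]; simp only [cst, AlgHom.commutes]; rfl
end

theorem cst_self (w : Fin 6 → ℂ) : cst ℂ w = w := rfl

/-- independence of the pair over `ℂ[s]`. -/
theorem num_connect (hs : SymT c) (F : FO (Polynomial ℂ)) (h : F.Valid c) (w1 w2 w3 w4 : Fin 6 → ℂ)
    (h1 : F.den c (cst _ w1) (cst _ w2) ≠ 0) (h3 : F.den c (cst _ w3) (cst _ w4) ≠ 0) :
    F.num c (cst _ w1) (cst _ w2) * F.den c (cst _ w3) (cst _ w4) =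
    F.num c (cst _ w3) (cst _ w4) * F.den c (cst _ w1) (cst _ w2) := by
  obtain ⟨s, hsv⟩ : ∃ s : ℂ, (F.den c (cst _ w1) (cst _ w2) * F.den c (cst _ w3) (cst _ w4)).eval s ≠ 0 := by
    by_contra hcon
    push Not at hcon
    exact mul_ne_zero h1 h3 (Polynomial.funext (by simpa using hcon))
  have e : ∀ w w', (F.den c (cst _ w) (cst _ w')).eval s = (F.map (Polynomial.aeval s)).den c w w' := by
    intro w w'
    have := map_den_cst (c := c) (Polynomial.aeval s) F w w'
    rw [cst_self, cst_self] at this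
    rw [← this, Polynomial.coe_aeval_eq_eval]
  rw [Polynomial.eval_mul, mul_ne_zero_iff, e, e] at hsv
  obtain ⟨x, hx1, hx3⟩ := exists_mid _ w1 w2 w3 w4 hsv.1 hsv.2
  refine num_chain hs h _ _ _ _ (cst _ x) ?_ ?_
  · intro h0; apply hx1; rw [← e, h0]; simp
  · intro h0; apply hx3; rw [← e, h0]; simp

end FO
end

open MvPolynomial

noncomputable section

/-- degree at most `m` with `m`-th coefficient `l` -/
def HL (p : Polynomial ℂ) (m : ℕ) (l : ℂ) : Prop := p.natDegree ≤ m ∧ p.coeff m = l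

namespace HL
theorem add {p q : Polynomial ℂ} {m : ℕ} {l k : ℂ} (h : HL p m l) (h' : HL q m k) : HL (p + q) m (l + k) :=
  ⟨(Polynomial.natDegree_add_le _ _).trans (max_le h.1 h'.1), by rw [Polynomial.coeff_add, h.2, h'.2]⟩
theorem sub {p q : Polynomial ℂ} {m : ℕ} {l k : ℂ} (h : HL p m l) (h' : HL q m k) : HL (p - q) m (l - k) :=
  ⟨(Polynomial.natDegree_sub_le _ _).trans (max_le h.1 h'.1), by rw [Polynomial.coeff_sub, h.2, h'.2]⟩
theorem mul {p q : Polynomial ℂ} {m n : ℕ} {l k : ℂ} (h : HL p m l) (h' : HL q n k) : HL (p * q) (m + n) (l * k) :=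
  ⟨(Polynomial.natDegree_mul_le).trans (add_le_add h.1 h'.1), by
    rw [Polynomial.coeff_mul_add_eq_of_natDegree_le h.1 h'.1, h.2, h'.2]⟩
theorem const (x : ℂ) : HL (Polynomial.C x) 0 x := ⟨by simp, by simp⟩
theorem sum {ι : Type} (s : Finset ι) (p : ι → Polynomial ℂ) (m : ℕ) (l : ι → ℂ) (h : ∀ i ∈ s, HL (p i) m (l i)) :
    HL (∑ i ∈ s, p i) m (∑ i ∈ s, l i) := by
  classical
  induction s using Finset.induction_on with
  | empty => exact ⟨by simp, by simp⟩
  | insert i s hi ih =>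
    rw [Finset.sum_insert hi, Finset.sum_insert hi]
    exact (h i (Finset.mem_insert_self _ _)).add (ih fun j hj => h j (Finset.mem_insert_of_mem hj))
theorem prod {ι : Type} (s : Finset ι) (p : ι → Polynomial ℂ) (m : ι → ℕ) (l : ι → ℂ) (h : ∀ i ∈ s, HL (p i) (m i) (l i)) :
    HL (∏ i ∈ s, p i) (∑ i ∈ s, m i) (∏ i ∈ s, l i) := by
  classical
  induction s using Finset.induction_on with
  | empty => exact ⟨by simp, by simp⟩
  | insert i s hi ih =>
    rw [Finset.prod_insert hi, Finset.prod_insert hi, Finset.sum_insert hi]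
    exact (h i (Finset.mem_insert_self _ _)).mul (ih fun j hj => h j (Finset.mem_insert_of_mem hj))
theorem det (A : Matrix (Fin 6) (Fin 6) (Polynomial ℂ)) (B : Matrix (Fin 6) (Fin 6) ℂ) (m : Fin 6 → ℕ)
    (h : ∀ i j, HL (A i j) (m i) (B i j)) : HL A.det (∑ i, m i) B.det := by
  rw [← Matrix.det_transpose, ← Matrix.det_transpose B, Matrix.det_apply', Matrix.det_apply']
  refine sum _ _ _ _ fun σ _ => ?_
  have h1 := prod Finset.univ (fun i => A i (σ i)) m (fun i => B i (σ i)) fun i _ => h i (σ i)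
  have h2 := (const ((Equiv.Perm.sign σ : ℤ) : ℂ)).mul h1
  rw [zero_add] at h2
  refine ⟨?_, ?_⟩
  · simpa using h2.1
  · simpa using h2.2
end HL


theorem HL.tri (c : Fin 6 → Fin 6 → Fin 6 → ℂ) {x y z : Fin 6 → Polynomial ℂ} {k l m : ℕ} {x' y' z' : Fin 6 → ℂ}
    (hx : ∀ i, HL (x i) k (x' i)) (hy : ∀ i, HL (y i) l (y' i)) (hz : ∀ i, HL (z i) m (z' i)) :
    HL (tri c x y z) (k + l + m) (tri c x' y' z') := by
  unfold _root_.tri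
  refine HL.sum _ _ _ _ fun i _ => HL.sum _ _ _ _ fun j _ => HL.sum _ _ _ _ fun r _ => ?_
  have := (((HL.const (c i j r)).mul (hx i)).mul (hy j)).mul (hz r)
  rw [zero_add] at this
  exact this

theorem HL.vol6 {a b w1 w2 x y : Fin 6 → Polynomial ℂ} {a' b' w1' w2' x' y' : Fin 6 → ℂ} {M : ℕ}
    (ha : ∀ i, HL (a i) M (a' i)) (hb : ∀ i, HL (b i) M (b' i)) (hw1 : ∀ i, HL (w1 i) 0 (w1' i))
    (hw2 : ∀ i, HL (w2 i) 0 (w2' i)) (hx : ∀ i, HL (x i) M (x' i)) (hy : ∀ i, HL (y i) M (y' i)) :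
    HL (vol6 a b w1 w2 x y) (4 * M) (vol6 a' b' w1' w2' x' y') := by
  have := HL.det (Matrix.of ![a, b, w1, w2, x, y]) (Matrix.of ![a', b', w1', w2', x', y'])
    ![M, M, 0, 0, M, M] (by
      intro i j
      fin_cases i
      · exact ha j
      · exact hb j
      · exact hw1 j
      · exact hw2 j
      · exact hx j
      · exact hy j)
  have e : ∑ i, (![M, M, 0, 0, M, M] : Fin 6 → ℕ) i = 4 * M := by
    simp [Fin.sum_univ_succ]; ring
  rwa [e] at this

theorem HL.two {p : Polynomial ℂ} {m : ℕ} {l : ℂ} (h : HL p m l) : HL (2 * p) m (2 * l) := by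
  have := (HL.const 2).mul h
  rw [zero_add, map_ofNat] at this
  exact this

theorem HL.res2 {p0 p1 p2 q0 q1 q2 : Polynomial ℂ} {p0' p1' p2' q0' q1' q2' : ℂ} {m : ℕ}
    (h0 : HL p0 m p0') (h1 : HL p1 m p1') (h2 : HL p2 m p2')
    (k0 : HL q0 m q0') (k1 : HL q1 m q1') (k2 : HL q2 m q2') :
    HL (res2 p0 p1 p2 q0 q1 q2) (m + m + (m + m)) (res2 p0' p1' p2' q0' q1' q2') := by
  unfold _root_.res2
  rw [sq, sq]
  exact (((h0.mul k2).sub (h2.mul k0)).mul ((h0.mul k2).sub (h2.mul k0))).sub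
    (((h0.mul k1).sub (h1.mul k0)).mul ((h1.mul k2).sub (h2.mul k1)))

theorem HL.det3 {p0 p1 p2 q0 q1 q2 n0 n1 n2 : Polynomial ℂ} {p0' p1' p2' q0' q1' q2' n0' n1' n2' : ℂ} {m k : ℕ}
    (h0 : HL p0 m p0') (h1 : HL p1 m p1') (h2 : HL p2 m p2')
    (k0 : HL q0 m q0') (k1 : HL q1 m q1') (k2 : HL q2 m q2')
    (l0 : HL n0 k n0') (l1 : HL n1 k n1') (l2 : HL n2 k n2') :
    HL (det3 p0 p1 p2 q0 q1 q2 n0 n1 n2) (m + (m + k)) (det3 p0' p1' p2' q0' q1' q2' n0' n1' n2') := by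
  unfold _root_.det3
  exact ((h0.mul ((k1.mul l2).sub (k2.mul l1))).sub (h1.mul ((k0.mul l2).sub (k2.mul l0)))).add
    (h2.mul ((k0.mul l1).sub (k1.mul l0)))

/-- leading behaviour of a frame -/
structure FO.HLF (F : FO (Polynomial ℂ)) (M : ℕ) (L : FO ℂ) : Prop where
  a : ∀ i, HL (F.a i) M (L.a i)
  b : ∀ i, HL (F.b i) M (L.b i)
  u1 : ∀ i, HL (F.u1 i) M (L.u1 i)
  v1 : ∀ i, HL (F.v1 i) M (L.v1 i)
  u2 : ∀ i, HL (F.u2 i) M (L.u2 i)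
  v2 : ∀ i, HL (F.v2 i) M (L.v2 i)

namespace FO
variable {c : Fin 6 → Fin 6 → Fin 6 → ℂ}

theorem HLF.den {F : FO (Polynomial ℂ)} {M : ℕ} {L : FO ℂ} (h : F.HLF M L) (w1 w2 : Fin 6 → ℂ) :
    HL (F.den c (cst _ w1) (cst _ w2)) (8 * M) (L.den c w1 w2) := by
  have hc : ∀ w : Fin 6 → ℂ, ∀ i, HL (cst (Polynomial ℂ) w i) 0 (w i) := fun w i => HL.const _
  have q0 : ∀ w, HL (F.Q0 c (cst _ w)) (M + M + 0) (L.Q0 c w) := fun w => HL.tri c h.a h.a (hc w)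
  have q1 : ∀ w, HL (F.Q1 c (cst _ w)) (M + M + 0) (L.Q1 c w) := fun w => (HL.tri c h.a h.b (hc w)).two
  have q2 : ∀ w, HL (F.Q2 c (cst _ w)) (M + M + 0) (L.Q2 c w) := fun w => HL.tri c h.b h.b (hc w)
  have := HL.res2 (q0 w1) (q1 w1) (q2 w1) (q0 w2) (q1 w2) (q2 w2)
  have e : M + M + 0 + (M + M + 0) + (M + M + 0 + (M + M + 0)) = 8 * M := by ring
  rw [e] at this
  exact this

theorem HLF.num {F : FO (Polynomial ℂ)} {M : ℕ} {L : FO ℂ} (h : F.HLF M L) (w1 w2 : Fin 6 → ℂ) :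
    HL (F.num c (cst _ w1) (cst _ w2)) (8 * M) (L.num c w1 w2) := by
  have hc : ∀ w : Fin 6 → ℂ, ∀ i, HL (cst (Polynomial ℂ) w i) 0 (w i) := fun w i => HL.const _
  have q0 : ∀ w, HL (F.Q0 c (cst _ w)) (M + M + 0) (L.Q0 c w) := fun w => HL.tri c h.a h.a (hc w)
  have q1 : ∀ w, HL (F.Q1 c (cst _ w)) (M + M + 0) (L.Q1 c w) := fun w => (HL.tri c h.a h.b (hc w)).two
  have q2 : ∀ w, HL (F.Q2 c (cst _ w)) (M + M + 0) (L.Q2 c w) := fun w => HL.tri c h.b h.b (hc w)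
  have := HL.det3 (q0 w1) (q1 w1) (q2 w1) (q0 w2) (q1 w2) (q2 w2)
    (HL.vol6 h.a h.b (hc w1) (hc w2) h.u1 h.u2)
    ((HL.vol6 h.a h.b (hc w1) (hc w2) h.u1 h.v2).add (HL.vol6 h.a h.b (hc w1) (hc w2) h.v1 h.u2))
    (HL.vol6 h.a h.b (hc w1) (hc w2) h.v1 h.v2)
  have e : M + M + 0 + (M + M + 0 + 4 * M) = 8 * M := by ring
  rw [e] at this
  unfold FO.num FO.N0 FO.N1 FO.N2
  exact this

theorem num_zero_of_u1 (L : FO ℂ) (h1 : L.u1 = 0) (h2 : L.v1 = 0) (w1 w2 : Fin 6 → ℂ) : L.num c w1 w2 = 0 := by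
  have hz : ∀ a b w1 w2 y : Fin 6 → ℂ, vol6 a b w1 w2 0 y = 0 := by
    intro a b w1 w2 y
    have := vol6_smul4 (0 : ℂ) a b w1 w2 0 y
    rw [zero_smul, zero_mul] at this
    exact this
  simp [FO.num, N0, N1, N2, h1, h2, hz, _root_.det3]

end FO

theorem dvd_of_local (p q : Polynomial ℂ) (h : ∀ s : ℂ, ∃ n d : Polynomial ℂ, d.eval s ≠ 0 ∧ p * d = n * q) : q ∣ p := by
  let J : Ideal (Polynomial ℂ) :=
    { carrier := {d | q ∣ p * d}
      add_mem' := fun {x y} hx hy => by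
        change q ∣ p * (x + y); rw [mul_add]; exact dvd_add hx hy
      zero_mem' := by change q ∣ p * 0; simp
      smul_mem' := fun r x hx => by
        change q ∣ p * (r * x)
        rw [mul_left_comm]; exact Dvd.dvd.mul_left hx r }
  have hJ : J = ⊤ := by
    obtain ⟨e, he⟩ := (IsPrincipalIdealRing.principal J)
    rw [Ideal.submodule_span_eq] at he
    by_contra hne
    have hroot : ∃ s, e.eval s = 0 := by
      by_cases h0 : e.degree = 0
      · exfalso; apply hne; rw [he, Ideal.span_singleton_eq_top]; exact Polynomial.isUnit_iff_degree_eq_zero.2 h0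
      · exact IsAlgClosed.exists_root e h0
    obtain ⟨s, hs⟩ := hroot
    obtain ⟨n, d, hd, hnd⟩ := h s
    have hdJ : d ∈ J := ⟨n, by rw [hnd, mul_comm]⟩
    rw [he, Ideal.mem_span_singleton] at hdJ
    obtain ⟨k, rfl⟩ := hdJ
    apply hd; simp [hs]
  have : (1 : Polynomial ℂ) ∈ J := hJ ▸ Submodule.mem_top
  have h1 : q ∣ p * 1 := this
  simpa using h1

namespace FO
variable {c : Fin 6 → Fin 6 → Fin 6 → ℂ}

theorem den_eval (F : FO (Polynomial ℂ)) (s : ℂ) (w w' : Fin 6 → ℂ) :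
    (F.den c (cst _ w) (cst _ w')).eval s = (F.map (Polynomial.aeval s)).den c w w' := by
  have := map_den_cst (c := c) (Polynomial.aeval s) F w w'
  rw [cst_self, cst_self] at this
  rw [← this, Polynomial.coe_aeval_eq_eval]

/-- degree argument on the projective line -/
theorem num_zero_line (hs : SymT c) (F : FO (Polynomial ℂ)) (hF : F.Valid c) {κ : Type}
    (G : κ → FO (Polynomial ℂ)) (g : Polynomial ℂ) (hg : g ≠ 0) (e : κ → Polynomial ℂ)
    (hden : ∀ k w1 w2, g * (G k).den c (cst _ w1) (cst _ w2) = e k * F.den c (cst _ w1) (cst _ w2))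
    (hnum : ∀ k w1 w2, g * (G k).num c (cst _ w1) (cst _ w2) = e k * F.num c (cst _ w1) (cst _ w2))
    (hloc : ∀ s : ℂ, ∃ k, (e k).eval s ≠ 0 ∧ Smooth c ((G k).map (Polynomial.aeval s)))
    (k0 : κ) (he0 : e k0 ≠ 0) (M : ℕ) (L : FO ℂ) (hL : (G k0).HLF M L) (hLs : Smooth c L)
    (hL1 : L.u1 = 0) (hL2 : L.v1 = 0) (w1 w2 : Fin 6 → ℂ)
    (hd : F.den c (cst _ w1) (cst _ w2) ≠ 0) : F.num c (cst _ w1) (cst _ w2) = 0 := by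
  obtain ⟨v1, v2, hv⟩ := exists_good L hLs
  have hdeg : ((G k0).den c (cst _ v1) (cst _ v2)).natDegree = 8 * M := by
    refine le_antisymm (hL.den v1 v2).1 (Polynomial.le_natDegree_of_ne_zero ?_)
    rw [(hL.den v1 v2).2]; exact hv
  have hG0 : (G k0).den c (cst _ v1) (cst _ v2) ≠ 0 := by
    intro h0
    have := (hL.den (c := c) v1 v2).2
    rw [h0] at this
    exact hv (by simpa using this.symm)
  have hF0 : F.den c (cst _ v1) (cst _ v2) ≠ 0 := by
    intro h0
    have := hden k0 v1 v2
    rw [h0, mul_zero] at this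
    exact mul_ne_zero hg hG0 this
  have hdvd : (G k0).den c (cst _ v1) (cst _ v2) ∣ (G k0).num c (cst _ v1) (cst _ v2) := by
    refine dvd_of_local _ _ fun s => ?_
    obtain ⟨k, hk, hsm⟩ := hloc s
    obtain ⟨x1, x2, hx⟩ := exists_good _ hsm
    rw [← den_eval] at hx
    have hx0 : (G k).den c (cst _ x1) (cst _ x2) ≠ 0 := by
      intro h0; rw [h0] at hx; simp at hx
    have hF1 : F.den c (cst _ x1) (cst _ x2) ≠ 0 := by
      intro h0
      have := hden k x1 x2
      rw [h0, mul_zero] at this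
      exact mul_ne_zero hg hx0 this
    refine ⟨(G k).num c (cst _ x1) (cst _ x2), _, hx, ?_⟩
    have h12 := num_connect hs F hF v1 v2 x1 x2 hF0 hF1
    apply mul_left_cancel₀ (mul_ne_zero hg hg)
    linear_combination (g * (G k).den c (cst _ x1) (cst _ x2)) * hnum k0 v1 v2 +
      e k0 * F.num c (cst _ v1) (cst _ v2) * hden k x1 x2 + e k0 * e k * h12
      - (g * (G k0).den c (cst _ v1) (cst _ v2)) * hnum k x1 x2 - e k * F.num c (cst _ x1) (cst _ x2) * hden k0 v1 v2
  have hn0 : (G k0).num c (cst _ v1) (cst _ v2) = 0 := by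
    by_contra hne
    have h1 := Polynomial.natDegree_le_of_dvd hdvd hne
    rw [hdeg] at h1
    have h2 := hL.num (c := c) v1 v2
    have h3 := le_antisymm h2.1 h1
    rw [num_zero_of_u1 L hL1 hL2] at h2
    apply hne
    rw [← Polynomial.leadingCoeff_eq_zero, Polynomial.leadingCoeff, h3]
    exact h2.2
  have hF00 : F.num c (cst _ v1) (cst _ v2) = 0 := by
    have := hnum k0 v1 v2
    rw [hn0, mul_zero] at this
    exact (mul_eq_zero.1 this.symm).resolve_left he0
  have h12 := num_connect hs F hF w1 w2 v1 v2 hd hF0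
  rw [hF00, zero_mul] at h12
  exact (mul_eq_zero.1 h12).resolve_right hF0

end FO
end

open MvPolynomial

noncomputable section

/-- a derivation -/
structure IsDer {R : Type} [CommRing R] [Algebra ℂ R] (D : R → R) : Prop where
  add : ∀ x y, D (x + y) = D x + D y
  mul : ∀ x y, D (x * y) = x * D y + D x * y
  const : ∀ z : ℂ, D (algebraMap ℂ R z) = 0

section
variable {R : Type} [CommRing R] [Algebra ℂ R] {D : R → R}

theorem IsDer.zero (h : IsDer D) : D 0 = 0 := by
  have := h.add 0 0
  simpa using this
theorem IsDer.sum (h : IsDer D) {ι : Type} (s : Finset ι) (f : ι → R) : D (∑ i ∈ s, f i) = ∑ i ∈ s, D (f i) := by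
  classical
  induction s using Finset.induction_on with
  | empty => simpa using h.zero
  | insert i s hi ih => rw [Finset.sum_insert hi, Finset.sum_insert hi, h.add, ih]

theorem IsDer.tri (h : IsDer D) {ι : Type} [Fintype ι] (c : ι → ι → ι → ℂ) (x y z : ι → R) :
    D (tri c x y z) = tri c (fun i => D (x i)) y z + tri c x (fun i => D (y i)) z + tri c x y (fun i => D (z i)) := by
  unfold _root_.tri
  simp only [h.sum, ← Finset.sum_add_distrib]
  refine Finset.sum_congr rfl fun i _ => Finset.sum_congr rfl fun j _ => Finset.sum_congr rfl fun k _ => ?_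
  rw [h.mul, h.mul, h.mul, h.const]
  ring
end

namespace FO
variable {R : Type} [CommRing R] [Algebra ℂ R] {c : Fin 6 → Fin 6 → Fin 6 → ℂ}

/-- the frame with its derivatives -/
def ofD (D1 D2 : R → R) (a b : Fin 6 → R) : FO R :=
  ⟨a, b, fun i => D1 (a i), fun i => D1 (b i), fun i => D2 (a i), fun i => D2 (b i)⟩

theorem tan_of [IsDomain R] [CharZero R] (hs : SymT c) {D : R → R} (hD : IsDer D) (F : FO R) (h : F.OnLine c) :
    F.Tan c (fun i => D (F.a i)) (fun i => D (F.b i)) := by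
  have key : ∀ x : R, x = 0 → D x = 0 := by rintro x rfl; exact hD.zero
  have h1 := key _ h.aaa
  have h2 := key _ h.aab
  have h3 := key _ h.abb
  have h4 := key _ h.bbb
  rw [hD.tri] at h1 h2 h3 h4
  set u : Fin 6 → R := fun i => D (F.a i)
  set v : Fin 6 → R := fun i => D (F.b i)
  have p1 : ∀ x y z : Fin 6 → R, tri c x y z = tri c y z x := fun x y z => by
    rw [tri_swap12 hs, tri_swap23 hs]
  refine ⟨?_, ?_, ?_, ?_⟩
  · rw [p1 u F.a F.a, ← p1 F.a F.a u] at h1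
    have : (3 : R) * tri c F.a F.a u = 0 := by
      linear_combination h1
    exact (mul_eq_zero.1 this).resolve_left (by norm_num)
  · rw [p1 u F.a F.b, tri_swap23 hs F.a u F.b] at h2
    linear_combination h2
  · rw [p1 u F.b F.b, tri_swap23 hs F.a v F.b] at h3
    linear_combination h3
  · rw [p1 v F.b F.b, tri_swap23 hs F.b v F.b] at h4
    have : (3 : R) * tri c F.b F.b v = 0 := by linear_combination h4
    exact (mul_eq_zero.1 this).resolve_left (by norm_num)

theorem valid_ofD [IsDomain R] [CharZero R] (hs : SymT c) {D1 D2 : R → R} (h1 : IsDer D1) (h2 : IsDer D2)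
    (a b : Fin 6 → R) (h : (ofD D1 D2 a b).OnLine c) : (ofD D1 D2 a b).Valid c :=
  ⟨h, tan_of hs h1 _ h, tan_of hs h2 _ h⟩

theorem frame_ofD (hs : SymT c) {D1 D2 : R → R} (h1 : IsDer D1) (h2 : IsDer D2)
    (a b a' b' : Fin 6 → R) (g α β γ δ : R) (ha : ∀ i, g * a' i = α * a i + β * b i)
    (hb : ∀ i, g * b' i = γ * a i + δ * b i) (w1 w2 : Fin 6 → R) :
    g ^ 8 * (ofD D1 D2 a' b').num c w1 w2 = (α * δ - β * γ) ^ 4 * (ofD D1 D2 a b).num c w1 w2 ∧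
    g ^ 8 * (ofD D1 D2 a' b').den c w1 w2 = (α * δ - β * γ) ^ 4 * (ofD D1 D2 a b).den c w1 w2 := by
  have key : ∀ D : R → R, IsDer D → ∀ (x x' y : R) (p q : R), g * x' = p * x + q * y →
      g * D x' + D g * x' = p * D x + q * D y + (D p * x + D q * y) := by
    intro D hD x x' y p q h
    have := congrArg D h
    rw [hD.add, hD.mul, hD.mul, hD.mul] at this
    linear_combination this
  refine num_den_frame hs (ofD D1 D2 a b) (ofD D1 D2 a' b') g α β γ δ (D1 g) (D2 g)
    (D1 α) (D1 β) (D1 γ) (D1 δ) (D2 α) (D2 β) (D2 γ) (D2 δ) (funext ha) (funext hb) (funext fun i => ?_)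
    (funext fun i => ?_) (funext fun i => ?_) (funext fun i => ?_) w1 w2
  · exact key D1 h1 _ _ _ _ _ (ha i)
  · exact key D1 h1 _ _ _ _ _ (hb i)
  · exact key D2 h2 _ _ _ _ _ (ha i)
  · exact key D2 h2 _ _ _ _ _ (hb i)

end FO

/-- two-variable polynomials `ℂ[t][s]` -/
abbrev R2 := Polynomial (Polynomial ℂ)

def dS (p : R2) : R2 := Polynomial.derivative p
def dT (p : R2) : R2 := p.sum fun i x => Polynomial.monomial i (Polynomial.derivative x)

theorem coeff_dT (p : R2) (n : ℕ) : (dT p).coeff n = Polynomial.derivative (p.coeff n) := by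
  unfold dT
  rw [Polynomial.sum_def, Polynomial.finsetSum_coeff]
  simp only [Polynomial.coeff_monomial]
  rw [Finset.sum_ite_eq']
  split_ifs with h
  · rfl
  · rw [Polynomial.notMem_support_iff.1 h]; simp

theorem isDer_dT : IsDer dT := by
  refine ⟨fun x y => ?_, fun x y => ?_, fun z => ?_⟩
  · ext1 n; simp [coeff_dT]
  · ext1 n
    rw [coeff_dT, Polynomial.coeff_mul, Polynomial.derivative_sum, Polynomial.coeff_add, Polynomial.coeff_mul,
      Polynomial.coeff_mul, ← Finset.sum_add_distrib]
    refine Finset.sum_congr rfl fun i _ => ?_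
    rw [Polynomial.derivative_mul, coeff_dT, coeff_dT, add_comm]
  · ext1 n
    rw [coeff_dT, Polynomial.algebraMap_apply, Polynomial.coeff_C]
    split_ifs
    · simp [Polynomial.algebraMap_apply]
    · simp

theorem isDer_dS : IsDer dS := by
  refine ⟨fun x y => ?_, fun x y => ?_, fun z => ?_⟩
  · simp [dS]
  · simp only [dS, Polynomial.derivative_mul]; ring
  · simp [dS, Polynomial.algebraMap_apply]

theorem clear_denoms_aux (K : Type) [Field K] [Algebra (Polynomial ℂ) K] [IsFractionRing (Polynomial ℂ) K] (π : Fin 6 → Fin 6 → R2) (h : ∃ i j, π i j ≠ 0) :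
    ∃ (r : Polynomial ℂ) (g : R2) (π' κ : Fin 6 → Fin 6 → R2), r ≠ 0 ∧ g ≠ 0 ∧
      (∀ i j, Polynomial.C r * π i j = g * π' i j) ∧ ∑ i, ∑ j, κ i j * π' i j = Polynomial.C r := by
  let : Algebra R2 (Polynomial K) := Polynomial.algebra (Polynomial ℂ) K
  have : IsLocalization ((nonZeroDivisors (Polynomial ℂ)).map Polynomial.C) (Polynomial K) :=
    Polynomial.isLocalization (nonZeroDivisors (Polynomial ℂ)) K
  have hinj : Function.Injective (algebraMap R2 (Polynomial K)) := by
    apply IsLocalization.injective (M := (nonZeroDivisors (Polynomial ℂ)).map Polynomial.C)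
    rintro _ ⟨x, hx, rfl⟩
    exact mem_nonZeroDivisors_of_ne_zero (by simpa using nonZeroDivisors.ne_zero hx)
  let P : Fin 6 × Fin 6 → Polynomial K := fun x => algebraMap R2 (Polynomial K) (π x.1 x.2)
  let I : Ideal (Polynomial K) := Ideal.span (Set.range P)
  obtain ⟨G, hG⟩ := IsPrincipalIdealRing.principal I
  rw [Ideal.submodule_span_eq] at hG
  have hdiv : ∀ x, ∃ y, P x = G * y := by
    intro x
    have : P x ∈ I := Ideal.subset_span ⟨x, rfl⟩
    rw [hG, Ideal.mem_span_singleton] at this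
    exact this
  choose Y hY using hdiv
  have hGI : G ∈ I := by rw [hG]; exact Ideal.mem_span_singleton_self G
  obtain ⟨k, hk⟩ := (Submodule.mem_span_range_iff_exists_fun _).1 hGI
  have hG0 : G ≠ 0 := by
    rintro rfl
    obtain ⟨i, j, hij⟩ := h
    have := hY (i, j)
    rw [zero_mul] at this
    exact hij (hinj (by rw [map_zero]; exact this))
  have hB : ∑ x, k x * Y x = 1 := by
    apply mul_left_cancel₀ hG0
    rw [mul_one, Finset.mul_sum]
    conv_rhs => rw [← hk]
    refine Finset.sum_congr rfl fun x _ => ?_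
    rw [smul_eq_mul, hY x]; ring
  obtain ⟨⟨b, ⟨r, hr, rfl⟩⟩, hb⟩ := IsLocalization.exist_integer_multiples_of_finite
    ((nonZeroDivisors (Polynomial ℂ)).map Polynomial.C)
    (fun x : Unit ⊕ ((Fin 6 × Fin 6) ⊕ (Fin 6 × Fin 6)) => Sum.elim (fun _ => G) (Sum.elim Y k) x)
  have hr0 : r ≠ 0 := nonZeroDivisors.ne_zero hr
  obtain ⟨g, hg⟩ := hb (Sum.inl ())
  have hb1 := fun x => hb (Sum.inr (Sum.inl x))
  have hb2 := fun x => hb (Sum.inr (Sum.inr x))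
  choose y hy using hb1
  choose k' hk' using hb2
  simp only [Sum.elim_inl, Sum.elim_inr, Algebra.smul_def] at hg hy hk'
  have hCr : algebraMap R2 (Polynomial K) (Polynomial.C r) ≠ 0 := by
    rw [Ne, map_eq_zero_iff _ hinj]; simpa using hr0
  refine ⟨r ^ 2, g, fun i j => y (i, j), fun i j => k' (i, j), pow_ne_zero 2 hr0, ?_, fun i j => hinj ?_, hinj ?_⟩
  · rintro rfl
    rw [map_zero] at hg
    exact mul_ne_zero hCr hG0 hg.symm
  · rw [map_mul, map_mul, hg, hy, map_pow, map_pow]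
    have := hY (i, j)
    change algebraMap R2 (Polynomial K) (π i j) = _ at this
    rw [this]; ring
  · rw [← Fintype.sum_prod_type (f := fun x : Fin 6 × Fin 6 => k' x * y x), map_sum, map_pow, map_pow]
    have : ∀ x, algebraMap R2 (Polynomial K) (k' x * y x) = (algebraMap R2 (Polynomial K) (Polynomial.C r)) ^ 2 * (k x * Y x) := by
      intro x; rw [map_mul, hk', hy]; ring
    simp only [this]
    rw [← Finset.mul_sum, hB, mul_one]

theorem clear_denoms (π : Fin 6 → Fin 6 → R2) (h : ∃ i j, π i j ≠ 0) :
    ∃ (r : Polynomial ℂ) (g : R2) (π' κ : Fin 6 → Fin 6 → R2), r ≠ 0 ∧ g ≠ 0 ∧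
      (∀ i j, Polynomial.C r * π i j = g * π' i j) ∧ ∑ i, ∑ j, κ i j * π' i j = Polynomial.C r :=
  clear_denoms_aux (FractionRing (Polynomial ℂ)) π h

end

open MvPolynomial

noncomputable section

/-- specialization `t = t0` -/
def sp (t : ℂ) : R2 →ₐ[ℂ] Polynomial ℂ := Polynomial.mapAlgHom (Polynomial.aeval t)

theorem coeff_sp (t : ℂ) (p : R2) (n : ℕ) : (sp t p).coeff n = (p.coeff n).eval t := by
  simp [sp]

theorem exists_t0 {k : ℕ} (f : Fin k → Polynomial ℂ) (h : ∀ i, f i ≠ 0) : ∃ t, ∀ i, (f i).eval t ≠ 0 := by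
  have h1 : ∏ i, f i ≠ 0 := Finset.prod_ne_zero_iff.2 fun i _ => h i
  obtain ⟨t, ht⟩ : ∃ t, (∏ i, f i).eval t ≠ 0 := by
    by_contra hcon
    push Not at hcon
    exact h1 (Polynomial.funext (by simpa using hcon))
  rw [Polynomial.eval_prod] at ht
  exact ⟨t, fun i => Finset.prod_ne_zero_iff.1 ht i (Finset.mem_univ i)⟩

theorem exists_coeff_ne {p : R2} (h : p ≠ 0) : ∃ n, p.coeff n ≠ 0 := by
  by_contra hcon
  push Not at hcon
  exact h (Polynomial.ext (by simpa using hcon))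

theorem sp_ne_zero {p : R2} {t : ℂ} {n : ℕ} (h : (p.coeff n).eval t ≠ 0) : sp t p ≠ 0 := by
  intro h0
  apply h
  rw [← coeff_sp, h0]; simp

/-- membership of polynomial families in a subspace after clearing a factor -/
theorem mem_of_factor (W : Submodule ℂ (Fin 6 → ℂ)) (r : Fin 6 → Polynomial ℂ) (a b : Fin 6 → Polynomial ℂ)
    (g α β : Polynomial ℂ) (hg : g ≠ 0) (h : ∀ i, g * r i = α * a i + β * b i)
    (ha : ∀ s : ℂ, (fun i => (a i).eval s) ∈ W) (hb : ∀ s : ℂ, (fun i => (b i).eval s) ∈ W) :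
    (∀ s : ℂ, (fun i => (r i).eval s) ∈ W) ∧ ∀ n, (fun i => (r i).coeff n) ∈ W := by
  have key : ∀ L : (Fin 6 → ℂ) →ₗ[ℂ] ℂ, (∀ w ∈ W, L w = 0) →
      ∑ i, Polynomial.C (L (Pi.single i 1)) * r i = 0 := by
    intro L hL
    have hLs : ∀ v : Fin 6 → ℂ, L v = ∑ i, L (Pi.single i 1) * v i := by
      intro v
      conv_lhs => rw [pi_eq_sum_univ' v]
      simp [map_sum, mul_comm]
    have h1 : g * ∑ i, Polynomial.C (L (Pi.single i 1)) * r i = 0 := by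
      apply Polynomial.funext
      intro s
      have e1 := hL _ (ha s)
      have e2 := hL _ (hb s)
      rw [hLs] at e1 e2
      have : g * ∑ i, Polynomial.C (L (Pi.single i 1)) * r i =
          α * ∑ i, Polynomial.C (L (Pi.single i 1)) * a i + β * ∑ i, Polynomial.C (L (Pi.single i 1)) * b i := by
        simp only [Finset.mul_sum, ← Finset.sum_add_distrib]
        refine Finset.sum_congr rfl fun i _ => ?_
        linear_combination Polynomial.C (L (Pi.single i 1)) * h i
      rw [this]
      simp only [Polynomial.eval_add, Polynomial.eval_mul, Polynomial.eval_finsetSum, Polynomial.eval_C, e1, e2,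
        Polynomial.eval_zero]
      ring
    exact (mul_eq_zero.1 h1).resolve_left hg
  have hLs : ∀ (L : (Fin 6 → ℂ) →ₗ[ℂ] ℂ) (v : Fin 6 → ℂ), L v = ∑ i, L (Pi.single i 1) * v i := by
    intro L v
    conv_lhs => rw [pi_eq_sum_univ' v]
    simp [map_sum, mul_comm]
  refine ⟨fun s => ?_, fun n => ?_⟩
  · by_contra hcon
    obtain ⟨L, hL, hW⟩ := exists_dual_sep W _ hcon
    apply hL
    rw [hLs]
    have := congrArg (Polynomial.eval s) (key L hW)
    simpa [Polynomial.eval_finsetSum] using this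
  · by_contra hcon
    obtain ⟨L, hL, hW⟩ := exists_dual_sep W _ hcon
    apply hL
    rw [hLs]
    have := congrArg (fun p => Polynomial.coeff p n) (key L hW)
    simpa [Polynomial.finsetSum_coeff] using this

namespace FO
variable {c : Fin 6 → Fin 6 → Fin 6 → ℂ}

theorem smooth_of (hs : SymT c) (W : Submodule ℂ (Fin 6 → ℂ)) (hW : ∀ p ∈ W, p ≠ 0 → ∃ w, tri c p p w ≠ 0)
    (F : FO ℂ) (ha : F.a ∈ W) (hb : F.b ∈ W) (i j : Fin 6) (hij : F.a i * F.b j - F.a j * F.b i ≠ 0) :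
    Smooth c F := by
  intro x y hxy
  have hp : x • F.a + y • F.b ≠ 0 := by
    intro h0
    have h1 := congrFun h0 i
    have h2 := congrFun h0 j
    simp only [Pi.add_apply, Pi.smul_apply, smul_eq_mul, Pi.zero_apply] at h1 h2
    have hx : x * (F.a i * F.b j - F.a j * F.b i) = 0 := by linear_combination F.b j * h1 - F.b i * h2
    have hy : y * (F.a i * F.b j - F.a j * F.b i) = 0 := by linear_combination F.a i * h2 - F.a j * h1
    rcases hxy with h | h
    · exact mul_ne_zero h hij hx
    · exact mul_ne_zero h hij hy
  obtain ⟨w, hw⟩ := hW _ (W.add_mem (W.smul_mem x ha) (W.smul_mem y hb)) hp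
  refine ⟨w, ?_⟩
  intro h0
  apply hw
  simp only [tri_add1, tri_add2, tri_smul1, tri_smul2]
  rw [tri_swap12 hs F.b F.a w]
  simp only [Q0, Q1, Q2] at h0
  linear_combination h0

theorem theta (hs : SymT c) (a b : Fin 6 → R2) (hl : (ofD dS dT a b).OnLine c)
    (hπ : ∃ i j, a i * b j - a j * b i ≠ 0) (W : ℂ → Submodule ℂ (Fin 6 → ℂ))
    (ha : ∀ t s : ℂ, (fun i => (sp t (a i)).eval s) ∈ W t)
    (hb : ∀ t s : ℂ, (fun i => (sp t (b i)).eval s) ∈ W t)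
    (hW : ∀ t, ∀ p ∈ W t, p ≠ 0 → ∃ w, tri c p p w ≠ 0) (w1 w2 : Fin 6 → ℂ)
    (hden : (ofD dS dT a b).den c (cst _ w1) (cst _ w2) ≠ 0) :
    (ofD dS dT a b).num c (cst _ w1) (cst _ w2) = 0 := by
  by_contra hnum
  obtain ⟨r, g, π, κ, hr, hg, hrel, hBez⟩ := clear_denoms (fun i j => a i * b j - a j * b i) hπ
  -- maximal degree
  have hπ0 : ∃ i j, π i j ≠ 0 := by
    obtain ⟨i, j, hij⟩ := hπ
    refine ⟨i, j, fun h0 => ?_⟩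
    have := hrel i j
    rw [h0, mul_zero] at this
    exact mul_ne_zero (by simpa using hr) hij this
  obtain ⟨i0, j0, hne0, hmax⟩ : ∃ i0 j0, π i0 j0 ≠ 0 ∧ ∀ i j, (π i j).natDegree ≤ (π i0 j0).natDegree := by
    obtain ⟨⟨i0, j0⟩, -, hm⟩ := Finset.exists_max_image (Finset.univ : Finset (Fin 6 × Fin 6))
      (fun x => (π x.1 x.2).degree) ⟨(0, 0), Finset.mem_univ _⟩
    have hne : π i0 j0 ≠ 0 := by
      obtain ⟨i, j, hij⟩ := hπ0
      intro h0
      have := hm (i, j) (Finset.mem_univ _)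
      simp only [h0, Polynomial.degree_zero, le_bot_iff, Polynomial.degree_eq_bot] at this
      exact hij this
    exact ⟨i0, j0, hne, fun i j => Polynomial.natDegree_le_natDegree (hm (i, j) (Finset.mem_univ _))⟩
  set M := (π i0 j0).natDegree with hM
  -- choose t0
  obtain ⟨n1, hn1⟩ := exists_coeff_ne hg
  obtain ⟨n2, hn2⟩ := exists_coeff_ne hden
  obtain ⟨n3, hn3⟩ := exists_coeff_ne hnum
  have hlead : (π i0 j0).coeff M ≠ 0 := by
    rw [hM, Polynomial.coeff_natDegree]; exact Polynomial.leadingCoeff_ne_zero.2 hne0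
  obtain ⟨t, ht⟩ := exists_t0 ![r, g.coeff n1, ((ofD dS dT a b).den c (cst _ w1) (cst _ w2)).coeff n2,
    ((ofD dS dT a b).num c (cst _ w1) (cst _ w2)).coeff n3, (π i0 j0).coeff M] (by
    intro i; fin_cases i
    · exact hr
    · exact hn1
    · exact hn2
    · exact hn3
    · exact hlead)
  have t0 : r.eval t ≠ 0 := ht 0
  have t1 : sp t g ≠ 0 := sp_ne_zero (ht 1)
  have t2 : sp t ((ofD dS dT a b).den c (cst _ w1) (cst _ w2)) ≠ 0 := sp_ne_zero (ht 2)
  have t3 : sp t ((ofD dS dT a b).num c (cst _ w1) (cst _ w2)) ≠ 0 := sp_ne_zero (ht 3)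
  have t4 : ((π i0 j0).coeff M).eval t ≠ 0 := ht 4
  clear ht
  -- rows
  have hanti : ∀ i j, π i j = - π j i := by
    intro i j
    apply mul_left_cancel₀ hg
    linear_combination -(hrel i j) - hrel j i
  have hrow : ∀ i k, g * π k i = (Polynomial.C r * b i) * a k + (- (Polynomial.C r * a i)) * b k := by
    intro i k; rw [← hrel]; ring
  have hfr : ∀ (x : Fin 6 × Fin 6) (w1 w2 : Fin 6 → R2),
      g ^ 4 * (ofD dS dT (fun k => π k x.1) (fun k => π k x.2)).num c w1 w2 =
        (Polynomial.C r * π x.1 x.2) ^ 4 * (ofD dS dT a b).num c w1 w2 ∧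
      g ^ 4 * (ofD dS dT (fun k => π k x.1) (fun k => π k x.2)).den c w1 w2 =
        (Polynomial.C r * π x.1 x.2) ^ 4 * (ofD dS dT a b).den c w1 w2 := by
    intro x w1 w2
    have h := frame_ofD (c := c) hs isDer_dS isDer_dT a b (fun k => π k x.1) (fun k => π k x.2) g _ _ _ _
      (hrow x.1) (hrow x.2) w1 w2
    have e : (Polynomial.C r * b x.1) * (-(Polynomial.C r * a x.2)) - (-(Polynomial.C r * a x.1)) * (Polynomial.C r * b x.2)
       = Polynomial.C r * π x.1 x.2 * g := by
      linear_combination Polynomial.C r * hrel x.1 x.2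
    rw [e] at h
    refine ⟨?_, ?_⟩
    · apply mul_left_cancel₀ (pow_ne_zero 4 hg)
      linear_combination h.1
    · apply mul_left_cancel₀ (pow_ne_zero 4 hg)
      linear_combination h.2
  have hV := valid_ofD hs isDer_dS isDer_dT a b hl
  have hmem : ∀ i, (∀ s : ℂ, (fun k => (sp t (π k i)).eval s) ∈ W t) ∧ ∀ n, (fun k => (sp t (π k i)).coeff n) ∈ W t := by
    intro i
    refine mem_of_factor (W t) (fun k => sp t (π k i)) (fun k => sp t (a k)) (fun k => sp t (b k)) (sp t g)
      (sp t (Polynomial.C r * b i)) (sp t (- (Polynomial.C r * a i))) t1 (fun k => ?_) (ha t) (hb t)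
    rw [← map_mul, hrow i k, map_add, map_mul, map_mul _ (-_)]
  -- apply the line theorem
  apply t3
  rw [map_num_cst]
  have hdeg : ∀ i k n, M < n → (π k i).coeff n = 0 := fun i k n hn =>
    Polynomial.coeff_eq_zero_of_natDegree_lt (lt_of_le_of_lt (hmax k i) hn)
  have hHL : ∀ (p : R2), (∀ n, M < n → p.coeff n = 0) → HL (sp t p) M ((p.coeff M).eval t) := by
    intro p hp
    refine ⟨?_, coeff_sp _ _ _⟩
    rw [Polynomial.natDegree_le_iff_coeff_eq_zero]
    intro n hn
    rw [coeff_sp, hp n hn]; simp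
  have hcr : sp t (Polynomial.C r) = Polynomial.C (r.eval t) := by
    ext n
    rw [coeff_sp, Polynomial.coeff_C, Polynomial.coeff_C]
    split_ifs <;> simp
  refine num_zero_line hs ((ofD dS dT a b).map (sp t)) (hV.map (sp t)) (κ := Fin 6 × Fin 6)
    (fun x => (ofD dS dT (fun k => π k x.1) (fun k => π k x.2)).map (sp t)) (sp t g ^ 4) (pow_ne_zero 4 t1)
    (fun x => (sp t (Polynomial.C r * π x.1 x.2)) ^ 4) ?_ ?_ ?_ (i0, j0) ?_ M
    ⟨fun k => ((π k i0).coeff M).eval t, fun k => ((π k j0).coeff M).eval t, 0, 0,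
      fun k => ((dT (π k i0)).coeff M).eval t, fun k => ((dT (π k j0)).coeff M).eval t⟩ ?_ ?_ rfl rfl w1 w2 ?_
  · intro x v1 v2
    have := congrArg (sp t) (hfr x (cst _ v1) (cst _ v2)).2
    rw [map_mul, map_mul, map_pow, map_pow, map_den_cst, map_den_cst] at this
    beta_reduce
    exact this
  · intro x v1 v2
    have := congrArg (sp t) (hfr x (cst _ v1) (cst _ v2)).1
    rw [map_mul, map_mul, map_pow, map_pow, map_num_cst, map_num_cst] at this
    convert this using 2
  · intro s
    obtain ⟨i, j, hij⟩ : ∃ i j, (sp t (π i j)).eval s ≠ 0 := by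
      by_contra hcon
      push Not at hcon
      have := congrArg (fun p => (sp t p).eval s) hBez
      simp only [map_sum, map_mul, Polynomial.eval_finsetSum, Polynomial.eval_mul, hcon, mul_zero,
        Finset.sum_const_zero, hcr, Polynomial.eval_C] at this
      exact t0 this.symm
    refine ⟨(i, j), ?_, ?_⟩
    · simp only [map_mul, Polynomial.eval_pow, Polynomial.eval_mul, hcr, Polynomial.eval_C]
      exact pow_ne_zero _ (mul_ne_zero t0 hij)
    · refine smooth_of hs (W t) (hW t) _ ?_ ?_ i j ?_
      · have := (hmem i).1 s
        simpa only [map, ofD, Polynomial.coe_aeval_eq_eval] using this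
      · have := (hmem j).1 s
        simpa only [map, ofD, Polynomial.coe_aeval_eq_eval] using this
      · have e0 : ∀ i, π i i = 0 := by
          intro i
          apply mul_left_cancel₀ hg
          rw [mul_zero, ← hrel]; ring
        have e2 : (sp t (π j i)).eval s = - (sp t (π i j)).eval s := by
          rw [hanti j i, map_neg, Polynomial.eval_neg]
        simp only [map, ofD, Polynomial.coe_aeval_eq_eval, e0, map_zero, Polynomial.eval_zero, e2]
        intro h0
        apply mul_ne_zero hij hij
        linear_combination h0
  · apply pow_ne_zero
    rw [map_mul, hcr]
    exact mul_ne_zero (by simpa using t0) (sp_ne_zero t4)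
  · refine ⟨fun k => hHL _ (hdeg i0 k), fun k => hHL _ (hdeg j0 k), fun k => ?_, fun k => ?_, fun k => ?_, fun k => ?_⟩
    · have h1 : ∀ n, M ≤ n → (dS (π k i0)).coeff n = 0 := by
        intro n hn
        rw [dS, Polynomial.coeff_derivative, hdeg i0 k _ (by omega), zero_mul]
      have := hHL (dS (π k i0)) (fun n hn => h1 n hn.le)
      rw [h1 M le_rfl] at this
      simpa [map, ofD] using this
    · have h1 : ∀ n, M ≤ n → (dS (π k j0)).coeff n = 0 := by
        intro n hn
        rw [dS, Polynomial.coeff_derivative, hdeg j0 k _ (by omega), zero_mul]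
      have := hHL (dS (π k j0)) (fun n hn => h1 n hn.le)
      rw [h1 M le_rfl] at this
      simpa [map, ofD] using this
    · exact hHL (dT (π k i0)) fun n hn => by rw [coeff_dT, hdeg i0 k n hn]; simp
    · exact hHL (dT (π k j0)) fun n hn => by rw [coeff_dT, hdeg j0 k n hn]; simp
  · refine smooth_of hs (W t) (hW t) _ ?_ ?_ i0 j0 ?_
    · have := (hmem i0).2 M
      simpa only [coeff_sp] using this
    · have := (hmem j0).2 M
      simpa only [coeff_sp] using this
    · have e0 : ∀ i, π i i = 0 := by
        intro i
        apply mul_left_cancel₀ hg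
        rw [mul_zero, ← hrel]; ring
      simp only [e0, hanti j0 i0, Polynomial.coeff_zero, Polynomial.eval_zero, Polynomial.coeff_neg, Polynomial.eval_neg]
      intro h0
      apply mul_ne_zero t4 t4
      linear_combination h0
  · rw [map_den_cst] at t2
    exact t2

end FO
end

open MvPolynomial

noncomputable section

theorem sylvester_inj (p0 p1 p2 q0 q1 q2 x0 x1 y0 y1 : ℂ) (hr : res2 p0 p1 p2 q0 q1 q2 ≠ 0)
    (E0 : x0 * p0 - y0 * q0 = 0) (E1 : x0 * p1 + x1 * p0 - (y0 * q1 + y1 * q0) = 0)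
    (E2 : x0 * p2 + x1 * p1 - (y0 * q2 + y1 * q1) = 0) (E3 : x1 * p2 - y1 * q2 = 0) :
    x0 = 0 ∧ x1 = 0 ∧ y0 = 0 ∧ y1 = 0 := by
  have key : ∀ z : ℂ, res2 p0 p1 p2 q0 q1 q2 * z = 0 → z = 0 := fun z h => (mul_eq_zero.1 h).resolve_left hr
  refine ⟨key _ ?_, key _ ?_, key _ ?_, key _ ?_⟩ <;> unfold res2
  · linear_combination ((1)*p0*q2*q2+(-1)*p1*q1*q2+(1)*p2*q1*q1+(-1)*p2*q0*q2)*E0 + ((1)*p1*q0*q2+(-1)*p2*q0*q1)*E1 + ((-1)*p0*q0*q2+(1)*p2*q0*q0)*E2 + ((1)*p0*q0*q1+(-1)*p1*q0*q0)*E3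
  · linear_combination ((-1)*p1*q2*q2+(1)*p2*q1*q2)*E0 + ((1)*p0*q2*q2+(-1)*p2*q0*q2)*E1 + ((-1)*p0*q1*q2+(1)*p1*q0*q2)*E2 + ((1)*p0*q1*q1+(-1)*p0*q0*q2+(-1)*p1*q0*q1+(1)*p2*q0*q0)*E3
  · linear_combination ((-1)*p1*p1*q2+(1)*p1*p2*q1+(1)*p0*p2*q2+(-1)*p2*p2*q0)*E0 + ((1)*p0*p1*q2+(-1)*p0*p2*q1)*E1 + ((-1)*p0*p0*q2+(1)*p0*p2*q0)*E2 + ((1)*p0*p0*q1+(-1)*p0*p1*q0)*E3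
  · linear_combination ((-1)*p1*p2*q2+(1)*p2*p2*q1)*E0 + ((1)*p0*p2*q2+(-1)*p2*p2*q0)*E1 + ((-1)*p0*p2*q1+(1)*p1*p2*q0)*E2 + ((-1)*p0*p0*q2+(1)*p0*p1*q1+(-1)*p1*p1*q0+(1)*p0*p2*q0)*E3

/-- `A P = B Q` with coprime binary quadratic forms -/
theorem coprime_quad (p0 p1 p2 q0 q1 q2 a0 a1 a2 b0 b1 b2 : ℂ) (hr : res2 p0 p1 p2 q0 q1 q2 ≠ 0)
    (E0 : a0 * p0 - b0 * q0 = 0) (E1 : a0 * p1 + a1 * p0 - (b0 * q1 + b1 * q0) = 0)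
    (E2 : a0 * p2 + a1 * p1 + a2 * p0 - (b0 * q2 + b1 * q1 + b2 * q0) = 0)
    (E3 : a1 * p2 + a2 * p1 - (b1 * q2 + b2 * q1) = 0) (E4 : a2 * p2 - b2 * q2 = 0) :
    ∃ l, a0 = l * q0 ∧ a1 = l * q1 ∧ a2 = l * q2 ∧ b0 = l * p0 ∧ b1 = l * p1 ∧ b2 = l * p2 := by
  obtain ⟨l, h1, h2⟩ : ∃ l, a2 = l * q2 ∧ b2 = l * p2 := by
    by_cases hq : q2 = 0
    · have hp : p2 ≠ 0 := by
        rintro rfl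
        apply hr; rw [hq]; unfold res2; ring
      refine ⟨b2 / p2, ?_, by field_simp⟩
      rw [hq] at E4 ⊢
      rw [mul_zero]
      have : a2 * p2 = 0 := by linear_combination E4
      exact (mul_eq_zero.1 this).resolve_right hp
    · refine ⟨a2 / q2, by field_simp, ?_⟩
      field_simp
      linear_combination -E4
  obtain ⟨e0, e1, e2, e3⟩ := sylvester_inj p0 p1 p2 q0 q1 q2 (a0 - l * q0) (a1 - l * q1) (b0 - l * p0) (b1 - l * p1) hr
    (by linear_combination E0) (by linear_combination E1)
    (by rw [h1, h2] at E2; linear_combination E2) (by rw [h1, h2] at E3; linear_combination E3)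
  exact ⟨l, sub_eq_zero.1 e0, sub_eq_zero.1 e1, h1, sub_eq_zero.1 e2, sub_eq_zero.1 e3, h2⟩

theorem span_of_det3 (p0 p1 p2 q0 q1 q2 n0 n1 n2 : ℂ) (hr : res2 p0 p1 p2 q0 q1 q2 ≠ 0)
    (h : det3 p0 p1 p2 q0 q1 q2 n0 n1 n2 = 0) :
    ∃ x y, n0 = x * p0 - y * q0 ∧ n1 = x * p1 - y * q1 ∧ n2 = x * p2 - y * q2 := by
  unfold det3 at h
  by_cases c1 : p0 * q1 - p1 * q0 = 0
  · by_cases c2 : p0 * q2 - p2 * q0 = 0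
    · exfalso; apply hr; unfold res2; rw [c1, c2]; ring
    · have hi := mul_inv_cancel₀ c2
      refine ⟨(n0 * q2 - n2 * q0) * (p0 * q2 - p2 * q0)⁻¹, -((p0 * n2 - p2 * n0) * (p0 * q2 - p2 * q0)⁻¹), ?_, ?_, ?_⟩
      · linear_combination (-n0) * hi
      · linear_combination (-n1) * hi - (p0 * q2 - p2 * q0)⁻¹ * h
      · linear_combination (-n2) * hi
  · have hi := mul_inv_cancel₀ c1
    refine ⟨(n0 * q1 - n1 * q0) * (p0 * q1 - p1 * q0)⁻¹, -((p0 * n1 - p1 * n0) * (p0 * q1 - p1 * q0)⁻¹), ?_, ?_, ?_⟩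
    · linear_combination (-n0) * hi
    · linear_combination (-n1) * hi
    · linear_combination (-n2) * hi + (p0 * q1 - p1 * q0)⁻¹ * h

/-- cancel a nonzero binary quadratic form -/
theorem cancel_quad (p0 p1 p2 a0 a1 a2 : ℂ) (hp : ¬ (p0 = 0 ∧ p1 = 0 ∧ p2 = 0))
    (E0 : a0 * p0 = 0) (E1 : a0 * p1 + a1 * p0 = 0) (E2 : a0 * p2 + a1 * p1 + a2 * p0 = 0)
    (E3 : a1 * p2 + a2 * p1 = 0) (E4 : a2 * p2 = 0) : a0 = 0 ∧ a1 = 0 ∧ a2 = 0 := by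
  grind

namespace FO
variable {c : Fin 6 → Fin 6 → Fin 6 → ℂ}

theorem split (hs : SymT c) (F : FO ℂ) (hV : F.Valid c) (hsm : Smooth c F)
    (hnum : ∀ w1 w2, F.den c w1 w2 ≠ 0 → F.num c w1 w2 = 0) :
    ∃ l : (Fin 6 → ℂ) → ℂ, ∀ w w',
      F.N0 w w' = l w' * F.Q0 c w - l w * F.Q0 c w' ∧
      F.N1 w w' = l w' * F.Q1 c w - l w * F.Q1 c w' ∧
      F.N2 w w' = l w' * F.Q2 c w - l w * F.Q2 c w' := by
  obtain ⟨x, y, hxy⟩ := exists_good F hsm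
  obtain ⟨l2, l1, n0, n1, n2⟩ := span_of_det3 _ _ _ _ _ _ _ _ _ hxy (hnum x y hxy)
  have step : ∀ w, ∃ l, F.N0 x w = l * F.Q0 c x - l1 * F.Q0 c w ∧ F.N1 x w = l * F.Q1 c x - l1 * F.Q1 c w ∧
      F.N2 x w = l * F.Q2 c x - l1 * F.Q2 c w := by
    intro w
    obtain ⟨e0, e1, e2, e3, e4⟩ := cocycle hs hV x y w
    rw [n0] at e0
    rw [n0, n1] at e1
    rw [n0, n1, n2] at e2
    rw [n1, n2] at e3
    rw [n2] at e4
    obtain ⟨l, -, -, -, h0, h1, h2⟩ := coprime_quad (F.Q0 c x) (F.Q1 c x) (F.Q2 c x) (F.Q0 c y) (F.Q1 c y) (F.Q2 c y)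
      (F.N0 y w + l2 * F.Q0 c w) (F.N1 y w + l2 * F.Q1 c w) (F.N2 y w + l2 * F.Q2 c w)
      (F.N0 x w + l1 * F.Q0 c w) (F.N1 x w + l1 * F.Q1 c w) (F.N2 x w + l1 * F.Q2 c w) hxy
      (by linear_combination e0) (by linear_combination e1) (by linear_combination e2)
      (by linear_combination e3) (by linear_combination e4)
    exact ⟨l, by linear_combination h0, by linear_combination h1, by linear_combination h2⟩
  choose l hl using step
  refine ⟨l, fun w w' => ?_⟩
  obtain ⟨e0, e1, e2, e3, e4⟩ := cocycle hs hV x w w'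
  obtain ⟨f0, f1, f2⟩ := hl w
  obtain ⟨g0, g1, g2⟩ := hl w'
  rw [f0, g0] at e0
  rw [f0, g0, f1, g1] at e1
  rw [f0, g0, f1, g1, f2, g2] at e2
  rw [f1, g1, f2, g2] at e3
  rw [f2, g2] at e4
  obtain ⟨h0, h1, h2⟩ := cancel_quad (F.Q0 c x) (F.Q1 c x) (F.Q2 c x)
    (F.N0 w w' - (l w' * F.Q0 c w - l w * F.Q0 c w'))
    (F.N1 w w' - (l w' * F.Q1 c w - l w * F.Q1 c w'))
    (F.N2 w w' - (l w' * F.Q2 c w - l w * F.Q2 c w')) (den_ne_left hxy)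
    (by linear_combination e0) (by linear_combination e1) (by linear_combination e2)
    (by linear_combination e3) (by linear_combination e4)
  exact ⟨by linear_combination h0, by linear_combination h1, by linear_combination h2⟩

end FO
end

open MvPolynomial

noncomputable section

section
variable {R : Type} [CommRing R]
theorem vol6_perm (σ : Equiv.Perm (Fin 6)) (M : Fin 6 → Fin 6 → R) :
    Matrix.det (Matrix.of (fun i => M (σ i))) = (Equiv.Perm.sign σ : ℤ) * Matrix.det (Matrix.of M) := by
  have := Matrix.det_permute σ (Matrix.of M)
  rw [← this]; rfl

theorem vol6_24 (a b w x y : Fin 6 → R) : vol6 a b w x w y = 0 := vol6_alt _ 2 4 (by decide) rfl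
theorem vol6_25 (a b w x y : Fin 6 → R) : vol6 a b w x y w = 0 := vol6_alt _ 2 5 (by decide) rfl
theorem vol6_45 (a b w x y : Fin 6 → R) : vol6 a b w x y y = 0 := vol6_alt _ 4 5 (by decide) rfl

theorem vol6_swap45 (a b w1 w2 x y : Fin 6 → R) : vol6 a b w1 w2 y x = - vol6 a b w1 w2 x y := by
  have := vol6_45 a b w1 w2 (x + y)
  rw [vol6_add4, vol6_add5, vol6_add5, vol6_45, vol6_45] at this
  linear_combination this
theorem vol6_swap24 (a b w1 w2 x y : Fin 6 → R) : vol6 a b x w2 w1 y = - vol6 a b w1 w2 x y := by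
  have := vol6_24 a b (w1 + x) w2 y
  rw [vol6_add2, vol6_add4, vol6_add4, vol6_24, vol6_24] at this
  linear_combination this
theorem vol6_cyc (a b w x y z : Fin 6 → R) : vol6 a b z w x y = vol6 a b x w y z := by
  rw [vol6_swap24 a b x w z y, vol6_swap45, neg_neg]
end

theorem vol6_ne_of_li (a b x y z : Fin 6 → ℂ) (h : LinearIndependent ℂ ![a, b, x, y, z]) :
    ∃ w, vol6 a b x w y z ≠ 0 := by
  obtain ⟨w, hw⟩ : ∃ w, w ∉ Submodule.span ℂ (Set.range ![a, b, x, y, z]) := by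
    by_contra hcon
    push Not at hcon
    have h1 : Submodule.span ℂ (Set.range ![a, b, x, y, z]) = ⊤ := by
      rw [eq_top_iff]; exact fun w _ => hcon w
    have h2 := finrank_span_eq_card h
    rw [h1] at h2
    simp at h2
  refine ⟨w, ?_⟩
  have h6 : LinearIndependent ℂ (Fin.cons w ![a, b, x, y, z] : Fin 6 → Fin 6 → ℂ) :=
    linearIndependent_finCons.2 ⟨h, hw⟩
  have h7 : LinearIndependent ℂ (![a, b, x, w, y, z] : Fin 6 → Fin 6 → ℂ) := by
    have := h6.comp ![1, 2, 3, 0, 4, 5] (by decide)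
    convert this using 1
    ext i j
    fin_cases i <;> rfl
  have h8 := Matrix.linearIndependent_rows_iff_isUnit.1 (show LinearIndependent ℂ (Matrix.of ![a, b, x, w, y, z]).row from h7)
  rw [Matrix.isUnit_iff_isUnit_det] at h8
  exact h8.ne_zero

theorem dep_of_vol6 (a b x y z : Fin 6 → ℂ) (hab : LinearIndependent ℂ ![a, b])
    (h : ∀ w, vol6 a b z w x y = 0) :
    ∃ α β r s t : ℂ, (r ≠ 0 ∨ s ≠ 0 ∨ t ≠ 0) ∧ r • x + s • y + t • z = α • a + β • b := by
  by_contra hcon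
  push Not at hcon
  have hli : LinearIndependent ℂ ![a, b, z, x, y] := by
    rw [Fintype.linearIndependent_iff]
    intro g hg
    simp only [Fin.sum_univ_five] at hg
    have h1 : g 3 = 0 ∧ g 4 = 0 ∧ g 2 = 0 := by
      by_contra hne
      refine hcon (-g 0) (-g 1) (g 3) (g 4) (g 2) ?_ ?_
      · by_contra hx
        push Not at hx
        exact hne hx
      · have : g 0 • a + g 1 • b + g 2 • z + g 3 • x + g 4 • y = 0 := hg
        rw [← sub_eq_zero, ← this]
        module
    obtain ⟨h3, h4, h2⟩ := h1
    have : g 0 • a + g 1 • b + g 2 • z + g 3 • x + g 4 • y = 0 := hg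
    rw [h2, h3, h4] at this
    have h0 := LinearIndependent.pair_iff.1 hab (g 0) (g 1) (by rw [← this]; module)
    intro i
    fin_cases i
    exacts [h0.1, h0.2, h2, h3, h4]
  obtain ⟨w, hw⟩ := vol6_ne_of_li _ _ _ _ _ hli
  exact hw (h w)

namespace FO
variable {c : Fin 6 → Fin 6 → Fin 6 → ℂ}

theorem tri_comb2 (hs : SymT c) (a b w : Fin 6 → ℂ) (x y : ℂ) :
    tri c (x • a + y • b) (x • a + y • b) w = tri c a a w * x ^ 2 + (2 * tri c a b w) * x * y + tri c b b w * y ^ 2 := by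
  simp only [tri_add1, tri_add2, tri_smul1, tri_smul2]
  rw [tri_swap12 hs b a w]
  ring

theorem split_lin (hs : SymT c) (F : FO ℂ) (hV : F.Valid c) (hsm : Smooth c F)
    (hnum : ∀ w1 w2, F.den c w1 w2 ≠ 0 → F.num c w1 w2 = 0) :
    ∃ l : (Fin 6 → ℂ) →ₗ[ℂ] ℂ, ∀ (x y : ℂ) w w',
      vol6 F.a F.b w w' (x • F.u1 + y • F.v1) (x • F.u2 + y • F.v2) =
        l w' * tri c (x • F.a + y • F.b) (x • F.a + y • F.b) w
        - l w * tri c (x • F.a + y • F.b) (x • F.a + y • F.b) w' := by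
  obtain ⟨l, hl⟩ := split hs F hV hsm hnum
  have key : ∀ (x y : ℂ) w w', vol6 F.a F.b w w' (x • F.u1 + y • F.v1) (x • F.u2 + y • F.v2) =
        l w' * tri c (x • F.a + y • F.b) (x • F.a + y • F.b) w
        - l w * tri c (x • F.a + y • F.b) (x • F.a + y • F.b) w' := by
    intro x y w w'
    obtain ⟨h0, h1, h2⟩ := hl w w'
    rw [tri_comb2 hs, tri_comb2 hs]
    simp only [vol6_add4, vol6_add5, vol6_smul4, vol6_smul5]
    simp only [N0, N1, N2, Q0, Q1, Q2] at h0 h1 h2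
    linear_combination x ^ 2 * h0 + x * y * h1 + y ^ 2 * h2
  obtain ⟨w, hw⟩ := hsm 1 0 (Or.inl one_ne_zero)
  have hw' : tri c F.a F.a w ≠ 0 := by
    simpa [Q0] using hw
  have k2 : ∀ w', vol6 F.a F.b w w' F.u1 F.u2 = l w' * tri c F.a F.a w - l w * tri c F.a F.a w' := by
    intro w'
    have := key 1 0 w w'
    simpa using this
  refine ⟨⟨⟨l, fun p q => ?_⟩, fun r p => ?_⟩, key⟩
  · apply mul_right_cancel₀ hw'
    have h1 := k2 p
    have h2 := k2 q
    have h3 := k2 (p + q)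
    rw [vol6_add3, tri_add3] at h3
    linear_combination h1 + h2 - h3
  · apply mul_right_cancel₀ hw'
    have h1 := k2 p
    have h3 := k2 (r • p)
    rw [vol6_smul3, tri_smul3] at h3
    simp only [RingHom.id_apply, smul_eq_mul]
    linear_combination r * h1 - h3

/-- The contradiction for threefolds. -/
theorem contra3_aux (hs : SymT c) (a b u1 v1 u2 v2 u3 v3 : Fin 6 → ℂ)
    (l12 l23 l31 : (Fin 6 → ℂ) →ₗ[ℂ] ℂ)
    (hsm : ∀ x y : ℂ, (x ≠ 0 ∨ y ≠ 0) → ∃ w, tri c (x • a + y • b) (x • a + y • b) w ≠ 0)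
    (hQ1 : ∀ x y : ℂ, tri c (x • a + y • b) (x • a + y • b) (x • u1 + y • v1) = 0)
    (hQ2 : ∀ x y : ℂ, tri c (x • a + y • b) (x • a + y • b) (x • u2 + y • v2) = 0)
    (hQ3 : ∀ x y : ℂ, tri c (x • a + y • b) (x • a + y • b) (x • u3 + y • v3) = 0)
    (h12 : ∀ (x y : ℂ) (w w'), vol6 a b w w' (x • u1 + y • v1) (x • u2 + y • v2) =
      l12 w' * tri c (x • a + y • b) (x • a + y • b) w - l12 w * tri c (x • a + y • b) (x • a + y • b) w')
    (h23 : ∀ (x y : ℂ) (w w'), vol6 a b w w' (x • u2 + y • v2) (x • u3 + y • v3) =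
      l23 w' * tri c (x • a + y • b) (x • a + y • b) w - l23 w * tri c (x • a + y • b) (x • a + y • b) w')
    (h31 : ∀ (x y : ℂ) (w w'), vol6 a b w w' (x • u3 + y • v3) (x • u1 + y • v1) =
      l31 w' * tri c (x • a + y • b) (x • a + y • b) w - l31 w * tri c (x • a + y • b) (x • a + y • b) w')
    (hli : LinearIndependent ℂ ![a, b, u3, u1, u2]) : False := by
  have hab : LinearIndependent ℂ ![a, b] := by
    have := hli.comp ![0, 1] (by decide)
    convert this using 1
    ext i j
    fin_cases i <;> rfl
  -- equality of the mixed values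
  have E1 : ∀ x y : ℂ, (x ≠ 0 ∨ y ≠ 0) → l12 (x • u3 + y • v3) = l23 (x • u1 + y • v1) := by
    intro x y hxy
    obtain ⟨w, hw⟩ := hsm x y hxy
    apply mul_right_cancel₀ hw
    have e1 := h12 x y (x • u3 + y • v3) w
    have e2 := h23 x y (x • u1 + y • v1) w
    rw [hQ3] at e1
    rw [hQ1] at e2
    rw [vol6_cyc] at e1
    linear_combination e1 - e2 
  have E2 : ∀ x y : ℂ, (x ≠ 0 ∨ y ≠ 0) → l23 (x • u1 + y • v1) = l31 (x • u2 + y • v2) := by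
    intro x y hxy
    obtain ⟨w, hw⟩ := hsm x y hxy
    apply mul_right_cancel₀ hw
    have e1 := h23 x y (x • u1 + y • v1) w
    have e2 := h31 x y (x • u2 + y • v2) w
    rw [hQ1] at e1
    rw [hQ2] at e2
    rw [vol6_cyc] at e1
    linear_combination e1 - e2
  have e10 : ∀ p q : Fin 6 → ℂ, (1 : ℂ) • p + (0 : ℂ) • q = p := by intro p q; simp
  obtain ⟨w0, hw0⟩ := hsm 1 0 (Or.inl one_ne_zero)
  rw [e10] at hw0
  have H12 := h12 1 0
  have H23 := h23 1 0
  have H31 := h31 1 0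
  have q1 := hQ1 1 0
  have q2 := hQ2 1 0
  have q3 := hQ3 1 0
  have m1 := E1 1 0 (Or.inl one_ne_zero)
  have m2 := E2 1 0 (Or.inl one_ne_zero)
  simp only [e10] at H12 H23 H31 q1 q2 q3 m1 m2
  have z1 : l12 u1 = 0 := by
    have := H12 u1 w0
    rw [vol6_24, q1] at this
    exact (mul_eq_zero.1 (by linear_combination this : l12 u1 * tri c a a w0 = 0)).resolve_right hw0
  have z2 : l12 u2 = 0 := by
    have := H12 u2 w0
    rw [vol6_25, q2] at this
    exact (mul_eq_zero.1 (by linear_combination this : l12 u2 * tri c a a w0 = 0)).resolve_right hw0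
  have z3 : l23 u2 = 0 := by
    have := H23 u2 w0
    rw [vol6_24, q2] at this
    exact (mul_eq_zero.1 (by linear_combination this : l23 u2 * tri c a a w0 = 0)).resolve_right hw0
  have z4 : l23 u3 = 0 := by
    have := H23 u3 w0
    rw [vol6_25, q3] at this
    exact (mul_eq_zero.1 (by linear_combination this : l23 u3 * tri c a a w0 = 0)).resolve_right hw0
  have z5 : l31 u3 = 0 := by
    have := H31 u3 w0
    rw [vol6_24, q3] at this
    exact (mul_eq_zero.1 (by linear_combination this : l31 u3 * tri c a a w0 = 0)).resolve_right hw0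
  have z6 : l31 u1 = 0 := by
    have := H31 u1 w0
    rw [vol6_25, q1] at this
    exact (mul_eq_zero.1 (by linear_combination this : l31 u1 * tri c a a w0 = 0)).resolve_right hw0
  have hc : l12 u3 ≠ 0 := by
    intro h0
    obtain ⟨w, hw⟩ := vol6_ne_of_li _ _ _ _ _ hli
    apply hw
    rw [H12, q3, h0]; ring
  -- the special point
  obtain ⟨x0, hx0⟩ : ∃ x, x = - l12 v3 := ⟨_, rfl⟩
  obtain ⟨y0, hy0⟩ : ∃ y, y = l12 u3 := ⟨_, rfl⟩
  have hxy : x0 ≠ 0 ∨ y0 ≠ 0 := Or.inr (hy0 ▸ hc)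
  obtain ⟨α, β, r, s, t, hne, hrel⟩ := dep_of_vol6 a b (x0 • u1 + y0 • v1) (x0 • u2 + y0 • v2)
    (x0 • u3 + y0 • v3) hab (by
      intro w
      rw [h12, hQ3, map_add, map_smul, map_smul, hx0, hy0]
      simp only [smul_eq_mul]; ring)
  obtain ⟨w1, hw1⟩ := hsm x0 y0 hxy
  have zero : ∀ w w' p, vol6 a b w w' (α • a + β • b) p = 0 := by
    intro w w' p
    rw [vol6_add4, vol6_smul4, vol6_smul4, vol6_04, vol6_14]; ring
  generalize hτ1 : x0 • u1 + y0 • v1 = τ1 at *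
  generalize hτ2 : x0 • u2 + y0 • v2 = τ2 at *
  generalize hτ3 : x0 • u3 + y0 • v3 = τ3 at *
  have k12 := h12 x0 y0
  have k23 := h23 x0 y0
  have k31 := h31 x0 y0
  generalize hp : x0 • a + y0 • b = p at *
  rw [hτ1, hτ2] at k12
  rw [hτ2, hτ3] at k23
  rw [hτ3, hτ1] at k31
  have L1 : ∀ w w', (-s * l12 w' + t * l31 w') * tri c p p w = (-s * l12 w + t * l31 w) * tri c p p w' := by
    intro w w'
    have := zero w w' τ1
    rw [← hrel, vol6_add4, vol6_add4, vol6_smul4, vol6_smul4, vol6_smul4, vol6_45, vol6_swap45, k12, k31] at this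
    linear_combination this
  have L2 : ∀ w w', (r * l12 w' - t * l23 w') * tri c p p w = (r * l12 w - t * l23 w) * tri c p p w' := by
    intro w w'
    have := zero w w' τ2
    rw [← hrel, vol6_add4, vol6_add4, vol6_smul4, vol6_smul4, vol6_smul4, vol6_45, vol6_swap45 _ _ _ _ τ2 τ3, k12, k23] at this
    linear_combination this
  have L3 : ∀ w w', (-r * l31 w' + s * l23 w') * tri c p p w = (-r * l31 w + s * l23 w) * tri c p p w' := by
    intro w w'
    have := zero w w' τ3
    rw [← hrel, vol6_add4, vol6_add4, vol6_smul4, vol6_smul4, vol6_smul4, vol6_45, vol6_swap45 _ _ _ _ τ3 τ1, k31, k23] at this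
    linear_combination this
  rcases hne with hr | hs' | ht
  · -- r nonzero
    have f1 := L2 u2 u3
    rw [z2, z3, z4] at f1
    have g1 : tri c p p u2 = 0 := by
      have : (r * l12 u3) * tri c p p u2 = 0 := by linear_combination f1
      exact (mul_eq_zero.1 this).resolve_left (mul_ne_zero hr hc)
    have f2 := L3 u2 w1
    rw [z3, g1, ← m2, ← m1] at f2
    have : (r * l12 u3) * tri c p p w1 = 0 := by linear_combination f2
    exact (mul_ne_zero (mul_ne_zero hr hc) hw1) this
  · have f1 := L3 u3 u1
    rw [z4, z5, z6, ← m1] at f1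
    have g1 : tri c p p u3 = 0 := by
      have : (s * l12 u3) * tri c p p u3 = 0 := by linear_combination f1
      exact (mul_eq_zero.1 this).resolve_left (mul_ne_zero hs' hc)
    have f2 := L1 u3 w1
    rw [z5, g1] at f2
    have : (s * l12 u3) * tri c p p w1 = 0 := by linear_combination f2
    exact (mul_ne_zero (mul_ne_zero hs' hc) hw1) this
  · have f1 := L1 u1 u2
    rw [z1, z2, z6, ← m2, ← m1] at f1
    have g1 : tri c p p u1 = 0 := by
      have : (t * l12 u3) * tri c p p u1 = 0 := by linear_combination f1
      exact (mul_eq_zero.1 this).resolve_left (mul_ne_zero ht hc)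
    have f2 := L2 u1 w1
    rw [z1, g1, ← m1] at f2
    have : (t * l12 u3) * tri c p p w1 = 0 := by linear_combination f2
    exact (mul_ne_zero (mul_ne_zero ht hc) hw1) this

theorem contra3 (hs : SymT c) (a b : Fin 6 → ℂ) (u v : Fin 3 → Fin 6 → ℂ)
    (hV : ∀ i j, i ≠ j → (⟨a, b, u i, v i, u j, v j⟩ : FO ℂ).Valid c)
    (hsm : ∀ x y : ℂ, (x ≠ 0 ∨ y ≠ 0) → ∃ w, tri c (x • a + y • b) (x • a + y • b) w ≠ 0)
    (hnum : ∀ i j, i ≠ j → ∀ w1 w2, (⟨a, b, u i, v i, u j, v j⟩ : FO ℂ).den c w1 w2 ≠ 0 →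
      (⟨a, b, u i, v i, u j, v j⟩ : FO ℂ).num c w1 w2 = 0)
    (hli : LinearIndependent ℂ ![a, b, u 2, u 0, u 1]) : False := by
  have hsm' : ∀ i j, Smooth c (⟨a, b, u i, v i, u j, v j⟩ : FO ℂ) := by
    intro i j x y hxy
    obtain ⟨w, hw⟩ := hsm x y hxy
    rw [tri_comb2 hs] at hw
    exact ⟨w, hw⟩
  have hQ : ∀ i, ∀ x y : ℂ, tri c (x • a + y • b) (x • a + y • b) (x • u i + y • v i) = 0 := by
    intro i x y
    obtain ⟨j, hj⟩ : ∃ j, i ≠ j := by fin_cases i; exacts [⟨1, by decide⟩, ⟨0, by decide⟩, ⟨0, by decide⟩]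
    have h := (hV i j hj).t1
    rw [tri_comb2 hs]
    simp only [tri_add3, tri_smul3]
    have h1 := h.aau
    have h2 := h.t1
    have h3 := h.t2
    have h4 := h.bbv
    simp only at h1 h2 h3 h4
    linear_combination x ^ 3 * h1 + x ^ 2 * y * h2 + x * y ^ 2 * h3 + y ^ 3 * h4
  obtain ⟨l12, k12⟩ := split_lin hs _ (hV 0 1 (by decide)) (hsm' 0 1) (hnum 0 1 (by decide))
  obtain ⟨l23, k23⟩ := split_lin hs _ (hV 1 2 (by decide)) (hsm' 1 2) (hnum 1 2 (by decide))
  obtain ⟨l31, k31⟩ := split_lin hs _ (hV 2 0 (by decide)) (hsm' 2 0) (hnum 2 0 (by decide))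
  exact contra3_aux hs a b (u 0) (v 0) (u 1) (v 1) (u 2) (v 2) l12 l23 l31 hsm (hQ 0) (hQ 1) (hQ 2) k12 k23 k31 hli

end FO
end

open MvPolynomial

noncomputable section
namespace FO
variable {c : Fin 6 → Fin 6 → Fin 6 → ℂ}

/-- The conclusion for surfaces: the moving line does not move. -/
theorem contra2 (hs : SymT c) (a b u v e : Fin 6 → ℂ)
    (hV : ∀ α β : ℂ, (⟨a, b, u, v, α • e, β • e⟩ : FO ℂ).Valid c)
    (hsm : ∀ x y : ℂ, (x ≠ 0 ∨ y ≠ 0) → ∃ w, tri c (x • a + y • b) (x • a + y • b) w ≠ 0)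
    (hnum : ∀ α β : ℂ, ∀ w1 w2, (⟨a, b, u, v, α • e, β • e⟩ : FO ℂ).den c w1 w2 ≠ 0 →
      (⟨a, b, u, v, α • e, β • e⟩ : FO ℂ).num c w1 w2 = 0) (w w' : Fin 6 → ℂ) :
    vol6 a b w w' u e = 0 := by
  have hsm' : ∀ α β : ℂ, Smooth c (⟨a, b, u, v, α • e, β • e⟩ : FO ℂ) := by
    intro i j x y hxy
    obtain ⟨w, hw⟩ := hsm x y hxy
    rw [tri_comb2 hs] at hw
    exact ⟨w, hw⟩
  obtain ⟨l, k1⟩ := split_lin hs _ (hV 1 0) (hsm' 1 0) (hnum 1 0)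
  obtain ⟨l', k2⟩ := split_lin hs _ (hV 0 1) (hsm' 0 1) (hnum 0 1)
  simp only at k1 k2
  have K1 : ∀ (x y : ℂ) w w', x * vol6 a b w w' (x • u + y • v) e =
      l w' * tri c (x • a + y • b) (x • a + y • b) w - l w * tri c (x • a + y • b) (x • a + y • b) w' := by
    intro x y w w'
    rw [← k1, ← vol6_smul5]; congr 1; module
  have K2 : ∀ (x y : ℂ) w w', y * vol6 a b w w' (x • u + y • v) e =
      l' w' * tri c (x • a + y • b) (x • a + y • b) w - l' w * tri c (x • a + y • b) (x • a + y • b) w' := by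
    intro x y w w'
    rw [← k2, ← vol6_smul5]; congr 1; module
  obtain ⟨p, r, hpr⟩ := exists_good _ (hsm' 1 0)
  have E : ∀ x y : ℂ, y * (l r * tri c (x • a + y • b) (x • a + y • b) p - l p * tri c (x • a + y • b) (x • a + y • b) r)
     = x * (l' r * tri c (x • a + y • b) (x • a + y • b) p - l' p * tri c (x • a + y • b) (x • a + y • b) r) := by
    intro x y
    rw [← K1, ← K2]; ring
  simp only [tri_comb2 hs] at E
  rw [den] at hpr
  simp only [Q0, Q1, Q2] at hpr
  have e1 := E 1 0
  have e2 := E 0 1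
  have e3 := E 1 1
  have e4 := E 1 (-1)
  obtain ⟨z1, z2, z3, z4⟩ := sylvester_inj _ _ _ _ _ _ (-l' r) (l r) (-l' p) (l p) hpr
    (by linear_combination e1) (by linear_combination (e3 - e4) / 2 - e2)
    (by linear_combination (e3 + e4) / 2 - e1) (by linear_combination e2)
  have lw : ∀ w, l w = 0 := by
    intro w
    have f1 := K1 0 1 p w
    have f2 := K1 0 1 r w
    rw [z4] at f1
    rw [z2] at f2
    simp only [tri_comb2 hs] at f1 f2
    by_contra hne
    have g1 : tri c b b p = 0 := (mul_eq_zero.1 (by linear_combination -f1 : l w * tri c b b p = 0)).resolve_left hne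
    have g2 : tri c b b r = 0 := (mul_eq_zero.1 (by linear_combination -f2 : l w * tri c b b r = 0)).resolve_left hne
    apply hpr
    rw [g1, g2]
    unfold res2; ring
  have := K1 1 0 w w'
  rw [lw, lw] at this
  simpa using this

end FO
end

open MvPolynomial

noncomputable section
namespace FO

/-- lines contained in `X` -/
theorem contra3' (a b u1 v1 u2 v2 : Fin 6 → ℂ) (e : ℕ) (he : 1 ≤ e)
    (Q G : (Fin 6 → Polynomial ℂ) →ₗ[Polynomial ℂ] Polynomial ℂ)
    (Qa : Q (cst _ a) = 0) (Qb : Q (cst _ b) = 0) (Ga : G (cst _ a) = 0) (Gb : G (cst _ b) = 0)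
    (Q1 : Q (cst _ u1 + (Polynomial.X : Polynomial ℂ) • cst _ v1) = 0)
    (Q2 : Q (cst _ u2 + (Polynomial.X : Polynomial ℂ) • cst _ v2) = 0)
    (G1 : G (cst _ u1 + (Polynomial.X : Polynomial ℂ) • cst _ v1) = 0)
    (G2 : G (cst _ u2 + (Polynomial.X : Polynomial ℂ) • cst _ v2) = 0)
    (dQ : ∀ w, (Q (cst _ w)).natDegree ≤ 2) (dG : ∀ w, (G (cst _ w)).natDegree ≤ e)
    (hfin : ∀ r : ℂ, ∃ w w', (Q (cst _ w) * G (cst _ w') - Q (cst _ w') * G (cst _ w)).eval r ≠ 0)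
    (hinf : ∃ w w', (Q (cst _ w)).coeff 2 * (G (cst _ w')).coeff e - (Q (cst _ w')).coeff 2 * (G (cst _ w)).coeff e ≠ 0)
    (w w' : Fin 6 → ℂ) : vol6 a b w w' u1 u2 = 0 := by
  set U1 : Fin 6 → Polynomial ℂ := cst _ u1 + (Polynomial.X : Polynomial ℂ) • cst _ v1 with hU1
  set U2 : Fin 6 → Polynomial ℂ := cst _ u2 + (Polynomial.X : Polynomial ℂ) • cst _ v2 with hU2
  set K : (Fin 6 → ℂ) → (Fin 6 → ℂ) → Polynomial ℂ := fun w w' =>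
    vol6 (cst _ a) (cst _ b) (cst _ w) (cst _ w') U1 U2 with hK
  set H : (Fin 6 → ℂ) → (Fin 6 → ℂ) → Polynomial ℂ := fun w w' =>
    Q (cst _ w) * G (cst _ w') - Q (cst _ w') * G (cst _ w) with hH
  have anti : ∀ w w', K w' w = - K w w' := fun w w' => vol6_swap23 _ _ _ _ _ _
  have cQ : ∀ x y z, K x y * Q (cst _ z) = K z y * Q (cst _ x) + K x z * Q (cst _ y) := fun x y z =>
    vol6_cramer Q _ _ _ _ _ _ _ Qa Qb Q1 Q2
  have cG : ∀ x y z, K x y * G (cst _ z) = K z y * G (cst _ x) + K x z * G (cst _ y) := fun x y z =>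
    vol6_cramer G _ _ _ _ _ _ _ Ga Gb G1 G2
  have prop : ∀ x y z t, H z t * K x y = K z t * H x y := by
    intro x y z t
    have e1 := cQ x y z
    have e2 := cQ x y t
    have e3 := cG z t y
    have e4 := cG z t x
    simp only [hH]
    linear_combination G (cst _ t) * e1 - G (cst _ z) * e2 - Q (cst _ x) * e3 + Q (cst _ y) * e4 -
      Q (cst _ x) * G (cst _ z) * anti y t + Q (cst _ y) * G (cst _ t) * anti x z
  have cmap : ∀ x y z t p q : Fin 6 → ℂ, vol6 (cst (Polynomial ℂ) x) (cst _ y) (cst _ z) (cst _ t) (cst _ p) (cst _ q) =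
      Polynomial.C (vol6 x y z t p q) := by
    intro x y z t p q
    rw [vol6_map]; rfl
  have Kform : ∀ x y, K x y = Polynomial.C (vol6 a b x y u1 u2) + Polynomial.X * Polynomial.C (vol6 a b x y u1 v2 + vol6 a b x y v1 u2)
      + Polynomial.X ^ 2 * Polynomial.C (vol6 a b x y v1 v2) := by
    intro x y
    simp only [hK, hU1, hU2, vol6_add4, vol6_add5, vol6_smul4, vol6_smul5, cmap, map_add]
    ring
  have Kdeg : ∀ x y, (K x y).natDegree ≤ 2 := by
    intro x y
    rw [Kform]
    compute_degree
  obtain ⟨x, y, hxy⟩ := hinf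
  have Hdeg : 2 + e ≤ (H x y).natDegree := by
    apply Polynomial.le_natDegree_of_ne_zero
    simp only [hH]
    rw [Polynomial.coeff_sub, Polynomial.coeff_mul_add_eq_of_natDegree_le (dQ _) (dG _),
      Polynomial.coeff_mul_add_eq_of_natDegree_le (dQ _) (dG _)]
    exact hxy
  have Hne : H x y ≠ 0 := by
    intro h0
    rw [h0] at Hdeg; simp at Hdeg
  let J : Ideal (Polynomial ℂ) :=
    { carrier := {p | H x y ∣ p * K x y}
      add_mem' := by
        intro p q hp hq
        simp only [Set.mem_setOf_eq] at *
        rw [add_mul]; exact dvd_add hp hq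
      zero_mem' := by simp
      smul_mem' := by
        intro r p hp
        simp only [Set.mem_setOf_eq, smul_eq_mul] at *
        rw [mul_assoc]; exact Dvd.dvd.mul_left hp r }
  have hJ : ∀ z t, H z t ∈ J := fun z t => ⟨K z t, by rw [prop]; ring⟩
  have htop : (1 : Polynomial ℂ) ∈ J := by
    obtain ⟨h, hh⟩ := (IsPrincipalIdealRing.principal J).principal
    by_cases hu : IsUnit h
    · rw [hh]
      rw [Submodule.mem_span_singleton]
      obtain ⟨h', rfl⟩ := hu
      exact ⟨((h'⁻¹ : (Polynomial ℂ)ˣ) : Polynomial ℂ), by simp⟩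
    · exfalso
      obtain ⟨r, hr⟩ : ∃ r, h.eval r = 0 := by
        have hd : h.degree ≠ 0 := by
          intro h0
          rw [Polynomial.isUnit_iff_degree_eq_zero] at hu
          exact hu h0
        by_cases h0 : h = 0
        · exact ⟨0, by simp [h0]⟩
        · exact IsAlgClosed.exists_root h hd
      obtain ⟨z, t, hzt⟩ := hfin r
      apply hzt
      have := hJ z t
      rw [hh, Submodule.mem_span_singleton] at this
      obtain ⟨k, hk⟩ := this
      have h2 : H z t = k * h := by rw [← hk, smul_eq_mul]
      change (H z t).eval r = 0
      rw [h2, Polynomial.eval_mul, hr, mul_zero]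
  have hK0 : K x y = 0 := by
    have h1 : H x y ∣ 1 * K x y := htop
    rw [one_mul] at h1
    by_contra hne
    have := Polynomial.natDegree_le_of_dvd h1 hne
    have := Kdeg x y
    omega
  have h2 := prop x y w w'
  rw [hK0, mul_zero] at h2
  have h3 : K w w' = 0 := (mul_eq_zero.1 h2.symm).resolve_right Hne
  have h4 := congrArg (Polynomial.eval 0) h3
  rw [Kform] at h4
  simpa using h4

end FO
end

open MvPolynomial
noncomputable section
open MeasureTheory Set Filter Topology in
theorem circ_mean (h : ℂ → ℂ) (z : ℂ) (R r : ℝ) (hd : DifferentiableOn ℂ h (Metric.ball z R))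
    (hr : 0 < r) (hrR : r < R) :
    ENNReal.ofReal (2 * Real.pi) * ‖h z‖ₑ ^ 2 ≤
      ∫⁻ θ in Set.Ioo (-Real.pi) Real.pi, ‖h (circleMap z r θ)‖ₑ ^ 2 := by
  have hd2 : DiffContOnCl ℂ (fun w => h w ^ 2) (Metric.ball z |r|) := by
    rw [abs_of_pos hr]
    have : DifferentiableOn ℂ (fun w => h w ^ 2) (Metric.closedBall z r) :=
      (hd.mono (Metric.closedBall_subset_ball hrR)).pow 2
    refine DifferentiableOn.diffContOnCl ?_
    rw [closure_ball z hr.ne']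
    exact this
  have h1 := DiffContOnCl.circleAverage hd2
  rw [Real.circleAverage_eq_integral_add (-Real.pi)] at h1
  rw [intervalIntegral.integral_comp_add_right (fun t => h (circleMap z r t) ^ 2)] at h1
  rw [show (0:ℝ) + -Real.pi = -Real.pi by ring, show 2 * Real.pi + -Real.pi = Real.pi by ring] at h1
  rw [intervalIntegral.integral_of_le (by linarith [Real.pi_pos]),
    integral_Ioc_eq_integral_Ioo] at h1
  have h2 : (2 * Real.pi) • (h z ^ 2) = ∫ t in Set.Ioo (-Real.pi) Real.pi, h (circleMap z r t) ^ 2 := by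
    rw [← h1, smul_smul, mul_inv_cancel₀ (by positivity), one_smul]
  have h3 := enorm_integral_le_lintegral_enorm (μ := volume.restrict (Set.Ioo (-Real.pi) Real.pi))
    (fun t => h (circleMap z r t) ^ 2)
  rw [← h2] at h3
  rw [enorm_smul, enorm_pow, Real.enorm_eq_ofReal_abs, abs_of_pos (by positivity)] at h3
  simpa only [enorm_pow] using h3

open MeasureTheory Set Filter Topology in
theorem ball_mean (h : ℂ → ℂ) (z : ℂ) (R : ℝ) (hR : 0 < R)
    (hd : DifferentiableOn ℂ h (Metric.ball z R)) :
    ENNReal.ofReal (Real.pi * R ^ 2) * ‖h z‖ₑ ^ 2 ≤ ∫⁻ w in Metric.ball z R, ‖h w‖ₑ ^ 2 := by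
  classical
  have hmeas : Measurable ((Metric.ball z R).piecewise (fun w => h w) (fun _ => 0)) :=
    ContinuousOn.measurable_piecewise hd.continuousOn continuousOn_const measurableSet_ball
  set G0 : ℂ → ENNReal := fun w => ‖(Metric.ball z R).piecewise (fun w => h w) (fun _ => 0) w‖ₑ ^ 2
    with hG0
  have hG0m : Measurable G0 := hmeas.enorm.pow_const 2
  have e1 : ∫⁻ w in Metric.ball z R, ‖h w‖ₑ ^ 2 = ∫⁻ w, G0 w := by
    rw [← lintegral_indicator measurableSet_ball]
    congr 1; ext w
    by_cases hw : w ∈ Metric.ball z R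
    · simp only [hG0, Set.piecewise_eq_of_mem _ _ _ hw, Set.indicator_of_mem hw]
    · simp only [hG0, Set.piecewise_eq_of_notMem _ _ _ hw, Set.indicator_of_notMem hw]
      simp
  rw [e1, ← lintegral_add_left_eq_self G0 z, ← Complex.lintegral_comp_polarCoord_symm]
  have hm2 : Measurable (fun p : ℝ × ℝ => ENNReal.ofReal p.1 • G0 (z + Complex.polarCoord.symm p)) := by
    simp only [Complex.polarCoord_symm_apply, smul_eq_mul]
    refine Measurable.mul (by fun_prop) (hG0m.comp ?_)
    fun_prop
  have e2 : (volume : Measure (ℝ × ℝ)).restrict polarCoord.target =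
      (volume.restrict (Set.Ioi (0:ℝ))).prod (volume.restrict (Set.Ioo (-Real.pi) Real.pi)) := by
    rw [Measure.prod_restrict]; rfl
  rw [e2, lintegral_prod _ hm2.aemeasurable]
  calc ENNReal.ofReal (Real.pi * R ^ 2) * ‖h z‖ₑ ^ 2
      = ∫⁻ r in Set.Ioo (0:ℝ) R, ENNReal.ofReal r * (ENNReal.ofReal (2 * Real.pi) * ‖h z‖ₑ ^ 2) := by
        rw [lintegral_mul_const _ (by fun_prop)]
        have : ∫⁻ r in Set.Ioo (0:ℝ) R, ENNReal.ofReal r = ENNReal.ofReal (R ^ 2 / 2) := by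
          rw [← ofReal_integral_eq_lintegral_ofReal]
          · rw [← integral_Ioc_eq_integral_Ioo, ← intervalIntegral.integral_of_le hR.le]
            simp
          · exact (continuous_id.integrableOn_Icc).mono_set Set.Ioo_subset_Icc_self
          · filter_upwards [ae_restrict_mem measurableSet_Ioo] with x hx using hx.1.le
        rw [this, ← mul_assoc, ← ENNReal.ofReal_mul (by positivity)]
        congr 2; ring
    _ ≤ ∫⁻ r in Set.Ioo (0:ℝ) R, ∫⁻ θ in Set.Ioo (-Real.pi) Real.pi,
          ENNReal.ofReal r • G0 (z + Complex.polarCoord.symm (r, θ)) := by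
        refine setLIntegral_mono' measurableSet_Ioo fun r hr => ?_
        simp only [smul_eq_mul]
        rw [lintegral_const_mul' _ _ (by simp)]
        gcongr
        refine (circ_mean h z R r hd hr.1 hr.2).trans (le_of_eq ?_)
        congr 1; ext θ
        have : z + Complex.polarCoord.symm (r, θ) = circleMap z r θ := by
          simp [circleMap, Complex.exp_mul_I]
        rw [this]
        have hb : circleMap z r θ ∈ Metric.ball z R := by
          simp [dist_eq_norm, circleMap, abs_of_pos hr.1, hr.2]
        simp only [hG0, Set.piecewise_eq_of_mem _ _ _ hb]
    _ ≤ _ := lintegral_mono_set Set.Ioo_subset_Ioi_self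

open MeasureTheory Set Filter Topology Asymptotics in
/-- remove one puncture -/
theorem l2_remove (h : ℂ → ℂ) (S : Finset ℂ) (c : ℂ) (hc : c ∉ S)
    (hd : DifferentiableOn ℂ h {z | z ∉ insert c S})
    (hL : ∫⁻ w, ‖h w‖ₑ ^ 2 ≠ ⊤) :
    ∃ h', DifferentiableOn ℂ h' {z | z ∉ S} ∧ ∀ z, z ≠ c → h' z = h z := by
  classical
  have hopen : IsOpen {z : ℂ | z ∉ S} := by
    have := (S.finite_toSet.isClosed (X := ℂ)).isOpen_compl
    simpa [Set.compl_def] using this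
  have hs : {z : ℂ | z ∉ S} ∈ 𝓝 c := hopen.mem_nhds hc
  have hd' : DifferentiableOn ℂ h ({z | z ∉ S} \ {c}) := by
    refine hd.mono ?_
    rintro z ⟨hz, hzc⟩
    simp only [Set.mem_ofPred_eq, Finset.mem_insert, not_or] at *
    exact ⟨hzc, hz⟩
  have ho : (fun z => h z - h c) =o[𝓝[≠] c] fun z => (z - c)⁻¹ := by
    have hconst : (fun _ : ℂ => h c) =o[𝓝[≠] c] fun z => (z - c)⁻¹ := by
      refine isLittleO_const_left.2 (Or.inr ?_)
      have : Tendsto (fun z : ℂ => z - c) (𝓝[≠] c) (𝓝[≠] 0) := by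
        refine tendsto_nhdsWithin_iff.2 ⟨?_, ?_⟩
        · have : Tendsto (fun z : ℂ => z - c) (𝓝 c) (𝓝 (c - c)) := (continuous_id.sub continuous_const).tendsto c
          rw [sub_self] at this
          exact this.mono_left nhdsWithin_le_nhds
        · filter_upwards [self_mem_nhdsWithin] with z hz
          exact sub_ne_zero.2 hz
      exact tendsto_norm_cobounded_atTop.comp (tendsto_inv₀_nhdsNE_zero.comp this)
    refine IsLittleO.sub ?_ hconst
    obtain ⟨R, hR, hRS⟩ := Metric.isOpen_iff.1 hopen c hc
    rw [isLittleO_iff]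
    intro ε hε
    -- small integral near c
    have hlim : Tendsto (fun r : ℝ => ∫⁻ w in Metric.ball c (2 * r), ‖h w‖ₑ ^ 2) (𝓝[>] 0) (𝓝 0) := by
      refine tendsto_setLIntegral_zero hL ?_
      have : ∀ r : ℝ, volume (Metric.ball c (2 * r)) = ENNReal.ofReal (2 * r) ^ 2 * NNReal.pi := by
        intro r; exact Complex.volume_ball c (2 * r)
      simp only [Function.comp_def, this]
      have h0 : Tendsto (fun r : ℝ => ENNReal.ofReal (2 * r) ^ 2 * (NNReal.pi : ENNReal)) (𝓝 0)
          (𝓝 (ENNReal.ofReal (2 * 0) ^ 2 * NNReal.pi)) := by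
        refine ENNReal.Tendsto.mul_const ?_ (by simp)
        refine ENNReal.Tendsto.pow ?_
        exact ENNReal.tendsto_ofReal ((continuous_const.mul continuous_id).tendsto 0)
      simp only [mul_zero, ENNReal.ofReal_zero, ne_eq, OfNat.ofNat_ne_zero, not_false_eq_true,
        zero_pow, zero_mul] at h0
      exact h0.mono_left nhdsWithin_le_nhds
    have hev : ∀ᶠ r : ℝ in 𝓝[>] 0, ∫⁻ w in Metric.ball c (2 * r), ‖h w‖ₑ ^ 2 <
        ENNReal.ofReal (Real.pi * ε ^ 2) :=
      hlim.eventually_lt_const (by simp; positivity)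
    have hev2 : ∀ᶠ r : ℝ in 𝓝[>] 0, r < R / 2 :=
      nhdsWithin_le_nhds (Iio_mem_nhds (by positivity))
    have htend : Tendsto (fun z : ℂ => ‖z - c‖) (𝓝[≠] c) (𝓝[>] 0) := by
      refine tendsto_nhdsWithin_iff.2 ⟨?_, ?_⟩
      · have : Tendsto (fun z : ℂ => ‖z - c‖) (𝓝 c) (𝓝 ‖c - c‖) :=
          (continuous_id.sub continuous_const).norm.tendsto c
        rw [sub_self, norm_zero] at this
        exact this.mono_left nhdsWithin_le_nhds
      · filter_upwards [self_mem_nhdsWithin] with z hz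
        exact norm_pos_iff.2 (sub_ne_zero.2 hz)
    filter_upwards [htend.eventually hev, htend.eventually hev2, self_mem_nhdsWithin] with z h1 h2 h3
    have hzc : 0 < ‖z - c‖ := norm_pos_iff.2 (sub_ne_zero.2 h3)
    set r := ‖z - c‖ with hr
    have hb : Metric.ball z r ⊆ Metric.ball c (2 * r) := by
      refine Metric.ball_subset_ball' ?_
      rw [dist_eq_norm]; linarith
    have hbd : DifferentiableOn ℂ h (Metric.ball z r) := by
      refine hd'.mono fun w hw => ⟨hRS (Metric.ball_subset_ball (by linarith) (hb hw)), ?_⟩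
      rintro rfl
      rw [Metric.mem_ball, dist_comm, dist_eq_norm] at hw
      exact lt_irrefl _ hw
    have hm := ball_mean h z r hzc hbd
    have hm2 := (hm.trans (lintegral_mono_set hb)).trans h1.le
    rw [← ofReal_norm, ← ENNReal.ofReal_pow (norm_nonneg _),
      ← ENNReal.ofReal_mul (by positivity),
      ENNReal.ofReal_le_ofReal_iff (by positivity)] at hm2
    have hm3 : (r * ‖h z‖) ^ 2 ≤ ε ^ 2 := by
      have : Real.pi * (r * ‖h z‖) ^ 2 ≤ Real.pi * ε ^ 2 := by nlinarith
      exact le_of_mul_le_mul_left this Real.pi_pos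
    have hm4 := abs_le_of_sq_le_sq hm3 hε.le
    rw [norm_inv, ← hr, ← div_eq_mul_inv, le_div_iff₀ hzc]
    nlinarith [le_abs_self (r * ‖h z‖)]
  refine ⟨Function.update h c (limUnder (𝓝[≠] c) h),
    Complex.differentiableOn_update_limUnder_of_isLittleO hs hd' ho, fun z hz => ?_⟩
  simp [Function.update, hz]

open MeasureTheory Set Filter Topology in
theorem l2_entire (h : ℂ → ℂ) (hd : Differentiable ℂ h) (hL : ∫⁻ w, ‖h w‖ₑ ^ 2 ≠ ⊤) : ∀ z, h z = 0 := by
  -- h is bounded, then Liouville on average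
  have key : ∀ z, ∀ R : ℝ, 0 < R → ENNReal.ofReal (Real.pi * R ^ 2) * ‖h z‖ₑ ^ 2 ≤ ∫⁻ w, ‖h w‖ₑ ^ 2 :=
    fun z R hR => (ball_mean h z R hR hd.differentiableOn).trans (setLIntegral_le_lintegral _ _)
  intro z
  by_contra hz
  set I := ∫⁻ w, ‖h w‖ₑ ^ 2
  have hpos : 0 < ‖h z‖ ^ 2 := by positivity
  set R := Real.sqrt ((I.toReal + 1) / ‖h z‖ ^ 2) with hR
  have hI : 0 ≤ I.toReal := ENNReal.toReal_nonneg
  have hR0 : 0 < R := Real.sqrt_pos.2 (by positivity)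
  have := key z R hR0
  rw [← ofReal_norm, ← ENNReal.ofReal_pow (norm_nonneg _),
      ← ENNReal.ofReal_mul (by positivity)] at this
  have h2 := (ENNReal.ofReal_le_iff_le_toReal hL).1 this
  rw [hR, Real.sq_sqrt (by positivity)] at h2
  have h3 : Real.pi * ((I.toReal + 1) / ‖h z‖ ^ 2) * ‖h z‖ ^ 2 = Real.pi * (I.toReal + 1) := by
    field_simp
  rw [h3] at h2
  nlinarith [Real.pi_gt_three]

open MeasureTheory Set Filter Topology in
theorem l2_zero (S : Finset ℂ) : ∀ (h : ℂ → ℂ) (hd : DifferentiableOn ℂ h {z | z ∉ S})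
    (hL : ∫⁻ w, ‖h w‖ₑ ^ 2 ≠ ⊤), ∀ z, z ∉ S → h z = 0 := by
  classical
  induction S using Finset.induction_on with
  | empty =>
    intro h hd hL z _
    refine l2_entire h ?_ hL z
    have : {z : ℂ | z ∉ (∅ : Finset ℂ)} = Set.univ := by ext; simp
    rw [this] at hd
    exact differentiableOn_univ.1 hd
  | insert c S hc ih =>
    intro h hd hL z hz
    obtain ⟨h', hd', he⟩ := l2_remove h S c hc hd hL
    have hae : ∫⁻ w, ‖h' w‖ₑ ^ 2 = ∫⁻ w, ‖h w‖ₑ ^ 2 := by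
      refine lintegral_congr_ae ?_
      have : ∀ᵐ w : ℂ, w ≠ c := by
        simp [ae_iff]
      filter_upwards [this] with w hw
      rw [he w hw]
    simp only [Finset.mem_insert, not_or] at hz
    rw [← he z hz.1]
    exact ih h' hd' (by rw [hae]; exact hL) z hz.2
end

open MvPolynomial
noncomputable section
open MeasureTheory Set Filter Topology in
/-- a polynomial restricted to a line in the first variable -/
theorem poly_slice {m : ℕ} (f : MvPolynomial (Fin (m + 1)) ℂ) (y' : Fin m → ℂ) :
    ∃ p : Polynomial ℂ, ∀ s, p.eval s = eval (Fin.cons s y') f := by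
  refine ⟨Polynomial.map (eval y') (finSuccEquiv ℂ m f), fun s => ?_⟩
  rw [eval_eq_eval_mv_eval']

theorem isOpen_D {ι : Type} (f : MvPolynomial ι ℂ) :
    IsOpen {y : ι → ℂ | eval y f ≠ 0} := by
  have : Continuous fun y : ι → ℂ => eval y f := MvPolynomial.continuous_eval f
  exact isOpen_ne_fun this continuous_const

open MeasureTheory Set Filter Topology in
theorem l2_zero_n {m : ℕ} (f : MvPolynomial (Fin (m + 1)) ℂ)
    (h : (Fin (m + 1) → ℂ) → ℂ) (hd : DifferentiableOn ℂ h {y | eval y f ≠ 0})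
    (h0 : ∀ y, eval y f = 0 → h y = 0)
    (hL : ∫⁻ y, ‖h y‖ₑ ^ 2 ≠ ⊤) : ∀ y, h y = 0 := by
  classical
  have hopen := isOpen_D f
  have hmeas : Measurable h := by
    have h1 : Measurable (({y : Fin (m+1) → ℂ | eval y f ≠ 0}).piecewise h (fun _ => 0)) :=
      ContinuousOn.measurable_piecewise hd.continuousOn continuousOn_const hopen.measurableSet
    convert h1 using 1
    ext y
    by_cases hy : eval y f = 0
    · rw [Set.piecewise_eq_of_notMem _ _ _ (by simpa using hy), h0 y hy]
    · rw [Set.piecewise_eq_of_mem _ _ _ (by simpa using hy)]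
  have hvp := (volume_preserving_piFinSuccAbove (fun _ : Fin (m+1) => ℂ) 0).symm
  set E := (MeasurableEquiv.piFinSuccAbove (fun _ : Fin (m+1) => ℂ) 0).symm with hE
  have hEapp : ∀ s y', E (s, y') = Fin.cons s y' := by
    intro s y'
    simp [hE, MeasurableEquiv.piFinSuccAbove, Fin.insertNthEquiv]
  have e1 : ∫⁻ y, ‖h y‖ₑ ^ 2 = ∫⁻ y', ∫⁻ s, ‖h (E (s, y'))‖ₑ ^ 2 := by
    rw [← hvp.lintegral_comp_emb E.measurableEmbedding]
    exact lintegral_prod_symm _ (((hmeas.comp E.measurable).enorm.pow_const 2).aemeasurable)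
  have hm2 : Measurable fun p : ℂ × (Fin m → ℂ) => ‖h (E p)‖ₑ ^ 2 :=
    ((hmeas.comp E.measurable).enorm.pow_const 2)
  have hae : ∀ᵐ y' : Fin m → ℂ, ∫⁻ s, ‖h (E (s, y'))‖ₑ ^ 2 < ⊤ := by
    refine ae_lt_top ?_ (by rw [← e1]; exact hL)
    exact hm2.lintegral_prod_left'
  have hz : ∀ᵐ y' : Fin m → ℂ, ∫⁻ s, ‖h (E (s, y'))‖ₑ ^ 2 = 0 := by
    filter_upwards [hae] with y' hy'
    have hall : ∀ s, h (E (s, y')) = 0 := by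
      intro s
      obtain ⟨p, hp⟩ := poly_slice f y'
      by_cases hs : eval (E (s, y')) f = 0
      · exact h0 _ hs
      · have hp0 : p ≠ 0 := by
          rintro rfl
          apply hs; rw [hEapp, ← hp]; simp
        refine l2_zero p.roots.toFinset (fun s => h (E (s, y'))) ?_ hy'.ne s ?_
        · have hc : DifferentiableOn ℂ (fun s : ℂ => (Fin.cons s y' : Fin (m+1) → ℂ))
              {z | z ∉ p.roots.toFinset} := by
            refine Differentiable.differentiableOn ?_
            rw [differentiable_pi]
            intro i
            refine Fin.cases ?_ (fun j => ?_) i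
            · simp only [Fin.cons_zero]; exact differentiable_id
            · simp only [Fin.cons_succ]; exact differentiable_const _
          simp only [hEapp]
          refine hd.comp hc ?_
          intro z hz
          simp only [Set.mem_ofPred_eq, Multiset.mem_toFinset, Polynomial.mem_roots hp0, Polynomial.IsRoot.def] at hz ⊢
          rw [← hp]; exact hz
        · simp only [Multiset.mem_toFinset, Polynomial.mem_roots hp0, Polynomial.IsRoot.def]
          rw [hp, ← hEapp]; exact hs
    simp [hall]
  have hI0 : ∫⁻ y, ‖h y‖ₑ ^ 2 = 0 := by
    rw [e1, lintegral_congr_ae hz]; simp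
  have hae0 : h =ᵐ[volume] fun _ => 0 := by
    have := (lintegral_eq_zero_iff (hmeas.enorm.pow_const 2)).1 hI0
    filter_upwards [this] with y hy
    simpa using hy
  intro y
  by_cases hy : eval y f = 0
  · exact h0 y hy
  · exact Measure.eqOn_open_of_ae_eq (ae_restrict_of_ae hae0) hopen hd.continuousOn
      continuousOn_const hy
end

open MvPolynomial
noncomputable section
/-- locally `Φ` is the union of `δ` disjoint graphs of holomorphic maps -/
def Branched {n N : ℕ} (δ : ℕ) (D : Set (Fin n → ℂ)) (Φ : (Fin n → ℂ) → Finset (Fin N → ℂ)) : Prop :=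
  ∀ y0 ∈ D, ∃ U, IsOpen U ∧ y0 ∈ U ∧ U ⊆ D ∧ ∃ v : Fin δ → (Fin n → ℂ) → (Fin N → ℂ),
    (∀ i, DifferentiableOn ℂ (v i) U) ∧ ∀ y ∈ U, Function.Injective (fun i => v i y) ∧
      Φ y = Finset.univ.image (fun i => v i y)

theorem real_det {n : ℕ} (L : (Fin n → ℂ) →L[ℂ] (Fin n → ℂ)) :
    ENNReal.ofReal |(L.restrictScalars ℝ).det| = ‖L.det‖ₑ ^ 2 := by
  have h1 : (L.restrictScalars ℝ).det = ‖L.det‖ ^ 2 := by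
    have := LinearMap.det_restrictScalars (R := ℝ) (S := ℂ) (f := (L : (Fin n → ℂ) →ₗ[ℂ] (Fin n → ℂ)))
    rw [Algebra.norm_complex_apply, Complex.normSq_eq_norm_sq] at this
    exact this
  rw [h1, abs_of_nonneg (by positivity), ENNReal.ofReal_pow (norm_nonneg _), ofReal_norm]

open MeasureTheory Set Filter Topology in
theorem sheets_area {n N δ : ℕ} (D : Set (Fin n → ℂ)) (hD : IsOpen D)
    (Φ : (Fin n → ℂ) → Finset (Fin N → ℂ)) (hB : Branched δ D Φ)
    (O : Set (Fin N → ℂ)) (hO : IsOpen O) (z : (Fin N → ℂ) → (Fin n → ℂ))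
    (hz : ∀ x ∈ O, DifferentiableAt ℂ z x)
    (hinj : ∀ y ∈ D, ∀ y' ∈ D, ∀ x ∈ Φ y, ∀ x' ∈ Φ y', x ∈ O → x' ∈ O → z x = z x' → y = y' ∧ x = x')
    (B : Set (Fin n → ℂ)) (hbd : ∀ y ∈ D, ∀ x ∈ Φ y, x ∈ O → z x ∈ B)
    (Jac : (Fin N → ℂ) → ℂ)
    (hJ : ∀ (U : Set (Fin n → ℂ)) (v : (Fin n → ℂ) → (Fin N → ℂ)), IsOpen U → U ⊆ D →
      DifferentiableOn ℂ v U → (∀ y ∈ U, v y ∈ Φ y) → ∀ y ∈ U, v y ∈ O →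
      (fderiv ℂ (z ∘ v) y).det = Jac (v y)) :
    ∫⁻ y in D, ∑ x ∈ Φ y, O.indicator (fun x => ‖Jac x‖ₑ ^ 2) x ≤ volume B := by
  classical
  rcases D.eq_empty_or_nonempty with rfl | hne
  · simp
  choose! U hUo hyU hUD v hvd hv using hB
  obtain ⟨T, hTD, hTc, hTcov⟩ := TopologicalSpace.countable_cover_nhdsWithin (s := D) (f := U)
    (fun y hy => nhdsWithin_le_nhds ((hUo y hy).mem_nhds (hyU y hy)))
  have hTne : T.Nonempty := by
    obtain ⟨y, hy⟩ := hne
    obtain ⟨t, ht, _⟩ := Set.mem_iUnion₂.1 (hTcov hy)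
    exact ⟨t, ht⟩
  obtain ⟨p, hp⟩ := hTc.exists_eq_range hTne
  have hpD : ∀ k, p k ∈ D := fun k => hTD (by rw [hp]; exact ⟨k, rfl⟩)
  have hcov : D = ⋃ k, disjointed (fun k => U (p k)) k := by
    rw [iUnion_disjointed]
    apply Set.Subset.antisymm
    · intro y hy
      obtain ⟨t, ht, hyt⟩ := Set.mem_iUnion₂.1 (hTcov hy)
      rw [hp] at ht
      obtain ⟨k, rfl⟩ := ht
      exact Set.mem_iUnion.2 ⟨k, hyt⟩
    · exact Set.iUnion_subset fun k => hUD _ (hpD k)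
  set Dk := disjointed (fun k => U (p k)) with hDk
  have hDkm : ∀ k, MeasurableSet (Dk k) := MeasurableSet.disjointed fun k => (hUo _ (hpD k)).measurableSet
  have hDkd : Pairwise (Function.onFun Disjoint Dk) := disjoint_disjointed _
  have hDkU : ∀ k, Dk k ⊆ U (p k) := fun k => disjointed_subset _ k
  -- the pieces
  set A : ℕ → Fin δ → Set (Fin n → ℂ) := fun k i => Dk k ∩ (U (p k) ∩ (v (p k) i) ⁻¹' O) with hA
  have hAo : ∀ k i, IsOpen (U (p k) ∩ (v (p k) i) ⁻¹' O) := fun k i =>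
    (hvd _ (hpD k) i).continuousOn.isOpen_inter_preimage (hUo _ (hpD k)) hO
  have hAm : ∀ k i, MeasurableSet (A k i) := fun k i => (hDkm k).inter (hAo k i).measurableSet
  have hmem : ∀ k i, ∀ y ∈ U (p k), v (p k) i y ∈ Φ y := by
    intro k i y hy
    rw [(hv _ (hpD k) y hy).2]
    exact Finset.mem_image_of_mem _ (Finset.mem_univ i)
  have hder : ∀ k i, ∀ y ∈ A k i, HasFDerivWithinAt (z ∘ v (p k) i)
      ((fderiv ℂ (z ∘ v (p k) i) y).restrictScalars ℝ) (A k i) y := by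
    intro k i y hy
    have h1 : DifferentiableAt ℂ (v (p k) i) y :=
      (hvd _ (hpD k) i).differentiableAt ((hUo _ (hpD k)).mem_nhds hy.2.1)
    have h2 : DifferentiableAt ℂ (z ∘ v (p k) i) y := (hz _ hy.2.2).comp y h1
    exact (h2.hasFDerivAt.restrictScalars ℝ).hasFDerivWithinAt
  have hinjA : ∀ k i, ∀ k' i', ∀ y ∈ A k i, ∀ y' ∈ A k' i', z (v (p k) i y) = z (v (p k') i' y') →
      k = k' ∧ i = i' ∧ y = y' := by
    intro k i k' i' y hy y' hy' he
    obtain ⟨h1, h2⟩ := hinj y (hUD _ (hpD k) hy.2.1) y' (hUD _ (hpD k') hy'.2.1) _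
      (hmem k i y hy.2.1) _ (hmem k' i' y' hy'.2.1) hy.2.2 hy'.2.2 he
    subst h1
    have hk : k = k' := by
      by_contra hne
      exact (Set.disjoint_left.1 (hDkd hne)) hy.1 hy'.1
    subst hk
    exact ⟨rfl, (hv _ (hpD k) y hy.2.1).1 h2, rfl⟩
  have harea : ∀ k i, ∫⁻ y in A k i, ‖Jac (v (p k) i y)‖ₑ ^ 2 = volume ((z ∘ v (p k) i) '' A k i) := by
    intro k i
    rw [← lintegral_abs_det_fderiv_eq_addHaar_image volume (hAm k i) (hder k i)
      (fun y hy y' hy' he => (hinjA k i k i y hy y' hy' he).2.2)]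
    refine setLIntegral_congr_fun (hAm k i) fun y hy => ?_
    rw [real_det, hJ (U (p k)) (v (p k) i) (hUo _ (hpD k)) (hUD _ (hpD k)) (hvd _ (hpD k) i)
      (hmem k i) y hy.2.1 hy.2.2]
  have hpiece : ∀ k, ∫⁻ y in Dk k, ∑ x ∈ Φ y, O.indicator (fun x => ‖Jac x‖ₑ ^ 2) x
      = ∑ i, volume ((z ∘ v (p k) i) '' A k i) := by
    intro k
    have e1 : ∫⁻ y in Dk k, ∑ x ∈ Φ y, O.indicator (fun x => ‖Jac x‖ₑ ^ 2) x
        = ∫⁻ y in Dk k, ∑ i, (A k i).indicator (fun y => ‖Jac (v (p k) i y)‖ₑ ^ 2) y := by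
      refine setLIntegral_congr_fun (hDkm k) fun y hy => ?_
      have hyU' := hDkU k hy
      rw [(hv _ (hpD k) y hyU').2, Finset.sum_image fun a _ b _ h => (hv _ (hpD k) y hyU').1 h]
      refine Finset.sum_congr rfl fun i _ => ?_
      by_cases hx : v (p k) i y ∈ O
      · rw [Set.indicator_of_mem hx, Set.indicator_of_mem (show y ∈ A k i from ⟨hy, hyU', hx⟩)]
      · rw [Set.indicator_of_notMem hx, Set.indicator_of_notMem (fun h => hx h.2.2)]
    rw [e1, lintegral_finsetSum']
    · refine Finset.sum_congr rfl fun i _ => ?_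
      rw [lintegral_indicator (hAm k i), Measure.restrict_restrict (hAm k i),
        Set.inter_eq_left.2 (fun y hy => hy.1), harea]
    · intro i _
      refine (aemeasurable_indicator_iff (hAm k i)).2 ?_
      rw [Measure.restrict_restrict (hAm k i), Set.inter_eq_left.2 (fun y hy => hy.1)]
      refine AEMeasurable.congr (aemeasurable_ofReal_abs_det_fderivWithin volume (hAm k i) (hder k i)) ?_
      filter_upwards [ae_restrict_mem (hAm k i)] with y hy
      rw [real_det, hJ (U (p k)) (v (p k) i) (hUo _ (hpD k)) (hUD _ (hpD k)) (hvd _ (hpD k) i)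
        (hmem k i) y hy.2.1 hy.2.2]
  have himm : ∀ k i, MeasurableSet ((z ∘ v (p k) i) '' A k i) := fun k i =>
    measurable_image_of_fderivWithin (hAm k i) (hder k i)
      (fun y hy y' hy' he => (hinjA k i k i y hy y' hy' he).2.2)
  have hsum : ∫⁻ y in D, ∑ x ∈ Φ y, O.indicator (fun x => ‖Jac x‖ₑ ^ 2) x
      = ∑' k, ∑ i, volume ((z ∘ v (p k) i) '' A k i) := by
    conv_lhs => rw [hcov]
    rw [lintegral_iUnion hDkm hDkd]
    simp only [hpiece]
  rw [hsum]
  have h3 : ∑' k, ∑ i, volume ((z ∘ v (p k) i) '' A k i)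
      = volume (⋃ a : ℕ × Fin δ, (z ∘ v (p a.1) a.2) '' A a.1 a.2) := by
    rw [measure_iUnion]
    · rw [ENNReal.tsum_prod (f := fun k i => volume ((z ∘ v (p k) i) '' A k i))]
      simp [tsum_fintype]
    · rintro ⟨k, i⟩ ⟨k', i'⟩ hne
      rw [Function.onFun, Set.disjoint_left]
      rintro _ ⟨y, hy, rfl⟩ ⟨y', hy', he⟩
      obtain ⟨h1, h2, _⟩ := hinjA k i k' i' y hy y' hy' he.symm
      exact hne (by rw [h1, h2])
    · exact fun a => himm a.1 a.2
  rw [h3]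
  refine measure_mono ?_
  refine Set.iUnion_subset ?_
  rintro ⟨k, i⟩ _ ⟨y, hy, rfl⟩
  exact hbd y (hUD _ (hpD k) hy.2.1) _ (hmem k i y hy.2.1) hy.2.2
end

open MvPolynomial
noncomputable section
/-- differential of a polynomial at a point -/
def dlin {ι : Type} [Fintype ι] (p : MvPolynomial ι ℂ) (v : ι → ℂ) : (ι → ℂ) →ₗ[ℂ] ℂ :=
  ∑ i, eval v (pderiv i p) • LinearMap.proj i

theorem dlin_apply {ι : Type} [Fintype ι] (p : MvPolynomial ι ℂ) (v w : ι → ℂ) :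
    dlin p v w = ∑ i, eval v (pderiv i p) * w i := by
  simp [dlin]

theorem homog_eval {ι : Type} [Fintype ι] {p : MvPolynomial ι ℂ} {e : ℕ} (hp : p.IsHomogeneous e) (c : ℂ)
    (v : ι → ℂ) : eval (c • v) p = c ^ e * eval v p := by
  rw [eval_eq', eval_eq', Finset.mul_sum]
  refine Finset.sum_congr rfl fun m hm => ?_
  have h1 : ∑ i, m i = e := by
    have := hp (mem_support_iff.1 hm)
    rw [Finsupp.weight_apply] at this
    simpa [Finsupp.sum_fintype] using this
  simp only [Pi.smul_apply, smul_eq_mul, mul_pow, Finset.prod_mul_distrib]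
  rw [Finset.prod_pow_eq_pow_sum, h1]
  ring

theorem dlin_smul {ι : Type} [Fintype ι] {p : MvPolynomial ι ℂ} {e : ℕ} (hp : p.IsHomogeneous e) (c : ℂ)
    (v : ι → ℂ) : dlin p (c • v) = c ^ (e - 1) • dlin p v := by
  ext1
  simp only [LinearMap.smul_apply, dlin_apply, smul_eq_mul]
  rw [Finset.mul_sum]
  refine Finset.sum_congr rfl fun i _ => ?_
  rw [homog_eval hp.pderiv]; ring

theorem dlin_self {ι : Type} [Fintype ι] {p : MvPolynomial ι ℂ} {e : ℕ} (hp : p.IsHomogeneous e)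
    (v : ι → ℂ) : dlin p v v = e * eval v p := by
  have := congrArg (eval v) hp.sum_X_mul_pderiv
  rw [dlin_apply]
  simp only [map_sum, map_mul, eval_X, nsmul_eq_mul, map_natCast] at this
  rw [← this]
  exact Finset.sum_congr rfl fun i _ => mul_comm _ _

theorem hasFDerivAt_eval {ι : Type} [Fintype ι] (p : MvPolynomial ι ℂ) (v : ι → ℂ) :
    HasFDerivAt (fun w : ι → ℂ => eval w p) (LinearMap.toContinuousLinearMap (dlin p v)) v := by
  classical
  induction p using MvPolynomial.induction_on with
  | C a =>
    have : LinearMap.toContinuousLinearMap (dlin (C a : MvPolynomial ι ℂ) v) = 0 := by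
      ext w; simp [dlin_apply]
    rw [this]; simp only [eval_C]; exact hasFDerivAt_const _ _
  | add p q hp hq =>
    have : LinearMap.toContinuousLinearMap (dlin (p + q) v) =
        LinearMap.toContinuousLinearMap (dlin p v) + LinearMap.toContinuousLinearMap (dlin q v) := by
      ext w; simp [dlin_apply, add_mul, Finset.sum_add_distrib]
    rw [this]; simp only [map_add]; exact hp.add hq
  | mul_X p i hp =>
    have h1 := hp.mul (hasFDerivAt_apply (𝕜 := ℂ) i v)
    have : LinearMap.toContinuousLinearMap (dlin (p * X i) v) =
        eval v p • ContinuousLinearMap.proj (R := ℂ) (φ := fun _ : ι => ℂ) i + v i • LinearMap.toContinuousLinearMap (dlin p v) := by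
      ext w
      simp only [LinearMap.coe_toContinuousLinearMap', dlin_apply, Derivation.leibniz, pderiv_X, smul_eq_mul, map_add,
        map_mul, eval_X, add_mul, Finset.sum_add_distrib, _root_.add_apply, _root_.smul_apply, Finset.mul_sum,
        ContinuousLinearMap.proj_apply]
      congr 1
      · rw [Finset.sum_eq_single i]
        · simp
        · intro j _ hj; simp [hj]
        · simp
      · exact Finset.sum_congr rfl fun j _ => by ring
    rw [this]; simp only [map_mul, eval_X]
    exact h1

theorem contDiff_eval {ι : Type} [Fintype ι] (p : MvPolynomial ι ℂ) :
    ContDiff ℂ 1 (fun w : ι → ℂ => eval w p) :=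
  contDiffOn_univ.1 ((AnalyticOnNhd.eval_mvPolynomial p).contDiffOn (uniqueDiffOn_univ))

end

open MvPolynomial
noncomputable section
/-- generic set-up for a dominant rational map of degree `δ` -/
structure Gen {n : ℕ} (q g : MvPolynomial (Fin (n + 3)) ℂ)
    (F : Fin (n + 1) → MvPolynomial (Fin (n + 3)) ℂ) (lam : (Fin (n + 3) → ℂ) →ₗ[ℂ] ℂ)
    (f : MvPolynomial (Fin n) ℂ) (Φ : (Fin n → ℂ) → Finset (Fin (n + 3) → ℂ)) (δ : ℕ) : Prop where
  f_ne : f ≠ 0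
  mem : ∀ y, eval y f ≠ 0 → ∀ x, x ∈ Φ y ↔ (lam x = 1 ∧ eval x q = 0 ∧ eval x g = 0 ∧
    eval x (F 0) ≠ 0 ∧ ∀ j : Fin n, eval x (F j.succ) = y j * eval x (F 0))
  card : ∀ y, eval y f ≠ 0 → (Φ y).card = δ
  nondeg : ∀ y, eval y f ≠ 0 → ∀ x ∈ Φ y, ∀ ξ, lam ξ = 0 → dlin q x ξ = 0 → dlin g x ξ = 0 →
    (∀ j : Fin n, dlin (F j.succ) x ξ = y j * dlin (F 0) x ξ) → ξ = 0
  growth : ∃ (C : ℝ) (K : ℕ), ∀ y, eval y f ≠ 0 → ∀ x ∈ Φ y,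
    ‖eval y f‖ * ‖x‖ ≤ C * (1 + ‖y‖) ^ K

/-- the map `(λ, q, g, F_j / F_0)` -/
def Psi {n : ℕ} (q g : MvPolynomial (Fin (n + 3)) ℂ)
    (F : Fin (n + 1) → MvPolynomial (Fin (n + 3)) ℂ) (lam : (Fin (n + 3) → ℂ) →ₗ[ℂ] ℂ)
    (v : Fin (n + 3) → ℂ) : ℂ × ℂ × ℂ × (Fin n → ℂ) :=
  (lam v, eval v q, eval v g, fun j => eval v (F j.succ) / eval v (F 0))

theorem Psi_contDiffAt {n : ℕ} (q g : MvPolynomial (Fin (n + 3)) ℂ)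
    (F : Fin (n + 1) → MvPolynomial (Fin (n + 3)) ℂ) (lam : (Fin (n + 3) → ℂ) →ₗ[ℂ] ℂ)
    (v : Fin (n + 3) → ℂ) (h0 : eval v (F 0) ≠ 0) : ContDiffAt ℂ 1 (Psi q g F lam) v := by
  unfold Psi
  refine ContDiffAt.prodMk (LinearMap.toContinuousLinearMap lam).contDiff.contDiffAt ?_
  refine ContDiffAt.prodMk (contDiff_eval q).contDiffAt ?_
  refine ContDiffAt.prodMk (contDiff_eval g).contDiffAt ?_
  refine contDiffAt_pi.2 fun j => ?_
  exact ((contDiff_eval _).contDiffAt).div (contDiff_eval _).contDiffAt h0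

/-- linear part of `Psi` -/
def dPsi {n : ℕ} (q g : MvPolynomial (Fin (n + 3)) ℂ)
    (F : Fin (n + 1) → MvPolynomial (Fin (n + 3)) ℂ) (lam : (Fin (n + 3) → ℂ) →ₗ[ℂ] ℂ)
    (v : Fin (n + 3) → ℂ) : (Fin (n + 3) → ℂ) →ₗ[ℂ] ℂ × ℂ × ℂ × (Fin n → ℂ) :=
  lam.prod ((dlin q v).prod ((dlin g v).prod (LinearMap.pi fun j =>
    ((eval v (F 0)) ^ 2)⁻¹ • (eval v (F 0) • dlin (F j.succ) v - eval v (F j.succ) • dlin (F 0) v))))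

theorem Psi_hasFDerivAt {n : ℕ} (q g : MvPolynomial (Fin (n + 3)) ℂ)
    (F : Fin (n + 1) → MvPolynomial (Fin (n + 3)) ℂ) (lam : (Fin (n + 3) → ℂ) →ₗ[ℂ] ℂ)
    (v : Fin (n + 3) → ℂ) (h0 : eval v (F 0) ≠ 0) :
    HasFDerivAt (Psi q g F lam) (LinearMap.toContinuousLinearMap (dPsi q g F lam v)) v := by
  have h1 : HasFDerivAt (fun v : Fin (n+3) → ℂ => lam v) (LinearMap.toContinuousLinearMap lam) v :=
    (LinearMap.toContinuousLinearMap lam).hasFDerivAt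
  have h4 : HasFDerivAt (fun v : Fin (n+3) → ℂ => fun j : Fin n => eval v (F j.succ) / eval v (F 0))
      (LinearMap.toContinuousLinearMap (LinearMap.pi fun j : Fin n =>
    ((eval v (F 0)) ^ 2)⁻¹ • (eval v (F 0) • dlin (F j.succ) v - eval v (F j.succ) • dlin (F 0) v))) v := by
    refine hasFDerivAt_pi'.2 fun j => ?_
    have h2 : HasFDerivAt (fun w : Fin (n+3) → ℂ => (eval w (F 0))⁻¹) _ v :=
      (hasDerivAt_inv h0).comp_hasFDerivAt v (hasFDerivAt_eval (F 0) v)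
    have := (hasFDerivAt_eval (F j.succ) v).mul h2
    simp only [div_eq_mul_inv]
    refine this.congr_fderiv ?_
    ext1 ξ
    simp
    field_simp
    ring
  exact h1.prodMk ((hasFDerivAt_eval q v).prodMk ((hasFDerivAt_eval g v).prodMk h4))

section
variable {n : ℕ} {q g : MvPolynomial (Fin (n + 3)) ℂ}
    {F : Fin (n + 1) → MvPolynomial (Fin (n + 3)) ℂ} {lam : (Fin (n + 3) → ℂ) →ₗ[ℂ] ℂ}
    {f : MvPolynomial (Fin n) ℂ} {Φ : (Fin n → ℂ) → Finset (Fin (n + 3) → ℂ)} {δ : ℕ}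

theorem Gen.Psi_eq (G : Gen q g F lam f Φ δ) {y} (hy : eval y f ≠ 0) {x} (hx : x ∈ Φ y) :
    Psi q g F lam x = (1, 0, 0, y) := by
  obtain ⟨h1, h2, h3, h4, h5⟩ := (G.mem y hy x).1 hx
  simp only [Psi, h1, h2, h3]
  congr 3
  ext j
  rw [h5, mul_div_assoc, div_self h4, mul_one]

theorem Gen.of_Psi (G : Gen q g F lam f Φ δ) {y} (hy : eval y f ≠ 0) {x} (h0 : eval x (F 0) ≠ 0)
    (hx : Psi q g F lam x = (1, 0, 0, y)) : x ∈ Φ y := by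
  simp only [Psi, Prod.mk.injEq] at hx
  refine (G.mem y hy x).2 ⟨hx.1, hx.2.1, hx.2.2.1, h0, fun j => ?_⟩
  rw [← congrFun hx.2.2.2 j]
  field_simp

theorem Gen.dPsi_inj (G : Gen q g F lam f Φ δ) {y} (hy : eval y f ≠ 0) {x} (hx : x ∈ Φ y) :
    Function.Injective (dPsi q g F lam x) := by
  rw [← LinearMap.ker_eq_bot, LinearMap.ker_eq_bot']
  intro ξ hξ
  obtain ⟨h1, h2, h3, h4, h5⟩ := (G.mem y hy x).1 hx
  have hξ : lam ξ = 0 ∧ dlin q x ξ = 0 ∧ dlin g x ξ = 0 ∧ (fun j : Fin n => (((eval x (F 0)) ^ 2)⁻¹ •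
      (eval x (F 0) • dlin (F j.succ) x - eval x (F j.succ) • dlin (F 0) x)) ξ) = 0 := by
    simp only [dPsi, LinearMap.prod_apply, Prod.ext_iff] at hξ
    exact ⟨hξ.1, hξ.2.1, hξ.2.2.1, hξ.2.2.2⟩
  refine G.nondeg y hy x hx ξ hξ.1 hξ.2.1 hξ.2.2.1 fun j => ?_
  have := congrFun hξ.2.2.2 j
  simp only [LinearMap.smul_apply, LinearMap.sub_apply, smul_eq_mul, Pi.zero_apply, h5] at this
  have h6 := (mul_eq_zero.1 this).resolve_left (by simp [h4])
  have h7 : eval x (F 0) * (dlin (F j.succ) x ξ - y j * dlin (F 0) x ξ) = 0 := by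
    linear_combination h6
  exact sub_eq_zero.1 ((mul_eq_zero.1 h7).resolve_left h4)

/-- `dPsi` as an equivalence -/
theorem Gen.dPsi_equiv (G : Gen q g F lam f Φ δ) {y} (hy : eval y f ≠ 0) {x} (hx : x ∈ Φ y) :
    ∃ L : (Fin (n + 3) → ℂ) ≃L[ℂ] ℂ × ℂ × ℂ × (Fin n → ℂ),
      (L : (Fin (n + 3) → ℂ) →L[ℂ] ℂ × ℂ × ℂ × (Fin n → ℂ)) =
        LinearMap.toContinuousLinearMap (dPsi q g F lam x) := by
  refine ⟨(LinearEquiv.ofInjectiveOfFinrankEq (dPsi q g F lam x) (G.dPsi_inj hy hx) ?_).toContinuousLinearEquiv, ?_⟩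
  · simp [Module.finrank_prod]; omega
  · ext1 ξ; rfl

open Filter Topology in
/-- a local branch through a point of the fibre -/
theorem Gen.branch (G : Gen q g F lam f Φ δ) {y0} (hy : eval y0 f ≠ 0) {x} (hx : x ∈ Φ y0) :
    ∃ v : (Fin n → ℂ) → (Fin (n + 3) → ℂ), v y0 = x ∧ ContDiffAt ℂ 1 v y0 ∧
      ∀ᶠ y in 𝓝 y0, v y ∈ Φ y := by
  obtain ⟨L, hL⟩ := G.dPsi_equiv hy hx
  have h0 := ((G.mem y0 hy x).1 hx).2.2.2.1
  have hc := Psi_contDiffAt q g F lam x h0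
  have hd : HasFDerivAt (Psi q g F lam) (L : (Fin (n + 3) → ℂ) →L[ℂ] ℂ × ℂ × ℂ × (Fin n → ℂ)) x := by
    rw [hL]; exact Psi_hasFDerivAt q g F lam x h0
  have hPx := G.Psi_eq hy hx
  set s := hc.localInverse hd one_ne_zero with hs
  have hs1 : s (Psi q g F lam x) = x := hc.localInverse_apply_image hd one_ne_zero
  have hs2 : ContDiffAt ℂ 1 s (Psi q g F lam x) := hc.to_localInverse hd one_ne_zero
  have hs3 : ∀ᶠ t in 𝓝 (Psi q g F lam x), Psi q g F lam (s t) = t :=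
    (hc.hasStrictFDerivAt' hd one_ne_zero).eventually_right_inverse
  rw [hPx] at hs1 hs2 hs3
  set j : (Fin n → ℂ) → ℂ × ℂ × ℂ × (Fin n → ℂ) := fun y => (1, 0, 0, y) with hj
  have hjc : ContDiff ℂ 1 j := by
    rw [hj]; fun_prop
  have hv : ContDiffAt ℂ 1 (fun y => s (j y)) y0 := ContDiffAt.comp y0 hs2 hjc.contDiffAt
  refine ⟨fun y => s (j y), hs1, hv, ?_⟩
  have e1 : ∀ᶠ y in 𝓝 y0, Psi q g F lam (s (j y)) = j y :=
    (hjc.continuous.tendsto y0).eventually hs3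
  have e2 : ∀ᶠ y in 𝓝 y0, eval y f ≠ 0 := (isOpen_D f).mem_nhds hy
  have e3 : ∀ᶠ y in 𝓝 y0, eval (s (j y)) (F 0) ≠ 0 := by
    refine hv.continuousAt.eventually ((isOpen_D (F 0)).mem_nhds ?_)
    show eval (s (j y0)) (F 0) ≠ 0
    rw [hj]; simp only [hs1]; exact h0
  filter_upwards [e1, e2, e3] with y h1 h2 h3
  exact G.of_Psi h2 h3 h1

open Filter Topology in
theorem Gen.branched (G : Gen q g F lam f Φ δ) : Branched δ {y | eval y f ≠ 0} Φ := by
  classical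
  intro y0 hy
  simp only [Set.mem_ofPred_eq] at hy
  have hb := fun x : Φ y0 => G.branch hy x.2
  choose v hv0 hvc hvm using hb
  let e : Fin δ ≃ Φ y0 := ((Φ y0).equivFinOfCardEq (G.card y0 hy)).symm
  have e1 : ∀ᶠ y in 𝓝 y0, ∀ i, v (e i) y ∈ Φ y := eventually_all.2 fun i => hvm _
  have e2 : ∀ᶠ y in 𝓝 y0, ∀ i, DifferentiableAt ℂ (v (e i)) y :=
    eventually_all.2 fun i => by
      filter_upwards [(hvc (e i)).eventually (by simp)] with y h
      exact h.differentiableAt one_ne_zero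
  have e3 : ∀ᶠ y in 𝓝 y0, ∀ i j, i ≠ j → v (e i) y ≠ v (e j) y := by
    refine eventually_all.2 fun i => eventually_all.2 fun j => ?_
    by_cases hij : i = j
    · simp [hij]
    · have hne : v (e i) y0 ≠ v (e j) y0 := by
        rw [hv0, hv0]; intro h; exact hij (e.injective (Subtype.ext h))
      have hc := ((hvc (e i)).continuousAt.sub (hvc (e j)).continuousAt).tendsto.eventually_ne
        (sub_ne_zero.2 hne)
      filter_upwards [hc] with y h _
      exact sub_ne_zero.1 h
  have e4 : ∀ᶠ y in 𝓝 y0, eval y f ≠ 0 := (isOpen_D f).mem_nhds hy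
  obtain ⟨U, hU, hUo, hyU⟩ := eventually_nhds_iff.1 (((e1.and e2).and e3).and e4)
  refine ⟨U, hUo, hyU, fun y h => (hU y h).2, fun i => v (e i), fun i y h =>
    ((hU y h).1.1.2 i).differentiableWithinAt, fun y h => ?_⟩
  have hinj : Function.Injective fun i => v (e i) y := by
    intro i j hij
    by_contra hne
    exact (hU y h).1.2 i j hne hij
  refine ⟨hinj, ?_⟩
  symm
  refine Finset.eq_of_subset_of_card_le ?_ ?_
  · intro x hx
    obtain ⟨i, _, rfl⟩ := Finset.mem_image.1 hx
    exact (hU y h).1.1.1 i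
  · rw [Finset.card_image_of_injective _ hinj, G.card y (hU y h).2]; simp
end
end

open MvPolynomial
noncomputable section
/-- index equivalence -/
def eN (n : ℕ) : Fin 3 ⊕ Fin n ≃ Fin (n + 3) := (Equiv.sumComm _ _).trans finSumFinEquiv

/-- matrix of linear forms -/
def rmat {n : ℕ} (R : Fin 3 ⊕ Fin n → ((Fin (n + 3) → ℂ) →ₗ[ℂ] ℂ)) :
    Matrix (Fin 3 ⊕ Fin n) (Fin 3 ⊕ Fin n) ℂ := fun r c => R r (Pi.single (eN n c) 1)

theorem rmat_mul {n : ℕ} (R : Fin 3 ⊕ Fin n → ((Fin (n + 3) → ℂ) →ₗ[ℂ] ℂ))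
    (X : Fin 3 ⊕ Fin n → (Fin (n + 3) → ℂ)) (r c : Fin 3 ⊕ Fin n) :
    (rmat R * Matrix.of (fun a b => X b (eN n a))) r c = R r (X c) := by
  rw [Matrix.mul_apply]
  conv_rhs => rw [LinearMap.pi_apply_eq_sum_univ (R r) (X c)]
  rw [← (eN n).sum_comp]
  refine Finset.sum_congr rfl fun a _ => ?_
  rw [smul_eq_mul, mul_comm]
  simp only [rmat, Matrix.of_apply]
  congr 2
  ext i
  by_cases h : i = eN n a
  · subst h; simp
  · have : ¬ (eN n a = i) := fun h' => h h'.symm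
    simp [Pi.single_apply, h, this]

theorem det_key {n : ℕ} (l0 l1 l2 k0 : (Fin (n + 3) → ℂ) →ₗ[ℂ] ℂ)
    (φ w : Fin n → ((Fin (n + 3) → ℂ) →ₗ[ℂ] ℂ))
    (hdet : (rmat (Sum.elim ![l0, l1, l2] φ)).det ≠ 0)
    (x : Fin (n + 3) → ℂ) (t : Fin n → Fin (n + 3) → ℂ)
    (hx0 : l0 x = 1) (hx1 : l1 x = 0) (hx2 : l2 x = 0) (hxφ : ∀ j, φ j x = 0)
    (ht0 : ∀ k, l0 (t k) = 0) (ht1 : ∀ k, l1 (t k) = 0) (ht2 : ∀ k, l2 (t k) = 0)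
    (htφ : ∀ j k, φ j (t k) = if j = k then 1 else 0) (hk : k0 x ≠ 0) :
    (rmat (Sum.elim ![k0, l1, l2] w)).det = (rmat (Sum.elim ![l0, l1, l2] φ)).det *
      (k0 x * (Matrix.of fun j k => w j (t k) - w j x * (k0 (t k) / k0 x)).det) := by
  classical
  set R : Fin 3 ⊕ Fin n → ((Fin (n + 3) → ℂ) →ₗ[ℂ] ℂ) := Sum.elim ![l0, l1, l2] φ with hR
  set M := rmat R with hM
  have hu : IsUnit M.det := isUnit_iff_ne_zero.2 hdet
  set X : Fin 3 ⊕ Fin n → (Fin (n + 3) → ℂ) := fun c i => M⁻¹ ((eN n).symm i) c with hX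
  have hXC : Matrix.of (fun a b => X b (eN n a)) = M⁻¹ := by
    ext a b; simp [hX]
  have hRX : ∀ r c, R r (X c) = if r = c then 1 else 0 := by
    intro r c
    rw [← rmat_mul, hXC, Matrix.mul_nonsing_inv _ hu, Matrix.one_apply]
  have hinj : ∀ a b : Fin (n + 3) → ℂ, (∀ r, R r a = R r b) → a = b := by
    intro a b hab
    have h1 : M.mulVec (fun c => a (eN n c)) = M.mulVec (fun c => b (eN n c)) := by
      ext r
      have h2 := rmat_mul R (fun _ => a) r (Sum.inl 0)
      have h3 := rmat_mul R (fun _ => b) r (Sum.inl 0)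
      rw [Matrix.mul_apply] at h2 h3
      simp only [Matrix.mulVec, dotProduct]
      simp only [Matrix.of_apply] at h2 h3
      rw [hM, h2, h3, hab]
    have h4 := Matrix.mulVec_injective_of_isUnit ((Matrix.isUnit_iff_isUnit_det _).2 hu) h1
    ext i
    have := congrFun h4 ((eN n).symm i)
    simpa using this
  have hX0 : X (Sum.inl 0) = x := by
    refine hinj _ _ fun r => ?_
    rw [hRX]
    rcases r with r | r
    · fin_cases r <;> simp [hR, hx0, hx1, hx2]
    · simp [hR, hxφ]
  have hXk : ∀ k, X (Sum.inr k) = t k := by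
    intro k
    refine hinj _ _ fun r => ?_
    rw [hRX]
    rcases r with r | r
    · fin_cases r <;> simp [hR, ht0, ht1, ht2]
    · simp [hR, htφ]
  have e1 : (rmat (Sum.elim ![k0, l1, l2] w)).det = (rmat (Sum.elim ![k0, l1, l2] w) * M⁻¹).det * M.det := by
    rw [Matrix.det_mul, mul_assoc, ← Matrix.det_mul, Matrix.nonsing_inv_mul _ hu, Matrix.det_one, mul_one]
  rw [e1, mul_comm]
  congr 1
  set A : Matrix (Fin 3) (Fin 3) ℂ := !![k0 x, k0 (X (Sum.inl 1)), k0 (X (Sum.inl 2)); 0, 1, 0; 0, 0, 1] with hA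
  set B : Matrix (Fin 3) (Fin n) ℂ := Matrix.of ![fun k => k0 (t k), 0, 0] with hB
  set B' : Matrix (Fin 3) (Fin n) ℂ := Matrix.of ![fun k => k0 (t k) / k0 x, 0, 0] with hB'
  set Cm : Matrix (Fin n) (Fin 3) ℂ := Matrix.of fun j c => w j (X (Sum.inl c)) with hCm
  set Dm : Matrix (Fin n) (Fin n) ℂ := Matrix.of fun j k => w j (t k) with hDm
  have hl1 : ∀ c, l1 (X c) = if Sum.inl 1 = c then 1 else 0 := fun c => by
    have := hRX (Sum.inl 1) c; simpa [hR] using this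
  have hl2 : ∀ c, l2 (X c) = if Sum.inl 2 = c then 1 else 0 := fun c => by
    have := hRX (Sum.inl 2) c; simpa [hR] using this
  have hK : rmat (Sum.elim ![k0, l1, l2] w) * M⁻¹ = Matrix.fromBlocks A B Cm Dm := by
    ext r c
    rw [← hXC, rmat_mul]
    rcases r with r | r <;> rcases c with c | c
    · fin_cases r <;> fin_cases c <;> simp [hA, hX0, hl1, hl2, hx1, hx2]
    · fin_cases r <;> simp [hB, hXk, ht1, ht2]
    · simp [hCm]
    · simp [hDm, hXk]
  have hAdet : A.det = k0 x := by
    rw [hA, Matrix.det_fin_three]; simp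
  have hAB : A * B' = B := by
    ext r k
    rw [Matrix.mul_apply, Fin.sum_univ_three]
    fin_cases r <;> simp [hA, hB, hB']
    field_simp
  have hAu : IsUnit A.det := by rw [hAdet]; exact isUnit_iff_ne_zero.2 hk
  letI := A.invertibleOfIsUnitDet hAu
  rw [hK, Matrix.det_fromBlocks₁₁, hAdet, ← hAB, Matrix.mul_assoc, ← Matrix.mul_assoc (⅟A) A,
    invOf_mul_self, Matrix.one_mul]
  congr 2
  ext j k
  rw [Matrix.sub_apply, Matrix.mul_apply, Fin.sum_univ_three]
  simp [hDm, hCm, hB', hX0]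

section
variable {n : ℕ} {q g : MvPolynomial (Fin (n + 3)) ℂ}
    {F : Fin (n + 1) → MvPolynomial (Fin (n + 3)) ℂ} {lam : (Fin (n + 3) → ℂ) →ₗ[ℂ] ℂ}
    {f : MvPolynomial (Fin n) ℂ} {Φ : (Fin n → ℂ) → Finset (Fin (n + 3) → ℂ)} {δ : ℕ}

open Filter Topology in
theorem Gen.section_deriv (G : Gen q g F lam f Φ δ) {U : Set (Fin n → ℂ)} (hU : IsOpen U)
    (hUD : U ⊆ {y | eval y f ≠ 0}) {v : (Fin n → ℂ) → (Fin (n + 3) → ℂ)}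
    (hv : DifferentiableOn ℂ v U) (hm : ∀ y ∈ U, v y ∈ Φ y) {y} (hy : y ∈ U) (η : Fin n → ℂ) :
    dPsi q g F lam (v y) (fderiv ℂ v y η) = (0, 0, 0, η) := by
  have h0 := ((G.mem y (hUD hy) _).1 (hm y hy)).2.2.2.1
  have h1 := (Psi_hasFDerivAt q g F lam (v y) h0).comp y (hv.differentiableAt (hU.mem_nhds hy)).hasFDerivAt
  set j : (Fin n → ℂ) →L[ℂ] ℂ × ℂ × ℂ × (Fin n → ℂ) :=
    (0 : (Fin n → ℂ) →L[ℂ] ℂ).prod ((0 : (Fin n → ℂ) →L[ℂ] ℂ).prod ((0 : (Fin n → ℂ) →L[ℂ] ℂ).prod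
      (ContinuousLinearMap.id ℂ (Fin n → ℂ)))) with hj
  have h2 : HasFDerivAt (Psi q g F lam ∘ v) j y := by
    have : HasFDerivAt (fun y => ((1 : ℂ), (0 : ℂ), (0 : ℂ), (y : Fin n → ℂ))) j y :=
      (hasFDerivAt_const _ _).prodMk ((hasFDerivAt_const _ _).prodMk ((hasFDerivAt_const _ _).prodMk
        (hasFDerivAt_id _)))
    refine this.congr_of_eventuallyEq ?_
    filter_upwards [hU.mem_nhds hy] with y' hy'
    exact G.Psi_eq (hUD hy') (hm y' hy')
  have h3 := h1.unique h2
  have h4 := congrArg (fun L => L η) h3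
  simpa [hj] using h4

/-- differential of `F_j/F_0` -/
def dphi (F : Fin (n + 1) → MvPolynomial (Fin (n + 3)) ℂ) (x : Fin (n + 3) → ℂ) (j : Fin n) :
    (Fin (n + 3) → ℂ) →ₗ[ℂ] ℂ :=
  ((eval x (F 0)) ^ 2)⁻¹ • (eval x (F 0) • dlin (F j.succ) x - eval x (F j.succ) • dlin (F 0) x)

theorem dPsi_eq (x ξ : Fin (n + 3) → ℂ) : dPsi q g F lam x ξ =
    (lam ξ, dlin q x ξ, dlin g x ξ, fun j => dphi F x j ξ) := rfl

/-- the big Jacobian -/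
def bigM (q g : MvPolynomial (Fin (n + 3)) ℂ)
    (F : Fin (n + 1) → MvPolynomial (Fin (n + 3)) ℂ) (lam : (Fin (n + 3) → ℂ) →ₗ[ℂ] ℂ)
    (x : Fin (n + 3) → ℂ) : ℂ := (rmat (Sum.elim ![lam, dlin q x, dlin g x] (dphi F x))).det

/-- the chart Jacobian -/
def chM (q g : MvPolynomial (Fin (n + 3)) ℂ) (κ : (Fin (n + 3) → ℂ) →ₗ[ℂ] ℂ)
    (w : Fin n → ((Fin (n + 3) → ℂ) →ₗ[ℂ] ℂ)) (x : Fin (n + 3) → ℂ) : ℂ :=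
  (rmat (Sum.elim ![κ, dlin q x, dlin g x] w)).det

theorem rmat_det_ne {n : ℕ} (R : Fin 3 ⊕ Fin n → ((Fin (n + 3) → ℂ) →ₗ[ℂ] ℂ))
    (h : ∀ ξ, (∀ r, R r ξ = 0) → ξ = 0) : (rmat R).det ≠ 0 := by
  intro h0
  obtain ⟨u, hu, hMu⟩ := Matrix.exists_mulVec_eq_zero_iff.2 h0
  apply hu
  have h1 := h (fun i => u ((eN n).symm i)) (fun r => by
    have h2 := rmat_mul R (fun _ => fun i => u ((eN n).symm i)) r (Sum.inl 0)
    rw [← h2, Matrix.mul_apply]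
    have := congrFun hMu r
    simpa [Matrix.mulVec, dotProduct] using this)
  ext c
  have := congrFun h1 (eN n c)
  simpa using this

theorem Gen.bigM_ne (G : Gen q g F lam f Φ δ) {y} (hy : eval y f ≠ 0) {x} (hx : x ∈ Φ y) :
    bigM q g F lam x ≠ 0 := by
  refine rmat_det_ne _ fun ξ hξ => ?_
  apply G.dPsi_inj hy hx
  rw [map_zero, dPsi_eq]
  have h0 := hξ (Sum.inl 0)
  have h1 := hξ (Sum.inl 1)
  have h2 := hξ (Sum.inl 2)
  simp at h0 h1 h2
  rw [h0, h1, h2]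
  have h3 : (fun j => dphi F x j ξ) = 0 := by
    ext j; exact hξ (Sum.inr j)
  rw [h3]; rfl

theorem dphi_self (e : ℕ) (hF : ∀ j, (F j).IsHomogeneous e) (x : Fin (n + 3) → ℂ) (j : Fin n) :
    dphi F x j x = 0 := by
  simp only [dphi, LinearMap.smul_apply, LinearMap.sub_apply, dlin_self (hF _), smul_eq_mul]
  ring

theorem chM_smul {d : ℕ} (hd : 1 ≤ d) (hq : q.IsHomogeneous 3) (hg : g.IsHomogeneous d)
    (κ : (Fin (n + 3) → ℂ) →ₗ[ℂ] ℂ) (w : Fin n → ((Fin (n + 3) → ℂ) →ₗ[ℂ] ℂ)) (c : ℂ) (u : Fin (n + 3) → ℂ) :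
    chM q g κ w (c • u) = c ^ (d + 1) * chM q g κ w u := by
  have h1 : rmat (Sum.elim ![κ, dlin q (c • u), dlin g (c • u)] w) =
      Matrix.of fun r cc => (Sum.elim ![1, c ^ 2, c ^ (d - 1)] (fun _ => 1) : Fin 3 ⊕ Fin n → ℂ) r *
        rmat (Sum.elim ![κ, dlin q u, dlin g u] w) r cc := by
    ext r cc
    rcases r with r | r
    · fin_cases r <;> simp [rmat, dlin_smul hq, dlin_smul hg]
    · simp [rmat]
  rw [chM, h1, Matrix.det_mul_column]
  simp only [Fintype.prod_sum_type, Sum.elim_inl, Sum.elim_inr, Finset.prod_const_one, Fin.prod_univ_three]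
  have : c ^ (d + 1) = c ^ 2 * c ^ (d - 1) := by rw [← pow_add]; congr 1; omega
  simp [this, chM]

/-- the key change of variables formula -/
theorem Gen.chart (G : Gen q g F lam f Φ δ) {d e : ℕ} (hd : 1 ≤ d) (hnd : n ≤ d) (hq : q.IsHomogeneous 3)
    (hg : g.IsHomogeneous d) (hF : ∀ j, (F j).IsHomogeneous e)
    (κ : (Fin (n + 3) → ℂ) →ₗ[ℂ] ℂ) (w : Fin n → ((Fin (n + 3) → ℂ) →ₗ[ℂ] ℂ))
    {U : Set (Fin n → ℂ)} (hU : IsOpen U)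
    (hUD : U ⊆ {y | eval y f ≠ 0}) {v : (Fin n → ℂ) → (Fin (n + 3) → ℂ)}
    (hv : DifferentiableOn ℂ v U) (hm : ∀ y ∈ U, v y ∈ Φ y) {y} (hy : y ∈ U) (hκ : κ (v y) ≠ 0) :
    (fderiv ℂ ((fun x => fun j => w j x / κ x) ∘ v) y).det =
      κ (v y) ^ (d - n) * chM q g κ w ((κ (v y))⁻¹ • v y) / bigM q g F lam (v y) := by
  have hyf := hUD hy
  have hx := hm y hy
  set x := v y with hxdef
  set t : Fin n → (Fin (n + 3) → ℂ) := fun k => fderiv ℂ v y (Pi.single k 1) with ht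
  obtain ⟨m1, m2, m3, m4, m5⟩ := (G.mem y hyf x).1 hx
  have hsd : ∀ k, (lam (t k) = 0 ∧ dlin q x (t k) = 0 ∧ dlin g x (t k) = 0 ∧
      (fun j => dphi F x j (t k)) = Pi.single k 1) := by
    intro k
    have := G.section_deriv hU hUD hv hm hy (Pi.single k 1)
    rw [dPsi_eq] at this
    simpa only [Prod.mk.injEq] using this
  have key := det_key lam (dlin q x) (dlin g x) κ (dphi F x) w (G.bigM_ne hyf hx) x t m1
    (by rw [dlin_self hq, m2, mul_zero]) (by rw [dlin_self hg, m3, mul_zero])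
    (dphi_self e hF x) (fun k => (hsd k).1) (fun k => (hsd k).2.1) (fun k => (hsd k).2.2.1)
    (fun j k => by
      have := congrFun (hsd k).2.2.2 j
      simp only [this, Pi.single_apply]) hκ
  have hvd : HasFDerivAt v (fderiv ℂ v y) y := (hv.differentiableAt (hU.mem_nhds hy)).hasFDerivAt
  have hder : ∀ j k, fderiv ℂ ((fun x => fun j => w j x / κ x) ∘ v) y (Pi.single k 1) j =
      (κ x)⁻¹ * (w j (t k) - w j x * (κ (t k) / κ x)) := by
    intro j k
    have hκd : HasFDerivAt (fun y => κ (v y)) ((LinearMap.toContinuousLinearMap κ).comp (fderiv ℂ v y)) y :=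
      (LinearMap.toContinuousLinearMap κ).hasFDerivAt.comp y hvd
    have hwd : ∀ j, HasFDerivAt (fun y => w j (v y)) ((LinearMap.toContinuousLinearMap (w j)).comp (fderiv ℂ v y)) y :=
      fun j => (LinearMap.toContinuousLinearMap (w j)).hasFDerivAt.comp y hvd
    have hinv : HasFDerivAt (fun y => (κ (v y))⁻¹) _ y := (hasDerivAt_inv hκ).comp_hasFDerivAt y hκd
    have hall : HasFDerivAt ((fun x => fun j => w j x / κ x) ∘ v) (ContinuousLinearMap.pi fun j => _) y :=
      hasFDerivAt_pi.2 fun j => (hwd j).mul hinv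
    rw [hall.fderiv]
    simp [ht, ← hxdef]
    field_simp
    ring
  have hdet : (fderiv ℂ ((fun x => fun j => w j x / κ x) ∘ v) y).det =
      ((κ x)⁻¹) ^ n * (Matrix.of fun j k => w j (t k) - w j x * (κ (t k) / κ x)).det := by
    rw [ContinuousLinearMap.det, ← LinearMap.det_toMatrix']
    have : LinearMap.toMatrix' ((fderiv ℂ ((fun x => fun j => w j x / κ x) ∘ v) y :
        (Fin n → ℂ) →L[ℂ] (Fin n → ℂ)) : (Fin n → ℂ) →ₗ[ℂ] (Fin n → ℂ)) =
        (κ x)⁻¹ • (Matrix.of fun j k => w j (t k) - w j x * (κ (t k) / κ x)) := by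
      ext j k
      rw [LinearMap.toMatrix'_apply]
      have h5 := hder j k
      simp only [Matrix.smul_apply, Matrix.of_apply, smul_eq_mul]
      rw [← h5]; congr 2
      
    rw [this, Matrix.det_smul, Fintype.card_fin]
  have hsm : chM q g κ w x = κ x ^ (d + 1) * chM q g κ w ((κ x)⁻¹ • x) := by
    rw [← chM_smul hd hq hg, smul_smul, mul_inv_cancel₀ hκ, one_smul]
  have key2 : chM q g κ w x = bigM q g F lam x *
      (κ x * (Matrix.of fun j k => w j (t k) - w j x * (κ (t k) / κ x)).det) := key
  rw [hdet, eq_div_iff (G.bigM_ne hyf hx)]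
  have h6 : κ x ^ (d + 1) = κ x ^ (d - n) * κ x ^ n * κ x := by
    rw [← pow_add, ← pow_succ]; congr 1; omega
  rw [hsm, h6] at key2
  have h7 : κ x ^ n * (κ x)⁻¹ ^ n = 1 := by
    rw [← mul_pow, mul_inv_cancel₀ hκ, one_pow]
  have hκn : κ x ^ n ≠ 0 := pow_ne_zero _ hκ
  apply mul_left_cancel₀ hκn
  apply mul_left_cancel₀ hκ
  linear_combination (-1 : ℂ) * key2 + κ x * (Matrix.of fun j k => w j (t k) - w j x * (κ (t k) / κ x)).det * bigM q g F lam x * h7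
end
end

open MvPolynomial
noncomputable section

theorem complete_forms {n : ℕ} (k0 k1 k2 : (Fin (n + 3) → ℂ) →ₗ[ℂ] ℂ)
    (hli : ∀ a b c : ℂ, a • k0 + b • k1 + c • k2 = 0 → a = 0 ∧ b = 0 ∧ c = 0) :
    ∃ w : Fin n → ((Fin (n + 3) → ℂ) →ₗ[ℂ] ℂ), ∀ ξ, k0 ξ = 0 → k1 ξ = 0 → k2 ξ = 0 →
      (∀ j, w j ξ = 0) → ξ = 0 := by
  set L : (Fin (n + 3) → ℂ) →ₗ[ℂ] (Fin 3 → ℂ) := LinearMap.pi ![k0, k1, k2] with hL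
  have hs : LinearMap.range L = ⊤ := by
    by_contra hne
    obtain ⟨f, hf, hle⟩ := Submodule.exists_le_ker_of_lt_top _ (lt_top_iff_ne_top.2 hne)
    have h1 : ∀ u : Fin 3 → ℂ, f u = f (Pi.single 0 1) * u 0 + f (Pi.single 1 1) * u 1 + f (Pi.single 2 1) * u 2 := by
      intro u
      conv_lhs => rw [LinearMap.pi_apply_eq_sum_univ f u]
      rw [Fin.sum_univ_three]
      have : ∀ i : Fin 3, (fun j => if i = j then (1:ℂ) else 0) = Pi.single i 1 := by
        intro i; ext j; by_cases h : i = j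
        · subst h; simp
        · have : ¬ j = i := fun h' => h h'.symm
          simp [h, this]
      simp only [this, smul_eq_mul]; ring
    have h2 := hli (f (Pi.single 0 1)) (f (Pi.single 1 1)) (f (Pi.single 2 1)) (by
      refine LinearMap.ext fun ξ => ?_
      have h3 : L ξ ∈ LinearMap.ker f := hle ⟨ξ, rfl⟩
      rw [LinearMap.mem_ker, h1] at h3
      simpa [hL] using h3)
    apply hf
    refine LinearMap.ext fun u => ?_
    rw [h1, h2.1, h2.2.1, h2.2.2]; simp
  have hk : Module.finrank ℂ (LinearMap.ker L) = n := by
    have := L.finrank_range_add_finrank_ker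
    rw [hs, finrank_top] at this
    simp at this
    omega
  obtain ⟨P, hP⟩ := LinearMap.exists_leftInverse_of_injective (LinearMap.ker L).subtype (by simp)
  let E : LinearMap.ker L ≃ₗ[ℂ] (Fin n → ℂ) := LinearEquiv.ofFinrankEq (LinearMap.ker L) (Fin n → ℂ) (by simpa using hk)
  refine ⟨fun j => LinearMap.proj j ∘ₗ E.toLinearMap ∘ₗ P, fun ξ h0 h1 h2 h3 => ?_⟩
  have hξ : ξ ∈ LinearMap.ker L := by
    rw [LinearMap.mem_ker]; ext i; fin_cases i <;> simp [hL, h0, h1, h2]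
  have h4 : P ξ = ⟨ξ, hξ⟩ := LinearMap.congr_fun hP ⟨ξ, hξ⟩
  have h5 : E (P ξ) = 0 := by ext j; exact h3 j
  have h6 := E.map_eq_zero_iff.1 h5
  rw [h4] at h6
  exact congrArg Subtype.val h6

/-- local coordinates -/
def Th {n : ℕ} (q g : MvPolynomial (Fin (n + 3)) ℂ) (κ : (Fin (n + 3) → ℂ) →ₗ[ℂ] ℂ)
    (w : Fin n → ((Fin (n + 3) → ℂ) →ₗ[ℂ] ℂ)) (x : Fin (n + 3) → ℂ) : ℂ × ℂ × ℂ × (Fin n → ℂ) :=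
  (κ x, eval x q, eval x g, fun j => w j x)

theorem Th_equiv {n : ℕ} (q g : MvPolynomial (Fin (n + 3)) ℂ) (κ : (Fin (n + 3) → ℂ) →ₗ[ℂ] ℂ)
    (w : Fin n → ((Fin (n + 3) → ℂ) →ₗ[ℂ] ℂ)) (x : Fin (n + 3) → ℂ)
    (h : ∀ ξ, κ ξ = 0 → dlin q x ξ = 0 → dlin g x ξ = 0 → (∀ j, w j ξ = 0) → ξ = 0) :
    ∃ L : (Fin (n + 3) → ℂ) ≃L[ℂ] ℂ × ℂ × ℂ × (Fin n → ℂ),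
      (∀ ξ, L ξ = (κ ξ, dlin q x ξ, dlin g x ξ, fun j => w j ξ)) ∧
      HasStrictFDerivAt (Th q g κ w) (L : (Fin (n + 3) → ℂ) →L[ℂ] ℂ × ℂ × ℂ × (Fin n → ℂ)) x := by
  let A : (Fin (n + 3) → ℂ) →ₗ[ℂ] ℂ × ℂ × ℂ × (Fin n → ℂ) :=
    κ.prod ((dlin q x).prod ((dlin g x).prod (LinearMap.pi w)))
  have hA : ∀ ξ, A ξ = (κ ξ, dlin q x ξ, dlin g x ξ, fun j => w j ξ) := fun ξ => rfl
  have hi : Function.Injective A := by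
    rw [← LinearMap.ker_eq_bot, LinearMap.ker_eq_bot']
    intro ξ hξ
    rw [hA] at hξ
    simp only [Prod.mk_eq_zero] at hξ
    exact h ξ hξ.1 hξ.2.1 hξ.2.2.1 fun j => congrFun hξ.2.2.2 j
  let E := LinearEquiv.ofInjectiveOfFinrankEq A hi (by simp; omega)
  refine ⟨E.toContinuousLinearEquiv, fun ξ => by rw [← hA]; rfl, ?_⟩
  have hcd : ContDiffAt ℂ 1 (Th q g κ w) x := by
    unfold Th
    refine ContDiffAt.prodMk (LinearMap.toContinuousLinearMap κ).contDiff.contDiffAt ?_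
    refine ContDiffAt.prodMk (contDiff_eval q).contDiffAt ?_
    refine ContDiffAt.prodMk (contDiff_eval g).contDiffAt ?_
    exact (LinearMap.toContinuousLinearMap (LinearMap.pi w)).contDiff.contDiffAt
  refine hcd.hasStrictFDerivAt' ?_ one_ne_zero
  have h1 : HasFDerivAt (Th q g κ w) (LinearMap.toContinuousLinearMap A) x := by
    exact (LinearMap.toContinuousLinearMap κ).hasFDerivAt.prodMk ((hasFDerivAt_eval q x).prodMk
      ((hasFDerivAt_eval g x).prodMk (LinearMap.toContinuousLinearMap (LinearMap.pi w)).hasFDerivAt))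
  exact h1

/-- coordinates at a point of `X` where `κ ≠ 0` -/
theorem exists_w {n d : ℕ} {q g : MvPolynomial (Fin (n + 3)) ℂ} (hX : IsSmoothCI2 q g)
    (hq : q.IsHomogeneous 3) (hg : g.IsHomogeneous d) (κ : (Fin (n + 3) → ℂ) →ₗ[ℂ] ℂ)
    (v0 : Fin (n + 3) → ℂ) (h1 : κ v0 ≠ 0) (hq0 : eval v0 q = 0) (hg0 : eval v0 g = 0) :
    ∃ w : Fin n → ((Fin (n + 3) → ℂ) →ₗ[ℂ] ℂ), ∀ ξ, κ ξ = 0 → dlin q v0 ξ = 0 → dlin g v0 ξ = 0 →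
      (∀ j, w j ξ = 0) → ξ = 0 := by
  refine complete_forms κ (dlin q v0) (dlin g v0) fun a b c h => ?_
  have h2 := LinearMap.congr_fun h v0
  simp [dlin_self hq, dlin_self hg, hq0, hg0, h1] at h2
  subst h2
  refine ⟨rfl, hX v0 (by rintro rfl; simp at h1) hq0 hg0 b c fun i => ?_⟩
  have h3 := LinearMap.congr_fun h (Pi.single i 1)
  simpa [dlin_apply, Pi.single_apply] using h3

theorem chM_continuous {n : ℕ} (q g : MvPolynomial (Fin (n + 3)) ℂ) (κ : (Fin (n + 3) → ℂ) →ₗ[ℂ] ℂ)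
    (w : Fin n → ((Fin (n + 3) → ℂ) →ₗ[ℂ] ℂ)) : Continuous (chM q g κ w) := by
  have hc : ∀ p : MvPolynomial (Fin (n + 3)) ℂ, Continuous fun x : Fin (n + 3) → ℂ => eval x p :=
    fun p => (contDiff_eval p).continuous
  refine Continuous.matrix_det ?_
  refine continuous_matrix fun r c => ?_
  rcases r with r | r
  · fin_cases r
    · simpa [rmat] using continuous_const
    · simpa [rmat, dlin_apply] using continuous_finsetSum _ fun i _ => (hc _).mul continuous_const
    · simpa [rmat, dlin_apply] using continuous_finsetSum _ fun i _ => (hc _).mul continuous_const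
  · simpa [rmat] using continuous_const

open Filter Topology in
theorem exists_cone_chart {n d : ℕ} {q g : MvPolynomial (Fin (n + 3)) ℂ} (hX : IsSmoothCI2 q g)
    (hq : q.IsHomogeneous 3) (hg : g.IsHomogeneous d) 
    (v0 : Fin (n + 3) → ℂ) (h0 : v0 ≠ 0) (hq0 : eval v0 q = 0) (hg0 : eval v0 g = 0) :
    ∃ (κ : (Fin (n + 3) → ℂ) →ₗ[ℂ] ℂ) (w : Fin n → ((Fin (n + 3) → ℂ) →ₗ[ℂ] ℂ))
      (O : Set (Fin (n + 3) → ℂ)) (ε C : ℝ), IsOpen O ∧ v0 ∈ O ∧ 0 < ε ∧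
      (∀ x ∈ O, κ x ≠ 0) ∧ (∀ x ∈ O, ∀ c : ℂ, c ≠ 0 → c • x ∈ O) ∧
      (∀ x ∈ O, ε ≤ ‖chM q g κ w ((κ x)⁻¹ • x)‖) ∧ (∀ x ∈ O, ‖(κ x)⁻¹ • x‖ ≤ C) ∧
      (∀ x ∈ O, ∀ x' ∈ O, eval x q = 0 → eval x g = 0 → eval x' q = 0 → eval x' g = 0 →
        (fun j => w j x / κ x) = (fun j => w j x' / κ x') → (κ x)⁻¹ • x = (κ x')⁻¹ • x') := by
  obtain ⟨κ', hκ', -⟩ := exists_dual_sep (⊥ : Submodule ℂ (Fin (n + 3) → ℂ)) v0 (by simpa using h0)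
  set κ := (κ' v0)⁻¹ • κ' with hκ
  have hκ1 : κ v0 = 1 := by simp [hκ, hκ']
  obtain ⟨w, hw⟩ := exists_w hX hq hg κ v0 (by rw [hκ1]; exact one_ne_zero) hq0 hg0
  obtain ⟨L, hL, hst⟩ := Th_equiv q g κ w v0 hw
  have hch : chM q g κ w v0 ≠ 0 := by
    refine rmat_det_ne _ fun ξ hξ => hw ξ ?_ ?_ ?_ fun j => ?_
    · simpa using hξ (Sum.inl 0)
    · simpa using hξ (Sum.inl 1)
    · simpa using hξ (Sum.inl 2)
    · simpa using hξ (Sum.inr j)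
  set P := hst.toOpenPartialHomeomorph (Th q g κ w) with hP
  have hPs : v0 ∈ P.source := hst.mem_toOpenPartialHomeomorph_source
  set O1 : Set (Fin (n + 3) → ℂ) := P.source ∩ ({x | ‖chM q g κ w v0‖ / 2 < ‖chM q g κ w x‖} ∩ Metric.ball v0 1) with hO1
  have hO1o : IsOpen O1 := P.open_source.inter
    ((isOpen_lt continuous_const (chM_continuous q g κ w).norm).inter Metric.isOpen_ball)
  have hpos : 0 < ‖chM q g κ w v0‖ := norm_pos_iff.2 hch
  have hv0 : v0 ∈ O1 := ⟨hPs, by change ‖chM q g κ w v0‖ / 2 < ‖chM q g κ w v0‖; linarith, Metric.mem_ball_self one_pos⟩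
  have hκc : Continuous κ := LinearMap.continuous_of_finiteDimensional κ
  have hO0 : IsOpen {x | κ x ≠ 0} := isOpen_ne_fun hκc continuous_const
  have hcont : ContinuousOn (fun x : Fin (n + 3) → ℂ => (κ x)⁻¹ • x) {x | κ x ≠ 0} :=
    (hκc.continuousOn.inv₀ fun x hx => hx).smul continuousOn_id
  refine ⟨κ, w, {x | κ x ≠ 0} ∩ (fun x => (κ x)⁻¹ • x) ⁻¹' O1, ‖chM q g κ w v0‖ / 2, ‖v0‖ + 1,
    hcont.isOpen_inter_preimage hO0 hO1o, ⟨by simp [hκ1], by simpa [hκ1] using hv0⟩, by linarith,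
    fun x hx => hx.1, ?_, fun x hx => hx.2.2.1.le, ?_, ?_⟩
  · intro x hx c hc
    have hx1 : κ x ≠ 0 := hx.1
    refine ⟨?_, ?_⟩
    · change κ (c • x) ≠ 0
      simp [hc, hx1]
    · have : (κ (c • x))⁻¹ • c • x = (κ x)⁻¹ • x := by
        rw [map_smul, smul_eq_mul, smul_smul]; congr 1; field_simp
      change (κ (c • x))⁻¹ • c • x ∈ O1
      rw [this]; exact hx.2
  · intro x hx
    have h := hx.2.2.2
    rw [Metric.mem_ball, dist_eq_norm] at h
    have := norm_sub_norm_le ((κ x)⁻¹ • x) v0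
    linarith
  · intro x hx x' hx' a b a' b' he
    refine P.injOn hx.2.1 hx'.2.1 ?_
    have hx1 : κ x ≠ 0 := hx.1
    have hx1' : κ x' ≠ 0 := hx'.1
    have key : ∀ x, κ x ≠ 0 → eval x q = 0 → eval x g = 0 → Th q g κ w ((κ x)⁻¹ • x) = (1, 0, 0, fun j => w j x / κ x) := by
      intro x hx a b
      simp [Th, homog_eval hq, homog_eval hg, a, b, hx, div_eq_inv_mul]
    change Th q g κ w _ = Th q g κ w _
    rw [key x hx1 a b, key x' hx1' a' b', he]

end

open MvPolynomial
noncomputable section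
section
variable {n : ℕ} {q g : MvPolynomial (Fin (n + 3)) ℂ}
    {F : Fin (n + 1) → MvPolynomial (Fin (n + 3)) ℂ} {lam : (Fin (n + 3) → ℂ) →ₗ[ℂ] ℂ}
    {f : MvPolynomial (Fin n) ℂ} {Φ : (Fin n → ℂ) → Finset (Fin (n + 3) → ℂ)} {δ : ℕ}

theorem diff_prod {E : Type*} [NormedAddCommGroup E] [NormedSpace ℂ E] {κ : Type*} (u : Finset κ)
    (h : κ → E → ℂ) (x : E) (hd : ∀ i, DifferentiableAt ℂ (h i) x) :
    DifferentiableAt ℂ (fun x => ∏ i ∈ u, h i x) x := by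
  classical
  induction u using Finset.induction_on with
  | empty => simp
  | insert a s ha ih =>
    simp only [Finset.prod_insert ha]
    exact (hd a).mul ih

theorem bigM_diff (x : Fin (n + 3) → ℂ) (h0 : eval x (F 0) ≠ 0) :
    DifferentiableAt ℂ (bigM q g F lam) x := by
  have hc : ∀ p : MvPolynomial (Fin (n + 3)) ℂ, DifferentiableAt ℂ (fun x : Fin (n + 3) → ℂ => eval x p) x :=
    fun p => (hasFDerivAt_eval p x).differentiableAt
  have hl : ∀ (p : MvPolynomial (Fin (n + 3)) ℂ) (ξ : Fin (n + 3) → ℂ), DifferentiableAt ℂ (fun x : Fin (n + 3) → ℂ => dlin p x ξ) x := by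
    intro p ξ
    simp only [dlin_apply]
    exact DifferentiableAt.fun_sum fun i _ => (hc _).mul_const _
  have he : ∀ r c, DifferentiableAt ℂ (fun x : Fin (n + 3) → ℂ => rmat (Sum.elim ![lam, dlin q x, dlin g x] (dphi F x)) r c) x := by
    intro r c
    rcases r with r | r
    · fin_cases r
      · simp [rmat]
      · simpa [rmat] using hl _ _
      · simpa [rmat] using hl _ _
    · simp only [rmat, Sum.elim_inr, dphi, LinearMap.smul_apply, LinearMap.sub_apply, smul_eq_mul]
      exact (((hc _).pow 2).inv (pow_ne_zero _ h0)).mul (((hc _).mul (hl _ _)).sub ((hc _).mul (hl _ _)))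
  unfold bigM
  simp only [Matrix.det_apply]
  refine DifferentiableAt.fun_sum fun σ _ => DifferentiableAt.const_smul ?_ _
  exact diff_prod _ _ _ fun i => he _ _

open MeasureTheory Set Filter Topology in
theorem Gen.meas (G : Gen q g F lam f Φ δ) (O : Set (Fin (n + 3) → ℂ)) (hO : IsOpen O)
    (J : (Fin (n + 3) → ℂ) → ℂ) (hJ : ∀ y, eval y f ≠ 0 → ∀ x ∈ Φ y, x ∈ O → ContinuousAt J x) :
    Measurable (Set.indicator {y | eval y f ≠ 0} fun y => ∑ x ∈ Φ y, O.indicator (fun x => ‖J x‖ₑ ^ 2) x) := by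
  classical
  refine LowerSemicontinuous.measurable ?_
  intro y0
  by_cases hy0 : eval y0 f ≠ 0
  · obtain ⟨U, hUo, hyU, hUD, v, hvd, hv⟩ := G.branched y0 hy0
    have hvc : ∀ i, ContinuousAt (v i) y0 := fun i =>
      ((hvd i).differentiableAt (hUo.mem_nhds hyU)).continuousAt
    have h1 : LowerSemicontinuousAt (fun y => ∑ i, O.indicator (fun x => ‖J x‖ₑ ^ 2) (v i y)) y0 := by
      refine lowerSemicontinuousAt_sum fun i _ => ?_
      by_cases hi : v i y0 ∈ O
      · have hc : ContinuousAt (fun y => O.indicator (fun x => ‖J x‖ₑ ^ 2) (v i y)) y0 := by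
          have h2 : ContinuousAt J (v i y0) := hJ y0 hy0 _ (by rw [(hv y0 hyU).2]; simp) hi
          have h3 : ContinuousAt (fun y => ‖J (v i y)‖ₑ ^ 2) y0 :=
            ((ENNReal.continuous_pow 2).comp continuous_enorm).continuousAt.comp (h2.comp (hvc i))
          refine h3.congr ?_
          filter_upwards [(hvc i).preimage_mem_nhds (hO.mem_nhds hi)] with y hy
          exact (Set.indicator_of_mem (f := fun x => ‖J x‖ₑ ^ 2) (show v i y ∈ O from hy)).symm
        exact hc.lowerSemicontinuousAt
      · intro a ha
        simp [Set.indicator_of_notMem hi] at ha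
    have h2 : ∀ y ∈ U, (Set.indicator {y | eval y f ≠ 0} fun y => ∑ x ∈ Φ y, O.indicator (fun x => ‖J x‖ₑ ^ 2) x) y
        = ∑ i, O.indicator (fun x => ‖J x‖ₑ ^ 2) (v i y) := by
      intro y hy
      rw [Set.indicator_of_mem (hUD hy), (hv y hy).2, Finset.sum_image fun i _ j _ h => (hv y hy).1 h]
    intro a ha
    rw [h2 y0 hyU] at ha
    filter_upwards [hUo.mem_nhds hyU, h1 a ha] with y hy hy2
    rw [h2 y hy]
    exact hy2
  · intro a ha
    rw [Set.indicator_of_notMem hy0] at ha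
    simp at ha

open MeasureTheory Set Filter Topology in
/-- vanishing of the traces: the Cayley–Bacharach property -/
theorem Gen.wcb {n : ℕ} {q g : MvPolynomial (Fin (n + 1 + 3)) ℂ}
    {F : Fin (n + 1 + 1) → MvPolynomial (Fin (n + 1 + 3)) ℂ} {lam : (Fin (n + 1 + 3) → ℂ) →ₗ[ℂ] ℂ}
    {f : MvPolynomial (Fin (n + 1)) ℂ} {Φ : (Fin (n + 1) → ℂ) → Finset (Fin (n + 1 + 3) → ℂ)} {δ : ℕ}
    (G : Gen q g F lam f Φ δ) {d e : ℕ} (hnd : n + 1 ≤ d) (hq : q.IsHomogeneous 3)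
    (hg : g.IsHomogeneous d) (hF : ∀ j, (F j).IsHomogeneous e) (hX : IsSmoothCI2 q g)
    {y} (hy : eval y f ≠ 0) : WCB (d - (n + 1)) (Φ y) (fun x => (bigM q g F lam x)⁻¹) := by
  classical
  refine ⟨fun x hx => inv_ne_zero (G.bigM_ne hy hx), fun L => ?_⟩
  set D : Set (Fin (n + 1) → ℂ) := {y | eval y f ≠ 0} with hD
  have hDo : IsOpen D := isOpen_D f
  set P : (Fin (n + 1 + 3) → ℂ) → ℂ := fun x => ∏ i, L i x with hP
  have hLd : ∀ i x, DifferentiableAt ℂ (L i) x := fun i x => (LinearMap.toContinuousLinearMap (L i)).differentiableAt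
  have hPd : Differentiable ℂ P := fun x => diff_prod _ _ _ fun i => hLd i x
  have hPs : ∀ (c : ℂ) x, P (c • x) = c ^ (d - (n + 1)) * P x := by
    intro c x
    simp [hP, Finset.prod_mul_distrib]
  set c : (Fin (n + 1 + 3) → ℂ) → ℂ := fun x => (bigM q g F lam x)⁻¹ * P x with hc
  set h : (Fin (n + 1) → ℂ) → ℂ := fun y => if eval y f = 0 then 0 else ∑ x ∈ Φ y, c x with hh
  have hmemΦ : ∀ y ∈ D, ∀ x ∈ Φ y, x ≠ 0 ∧ eval x q = 0 ∧ eval x g = 0 ∧ eval x (F 0) ≠ 0 ∧ lam x = 1 := by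
    intro y hy x hx
    obtain ⟨m1, m2, m3, m4, m5⟩ := (G.mem y hy x).1 hx
    exact ⟨by rintro rfl; simp at m1, m2, m3, m4, m1⟩
  have hdiff : DifferentiableOn ℂ h D := by
    intro y0 hy0
    obtain ⟨U, hUo, hyU, hUD, v, hvd, hv⟩ := G.branched y0 hy0
    have h1 : DifferentiableAt ℂ (fun y => ∑ i, c (v i y)) y0 := by
      refine DifferentiableAt.fun_sum fun i _ => ?_
      have hx : v i y0 ∈ Φ y0 := by rw [(hv y0 hyU).2]; simp
      have h2 : DifferentiableAt ℂ c (v i y0) :=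
        ((bigM_diff _ (hmemΦ y0 hy0 _ hx).2.2.2.1).inv (G.bigM_ne hy0 hx)).mul (hPd _)
      exact h2.comp y0 ((hvd i).differentiableAt (hUo.mem_nhds hyU))
    refine (h1.congr_of_eventuallyEq ?_).differentiableWithinAt
    filter_upwards [hUo.mem_nhds hyU] with y hy
    have hy' : eval y f ≠ 0 := hUD hy
    simp only [hh, if_neg hy']
    rw [(hv y hy).2, Finset.sum_image fun i _ j _ h => (hv y hy).1 h]
  -- charts
  set KX : Set (Fin (n + 1 + 3) → ℂ) := Metric.sphere 0 1 ∩ ({x | eval x q = 0} ∩ {x | eval x g = 0}) with hKX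
  have hKc : IsCompact KX := (isCompact_sphere 0 1).inter_right
    ((isClosed_eq (contDiff_eval q).continuous continuous_const).inter
      (isClosed_eq (contDiff_eval g).continuous continuous_const))
  have hch := fun v0 : KX => exists_cone_chart (d := d) hX hq hg v0.1
    (fun h => by have := v0.2.1; rw [h] at this; simp at this) v0.2.2.1 v0.2.2.2
  choose κ w O ε C hOo hOv hε hκ hOs hOe hOC hOi using hch
  obtain ⟨T, hT⟩ := hKc.elim_finite_subcover O hOo (fun x hx => mem_iUnion.2 ⟨⟨x, hx⟩, hOv ⟨x, hx⟩⟩)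
  have hcov : ∀ x, x ≠ 0 → eval x q = 0 → eval x g = 0 → ∃ t ∈ T, x ∈ O t := by
    intro x hx h1 h2
    have hn : (‖x‖ : ℂ) ≠ 0 := by simpa using hx
    have : ((‖x‖ : ℂ))⁻¹ • x ∈ KX := by
      refine ⟨by simp [norm_smul, hx], ?_, ?_⟩
      · change eval _ q = 0; rw [homog_eval hq, h1, mul_zero]
      · change eval _ g = 0; rw [homog_eval hg, h2, mul_zero]
    obtain ⟨t, ht, hxt⟩ := mem_iUnion₂.1 (hT this)
    refine ⟨t, ht, ?_⟩
    have := hOs t _ hxt _ hn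
    rwa [smul_inv_smul₀ hn] at this
  set J : KX → (Fin (n + 1 + 3) → ℂ) → ℂ := fun t x =>
    κ t x ^ (d - (n + 1)) * chM q g (κ t) (w t) ((κ t x)⁻¹ • x) / bigM q g F lam x with hJ
  have hκc : ∀ t, Differentiable ℂ (κ t) := fun t => (LinearMap.toContinuousLinearMap (κ t)).differentiable
  have hwc : ∀ t j, Differentiable ℂ (w t j) := fun t j => (LinearMap.toContinuousLinearMap (w t j)).differentiable
  set GG : KX → (Fin (n + 1) → ℂ) → ENNReal := fun t y => ∑ x ∈ Φ y, (O t).indicator (fun x => ‖J t x‖ₑ ^ 2) x with hGG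
  have harea : ∀ t, ∫⁻ y in D, GG t y ≠ ⊤ := by
    intro t
    obtain ⟨R, hR⟩ := (isCompact_closedBall (0 : Fin (n + 1 + 3) → ℂ) (C t)).exists_bound_of_continuousOn
      (f := fun x => (fun j => w t j x : Fin (n + 1) → ℂ))
      (continuous_pi fun j => (hwc t j).continuous).continuousOn
    have := sheets_area D hDo Φ G.branched (O t) (hOo t) (fun x j => w t j x / κ t x) ?_ ?_
      (Metric.closedBall 0 R) ?_ (J t) ?_
    · exact ne_top_of_le_ne_top (isCompact_closedBall _ _).measure_lt_top.ne this
    · intro x hx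
      refine differentiableAt_pi.2 fun j => ?_
      simp only [div_eq_mul_inv]
      exact (hwc t j x).mul ((hκc t x).inv (hκ t x hx))
    · intro y hy y' hy' x hx x' hx' hxO hxO' he
      obtain ⟨a0, a1, a2, a3, a4⟩ := hmemΦ y hy x hx
      obtain ⟨b0, b1, b2, b3, b4⟩ := hmemΦ y' hy' x' hx'
      have h1 := hOi t x hxO x' hxO' a1 a2 b1 b2 he
      have h2 := congrArg lam h1
      rw [map_smul, map_smul, a4, b4] at h2
      simp at h2
      rw [h2] at h1
      have h3 : x = x' := by
        have := congrArg (fun z => κ t x' • z) h1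
        simpa [smul_inv_smul₀ (hκ t x' hxO')] using this
      refine ⟨?_, h3⟩
      subst h3
      have e1 := ((G.mem y hy x).1 hx).2.2.2.2
      have e2 := ((G.mem y' hy' x).1 hx').2.2.2.2
      ext j
      have := (e1 j).symm.trans (e2 j)
      exact mul_right_cancel₀ a3 this
    · intro y hy x hx hxO
      have h1 := hR ((κ t x)⁻¹ • x) (by simpa using hOC t x hxO)
      rw [mem_closedBall_zero_iff]
      convert h1 using 2
      ext j
      simp [div_eq_inv_mul]
    · intro U v hU hUD hvd hvm y hy hvO
      exact G.chart (by omega) hnd hq hg hF (κ t) (w t) hU hUD hvd hvm hy (hκ t _ hvO)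
  have hbd : ∀ t, ∃ A : ℝ, 0 ≤ A ∧ ∀ x ∈ O t, ‖c x‖ ≤ A * ‖J t x‖ := by
    intro t
    obtain ⟨R, hR⟩ := (isCompact_closedBall (0 : Fin (n + 1 + 3) → ℂ) (C t)).exists_bound_of_continuousOn
      (f := P) hPd.continuous.continuousOn
    refine ⟨|R| / ε t, div_nonneg (abs_nonneg _) (hε t).le, fun x hx => ?_⟩
    have hk := hκ t x hx
    have h1 : P x = κ t x ^ (d - (n + 1)) * P ((κ t x)⁻¹ • x) := by
      rw [← hPs, smul_inv_smul₀ hk]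
    have h2 := hR ((κ t x)⁻¹ • x) (by simpa using hOC t x hx)
    have h3 := hOe t x hx
    have h4 : ‖c x‖ = ‖κ t x ^ (d - (n + 1)) / bigM q g F lam x‖ * ‖P ((κ t x)⁻¹ • x)‖ := by
      rw [← norm_mul]; congr 1; simp only [hc]; rw [h1]; ring
    have h5 : ‖J t x‖ = ‖κ t x ^ (d - (n + 1)) / bigM q g F lam x‖ * ‖chM q g (κ t) (w t) ((κ t x)⁻¹ • x)‖ := by
      rw [← norm_mul]; congr 1; simp only [hJ]; ring
    rw [h4, h5, mul_left_comm]
    refine mul_le_mul_of_nonneg_left ?_ (norm_nonneg _)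
    calc _ ≤ |R| := h2.trans (le_abs_self R)
      _ = |R| / ε t * ε t := by field_simp [(hε t).ne']
      _ ≤ _ := mul_le_mul_of_nonneg_left h3 (div_nonneg (abs_nonneg _) (hε t).le)
  choose A hA0 hA using hbd
  have hpt : ∀ y ∈ D, ‖h y‖ₑ ^ 2 ≤ ∑ t ∈ T, ENNReal.ofReal (δ * A t ^ 2) * GG t y := by
    intro y hy
    have hy' : eval y f ≠ 0 := hy
    have h1 : ‖h y‖ ^ 2 ≤ δ * ∑ x ∈ Φ y, ‖c x‖ ^ 2 := by
      simp only [hh, if_neg hy']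
      calc ‖∑ x ∈ Φ y, c x‖ ^ 2 ≤ (∑ x ∈ Φ y, ‖c x‖) ^ 2 := by gcongr; exact norm_sum_le _ _
        _ ≤ _ := by
          have := sq_sum_le_card_mul_sum_sq (s := Φ y) (f := fun x => ‖c x‖)
          rwa [G.card y hy'] at this
    have h2 : ∀ x ∈ Φ y, ‖c x‖ ^ 2 ≤ ∑ t ∈ T, A t ^ 2 * (O t).indicator (fun x => ‖J t x‖ ^ 2) x := by
      intro x hx
      obtain ⟨a0, a1, a2, a3, a4⟩ := hmemΦ y hy x hx
      obtain ⟨t, ht, hxt⟩ := hcov x a0 a1 a2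
      have h3 : ‖c x‖ ^ 2 ≤ A t ^ 2 * (O t).indicator (fun x => ‖J t x‖ ^ 2) x := by
        rw [Set.indicator_of_mem hxt, ← mul_pow]
        gcongr
        exact hA t x hxt
      refine h3.trans (Finset.single_le_sum (f := fun t => A t ^ 2 * (O t).indicator (fun x => ‖J t x‖ ^ 2) x) (fun t _ => ?_) ht)
      exact mul_nonneg (sq_nonneg _) (Set.indicator_nonneg (fun _ _ => sq_nonneg _) _)
    have h3 : ‖h y‖ ^ 2 ≤ ∑ t ∈ T, (δ * A t ^ 2) * ∑ x ∈ Φ y, (O t).indicator (fun x => ‖J t x‖ ^ 2) x := by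
      refine h1.trans ((mul_le_mul_of_nonneg_left (Finset.sum_le_sum h2) (Nat.cast_nonneg _)).trans (le_of_eq ?_))
      rw [Finset.sum_comm, Finset.mul_sum]
      refine Finset.sum_congr rfl fun t _ => ?_
      rw [← Finset.mul_sum, mul_assoc]
    have h4 : ‖h y‖ₑ ^ 2 = ENNReal.ofReal (‖h y‖ ^ 2) := by
      rw [ENNReal.ofReal_pow (norm_nonneg _), ofReal_norm]
    rw [h4]
    refine (ENNReal.ofReal_le_ofReal h3).trans (le_of_eq ?_)
    have hnn : ∀ t x, 0 ≤ (O t).indicator (fun x => ‖J t x‖ ^ 2) x := fun t x =>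
      Set.indicator_nonneg (fun _ _ => sq_nonneg _) _
    rw [ENNReal.ofReal_sum_of_nonneg fun t _ => mul_nonneg (by positivity) (Finset.sum_nonneg fun x _ => hnn t x)]
    refine Finset.sum_congr rfl fun t _ => ?_
    rw [ENNReal.ofReal_mul (by positivity), ENNReal.ofReal_sum_of_nonneg fun x _ => hnn t x]
    congr 1
    refine Finset.sum_congr rfl fun x _ => ?_
    by_cases hx : x ∈ O t
    · rw [Set.indicator_of_mem hx, Set.indicator_of_mem hx, ENNReal.ofReal_pow (norm_nonneg _), ofReal_norm]
    · rw [Set.indicator_of_notMem hx, Set.indicator_of_notMem hx, ENNReal.ofReal_zero]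
  have hmeas : ∀ t, AEMeasurable (GG t) (volume.restrict D) := by
    intro t
    have h1 := G.meas (O t) (hOo t) (J t) (by
      intro y hy x hx hxO
      have h2 : ContinuousAt (bigM q g F lam) x := (bigM_diff _ (hmemΦ y hy x hx).2.2.2.1).continuousAt
      have h3 : ContinuousAt (κ t) x := (hκc t x).continuousAt
      refine ((h3.pow _).mul ?_).div h2 (G.bigM_ne hy hx)
      exact (chM_continuous q g (κ t) (w t)).continuousAt.comp ((h3.inv₀ (hκ t x hxO)).smul continuousAt_id))
    exact (aemeasurable_indicator_iff hDo.measurableSet).1 h1.aemeasurable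
  have hfin : ∫⁻ y, ‖h y‖ₑ ^ 2 ≠ ⊤ := by
    have h1 : ∫⁻ y, ‖h y‖ₑ ^ 2 = ∫⁻ y in D, ‖h y‖ₑ ^ 2 := by
      rw [← lintegral_indicator hDo.measurableSet]
      congr 1
      ext y
      by_cases hy : y ∈ D
      · rw [Set.indicator_of_mem hy]
      · rw [Set.indicator_of_notMem hy]
        have : eval y f = 0 := by simpa [hD] using hy
        simp [hh, this]
    rw [h1]
    refine ne_top_of_le_ne_top ?_ (setLIntegral_mono' hDo.measurableSet hpt)
    rw [lintegral_finsetSum' _ fun t _ => (hmeas t).const_mul _]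
    refine (ENNReal.sum_lt_top.2 fun t _ => ?_).ne
    rw [lintegral_const_mul' _ _ ENNReal.ofReal_ne_top]
    exact ENNReal.mul_lt_top ENNReal.ofReal_lt_top (harea t).lt_top
  have hz := l2_zero_n f h hdiff (fun y hy => by simp [hh, hy]) hfin y
  simp only [hh, if_neg hy] at hz
  exact hz
end
end

open MvPolynomial
noncomputable section

section
variable {A : Type} [CommRing A] [IsDomain A] [CharZero A]
  {K : Type} [Field K] [Algebra A K] [IsFractionRing A K]
open Polynomial in
theorem clear_den (P : K[X]) : ∃ (c : A) (Q : A[X]), c ≠ 0 ∧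
    Q.map (algebraMap A K) = Polynomial.C (algebraMap A K c) * P := by
  obtain ⟨b, hb, h⟩ := IsLocalization.integerNormalization_spec (nonZeroDivisors A) P
  refine ⟨b, _, nonZeroDivisors.ne_zero hb, h.trans ?_⟩
  rw [Algebra.smul_def]; rfl

open Polynomial in
theorem sqfree_relation_aux (K : Type) [Field K] [Algebra A K] [IsFractionRing A K] (G : A[X]) (hG : G ≠ 0) :
    ∃ (R S α β : A[X]) (c r : A) (k : ℕ), R ≠ 0 ∧ c ≠ 0 ∧ r ≠ 0 ∧ R ^ k * Polynomial.C c = G * S ∧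
      α * R + β * derivative R = Polynomial.C r := by
  classical
  have hinj : Function.Injective (Polynomial.map (algebraMap A K)) :=
    Polynomial.map_injective _ (IsFractionRing.injective A K)
  have hi0 : ∀ a : A, a ≠ 0 → algebraMap A K a ≠ 0 := fun a ha h =>
    ha ((IsFractionRing.injective A K) (by rw [h, map_zero]))
  set GK := G.map (algebraMap A K) with hGK
  have hGK0 : GK ≠ 0 := fun h => hG (hinj (by rw [← hGK, h, Polynomial.map_zero]))
  haveI : CharZero K := charZero_of_injective_algebraMap (IsFractionRing.injective A K)
  set R0 := UniqueFactorizationMonoid.radical GK with hR0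
  have hsq : Squarefree R0 := UniqueFactorizationMonoid.squarefree_radical
  obtain ⟨a, b, hab⟩ := PerfectField.separable_iff_squarefree.2 hsq
  obtain ⟨k, s, hs⟩ := UniqueFactorizationMonoid.exists_dvd_radical_self_pow hGK0
  obtain ⟨c1, R, hc1, hR⟩ := clear_den (A := A) R0
  obtain ⟨c2, S, hc2, hS⟩ := clear_den (A := A) s
  obtain ⟨c3, α, hc3, hα⟩ := clear_den (A := A) a
  obtain ⟨c4, β, hc4, hβ⟩ := clear_den (A := A) b
  have hR00 : R0 ≠ 0 := hsq.ne_zero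
  refine ⟨R, S * Polynomial.C (c1 ^ k), α * Polynomial.C c4, β * Polynomial.C c3, c2, c1 * c3 * c4, k, ?_, hc2,
    mul_ne_zero (mul_ne_zero hc1 hc3) hc4, hinj ?_, hinj ?_⟩
  · rintro rfl
    rw [Polynomial.map_zero] at hR
    have := mul_ne_zero (Polynomial.C_ne_zero.2 (hi0 c1 hc1)) hR00
    exact this hR.symm
  · simp only [Polynomial.map_mul, Polynomial.map_pow, Polynomial.map_C, hR, hS, ← hGK, map_pow]
    have : R0 ^ k = GK * s := hs
    rw [mul_pow, this]; ring
  · have hR' : (derivative R).map (algebraMap A K) = Polynomial.C (algebraMap A K c1) * derivative R0 := by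
      rw [← Polynomial.derivative_map, hR, Polynomial.derivative_C_mul]
    simp only [Polynomial.map_mul, Polynomial.map_add, Polynomial.map_C, hR, hα, hβ, hR', map_mul]
    linear_combination (Polynomial.C (algebraMap A K c1) * Polynomial.C (algebraMap A K c3) * Polynomial.C (algebraMap A K c4)) * hab

open Polynomial in
theorem sqfree_relation (G : A[X]) (hG : G ≠ 0) :
    ∃ (R S α β : A[X]) (c r : A) (k : ℕ), R ≠ 0 ∧ c ≠ 0 ∧ r ≠ 0 ∧ R ^ k * Polynomial.C c = G * S ∧
      α * R + β * derivative R = Polynomial.C r := sqfree_relation_aux (FractionRing A) G hG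
end

theorem poly_bound {σ : Type} [Fintype σ] (p : MvPolynomial σ ℂ) :
    ∃ (C : ℝ) (K : ℕ), 0 ≤ C ∧ ∀ y, ‖eval y p‖ ≤ C * (1 + ‖y‖) ^ K := by
  induction p using MvPolynomial.induction_on with
  | C a => exact ⟨‖a‖, 0, norm_nonneg _, fun y => by simp⟩
  | add p q hp hq =>
    obtain ⟨C1, K1, h1, hp⟩ := hp
    obtain ⟨C2, K2, h2, hq⟩ := hq
    refine ⟨C1 + C2, K1 + K2, by positivity, fun y => ?_⟩
    have e : (1:ℝ) ≤ 1 + ‖y‖ := by linarith [norm_nonneg y]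
    rw [map_add]
    refine (norm_add_le _ _).trans ((add_le_add (hp y) (hq y)).trans ?_)
    rw [add_mul]
    gcongr <;> omega
  | mul_X p i hp =>
    obtain ⟨C1, K1, h1, hp⟩ := hp
    refine ⟨C1, K1 + 1, h1, fun y => ?_⟩
    rw [map_mul, norm_mul, eval_X, pow_succ, ← mul_assoc]
    have : ‖y i‖ ≤ 1 + ‖y‖ := (norm_le_pi_norm y i).trans (by linarith)
    exact mul_le_mul (hp y) this (norm_nonneg _) (by positivity)

theorem root_bound (P : Polynomial ℂ) (t : ℂ) (h : P.eval t = 0) :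
    ‖P.leadingCoeff‖ * ‖t‖ ≤ ∑ i ∈ Finset.range (P.natDegree + 1), ‖P.coeff i‖ := by
  have hlc : ‖P.leadingCoeff‖ ≤ ∑ i ∈ Finset.range (P.natDegree + 1), ‖P.coeff i‖ :=
    Finset.single_le_sum (f := fun i => ‖P.coeff i‖) (fun i _ => norm_nonneg _) (Finset.mem_range.2 (Nat.lt_succ_self _))
  rcases le_total ‖t‖ 1 with ht | ht
  · calc _ ≤ ‖P.leadingCoeff‖ * 1 := by gcongr
      _ ≤ _ := by rwa [mul_one]
  · set m := P.natDegree with hm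
    rcases Nat.eq_zero_or_pos m with h0 | hpos
    · have : P.leadingCoeff = 0 := by
        rw [Polynomial.eq_C_of_natDegree_eq_zero (hm.symm.trans h0)] at h ⊢
        simpa using h
      rw [this]; simp; exact Finset.sum_nonneg fun i _ => norm_nonneg _
    · rw [Polynomial.eval_eq_sum_range, Finset.sum_range_succ, add_eq_zero_iff_eq_neg'] at h
      have h1 : ‖P.leadingCoeff‖ * ‖t‖ ^ m ≤ (∑ i ∈ Finset.range m, ‖P.coeff i‖) * ‖t‖ ^ (m - 1) := by
        have : ‖P.leadingCoeff‖ * ‖t‖ ^ m = ‖P.coeff P.natDegree * t ^ P.natDegree‖ := by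
          rw [norm_mul, norm_pow]; rfl
        rw [this, h, norm_neg, Finset.sum_mul]
        refine (norm_sum_le _ _).trans (Finset.sum_le_sum fun i hi => ?_)
        rw [norm_mul, norm_pow]
        have := Finset.mem_range.1 hi
        gcongr
        omega
      have h2 : ‖t‖ ^ m = ‖t‖ * ‖t‖ ^ (m - 1) := by rw [← pow_succ']; congr 1; omega
      rw [h2, ← mul_assoc] at h1
      have h3 := le_of_mul_le_mul_right h1 (by positivity)
      refine h3.trans (Finset.sum_le_sum_of_subset_of_nonneg (Finset.range_mono (by omega)) fun i _ _ => norm_nonneg _)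

theorem exists_eval_ne {σ : Type} {p : MvPolynomial σ ℂ} (h : p ≠ 0) : ∃ y, eval y p ≠ 0 := by
  by_contra hc
  push Not at hc
  exact h (MvPolynomial.funext fun y => by rw [hc y, map_zero])
end

open MvPolynomial
noncomputable section

/-- affine fibre condition -/
def Fib {n : ℕ} (q g : MvPolynomial (Fin (n + 3)) ℂ)
    (F : Fin (n + 1) → MvPolynomial (Fin (n + 3)) ℂ) (y : Fin n → ℂ) (v : Fin (n + 3) → ℂ) : Prop :=
  eval v q = 0 ∧ eval v g = 0 ∧ eval v (F 0) ≠ 0 ∧ ∀ j : Fin n, eval v (F j.succ) = y j * eval v (F 0)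

theorem Fib.smul {n d e a : ℕ} {q g : MvPolynomial (Fin (n + 3)) ℂ}
    {F : Fin (n + 1) → MvPolynomial (Fin (n + 3)) ℂ} (hq : q.IsHomogeneous a) (hg : g.IsHomogeneous d)
    (hF : ∀ j, (F j).IsHomogeneous e) {y : Fin n → ℂ} {v : Fin (n + 3) → ℂ} (h : Fib q g F y v) {c : ℂ} (hc : c ≠ 0) :
    Fib q g F y (c • v) := by
  obtain ⟨h1, h2, h3, h4⟩ := h
  refine ⟨by rw [homog_eval hq, h1, mul_zero], by rw [homog_eval hg, h2, mul_zero], ?_, fun j => ?_⟩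
  · rw [homog_eval (hF 0)]; exact mul_ne_zero (pow_ne_zero _ hc) h3
  · rw [homog_eval (hF _), homog_eval (hF _), h4]; ring

theorem eval_aeval {σ τ : Type} (y : τ → ℂ) (h : σ → MvPolynomial τ ℂ) (p : MvPolynomial σ ℂ) :
    eval y (aeval h p) = eval (fun i => eval y (h i)) p := by
  induction p using MvPolynomial.induction_on with
  | C a => simp
  | add p q hp hq => simp only [map_add, hp, hq]
  | mul_X p i hp => simp only [map_mul, hp, aeval_X, eval_X]

theorem dehom {n m : ℕ} {p : MvPolynomial (Fin (n + 1)) ℂ} (hp : p.IsHomogeneous m) (hp0 : p ≠ 0) :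
    ∃ f : MvPolynomial (Fin n) ℂ, f ≠ 0 ∧ ∀ y : Fin n → ℂ, eval y f = eval (Fin.cons 1 y : Fin (n + 1) → ℂ) p := by
  have key : ∀ y : Fin n → ℂ, eval y (aeval (Fin.cons 1 X : Fin (n + 1) → MvPolynomial (Fin n) ℂ) p)
      = eval (Fin.cons 1 y : Fin (n + 1) → ℂ) p := by
    intro y
    rw [eval_aeval]
    congr 2
    ext i
    refine Fin.cases ?_ (fun j => ?_) i <;> simp
  refine ⟨aeval (Fin.cons 1 X : Fin (n + 1) → MvPolynomial (Fin n) ℂ) p, ?_, key⟩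
  intro h0
  obtain ⟨v, hv⟩ := exists_eval_ne (mul_ne_zero hp0 (X_ne_zero (R := ℂ) (0 : Fin (n + 1))))
  rw [map_mul, eval_X] at hv
  have h1 := left_ne_zero_of_mul hv
  have h2 := right_ne_zero_of_mul hv
  have h3 : eval ((v 0)⁻¹ • v) p ≠ 0 := by
    rw [homog_eval hp]; exact mul_ne_zero (pow_ne_zero _ (inv_ne_zero h2)) h1
  have h4 : (v 0)⁻¹ • v = (Fin.cons 1 (fun j => (v 0)⁻¹ * v j.succ) : Fin (n + 1) → ℂ) := by
    ext i
    refine Fin.cases ?_ (fun j => ?_) i <;> simp [h2]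
  rw [h4, ← key, h0, map_zero] at h3
  exact h3 rfl

theorem fib_proj {n d δ : ℕ} {q g : MvPolynomial (Fin (n + 3)) ℂ} (hq : q.IsHomogeneous 3) (hg : g.IsHomogeneous d)
    (φ : RatMapTo (Fin (n + 3)) n) (hφ : φ.DominantOfDegree (ZeroSet q ∩ ZeroSet g) δ) :
    ∃ f : MvPolynomial (Fin n) ℂ, f ≠ 0 ∧ ∀ y, eval y f ≠ 0 →
      {x : PPt (Fin (n + 3)) | ∃ v, ∃ hv : v ≠ 0, Projectivization.mk ℂ v hv = x ∧ Fib q g φ.F y v}.Finite ∧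
      {x : PPt (Fin (n + 3)) | ∃ v, ∃ hv : v ≠ 0, Projectivization.mk ℂ v hv = x ∧ Fib q g φ.F y v}.ncard = δ := by
  obtain ⟨-, V, ⟨Y, ⟨fs, hfs, rfl⟩, hY, hYV⟩, hV⟩ := hφ
  obtain ⟨x0, -, hx0⟩ := Set.not_subset.1 hY
  have hx0' : ∃ p ∈ fs, ¬ PVanish p x0 := by
    by_contra hc; push Not at hc; exact hx0 hc
  obtain ⟨p, hp, hpx⟩ := hx0'
  obtain ⟨m, hm⟩ := hfs p hp
  have hp0 : p ≠ 0 := by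
    rintro rfl; exact hpx fun v hv _ => by simp
  obtain ⟨f, hf0, hf⟩ := dehom hm hp0
  refine ⟨f, hf0, fun y hy => ?_⟩
  have hne : (Fin.cons 1 y : Fin (n + 1) → ℂ) ≠ 0 := fun h => by
    have := congrFun h 0; simp at this
  have hy1 : Projectivization.mk ℂ _ hne ∈ V := by
    refine hYV ⟨trivial, fun hmem => hy ?_⟩
    rw [hf]
    exact hmem p hp _ hne rfl
  have hset : {x : PPt (Fin (n + 3)) | ∃ v, ∃ hv : v ≠ 0, Projectivization.mk ℂ v hv = x ∧ Fib q g φ.F y v}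
      = φ.fiber (ZeroSet q ∩ ZeroSet g) (Projectivization.mk ℂ _ hne) := by
    ext x
    constructor
    · rintro ⟨v, hv, rfl, hF⟩
      have key : ∀ (v' : Fin (n + 3) → ℂ) (hv' : v' ≠ 0), Projectivization.mk ℂ v' hv' = Projectivization.mk ℂ v hv →
          Fib q g φ.F y v' := by
        intro v' hv' he
        obtain ⟨c, hc⟩ := (Projectivization.mk_eq_mk_iff' ℂ v' v hv' hv).1 he
        rw [← hc]
        refine hF.smul hq hg φ.homog ?_
        rintro rfl
        simp at hc; exact hv' hc.symm
      refine ⟨⟨fun v' hv' he => (key v' hv' he).1, fun v' hv' he => (key v' hv' he).2.1⟩, fun v' hv' he => ?_⟩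
      obtain ⟨k1, k2, k3, k4⟩ := key v' hv' he
      refine ⟨fun h => k3 (congrFun h 0), ?_⟩
      rw [Projectivization.mk_eq_mk_iff']
      refine ⟨eval v' (φ.F 0), ?_⟩
      ext i
      refine Fin.cases ?_ (fun j => ?_) i
      · simp [RatMapTo.evalVec]
      · simp [RatMapTo.evalVec, k4, mul_comm]
    · rintro ⟨⟨h1, h2⟩, h3⟩
      induction x using Projectivization.ind with
      | h v hv =>
        refine ⟨v, hv, rfl, h1 v hv rfl, h2 v hv rfl, ?_⟩
        obtain ⟨hw, he⟩ := h3 v hv rfl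
        obtain ⟨c, hc⟩ := (Projectivization.mk_eq_mk_iff' ℂ _ _ _ _).1 he
        have e0 : c = eval v (φ.F 0) := by
          have := congrFun hc 0; simpa [RatMapTo.evalVec] using this
        have e1 : ∀ j : Fin n, c * y j = eval v (φ.F j.succ) := fun j => by
          have := congrFun hc j.succ; simpa [RatMapTo.evalVec] using this
        refine ⟨fun h => hw ?_, fun j => ?_⟩
        · rw [← hc, e0, h, zero_smul]
        · rw [← e1, e0, mul_comm]
  rw [hset]
  exact hV _ hy1
end

open MvPolynomial
noncomputable section

theorem dichotomy_ne {σ τ : Type} [Finite σ] [Finite τ] (P : Set (MvPolynomial (σ ⊕ τ) ℂ)) (h : MvPolynomial (σ ⊕ τ) ℂ) :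
    ∃ f : MvPolynomial σ ℂ, f ≠ 0 ∧
      ((∀ y, (∃ x : τ → ℂ, (∀ p ∈ P, eval (Sum.elim y x) p = 0) ∧ eval (Sum.elim y x) h ≠ 0) → eval y f = 0) ∨
       (∀ y, eval y f ≠ 0 → ∃ x : τ → ℂ, (∀ p ∈ P, eval (Sum.elim y x) p = 0) ∧ eval (Sum.elim y x) h ≠ 0)) := by
  let r : σ ⊕ τ → σ ⊕ (τ ⊕ Unit) := Sum.map id Sum.inl
  have hr : ∀ (y : σ → ℂ) (x : τ ⊕ Unit → ℂ) p, eval (Sum.elim y x) (rename r p) = eval (Sum.elim y (x ∘ Sum.inl)) p := by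
    intro y x p
    rw [eval_rename]
    congr 2
    ext i; rcases i with i | i <;> rfl
  let P' : Set (MvPolynomial (σ ⊕ (τ ⊕ Unit)) ℂ) :=
    insert (X (Sum.inr (Sum.inr ())) * rename r h - 1) ((rename r) '' P)
  have key : ∀ y : σ → ℂ, (∃ x, ∀ p ∈ P', eval (Sum.elim y x) p = 0) ↔
      ∃ x : τ → ℂ, (∀ p ∈ P, eval (Sum.elim y x) p = 0) ∧ eval (Sum.elim y x) h ≠ 0 := by
    intro y
    constructor
    · rintro ⟨x, hx⟩
      refine ⟨x ∘ Sum.inl, fun p hp => ?_, fun h0 => ?_⟩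
      · rw [← hr]; exact hx _ (Or.inr ⟨p, hp, rfl⟩)
      · have := hx _ (Or.inl rfl)
        rw [map_sub, map_mul, hr, h0] at this
        simp at this
    · rintro ⟨x, hx, h0⟩
      refine ⟨Sum.elim x (fun _ => (eval (Sum.elim y x) h)⁻¹), ?_⟩
      rintro p (rfl | ⟨p, hp, rfl⟩)
      · rw [map_sub, map_mul, hr, Sum.elim_comp_inl]
        simp [h0]
      · rw [hr, Sum.elim_comp_inl]; exact hx p hp
  obtain ⟨f, hf, hd⟩ := dichotomy P'
  refine ⟨f, hf, ?_⟩
  simpa only [key] using hd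

/-- polynomial of a linear form -/
def linP {σ : Type} [Fintype σ] [DecidableEq σ] (l : (σ → ℂ) →ₗ[ℂ] ℂ) : MvPolynomial σ ℂ := ∑ i, C (l (Pi.single i 1)) * X i

theorem eval_linP {σ : Type} [Fintype σ] [DecidableEq σ] (l : (σ → ℂ) →ₗ[ℂ] ℂ) (v : σ → ℂ) : eval v (linP l) = l v := by
  unfold linP
  rw [map_sum]
  conv_rhs => rw [pi_eq_sum_univ v, map_sum]
  refine Finset.sum_congr rfl fun i _ => ?_
  rw [map_smul, smul_eq_mul, mul_comm]
  simp only [map_mul, eval_C, eval_X]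
  congr 2
  ext j
  simp [Pi.single_apply, eq_comm]

/-- fibre equations with parameters in `σ` containing `y` through `ι` -/
def fibP {n : ℕ} {σ : Type} (ι : Fin n → σ) (q g : MvPolynomial (Fin (n + 3)) ℂ)
    (F : Fin (n + 1) → MvPolynomial (Fin (n + 3)) ℂ) : Set (MvPolynomial (σ ⊕ Fin (n + 3)) ℂ) :=
  {rename Sum.inr q, rename Sum.inr g} ∪ Set.range fun j : Fin n =>
    rename Sum.inr (F j.succ) - X (Sum.inl (ι j)) * rename Sum.inr (F 0)

theorem fibP_iff {n : ℕ} {σ : Type} (ι : Fin n → σ) (q g : MvPolynomial (Fin (n + 3)) ℂ)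
    (F : Fin (n + 1) → MvPolynomial (Fin (n + 3)) ℂ) (s : σ → ℂ) (x : Fin (n + 3) → ℂ) :
    (∀ p ∈ fibP ι q g F, eval (Sum.elim s x) p = 0) ∧ eval (Sum.elim s x) (rename Sum.inr (F 0)) ≠ 0
      ↔ Fib q g F (s ∘ ι) x := by
  have hr : ∀ p, eval (Sum.elim s x) (rename Sum.inr p) = eval x p := by
    intro p; rw [eval_rename, Sum.elim_comp_inr]
  constructor
  · rintro ⟨h1, h2⟩
    refine ⟨?_, ?_, ?_, fun j => ?_⟩
    · rw [← hr]; exact h1 _ (Or.inl (Or.inl rfl))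
    · rw [← hr]; exact h1 _ (Or.inl (Or.inr rfl))
    · rwa [hr] at h2
    · have := h1 _ (Or.inr ⟨j, rfl⟩)
      simp only [map_sub, map_mul, hr, eval_X, Sum.elim_inl] at this
      exact sub_eq_zero.1 this
  · rintro ⟨h1, h2, h3, h4⟩
    refine ⟨?_, by rwa [hr]⟩
    rintro p ((rfl | rfl) | ⟨j, rfl⟩)
    · rwa [hr]
    · rwa [hr]
    · simp only [map_sub, map_mul, hr, eval_X, Sum.elim_inl, h4]; simp

/-- moment forms -/
def mom (N : ℕ) (m : ℕ) : (Fin N → ℂ) →ₗ[ℂ] ℂ := ∑ i : Fin N, ((m : ℂ) ^ (i : ℕ)) • LinearMap.proj i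

theorem mom_apply (N m : ℕ) (v : Fin N → ℂ) : mom N m v = ∑ i : Fin N, (m : ℂ) ^ (i : ℕ) * v i := by
  simp [mom, LinearMap.sum_apply]

theorem mom_zeros {N : ℕ} (v : Fin N → ℂ) (hv : v ≠ 0) (S : Finset ℕ) (hS : ∀ m ∈ S, mom N m v = 0) : S.card < N := by
  by_contra hc
  push Not at hc
  obtain ⟨S', hS', hcard⟩ := Finset.exists_subset_card_eq hc
  apply hv
  let e := S'.equivFinOfCardEq hcard
  refine Matrix.eq_zero_of_mulVec_eq_zero (M := Matrix.vandermonde fun i => (((e.symm i : ℕ)) : ℂ)) ?_ ?_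
  · rw [Matrix.det_vandermonde_ne_zero_iff]
    intro a b h
    have h' : (((e.symm a : ℕ)) : ℂ) = ((e.symm b : ℕ) : ℂ) := h
    exact e.symm.injective (Subtype.ext (Nat.cast_injective h'))
  · ext i
    have := hS _ (hS' (e.symm i).2)
    rw [mom_apply] at this
    simpa [Matrix.mulVec, dotProduct, Matrix.vandermonde_apply] using this
end

open MvPolynomial
noncomputable section

theorem exists_two {n : ℕ} (hn : 0 < n) (f : MvPolynomial (Fin n) ℂ) (hf : f ≠ 0) :
    ∃ y y', eval y f ≠ 0 ∧ eval y' f ≠ 0 ∧ y ≠ y' := by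
  obtain ⟨y, hy⟩ := exists_eval_ne hf
  have h2 : (X (⟨0, hn⟩ : Fin n) - C (y ⟨0, hn⟩) : MvPolynomial (Fin n) ℂ) ≠ 0 := by
    intro h
    have := congrArg (eval (fun _ => y ⟨0, hn⟩ + 1)) h
    simp at this
  obtain ⟨y', hy'⟩ := exists_eval_ne (mul_ne_zero hf h2)
  rw [map_mul] at hy'
  refine ⟨y, y', hy, left_ne_zero_of_mul hy', ?_⟩
  rintro rfl
  exact right_ne_zero_of_mul hy' (by simp)

theorem e_pos {n d δ : ℕ} (hn : 0 < n) {q g : MvPolynomial (Fin (n + 3)) ℂ} (hq : q.IsHomogeneous 3) (hg : g.IsHomogeneous d)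
    (φ : RatMapTo (Fin (n + 3)) n) (hφ : φ.DominantOfDegree (ZeroSet q ∩ ZeroSet g) δ) : φ.e ≠ 0 := by
  intro he
  obtain ⟨f, hf, hf'⟩ := fib_proj hq hg φ hφ
  obtain ⟨y, y', hy, hy', hne⟩ := exists_two hn f hf
  have hex : ∀ y, eval y f ≠ 0 → ∃ v, Fib q g φ.F y v := by
    intro y hy
    obtain ⟨h1, h2⟩ := hf' y hy
    have := Set.nonempty_of_ncard_ne_zero (h2.symm ▸ hφ.1.ne')
    obtain ⟨x, v, hv, -, h⟩ := this
    exact ⟨v, h⟩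
  obtain ⟨v, hv⟩ := hex y hy
  obtain ⟨v', hv'⟩ := hex y' hy'
  have hc : ∀ j (w : Fin (n + 3) → ℂ), eval w (φ.F j) = eval 0 (φ.F j) := by
    intro j w
    have h := homog_eval (φ.homog j) 0 w
    rw [he] at h
    simpa using h.symm
  apply hne
  ext j
  have h1 := hv.2.2.2 j
  have h2 := hv'.2.2.2 j
  have h3 := hv.2.2.1
  rw [hc, hc 0] at h1 h2
  rw [hc] at h3
  rw [h1] at h2
  exact mul_right_cancel₀ h3 h2

theorem exists_lam {n d δ : ℕ} (hn : 0 < n) {q g : MvPolynomial (Fin (n + 3)) ℂ} (hq : q.IsHomogeneous 3) (hg : g.IsHomogeneous d)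
    (φ : RatMapTo (Fin (n + 3)) n) (hφ : φ.DominantOfDegree (ZeroSet q ∩ ZeroSet g) δ) :
    ∃ (lam : (Fin (n + 3) → ℂ) →ₗ[ℂ] ℂ) (f : MvPolynomial (Fin n) ℂ), f ≠ 0 ∧ ∀ y, eval y f ≠ 0 →
      {v | lam v = 1 ∧ Fib q g φ.F y v}.Finite ∧ {v | lam v = 1 ∧ Fib q g φ.F y v}.ncard = δ := by
  have he := e_pos hn hq hg φ hφ
  have hv0 : ∀ {y v}, Fib q g φ.F y v → v ≠ 0 := by
    rintro y v h rfl
    apply h.2.2.1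
    have := homog_eval (φ.homog 0) 0 0
    simpa [he] using this
  obtain ⟨f0, hf0, hf0'⟩ := fib_proj hq hg φ hφ
  have hdich : ∀ m : ℕ, ∃ f : MvPolynomial (Fin n) ℂ, f ≠ 0 ∧
      ((∀ y, (∃ x, Fib q g φ.F y x ∧ mom (n + 3) m x = 0) → eval y f = 0) ∨
       (∀ y, eval y f ≠ 0 → ∃ x, Fib q g φ.F y x ∧ mom (n + 3) m x = 0)) := by
    intro m
    obtain ⟨f, hf, h⟩ := dichotomy_ne (insert (rename Sum.inr (linP (mom (n + 3) m))) (fibP (id : Fin n → Fin n) q g φ.F))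
      (rename Sum.inr (φ.F 0))
    have key : ∀ (y : Fin n → ℂ) (x : Fin (n + 3) → ℂ), ((∀ p ∈ insert (rename Sum.inr (linP (mom (n + 3) m))) (fibP (id : Fin n → Fin n) q g φ.F),
        eval (Sum.elim y x) p = 0) ∧ eval (Sum.elim y x) (rename Sum.inr (φ.F 0)) ≠ 0) ↔
        Fib q g φ.F y x ∧ mom (n + 3) m x = 0 := by
      intro y x
      have h1 := fibP_iff (id : Fin n → Fin n) q g φ.F y x
      rw [Function.comp_id] at h1
      rw [← h1, Set.forall_mem_insert, eval_rename, Sum.elim_comp_inr, eval_linP]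
      tauto
    refine ⟨f, hf, ?_⟩
    simpa only [key] using h
  choose fm hfm hd using hdich
  by_cases hgood : ∃ m, ∀ y, (∃ x, Fib q g φ.F y x ∧ mom (n + 3) m x = 0) → eval y (fm m) = 0
  · obtain ⟨m, hm⟩ := hgood
    refine ⟨mom (n + 3) m, f0 * fm m, mul_ne_zero hf0 (hfm m), fun y hy => ?_⟩
    rw [map_mul] at hy
    obtain ⟨h1, h2⟩ := hf0' y (left_ne_zero_of_mul hy)
    have hlam : ∀ v, Fib q g φ.F y v → mom (n + 3) m v ≠ 0 := fun v hv h =>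
      right_ne_zero_of_mul hy (hm y ⟨v, hv, h⟩)
    set l := mom (n + 3) m with hl
    set P := {x : PPt (Fin (n + 3)) | ∃ v, ∃ hv : v ≠ 0, Projectivization.mk ℂ v hv = x ∧ Fib q g φ.F y v} with hP
    let r : PPt (Fin (n + 3)) → (Fin (n + 3) → ℂ) := fun x => (l x.rep)⁻¹ • x.rep
    have hrep : ∀ x ∈ P, Fib q g φ.F y x.rep := by
      rintro x ⟨v, hv, rfl, hF⟩
      obtain ⟨a, ha⟩ := Projectivization.exists_smul_eq_mk_rep ℂ v hv
      rw [← ha]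
      exact hF.smul hq hg φ.homog a.ne_zero
    have himg : {v | l v = 1 ∧ Fib q g φ.F y v} = r '' P := by
      ext v
      constructor
      · rintro ⟨h3, h4⟩
        refine ⟨Projectivization.mk ℂ v (hv0 h4), ⟨v, hv0 h4, rfl, h4⟩, ?_⟩
        obtain ⟨a, ha⟩ := Projectivization.exists_smul_eq_mk_rep ℂ v (hv0 h4)
        change (l _)⁻¹ • _ = v
        rw [← ha]
        change (l ((a : ℂ) • v))⁻¹ • ((a : ℂ) • v) = v
        rw [map_smul, h3, smul_smul, smul_eq_mul, mul_one, inv_mul_cancel₀ a.ne_zero, one_smul]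
      · rintro ⟨x, hx, rfl⟩
        have h3 := hlam _ (hrep x hx)
        refine ⟨?_, (hrep x hx).smul hq hg φ.homog (inv_ne_zero h3)⟩
        change l ((l x.rep)⁻¹ • x.rep) = 1
        rw [map_smul, smul_eq_mul, inv_mul_cancel₀ h3]
    have hinj : Set.InjOn r P := by
      intro x hx x' hx' h
      have h3 := hlam _ (hrep x hx)
      have h3' := hlam _ (hrep x' hx')
      rw [← x.mk_rep, ← x'.mk_rep, Projectivization.mk_eq_mk_iff']
      refine ⟨l x.rep * (l x'.rep)⁻¹, ?_⟩
      rw [mul_smul]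
      change l x.rep • r x' = _
      rw [← h]
      change l x.rep • ((l x.rep)⁻¹ • x.rep) = _
      rw [smul_smul, mul_inv_cancel₀ h3, one_smul]
    rw [himg]
    exact ⟨h1.image r, by rw [hinj.ncard_image, h2]⟩
  · exfalso
    push Not at hgood
    have hd' : ∀ m y, eval y (fm m) ≠ 0 → ∃ x, Fib q g φ.F y x ∧ mom (n + 3) m x = 0 := by
      intro m
      rcases hd m with h | h
      · obtain ⟨y, h1, h2⟩ := hgood m
        exact absurd (h y h1) h2
      · exact h
    set M := δ * (n + 2) + 1 with hM
    obtain ⟨y, hy⟩ := exists_eval_ne (mul_ne_zero hf0 (Finset.prod_ne_zero_iff.2 fun m (_ : m ∈ Finset.range M) => hfm m))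
    rw [map_mul, map_prod] at hy
    obtain ⟨h1, h2⟩ := hf0' y (left_ne_zero_of_mul hy)
    have h3 := Finset.prod_ne_zero_iff.1 (right_ne_zero_of_mul hy)
    have h4 : ∀ m : ℕ, ∃ x : PPt (Fin (n + 3)), m ∈ Finset.range M → (∃ v, ∃ hv : v ≠ 0, Projectivization.mk ℂ v hv = x ∧ Fib q g φ.F y v) ∧
        mom (n + 3) m x.rep = 0 := by
      intro m
      by_cases hm : m ∈ Finset.range M
      · obtain ⟨v, hv, hl⟩ := hd' m y (h3 m hm)
        refine ⟨Projectivization.mk ℂ v (hv0 hv), fun _ => ⟨⟨v, hv0 hv, rfl, hv⟩, ?_⟩⟩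
        obtain ⟨a, ha⟩ := Projectivization.exists_smul_eq_mk_rep ℂ v (hv0 hv)
        rw [← ha]
        change mom (n + 3) m ((a : ℂ) • v) = 0
        rw [map_smul, hl, smul_zero]
      · exact ⟨Projectivization.mk ℂ 1 (fun h => by have := congrFun h 0; simp at this), fun h => absurd h hm⟩
    classical
    choose X hX using h4
    have hpig := Finset.exists_lt_card_fiber_of_mul_lt_card_of_maps_to (s := Finset.range M) (t := h1.toFinset) (f := X)
      (n := n + 2) (fun m hm => by rw [Set.Finite.mem_toFinset]; exact (hX m hm).1)
      (by rw [← Set.ncard_eq_toFinset_card _ h1, h2, Finset.card_range]; omega)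
    obtain ⟨x, -, hx⟩ := hpig
    have := mom_zeros x.rep x.rep_nonzero (Finset.filter (fun m => X m = x) (Finset.range M)) (by
      intro m hm
      rw [Finset.mem_filter] at hm
      rw [← hm.2]
      exact (hX m hm.1).2)
    omega
end

open MvPolynomial
noncomputable section

theorem exists_G {n : ℕ} {q g : MvPolynomial (Fin (n + 3)) ℂ} {F : Fin (n + 1) → MvPolynomial (Fin (n + 3)) ℂ}
    (lam : (Fin (n + 3) → ℂ) →ₗ[ℂ] ℂ) (f : MvPolynomial (Fin n) ℂ) (hf : f ≠ 0)
    (hfin : ∀ y, eval y f ≠ 0 → {v | lam v = 1 ∧ Fib q g F y v}.Finite) (k : Fin (n + 3)) :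
    ∃ G : Polynomial (MvPolynomial (Fin n) ℂ), G ≠ 0 ∧ ∀ y v, lam v = 1 → Fib q g F y v →
      (G.map (eval y)).eval (v k) = 0 := by
  let P : Set (MvPolynomial (Fin (n + 1) ⊕ Fin (n + 3)) ℂ) :=
    insert (rename Sum.inr (linP lam) - 1) (insert (X (Sum.inr k) - X (Sum.inl 0)) (fibP (Fin.succ : Fin n → Fin (n + 1)) q g F))
  have key : ∀ (s : Fin (n + 1) → ℂ) (x : Fin (n + 3) → ℂ), ((∀ p ∈ P, eval (Sum.elim s x) p = 0) ∧
      eval (Sum.elim s x) (rename Sum.inr (F 0)) ≠ 0) ↔ lam x = 1 ∧ x k = s 0 ∧ Fib q g F (s ∘ Fin.succ) x := by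
    intro s x
    rw [← fibP_iff Fin.succ q g F s x, Set.forall_mem_insert, Set.forall_mem_insert, map_sub, map_sub, eval_rename,
      Sum.elim_comp_inr, eval_linP, sub_eq_zero, sub_eq_zero]
    simp only [map_one, eval_X, Sum.elim_inl, Sum.elim_inr]
    tauto
  obtain ⟨h, hh, hd⟩ := dichotomy_ne P (rename Sum.inr (F 0))
  simp only [key] at hd
  rcases hd with hd | hd
  · refine ⟨finSuccEquiv ℂ n h, by simpa using hh, fun y v h1 h2 => ?_⟩
    rw [← eval_eq_eval_mv_eval']
    exact hd _ ⟨v, h1, by simp, h2⟩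
  · exfalso
    have hf' : rename (Fin.succ : Fin n → Fin (n + 1)) f ≠ 0 := by
      rw [Ne, rename_eq_zero_iff_of_injective]
      · exact hf
      · exact Fin.succ_injective n
    obtain ⟨s, hs⟩ := exists_eval_ne (mul_ne_zero hh hf')
    rw [map_mul, eval_rename] at hs
    have h1 := left_ne_zero_of_mul hs
    have h2 := hfin _ (right_ne_zero_of_mul hs)
    set y := s ∘ Fin.succ with hy
    have hs' : s = Fin.cons (s 0) y := (Fin.cons_self_tail s).symm
    set p := Polynomial.map (eval y) (finSuccEquiv ℂ n h) with hp
    have hp0 : p ≠ 0 := by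
      intro h0
      apply h1
      rw [hs', eval_eq_eval_mv_eval', ← hp, h0, Polynomial.eval_zero]
    have hsub : (Set.univ : Set ℂ) ⊆ {t | p.IsRoot t} ∪ (fun v : Fin (n + 3) → ℂ => v k) '' {v | lam v = 1 ∧ Fib q g F y v} := by
      intro t _
      by_cases ht : p.eval t = 0
      · exact Or.inl ht
      · right
        have := hd (Fin.cons t y) (by rw [eval_eq_eval_mv_eval']; exact ht)
        obtain ⟨x, h3, h4, h5⟩ := this
        refine ⟨x, ⟨h3, h5⟩, by simpa using h4⟩
    exact Set.infinite_univ (((p.finite_setOfPred_isRoot hp0).union (h2.image _)).subset hsub)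
end

open MvPolynomial
noncomputable section

theorem hasDerivAt_R {n : ℕ} (R : Polynomial (MvPolynomial (Fin n) ℂ)) {Y : ℂ → Fin n → ℂ} {T : ℂ → ℂ} {τ s0 : ℂ}
    (hY : HasDerivAt Y 0 s0) (hT : HasDerivAt T τ s0) :
    HasDerivAt (fun s => (R.map (eval (Y s))).eval (T s)) ((R.derivative.map (eval (Y s0))).eval (T s0) * τ) s0 := by
  induction R using Polynomial.induction_on' with
  | add p q hp hq =>
    simp only [Polynomial.map_add, Polynomial.eval_add, Polynomial.derivative_add, add_mul]
    exact hp.add hq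
  | monomial m a =>
    simp only [Polynomial.map_monomial, Polynomial.eval_monomial, Polynomial.derivative_monomial, map_mul, map_natCast]
    have h1 : HasDerivAt (fun s => eval (Y s) a) 0 s0 := by
      have := (hasFDerivAt_eval a (Y s0)).comp_hasDerivAt s0 hY
      rw [map_zero] at this
      exact this
    have := h1.mul (hT.pow m)
    refine this.congr_deriv ?_
    simp; ring

theorem exists_curve {n d : ℕ} {q g : MvPolynomial (Fin (n + 3)) ℂ} (hX : IsSmoothCI2 q g)
    (hq : q.IsHomogeneous 3) (hg : g.IsHomogeneous d) (lam : (Fin (n + 3) → ℂ) →ₗ[ℂ] ℂ)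
    (x ξ : Fin (n + 3) → ℂ) (h1 : lam x = 1) (hq0 : eval x q = 0) (hg0 : eval x g = 0)
    (h2 : lam ξ = 0) (h3 : dlin q x ξ = 0) (h4 : dlin g x ξ = 0) :
    ∃ γ : ℂ → Fin (n + 3) → ℂ, γ 0 = x ∧ HasDerivAt γ ξ 0 ∧ ∀ᶠ s in nhds 0, lam (γ s) = 1 ∧ eval (γ s) q = 0 ∧ eval (γ s) g = 0 := by
  obtain ⟨w, hw⟩ := exists_w hX hq hg lam x (by rw [h1]; exact one_ne_zero) hq0 hg0
  obtain ⟨L, hL, hst⟩ := Th_equiv q g lam w x hw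
  let l : ℂ → ℂ × ℂ × ℂ × (Fin n → ℂ) := fun s => Th q g lam w x + s • L ξ
  have hl0 : l 0 = Th q g lam w x := by simp [l]
  have hl : HasDerivAt l (L ξ) 0 := by
    have := ((hasDerivAt_id (0 : ℂ)).smul_const (L ξ)).const_add (Th q g lam w x)
    rw [one_smul] at this
    exact this
  refine ⟨fun s => hst.localInverse _ _ _ (l s), ?_, ?_, ?_⟩
  · beta_reduce; rw [hl0]; exact hst.localInverse_apply_image
  · have h5 := hst.to_localInverse.hasFDerivAt
    rw [← hl0] at h5
    have := h5.comp_hasDerivAt 0 hl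
    rw [ContinuousLinearEquiv.coe_coe, L.symm_apply_apply] at this
    exact this
  · have h5 := hst.eventually_right_inverse
    rw [← hl0] at h5
    filter_upwards [hl.continuousAt.eventually h5] with s hs
    have e : ∀ z, Th q g lam w z = l s → lam z = 1 ∧ eval z q = 0 ∧ eval z g = 0 := by
      intro z hz
      simp only [l, Th, hL, h2, h3, h4, h1, hq0, hg0, Prod.smul_mk, Prod.mk_add_mk, smul_zero, add_zero, Prod.mk.injEq] at hz
      exact ⟨hz.1, hz.2.1, hz.2.2.1⟩
    exact e _ hs

theorem exists_R {n : ℕ} {q g : MvPolynomial (Fin (n + 3)) ℂ} {F : Fin (n + 1) → MvPolynomial (Fin (n + 3)) ℂ}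
    (lam : (Fin (n + 3) → ℂ) →ₗ[ℂ] ℂ) (f : MvPolynomial (Fin n) ℂ) (hf : f ≠ 0)
    (hfin : ∀ y, eval y f ≠ 0 → {v | lam v = 1 ∧ Fib q g F y v}.Finite) (k : Fin (n + 3)) :
    ∃ (R : Polynomial (MvPolynomial (Fin n) ℂ)) (c : MvPolynomial (Fin n) ℂ), R ≠ 0 ∧ c ≠ 0 ∧
      (∀ y, eval y c ≠ 0 → ∀ v, lam v = 1 → Fib q g F y v → (R.map (eval y)).eval (v k) = 0 ∧
      (R.derivative.map (eval y)).eval (v k) ≠ 0) := by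
  obtain ⟨G, hG, hG'⟩ := exists_G lam f hf hfin k
  obtain ⟨R, S, α, β, c, r, m, hR, hc, hr, h1, h2⟩ := sqfree_relation G hG
  refine ⟨R, c * r, hR, mul_ne_zero hc hr, fun y hy v hv hF => ?_⟩
  rw [map_mul] at hy
  have h3 := congrArg (fun p => (Polynomial.map (eval y) p).eval (v k)) h1
  have h4 := congrArg (fun p => (Polynomial.map (eval y) p).eval (v k)) h2
  simp only [Polynomial.map_mul, Polynomial.eval_mul, Polynomial.map_pow, Polynomial.map_C, Polynomial.eval_pow,
    Polynomial.eval_C, hG' y v hv hF, zero_mul, Polynomial.map_add, Polynomial.eval_add] at h3 h4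
  have h5 : (R.map (eval y)).eval (v k) = 0 := by
    rcases mul_eq_zero.1 h3 with h | h
    · exact eq_zero_of_pow_eq_zero h
    · exact absurd h (left_ne_zero_of_mul hy)
  refine ⟨h5, fun h6 => ?_⟩
  rw [h5, h6, mul_zero, mul_zero, add_zero] at h4
  exact right_ne_zero_of_mul hy h4.symm

theorem family_bound {σ κ : Type} [Fintype σ] (s : Finset κ) (p : κ → MvPolynomial σ ℂ) :
    ∃ (C : ℝ) (K : ℕ), 0 ≤ C ∧ ∀ y, ∑ i ∈ s, ‖eval y (p i)‖ ≤ C * (1 + ‖y‖) ^ K := by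
  classical
  induction s using Finset.induction_on with
  | empty => exact ⟨0, 0, le_rfl, fun y => by simp⟩
  | insert a s ha ih =>
    obtain ⟨C, K, hC, h⟩ := ih
    obtain ⟨C', K', hC', h'⟩ := poly_bound (p a)
    refine ⟨C' + C, K' + K, by positivity, fun y => ?_⟩
    rw [Finset.sum_insert ha, add_mul]
    have h1 : (1 : ℝ) ≤ 1 + ‖y‖ := by linarith [norm_nonneg y]
    refine add_le_add ((h' y).trans ?_) ((h y).trans ?_)
    · exact mul_le_mul_of_nonneg_left (pow_le_pow_right₀ h1 (by omega)) hC'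
    · exact mul_le_mul_of_nonneg_left (pow_le_pow_right₀ h1 (by omega)) hC

theorem exists_gen {n d δ : ℕ} (hn : 0 < n) {q g : MvPolynomial (Fin (n + 3)) ℂ} (hX : IsSmoothCI2 q g)
    (hq : q.IsHomogeneous 3) (hg : g.IsHomogeneous d)
    (φ : RatMapTo (Fin (n + 3)) n) (hφ : φ.DominantOfDegree (ZeroSet q ∩ ZeroSet g) δ) :
    ∃ lam f Φ, Gen q g φ.F lam f Φ δ := by
  classical
  obtain ⟨lam, f1, hf1, hf1'⟩ := exists_lam hn hq hg φ hφ
  choose R c hR hc hRc using exists_R lam f1 hf1 (fun y hy => (hf1' y hy).1)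
  let f : MvPolynomial (Fin n) ℂ := f1 * ∏ k, (c k * (R k).leadingCoeff)
  have hf : f ≠ 0 := mul_ne_zero hf1 (Finset.prod_ne_zero_iff.2 fun k _ => mul_ne_zero (hc k) (Polynomial.leadingCoeff_ne_zero.2 (hR k)))
  have hev : ∀ y, eval y f ≠ 0 → eval y f1 ≠ 0 ∧ ∀ k, eval y (c k) ≠ 0 ∧ eval y (R k).leadingCoeff ≠ 0 := by
    intro y hy
    simp only [f, map_mul, map_prod] at hy
    refine ⟨left_ne_zero_of_mul hy, fun k => ?_⟩
    have := Finset.prod_ne_zero_iff.1 (right_ne_zero_of_mul hy) k (Finset.mem_univ k)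
    exact ⟨left_ne_zero_of_mul this, right_ne_zero_of_mul this⟩
  let Φ : (Fin n → ℂ) → Finset (Fin (n + 3) → ℂ) := fun y =>
    if h : {v | lam v = 1 ∧ Fib q g φ.F y v}.Finite then h.toFinset else ∅
  have hΦ : ∀ y, eval y f ≠ 0 → ∀ x, x ∈ Φ y ↔ lam x = 1 ∧ Fib q g φ.F y x := by
    intro y hy x
    have := (hf1' y (hev y hy).1).1
    simp only [Φ, dif_pos this, Set.Finite.mem_toFinset]
    rfl
  refine ⟨lam, f, Φ, hf, hΦ, ?_, ?_, ?_⟩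
  · intro y hy
    obtain ⟨h1, h2⟩ := hf1' y (hev y hy).1
    simp only [Φ, dif_pos h1]
    rw [← Set.ncard_eq_toFinset_card _ h1, h2]
  · intro y hy x hx ξ h1 h2 h3 h4
    obtain ⟨k1, k2, k3, k4, k5⟩ := (hΦ y hy x).1 hx
    obtain ⟨γ, hγ0, hγ, hev'⟩ := exists_curve hX hq hg lam x ξ k1 k2 k3 h1 h2 h3
    let Y : ℂ → Fin n → ℂ := fun s j => eval (γ s) (φ.F j.succ) * (eval (γ s) (φ.F 0))⁻¹
    have hY0 : Y 0 = y := by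
      ext j
      simp only [Y, hγ0, k5]
      field_simp
    have hdF : ∀ j, HasDerivAt (fun s => eval (γ s) (φ.F j)) (dlin (φ.F j) x ξ) 0 := by
      intro j
      have h5 := hasFDerivAt_eval (φ.F j) (γ 0)
      have := h5.comp_hasDerivAt 0 hγ
      rw [hγ0] at this
      exact this
    have hY : HasDerivAt Y 0 0 := by
      rw [hasDerivAt_pi]
      intro j
      have h0 : eval (γ 0) (φ.F 0) ≠ 0 := by rw [hγ0]; exact k4
      have := (hdF j.succ).mul ((hdF 0).inv h0)
      refine this.congr_deriv ?_
      simp only [hγ0, h4, k5, Pi.zero_apply, Pi.inv_apply]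
      field_simp
      ring
    ext k
    have hT : HasDerivAt (fun s => γ s k) (ξ k) 0 := (hasDerivAt_pi.1 hγ) k
    have hder := hasDerivAt_R (R k) hY hT
    have hc0 : eval y (c k) ≠ 0 := ((hev y hy).2 k).1
    have hev1 : ∀ᶠ s in nhds (0 : ℂ), eval (Y s) (c k) ≠ 0 := by
      have hcont : ContinuousAt (fun s => eval (Y s) (c k)) 0 := by
        have := (hasFDerivAt_eval (c k) (Y 0)).comp_hasDerivAt 0 hY
        exact this.continuousAt
      exact hcont.eventually_ne (by rw [hY0]; exact hc0)
    have hev2 : ∀ᶠ s in nhds (0 : ℂ), eval (γ s) (φ.F 0) ≠ 0 :=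
      (hdF 0).continuousAt.eventually_ne (by rw [hγ0]; exact k4)
    have hz : (fun s => ((R k).map (eval (Y s))).eval (γ s k)) =ᶠ[nhds 0] fun _ => 0 := by
      filter_upwards [hev', hev1, hev2] with s hs1 hs2 hs3
      refine (hRc k _ hs2 _ hs1.1 ⟨hs1.2.1, hs1.2.2, hs3, fun j => ?_⟩).1
      simp only [Y]
      field_simp
    have h0 := (hder.congr_of_eventuallyEq hz.symm).unique (hasDerivAt_const (0 : ℂ) (0 : ℂ))
    rw [hY0, hγ0] at h0
    rcases mul_eq_zero.1 h0 with h | h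
    · exact absurd h (hRc k y hc0 x k1 ⟨k2, k3, k4, k5⟩).2
    · exact h
  · have hk : ∀ k, ∃ (C : ℝ) (K : ℕ), 0 ≤ C ∧ ∀ y, eval y f ≠ 0 → ∀ x ∈ Φ y, ‖eval y f‖ * ‖x k‖ ≤ C * (1 + ‖y‖) ^ K := by
      intro k
      obtain ⟨h, hh⟩ : (R k).leadingCoeff ∣ f := by
        refine Dvd.dvd.mul_left ?_ _
        exact (Dvd.intro_left _ rfl).trans (Finset.dvd_prod_of_mem (fun k => c k * (R k).leadingCoeff) (Finset.mem_univ k))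
      obtain ⟨C, K, hC, hb⟩ := family_bound (Finset.range ((R k).natDegree + 1)) (fun i => h * (R k).coeff i)
      refine ⟨C, K, hC, fun y hy x hx => ?_⟩
      obtain ⟨k1, k2⟩ := (hΦ y hy x).1 hx
      obtain ⟨-, h2⟩ := hev y hy
      have h3 := root_bound _ _ (hRc k y (h2 k).1 x k1 k2).1
      rw [Polynomial.leadingCoeff_map_of_leadingCoeff_ne_zero _ (h2 k).2, Polynomial.natDegree_map_of_leadingCoeff_ne_zero _ (h2 k).2] at h3
      refine le_trans ?_ (hb y)
      rw [hh, map_mul, norm_mul, mul_comm ‖_‖ ‖eval y h‖, mul_assoc]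
      refine (mul_le_mul_of_nonneg_left h3 (norm_nonneg _)).trans (le_of_eq ?_)
      rw [Finset.mul_sum]
      refine Finset.sum_congr rfl fun i _ => ?_
      rw [map_mul, norm_mul, Polynomial.coeff_map]
    choose C K hC hb using hk
    refine ⟨∑ k, C k, ∑ k, K k, fun y hy x hx => ?_⟩
    have h1 : (1 : ℝ) ≤ 1 + ‖y‖ := by linarith [norm_nonneg y]
    have h2 : ‖eval y f • x‖ ≤ (∑ k, C k) * (1 + ‖y‖) ^ (∑ k, K k) := by
      refine (pi_norm_le_iff_of_nonneg (mul_nonneg (Finset.sum_nonneg fun k _ => hC k) (by positivity))).2 fun k => ?_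
      rw [Pi.smul_apply, norm_smul]
      refine (hb k y hy x hx).trans ?_
      refine mul_le_mul (Finset.single_le_sum (fun k _ => hC k) (Finset.mem_univ k))
        (pow_le_pow_right₀ h1 (Finset.single_le_sum (fun k _ => Nat.zero_le _) (Finset.mem_univ k))) (by positivity)
        (Finset.sum_nonneg fun k _ => hC k)
    rwa [norm_smul] at h2
end

open MvPolynomial
noncomputable section

theorem entire_poly (h : ℂ → ℂ) (hd : Differentiable ℂ h) (C : ℝ) (K : ℕ)
    (hb : ∀ s, ‖h s‖ ≤ C * (1 + ‖s‖) ^ K) :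
    ∃ p : Polynomial ℂ, p.natDegree ≤ K ∧ ∀ s, h s = p.eval s := by
  have hz : ∀ m, K < m → iteratedDeriv m h 0 = 0 := by
    intro m hm
    have hC : 0 ≤ C := by simpa using (norm_nonneg _).trans (hb 0)
    have key : ∀ R : ℝ, 1 ≤ R → ‖iteratedDeriv m h 0‖ ≤ (m.factorial * C * 2 ^ K) / R := by
      intro R hR
      have hR0 : 0 < R := by linarith
      have := Complex.norm_iteratedDeriv_le_of_forall_mem_sphere_norm_le (f := h) (c := 0) (R := R)
        (C := C * (1 + R) ^ K) m hR0 hd.diffContOnCl (fun z hz => by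
          have := hb z
          rwa [show ‖z‖ = R by simpa using hz] at this)
      refine this.trans ?_
      rw [div_le_div_iff₀ (by positivity) hR0]
      have h1 : (1 + R) ^ K ≤ 2 ^ K * R ^ K := by
        rw [← mul_pow]; exact pow_le_pow_left₀ (by linarith) (by linarith) _
      have h2 : R ^ K * R ≤ R ^ m := by
        rw [← pow_succ]; exact pow_le_pow_right₀ hR hm
      calc m.factorial * (C * (1 + R) ^ K) * R ≤ m.factorial * (C * (2 ^ K * R ^ K)) * R := by gcongr
        _ = m.factorial * C * 2 ^ K * (R ^ K * R) := by ring
        _ ≤ _ := by gcongr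
    have ht : Filter.Tendsto (fun R : ℝ => (m.factorial * C * 2 ^ K) / R) Filter.atTop (nhds 0) :=
      Filter.Tendsto.const_div_atTop Filter.tendsto_id _
    have := ge_of_tendsto ht (Filter.eventually_atTop.2 ⟨1, key⟩)
    exact norm_le_zero_iff.1 this
  refine ⟨∑ m ∈ Finset.range (K + 1), Polynomial.C ((m.factorial : ℂ)⁻¹ * iteratedDeriv m h 0) *
    Polynomial.X ^ m, ?_, fun s => ?_⟩
  · refine Polynomial.natDegree_sum_le_of_forall_le _ _ fun m hm => ?_
    exact (Polynomial.natDegree_C_mul_X_pow_le _ _).trans (by simpa [Nat.lt_succ_iff] using hm)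
  · rw [← Complex.taylorSeries_eq_of_entire' 0 s hd, tsum_eq_sum (s := Finset.range (K + 1))]
    · rw [Polynomial.eval_finsetSum]
      simp
    · intro m hm
      rw [hz m (by simpa using hm)]; simp

/-- restriction of a polynomial to a line -/
def lineP {σ : Type} (y e : σ → ℂ) : MvPolynomial σ ℂ →ₐ[ℂ] Polynomial ℂ :=
  aeval (fun i => Polynomial.C (y i) + Polynomial.X * Polynomial.C (e i))

theorem eval_lineP {σ : Type} (y e : σ → ℂ) (p : MvPolynomial σ ℂ) (s : ℂ) :
    (lineP y e p).eval s = eval (y + s • e) p := by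
  have : ((Polynomial.aeval s).comp (lineP y e)) = MvPolynomial.aeval (y + s • e) := by
    refine MvPolynomial.algHom_ext fun i => ?_
    simp [lineP]; ring
  have := DFunLike.congr_fun this p
  simpa [MvPolynomial.aeval_eq_eval, Polynomial.coe_aeval_eq_eval] using this

theorem lineP_natDegree {σ : Type} (y e : σ → ℂ) (p : MvPolynomial σ ℂ) :
    (lineP y e p).natDegree ≤ p.totalDegree := by
  have := MvPolynomial.aeval_natDegree_le p le_rfl
    (fun i => Polynomial.C (y i) + Polynomial.X * Polynomial.C (e i)) (n := 1) (fun i => by compute_degree)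
  simpa [lineP] using this

theorem lineP_coeff {σ : Type} (y e : σ → ℂ) {p : MvPolynomial σ ℂ} {m : ℕ} (hp : p.IsHomogeneous m) :
    (lineP y e p).coeff m = eval e p := by
  unfold lineP
  rw [MvPolynomial.aeval_def, MvPolynomial.eval₂_eq, Polynomial.finsetSum_coeff, MvPolynomial.eval_eq]
  refine Finset.sum_congr rfl fun b hb => ?_
  have hdeg : b.degree = m := by
    have := hp (by simpa using hb)
    rwa [Pi.one_def, ← Finsupp.degree_eq_weight_one] at this
  rw [Polynomial.algebraMap_eq, Polynomial.coeff_C_mul]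
  congr 1
  have h1 : m = ∑ i ∈ b.support, b i := by rw [← hdeg]; rfl
  rw [h1]
  have : ∀ (s : Finset σ), (∏ i ∈ s, (Polynomial.C (y i) + Polynomial.X * Polynomial.C (e i)) ^ b i).natDegree ≤ ∑ i ∈ s, b i ∧
      (∏ i ∈ s, (Polynomial.C (y i) + Polynomial.X * Polynomial.C (e i)) ^ b i).coeff (∑ i ∈ s, b i) = ∏ i ∈ s, e i ^ b i := by
    classical
    have hd : ∀ i, ((Polynomial.C (y i) + Polynomial.X * Polynomial.C (e i)) ^ b i).natDegree ≤ b i := fun i =>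
      (Polynomial.natDegree_pow_le_of_le (b i) (m := 1) (by compute_degree)).trans (by simp)
    intro s
    induction s using Finset.induction_on with
    | empty => simp
    | insert i s hi ih =>
      rw [Finset.prod_insert hi, Finset.sum_insert hi, Finset.prod_insert hi]
      refine ⟨Polynomial.natDegree_mul_le_of_le (hd i) ih.1, ?_⟩
      rw [Polynomial.coeff_mul_add_eq_of_natDegree_le (hd i) ih.1, ih.2]
      congr 1
      have := Polynomial.coeff_pow_of_natDegree_le (m := b i) (n := 1)
        (p := Polynomial.C (y i) + Polynomial.X * Polynomial.C (e i)) (by compute_degree)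
      simpa using this
  exact (this _).2

/-- functions which are polynomial of bounded degree on all lines -/
def LP {σ : Type} (h : (σ → ℂ) → ℂ) : Prop :=
  ∃ K : ℕ, ∀ y e, ∃ p : Polynomial ℂ, p.natDegree ≤ K ∧ ∀ s : ℂ, h (y + s • e) = p.eval s

theorem LP.eval {σ : Type} (p : MvPolynomial σ ℂ) : LP (fun y => eval y p) :=
  ⟨p.totalDegree, fun y e => ⟨lineP y e p, lineP_natDegree y e p, fun s => (eval_lineP y e p s).symm⟩⟩

theorem LP.const {σ : Type} (c : ℂ) : LP (fun _ : σ → ℂ => c) :=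
  ⟨0, fun _ _ => ⟨Polynomial.C c, by simp, fun s => by simp⟩⟩

theorem LP.add {σ : Type} {h k : (σ → ℂ) → ℂ} (hh : LP h) (hk : LP k) : LP (fun y => h y + k y) := by
  obtain ⟨K, hK⟩ := hh
  obtain ⟨L, hL⟩ := hk
  refine ⟨max K L, fun y e => ?_⟩
  obtain ⟨p, hp, hp'⟩ := hK y e
  obtain ⟨r, hr, hr'⟩ := hL y e
  exact ⟨p + r, Polynomial.natDegree_add_le_of_degree_le (hp.trans (le_max_left _ _)) (hr.trans (le_max_right _ _)),
    fun s => by simp [hp', hr']⟩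

theorem LP.mul {σ : Type} {h k : (σ → ℂ) → ℂ} (hh : LP h) (hk : LP k) : LP (fun y => h y * k y) := by
  obtain ⟨K, hK⟩ := hh
  obtain ⟨L, hL⟩ := hk
  refine ⟨K + L, fun y e => ?_⟩
  obtain ⟨p, hp, hp'⟩ := hK y e
  obtain ⟨r, hr, hr'⟩ := hL y e
  exact ⟨p * r, Polynomial.natDegree_mul_le_of_le hp hr, fun s => by simp [hp', hr']⟩

theorem LP.ext {σ : Type} [Fintype σ] (f : MvPolynomial σ ℂ) (T : (σ → ℂ) → ℂ) (N : ℕ)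
    (hd : ∀ y, MvPolynomial.eval y f ≠ 0 → DifferentiableAt ℂ T y) (C : ℝ) (K : ℕ)
    (hb : ∀ y, MvPolynomial.eval y f ≠ 0 → ‖MvPolynomial.eval y f ^ N * T y‖ ≤ C * (1 + ‖y‖) ^ K) :
    LP (fun y => MvPolynomial.eval y f ^ (N + 1) * T y) := by
  obtain ⟨C1, K1, -, h1⟩ := poly_bound f
  have hle : ∀ y, ‖MvPolynomial.eval y f ^ (N + 1) * T y‖ ≤ ‖MvPolynomial.eval y f‖ * (|C| * (1 + ‖y‖) ^ K) := by
    intro y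
    by_cases hy : MvPolynomial.eval y f = 0
    · simp [hy]
    · rw [pow_succ', mul_assoc, norm_mul]
      refine mul_le_mul_of_nonneg_left ((hb y hy).trans ?_) (norm_nonneg _)
      gcongr
      exact le_abs_self C
  refine ⟨K1 + K, fun y e => ?_⟩
  have hfc : Continuous (fun s : ℂ => MvPolynomial.eval (y + s • e) f) := by
    simp_rw [← eval_lineP]; exact (lineP y e f).continuous
  have hline : ∀ s : ℂ, 1 + ‖y + s • e‖ ≤ (1 + ‖y‖ + ‖e‖) * (1 + ‖s‖) := by
    intro s
    have := norm_add_le y (s • e)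
    rw [norm_smul] at this
    nlinarith [norm_nonneg y, norm_nonneg e, norm_nonneg s, mul_nonneg (norm_nonneg y) (norm_nonneg s)]
  by_cases hp0 : lineP y e f = 0
  · refine ⟨0, by simp, fun s => ?_⟩
    have : MvPolynomial.eval (y + s • e) f = 0 := by rw [← eval_lineP, hp0]; simp
    simp [this]
  refine entire_poly _ ?_ (|C1| * |C| * (1 + ‖y‖ + ‖e‖) ^ (K1 + K)) (K1 + K) ?_
  · have hgood : ∀ s : ℂ, MvPolynomial.eval (y + s • e) f ≠ 0 → DifferentiableAt ℂ
        (fun s : ℂ => MvPolynomial.eval (y + s • e) f ^ (N + 1) * T (y + s • e)) s := by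
      intro s hs
      have hl : DifferentiableAt ℂ (fun s : ℂ => y + s • e) s := by fun_prop
      refine DifferentiableAt.mul ?_ ((hd _ hs).comp s hl)
      simp_rw [← eval_lineP]
      fun_prop
    intro s0
    by_cases hs0 : MvPolynomial.eval (y + s0 • e) f = 0
    · refine (Complex.analyticAt_of_differentiable_on_punctured_nhds_of_continuousAt ?_ ?_).differentiableAt
      · have hf : {s | (lineP y e f).IsRoot s}.Finite := Polynomial.finite_setOfPred_isRoot hp0
        have : ∀ᶠ s in nhdsWithin s0 {s0}ᶜ, s ∉ {s | (lineP y e f).IsRoot s} := by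
          have h2 := (hf.subset (Set.sdiff_subset (t := {s0}))).isClosed.isOpen_compl.mem_nhds
            (x := s0) (by simp)
          rw [eventually_nhdsWithin_iff]
          filter_upwards [h2] with s hs hs' hr
          exact hs ⟨hr, hs'⟩
        filter_upwards [this] with s hs
        refine hgood s fun h => hs ?_
        simpa [Polynomial.IsRoot, eval_lineP] using h
      · unfold ContinuousAt
        simp only [hs0]
        rw [zero_pow (by omega), zero_mul, tendsto_zero_iff_norm_tendsto_zero]
        refine squeeze_zero (fun _ => norm_nonneg _) (fun s => hle _) ?_
        have : Continuous (fun s : ℂ => ‖MvPolynomial.eval (y + s • e) f‖ * (|C| * (1 + ‖y + s • e‖) ^ K)) := by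
          fun_prop
        have := this.tendsto s0
        simpa [hs0] using this
    · exact hgood s0 hs0
  · intro s
    refine (hle _).trans ?_
    have h2 := h1 (y + s • e)
    have h3 : ‖MvPolynomial.eval (y + s • e) f‖ ≤ |C1| * (1 + ‖y + s • e‖) ^ K1 :=
      h2.trans (by gcongr; exact le_abs_self _)
    calc _ ≤ |C1| * (1 + ‖y + s • e‖) ^ K1 * (|C| * (1 + ‖y + s • e‖) ^ K) := by gcongr
      _ = |C1| * |C| * (1 + ‖y + s • e‖) ^ (K1 + K) := by ring
      _ ≤ |C1| * |C| * ((1 + ‖y‖ + ‖e‖) * (1 + ‖s‖)) ^ (K1 + K) := by gcongr; exact hline s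
      _ = _ := by rw [mul_pow]; ring
end

open MvPolynomial
noncomputable section

/-- functions of two variables given by a polynomial in `ℂ[t][s]` -/
def BP (h : ℂ → ℂ → ℂ) : Prop := ∃ P : R2, ∀ s t, (sp t P).eval s = h s t

/-- evaluation -/
def ev2 (s t : ℂ) : R2 →ₐ[ℂ] ℂ := (Polynomial.aeval s).comp (sp t)

theorem ev2_apply (s t : ℂ) (P : R2) : ev2 s t P = (sp t P).eval s := by
  simp [ev2, Polynomial.coe_aeval_eq_eval]

theorem BP.mul {h k : ℂ → ℂ → ℂ} (hh : BP h) (hk : BP k) : BP (fun s t => h s t * k s t) := by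
  obtain ⟨P, hP⟩ := hh
  obtain ⟨Q, hQ⟩ := hk
  exact ⟨P * Q, fun s t => by simp [hP, hQ]⟩

theorem BP.fst (p : Polynomial ℂ) : BP (fun s _ => p.eval s) :=
  ⟨p.map Polynomial.C, fun s t => by
    have : sp t (p.map Polynomial.C) = p := by
      ext m; simp [coeff_sp]
    rw [this]⟩

theorem BP.snd : BP (fun _ t => t) := ⟨Polynomial.C Polynomial.X, fun s t => by simp [sp]⟩

theorem LP.plane {σ : Type} {h : (σ → ℂ) → ℂ} (hh : LP h) (y e e' : σ → ℂ) :
    BP (fun s t => h (y + s • e + t • e')) := by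
  obtain ⟨K, hK⟩ := hh
  choose p hp hp' using fun j : ℕ => hK (y + (j : ℂ) • e') e
  have hinj : Set.InjOn (fun j : ℕ => (j : ℂ)) (Finset.range (K + 1)) := fun a _ b _ hab => Nat.cast_injective hab
  refine ⟨∑ j ∈ Finset.range (K + 1), (p j).map Polynomial.C *
    Polynomial.C (Lagrange.basis (Finset.range (K + 1)) (fun j : ℕ => (j : ℂ)) j), fun s t => ?_⟩
  obtain ⟨r, hr, hr'⟩ := hK (y + s • e) e'
  beta_reduce
  rw [hr', Lagrange.eq_interpolate (f := r) hinj (by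
    refine lt_of_le_of_lt Polynomial.degree_le_natDegree ?_
    rw [Finset.card_range]; exact_mod_cast Nat.lt_succ_of_le hr), Lagrange.interpolate_apply,
    Polynomial.eval_finsetSum, map_sum, Polynomial.eval_finsetSum]
  refine Finset.sum_congr rfl fun j _ => ?_
  have h1 : sp t ((p j).map Polynomial.C) = p j := by
    ext m; simp [coeff_sp]
  have h2 : ∀ w : Polynomial ℂ, sp t (Polynomial.C w) = Polynomial.C (w.eval t) := by
    intro w; ext m; rw [coeff_sp, Polynomial.coeff_C, Polynomial.coeff_C]; split_ifs <;> simp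
  rw [map_mul, h1, h2, Polynomial.eval_mul, Polynomial.eval_C, Polynomial.eval_mul, Polynomial.eval_C, ← hp', ← hr']
  congr 2
  abel

theorem R2_ext {P : R2} (h : ∀ s t, ev2 s t P = 0) : P = 0 := by
  ext1 m
  refine Polynomial.funext fun t => ?_
  rw [← coeff_sp]
  have : sp t P = 0 := Polynomial.funext fun s => by rw [← ev2_apply, h]; simp
  rw [this]; simp

theorem ev2_dS (P : R2) {h : ℂ → ℂ → ℂ} (hP : ∀ s t, (sp t P).eval s = h s t) {u : ℂ}
    (hu : HasDerivAt (fun s => h s 0) u 0) : ev2 0 0 (dS P) = u := by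
  have h1 : HasDerivAt (fun s => h s 0) ((sp 0 P).derivative.eval 0) 0 := by
    simp_rw [← hP]; exact (sp 0 P).hasDerivAt 0
  rw [← h1.unique hu, ev2_apply]
  congr 1
  ext m
  rw [coeff_sp, dS, Polynomial.coeff_derivative, Polynomial.coeff_derivative, coeff_sp]
  simp

theorem ev2_dT (P : R2) {h : ℂ → ℂ → ℂ} (hP : ∀ s t, (sp t P).eval s = h s t) {u : ℂ}
    (hu : HasDerivAt (fun t => h 0 t) u 0) : ev2 0 0 (dT P) = u := by
  have h0 : ∀ (t : ℂ) (Q : R2), (sp t Q).eval 0 = (Q.coeff 0).eval t := by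
    intro t Q; rw [← Polynomial.coeff_zero_eq_eval_zero, coeff_sp]
  have h1 : HasDerivAt (fun t => h 0 t) ((P.coeff 0).derivative.eval 0) 0 := by
    simp_rw [← hP, h0]; exact (P.coeff 0).hasDerivAt 0
  rw [← h1.unique hu, ev2_apply, h0, coeff_dT]

theorem onLine_of {c : Fin 6 → Fin 6 → Fin 6 → ℂ} (hs : SymT c) {a b : Fin 6 → ℂ}
    (h : ∀ x z : ℂ, tri c (x • a + z • b) (x • a + z • b) (x • a + z • b) = 0) :
    tri c a a a = 0 ∧ tri c a a b = 0 ∧ tri c a b b = 0 ∧ tri c b b b = 0 := by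
  have key : ∀ x z : ℂ, x ^ 3 * tri c a a a + 3 * x ^ 2 * z * tri c a a b + 3 * x * z ^ 2 * tri c a b b
      + z ^ 3 * tri c b b b = 0 := by
    intro x z
    rw [← h x z]
    simp only [tri_add1, tri_add2, tri_add3, tri_smul1, tri_smul2, tri_smul3]
    rw [tri_swap23 hs a b a, tri_swap12 hs b a a, tri_swap23 hs a b a, tri_swap12 hs b a b, tri_swap23 hs b b a,
      tri_swap12 hs b a b]
    ring
  have h1 := key 1 0
  have h2 := key 0 1
  have h3 := key 1 1
  have h4 := key 1 (-1)
  refine ⟨by linear_combination h1, ?_, ?_, by linear_combination h2⟩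
  · linear_combination (h3 - h4 - 2 * h2) / 6
  · linear_combination (h3 + h4 - 2 * h1) / 6

theorem FO.plane {c : Fin 6 → Fin 6 → Fin 6 → ℂ} (hs : SymT c) (α β : ℂ → ℂ → Fin 6 → ℂ)
    (hα : ∀ i, BP (fun s t => α s t i)) (hβ : ∀ i, BP (fun s t => β s t i))
    (hl : ∀ s t x z : ℂ, tri c (x • α s t + z • β s t) (x • α s t + z • β s t) (x • α s t + z • β s t) = 0)
    (hπ : ∃ i j, α 0 0 i * β 0 0 j - α 0 0 j * β 0 0 i ≠ 0) (W : ℂ → Submodule ℂ (Fin 6 → ℂ))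
    (ha : ∀ s t, α s t ∈ W t) (hb : ∀ s t, β s t ∈ W t)
    (hW : ∀ t, ∀ p ∈ W t, p ≠ 0 → ∃ w, tri c p p w ≠ 0) {us ut vs vt : Fin 6 → ℂ}
    (hus : HasDerivAt (fun s => α s 0) us 0) (hut : HasDerivAt (fun t => α 0 t) ut 0)
    (hvs : HasDerivAt (fun s => β s 0) vs 0) (hvt : HasDerivAt (fun t => β 0 t) vt 0) :
    (⟨α 0 0, β 0 0, us, vs, ut, vt⟩ : FO ℂ).Valid c ∧ ∀ w1 w2,
      (⟨α 0 0, β 0 0, us, vs, ut, vt⟩ : FO ℂ).den c w1 w2 ≠ 0 →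
      (⟨α 0 0, β 0 0, us, vs, ut, vt⟩ : FO ℂ).num c w1 w2 = 0 := by
  choose A hA using hα
  choose B hB using hβ
  have eA : ∀ s t, (fun i => ev2 s t (A i)) = α s t := fun s t => funext fun i => by rw [ev2_apply, hA]
  have eB : ∀ s t, (fun i => ev2 s t (B i)) = β s t := fun s t => funext fun i => by rw [ev2_apply, hB]
  have hOn : (ofD dS dT A B).OnLine c := by
    constructor <;> refine R2_ext fun s t => ?_ <;> rw [tri_map] <;> simp only [ofD, eA, eB]
    exacts [(onLine_of hs (hl s t)).1, (onLine_of hs (hl s t)).2.1, (onLine_of hs (hl s t)).2.2.1,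
      (onLine_of hs (hl s t)).2.2.2]
  have hmap : (ofD dS dT A B).map (ev2 0 0) = ⟨α 0 0, β 0 0, us, vs, ut, vt⟩ := by
    simp only [FO.map, ofD, FO.mk.injEq]
    refine ⟨eA 0 0, eB 0 0, ?_, ?_, ?_, ?_⟩ <;> funext i
    · exact ev2_dS _ (hA i) (hasDerivAt_pi.1 hus i)
    · exact ev2_dS _ (hB i) (hasDerivAt_pi.1 hvs i)
    · exact ev2_dT _ (hA i) (hasDerivAt_pi.1 hut i)
    · exact ev2_dT _ (hB i) (hasDerivAt_pi.1 hvt i)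
  refine ⟨?_, fun w1 w2 hden => ?_⟩
  · rw [← hmap]
    exact (valid_ofD hs isDer_dS isDer_dT A B hOn).map _
  · have e1 := map_den_cst (c := c) (ev2 0 0) (ofD dS dT A B) w1 w2
    have e2 := map_num_cst (c := c) (ev2 0 0) (ofD dS dT A B) w1 w2
    rw [hmap] at e1 e2
    rw [cst_self, cst_self] at e1 e2
    rw [← e2, theta hs A B hOn ?_ W ?_ ?_ hW w1 w2 ?_, map_zero]
    · obtain ⟨i, j, hij⟩ := hπ
      refine ⟨i, j, fun h0 => hij ?_⟩
      have := congrArg (ev2 0 0) h0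
      simpa only [map_sub, map_mul, ev2_apply, hA, hB, map_zero] using this
    · intro t s; simp_rw [hA]; exact ha s t
    · intro t s; simp_rw [hB]; exact hb s t
    · intro h0; apply hden; rw [← e1, h0, map_zero]
end

open MvPolynomial
noncomputable section

theorem exists_tensor {ι : Type} [Fintype ι] {q : MvPolynomial ι ℂ} (hq : q.IsHomogeneous 3) :
    ∃ c : ι → ι → ι → ℂ, SymT c ∧ (∀ v, eval v q = tri c v v v) ∧
      ∀ v w, dlin q v w = 3 * tri c v v w := by
  have hcm : ∀ (i j : ι) (p : MvPolynomial ι ℂ), pderiv i (pderiv j p) = pderiv j (pderiv i p) := by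
    intro i j p
    have h0 : ⁅(pderiv i : Derivation ℂ (MvPolynomial ι ℂ) (MvPolynomial ι ℂ)), (pderiv j : Derivation ℂ (MvPolynomial ι ℂ) (MvPolynomial ι ℂ))⁆ = 0 := by
      classical
      refine MvPolynomial.derivation_ext fun k => ?_
      rw [Derivation.commutator_apply, pderiv_X, pderiv_X]
      simp only [Pi.single_apply]
      split_ifs <;> simp
    have := DFunLike.congr_fun h0 p
    rw [Derivation.commutator_apply] at this
    simpa [sub_eq_zero] using this
  refine ⟨fun i j k => 6⁻¹ * eval 0 (pderiv i (pderiv j (pderiv k q))), ?_, ?_⟩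
  · refine ⟨fun i j k => ?_, fun i j k => ?_⟩
    · beta_reduce; rw [hcm i j]
    · beta_reduce; rw [hcm j k]
  have h0 : ∀ i j k v, eval v (pderiv i (pderiv j (pderiv k q))) = eval 0 (pderiv i (pderiv j (pderiv k q))) := by
    intro i j k v
    have hh : (pderiv i (pderiv j (pderiv k q))).IsHomogeneous 0 :=
      ((hq.pderiv (i := k)).pderiv (i := j)).pderiv (i := i)
    have := homog_eval hh 0 v
    simpa using this.symm
  have h1 : ∀ j k v, eval v (pderiv j (pderiv k q)) = ∑ i, eval 0 (pderiv i (pderiv j (pderiv k q))) * v i := by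
    intro j k v
    have hh : (pderiv j (pderiv k q)).IsHomogeneous 1 := (hq.pderiv (i := k)).pderiv (i := j)
    have := dlin_self hh v
    rw [dlin_apply] at this
    simp only [h0] at this
    rw [this]; simp
  have h2 : ∀ k v, 2 * eval v (pderiv k q) = ∑ j, (∑ i, eval 0 (pderiv i (pderiv j (pderiv k q))) * v i) * v j := by
    intro k v
    have hh : (pderiv k q).IsHomogeneous 2 := (hq.pderiv (i := k))
    have := dlin_self hh v
    rw [dlin_apply] at this
    simp only [h1] at this
    rw [this]; simp
  have h3 : ∀ v w, dlin q v w = 3 * tri (fun i j k => 6⁻¹ * eval 0 (pderiv i (pderiv j (pderiv k q)))) v v w := by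
    intro v w
    rw [dlin_apply]
    have : 2 * ∑ i, eval v (pderiv i q) * w i = 6 * tri (fun i j k => 6⁻¹ * eval 0 (pderiv i (pderiv j (pderiv k q)))) v v w := by
      rw [Finset.mul_sum]
      simp_rw [← mul_assoc, h2]
      unfold tri
      simp only [Finset.mul_sum, Finset.sum_mul]
      rw [Finset.sum_comm]
      conv_rhs => rw [Finset.sum_comm]
      refine Finset.sum_congr rfl fun j _ => ?_
      rw [Finset.sum_comm]
      refine Finset.sum_congr rfl fun i _ => Finset.sum_congr rfl fun k _ => ?_
      simp; ring
    linear_combination this / 2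
  refine ⟨fun v => ?_, h3⟩
  have := dlin_self hq v
  rw [h3] at this
  push_cast at this
  linear_combination -this / 3

theorem exists_powersum (S : Finset ℂ) (m : ℂ → ℕ) (hm : ∀ x ∈ S, m x ≠ 0) (z : ℂ) (hz : z ∈ S) (hz0 : z ≠ 0) :
    ∃ k, ∑ x ∈ S, (m x : ℂ) * x ^ (k + 1) ≠ 0 := by
  classical
  by_contra hcon
  push Not at hcon
  -- test polynomial `X * ∏_{x ≠ z, 0} (X - x)`
  have key : ∀ p : Polynomial ℂ, ∑ x ∈ S, (m x : ℂ) * (x * p.eval x) = 0 := by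
    intro p
    induction p using Polynomial.induction_on' with
    | add p r hp hr => simp only [Polynomial.eval_add, mul_add, Finset.sum_add_distrib, hp, hr, add_zero]
    | monomial k a =>
      have := hcon k
      rw [← mul_zero a, ← this, Finset.mul_sum]
      refine Finset.sum_congr rfl fun x _ => ?_
      simp; ring
  have := key (∏ x ∈ S.erase z, (Polynomial.X - Polynomial.C x))
  rw [Finset.sum_eq_single z] at this
  · rw [Polynomial.eval_prod] at this
    have h4 : ∏ j ∈ S.erase z, Polynomial.eval z (Polynomial.X - Polynomial.C j) ≠ 0 :=
      Finset.prod_ne_zero_iff.2 fun x hx => by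
        simpa [sub_eq_zero] using (Finset.ne_of_mem_erase hx).symm
    exact mul_ne_zero (Nat.cast_ne_zero.2 (hm z hz)) (mul_ne_zero hz0 h4) this
  · intro x hx hxz
    rw [Polynomial.eval_prod, Finset.prod_eq_zero (Finset.mem_erase.2 ⟨hxz, hx⟩)] <;> simp
  · exact fun h => absurd hz h

/-- power sums with multiplicity -/
theorem exists_powersum' {κ : Type*} (S : Finset κ) (r : κ → ℂ) (z : κ) (hz : z ∈ S) (hz0 : r z ≠ 0) :
    ∃ k, ∑ x ∈ S, r x ^ (k + 1) ≠ 0 := by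
  classical
  obtain ⟨k, hk⟩ := exists_powersum (S.image r) (fun x => (S.filter fun y => r y = x).card)
    (fun x hx => by
      obtain ⟨y, hy, rfl⟩ := Finset.mem_image.1 hx
      exact Finset.card_ne_zero.2 ⟨y, by simp [hy]⟩) (r z) (Finset.mem_image_of_mem _ hz) hz0
  refine ⟨k, fun h => hk ?_⟩
  rw [← h, Finset.sum_comp (fun x => x ^ (k + 1)) r]
  simp
end

open MvPolynomial
noncomputable section

/-- collinearity of a finite set -/
def Col {V : Type*} [AddCommGroup V] [Module ℂ V] (S : Finset V) : Prop :=
  ∃ u w : V, ∀ v ∈ S, v ∈ Submodule.span ℂ {u, w}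

theorem Col.ker {V : Type*} [AddCommGroup V] [Module ℂ V] {S : Finset V} (hS : Col S) (lam : V →ₗ[ℂ] ℂ)
    {x : V} (hx : x ∈ S) (hx1 : lam x = 1) {p r : V} (hp : p ∈ Submodule.span ℂ (S : Set V))
    (hr : r ∈ Submodule.span ℂ (S : Set V)) (hp0 : lam p = 0) (hr0 : lam r = 0) (ν : V →ₗ[ℂ] ℂ) :
    ν r • p = ν p • r := by
  obtain ⟨u, w, h⟩ := hS
  have hle : Submodule.span ℂ (S : Set V) ≤ Submodule.span ℂ {u, w} := Submodule.span_le.2 h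
  obtain ⟨x1, x2, rfl⟩ := Submodule.mem_span_pair.1 (h x hx)
  obtain ⟨p1, p2, rfl⟩ := Submodule.mem_span_pair.1 (hle hp)
  obtain ⟨r1, r2, rfl⟩ := Submodule.mem_span_pair.1 (hle hr)
  simp only [map_add, map_smul, smul_eq_mul] at *
  have h0 : p1 * r2 - p2 * r1 = 0 := by
    linear_combination (-(p1 * r2 - p2 * r1)) * hx1 + (x1 * r2 - x2 * r1) * hp0 + (x2 * p1 - x1 * p2) * hr0
  have e1 : (r1 * ν u + r2 * ν w) * p1 = (p1 * ν u + p2 * ν w) * r1 := by linear_combination ν w * h0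
  have e2 : (r1 * ν u + r2 * ν w) * p2 = (p1 * ν u + p2 * ν w) * r2 := by linear_combination -ν u * h0
  rw [smul_add, smul_add, smul_smul, smul_smul, smul_smul, smul_smul, e1, e2]

theorem exists_dual {V : Type*} [AddCommGroup V] [Module ℂ V] {b : V} (hb : b ≠ 0) : ∃ ν : V →ₗ[ℂ] ℂ, ν b ≠ 0 := by
  by_contra h
  push Not at h
  exact hb ((Module.forall_dual_apply_eq_zero_iff ℂ b).1 h)

theorem Col.param {V : Type*} [AddCommGroup V] [Module ℂ V] {S : Finset V} (hS : Col S) (lam : V →ₗ[ℂ] ℂ)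
    {x : V} (hx : x ∈ S) (hx1 : lam x = 1) {b : V} (hb : b ∈ Submodule.span ℂ (S : Set V))
    (hb0 : lam b = 0) (hbn : b ≠ 0) {w : V} (hw : w ∈ Submodule.span ℂ (S : Set V)) :
    ∃ r : ℂ, w = lam w • x + r • b := by
  obtain ⟨ν, hν⟩ := exists_dual hbn
  have := hS.ker lam hx hx1 (p := w - lam w • x) (r := b)
    (Submodule.sub_mem _ hw (Submodule.smul_mem _ _ (Submodule.subset_span hx))) hb (by simp [hx1]) hb0 ν
  refine ⟨ν (w - lam w • x) / ν b, ?_⟩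
  rw [div_eq_inv_mul, mul_smul, ← this, smul_smul, inv_mul_cancel₀ hν, one_smul]
  abel

theorem eval_of_lineP {ι : Type} [Fintype ι] {p : MvPolynomial ι ℂ} {m : ℕ} (hp : p.IsHomogeneous m) {a b : ι → ℂ}
    (h : lineP a b p = 0) (x z : ℂ) : eval (x • a + z • b) p = 0 := by
  by_cases hx : x = 0
  · subst hx
    have := lineP_coeff a b hp
    rw [h] at this
    rw [zero_smul, zero_add, homog_eval hp, ← this]; simp
  · have := eval_lineP a b p (z / x)
    rw [h] at this
    rw [show x • a + z • b = x • (a + (z / x) • b) by rw [smul_add, smul_smul, mul_div_cancel₀ _ hx],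
      homog_eval hp, ← this]
    simp

theorem derivative_lineP {ι : Type} [Fintype ι] (p : MvPolynomial ι ℂ) (a b : ι → ℂ) (s : ℂ) :
    (lineP a b p).derivative.eval s = dlin p (a + s • b) b := by
  have h1 := (lineP a b p).hasDerivAt s
  have h2 : HasDerivAt (fun s : ℂ => a + s • b) b s := by
    simpa using ((hasDerivAt_id s).smul_const b).const_add a
  have h3 := (hasFDerivAt_eval p (a + s • b)).comp_hasDerivAt s h2
  have h4 : (fun x => Polynomial.eval x (lineP a b p)) = (fun v => eval v p) ∘ (fun s : ℂ => a + s • b) := by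
    funext s; simp [eval_lineP]
  rw [h4] at h1
  exact h1.unique h3

/-- parameters of the points of `S` on the line -/
theorem Col.params {V : Type*} [AddCommGroup V] [Module ℂ V] {S : Finset V} (hS : Col S) (lam : V →ₗ[ℂ] ℂ)
    (hl : ∀ v ∈ S, lam v = 1) {x : V} (hx : x ∈ S) {b : V} (hb : b ∈ Submodule.span ℂ (S : Set V))
    (hb0 : lam b = 0) (hbn : b ≠ 0) :
    ∃ T : Finset ℂ, T.card = S.card ∧ ∀ s ∈ T, x + s • b ∈ S := by
  classical
  have h : ∀ v : V, ∃ r : ℂ, v ∈ S → v = x + r • b := by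
    intro v
    by_cases hv : v ∈ S
    · obtain ⟨r, hr⟩ := hS.param lam hx (hl x hx) hb hb0 hbn (Submodule.subset_span hv)
      refine ⟨r, fun _ => ?_⟩
      rwa [hl v hv, one_smul] at hr
    · exact ⟨0, fun h => absurd h hv⟩
  choose r hr using h
  refine ⟨S.image r, Finset.card_image_of_injOn fun v hv v' hv' hvv => ?_, fun s hs => ?_⟩
  · rw [hr v hv, hr v' hv', hvv]
  · obtain ⟨v, hv, rfl⟩ := Finset.mem_image.1 hs
    rw [← hr v hv]; exact hv

theorem lineP_zero {ι : Type} [Fintype ι] {S : Finset (ι → ℂ)} (hS : Col S) (lam : (ι → ℂ) →ₗ[ℂ] ℂ)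
    (hl : ∀ v ∈ S, lam v = 1) {x : ι → ℂ} (hx : x ∈ S) {b : ι → ℂ} (hb : b ∈ Submodule.span ℂ (S : Set (ι → ℂ)))
    (hb0 : lam b = 0) (hbn : b ≠ 0) {p : MvPolynomial ι ℂ} {m : ℕ} (hp : p.IsHomogeneous m)
    (hm : m < S.card) (h0 : ∀ v ∈ S, eval v p = 0) : lineP x b p = 0 := by
  obtain ⟨T, hT, hTS⟩ := hS.params lam hl hx hb hb0 hbn
  refine Polynomial.eq_zero_of_natDegree_lt_card_of_eval_eq_zero' _ T (fun s hs => ?_) ?_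
  · rw [eval_lineP]; exact h0 _ (hTS s hs)
  · rw [hT]
    exact (lineP_natDegree _ _ _).trans_lt (hp.totalDegree_le.trans_lt hm)

theorem lineP_zero2 {ι : Type} [Fintype ι] {S : Finset (ι → ℂ)} (hS : Col S) (lam : (ι → ℂ) →ₗ[ℂ] ℂ)
    (hl : ∀ v ∈ S, lam v = 1) {x : ι → ℂ} (hx : x ∈ S) {b : ι → ℂ} (hb : b ∈ Submodule.span ℂ (S : Set (ι → ℂ)))
    (hb0 : lam b = 0) (hbn : b ≠ 0) {p : MvPolynomial ι ℂ} {m : ℕ} (hp : p.IsHomogeneous m)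
    (hm : m < 2 * S.card) (h0 : ∀ v ∈ S, eval v p = 0) (h1 : ∀ v ∈ S, dlin p v b = 0) : lineP x b p = 0 := by
  obtain ⟨T, hT, hTS⟩ := hS.params lam hl hx hb hb0 hbn
  by_contra hne
  have hdvd : (∏ s ∈ T, (Polynomial.X - Polynomial.C s) ^ 2) ∣ lineP x b p := by
    refine Finset.prod_dvd_of_coprime (fun s _ t _ hst => ?_) fun s hs => ?_
    · exact (Polynomial.isCoprime_X_sub_C_of_isUnit_sub (by simpa [sub_eq_zero] using hst)).pow
    · have e0 : (lineP x b p).eval s = 0 := by rw [eval_lineP]; exact h0 _ (hTS s hs)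
      have e1 : (lineP x b p).derivative.eval s = 0 := by rw [derivative_lineP]; exact h1 _ (hTS s hs)
      obtain ⟨Q, hQ⟩ := Polynomial.dvd_iff_isRoot.2 e0
      have e2 : Q.eval s = 0 := by
        rw [hQ] at e1; simpa [Polynomial.derivative_mul] using e1
      obtain ⟨Q', hQ'⟩ := Polynomial.dvd_iff_isRoot.2 e2
      exact ⟨Q', by rw [hQ, hQ']; ring⟩
  have h2 := Polynomial.natDegree_le_of_dvd hdvd hne
  rw [Polynomial.natDegree_prod_of_monic _ _ fun s _ => (Polynomial.monic_X_sub_C s).pow 2] at h2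
  have h3 := (lineP_natDegree x b p).trans hp.totalDegree_le
  simp [Polynomial.natDegree_pow, hT] at h2
  omega

section
variable {n : ℕ} {q g : MvPolynomial (Fin (n + 3)) ℂ}
    {F : Fin (n + 1) → MvPolynomial (Fin (n + 3)) ℂ} {lam : (Fin (n + 3) → ℂ) →ₗ[ℂ] ℂ}
    {f : MvPolynomial (Fin n) ℂ} {Φ : (Fin n → ℂ) → Finset (Fin (n + 3) → ℂ)} {δ : ℕ}

open Filter Topology in
theorem Gen.sum_lp (G : Gen q g F lam f Φ δ) (D : (Fin n → ℂ) → (Fin (n + 3) → ℂ))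
    (hD : ∀ y, eval y f ≠ 0 → DifferentiableAt ℂ D y)
    (hDb : ∃ (C : ℝ) (K : ℕ), ∀ y, eval y f ≠ 0 → ‖eval y f‖ * ‖D y‖ ≤ C * (1 + ‖y‖) ^ K)
    (H : (Fin (n + 3) → ℂ) → ℂ) (hH : Differentiable ℂ H) (k : ℕ) (C0 : ℝ) (hHb : ∀ w, ‖H w‖ ≤ C0 * ‖w‖ ^ k)
    (c0 : ℂ) :
    LP (fun y => eval y f ^ (k + 1) * ∑ v ∈ Φ y, H (c0 • v - D y)) ∧
    (∀ y, eval y f ≠ 0 → DifferentiableAt ℂ (fun y => ∑ v ∈ Φ y, H (c0 • v - D y)) y) ∧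
    ∃ (C : ℝ) (K : ℕ), ∀ y, eval y f ≠ 0 → ‖eval y f ^ k * ∑ v ∈ Φ y, H (c0 • v - D y)‖ ≤ C * (1 + ‖y‖) ^ K := by
  have hdiff : ∀ y, eval y f ≠ 0 → DifferentiableAt ℂ (fun y => ∑ v ∈ Φ y, H (c0 • v - D y)) y := by
    intro y0 hy0
    obtain ⟨U, hU, hyU, hUD, v, hv, hinj⟩ := G.branched y0 hy0
    have : DifferentiableAt ℂ (fun y => ∑ i, H (c0 • v i y - D y)) y0 := by
      refine DifferentiableAt.fun_sum fun i _ => ?_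
      exact (hH _).comp y0 ((((hv i).differentiableAt (hU.mem_nhds hyU)).const_smul c0).sub (hD y0 hy0))
    refine this.congr_of_eventuallyEq ?_
    filter_upwards [hU.mem_nhds hyU] with y hy
    rw [(hinj y hy).2, Finset.sum_image fun a _ b _ h => (hinj y hy).1 h]
  have hbound : ∃ (C : ℝ) (K : ℕ), ∀ y, eval y f ≠ 0 → ‖eval y f ^ k * ∑ v ∈ Φ y, H (c0 • v - D y)‖ ≤ C * (1 + ‖y‖) ^ K := by
    obtain ⟨C1, K1, h1⟩ := G.growth
    obtain ⟨C2, K2, h2⟩ := hDb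
    refine ⟨δ * (|C0| * (‖c0‖ * |C1| + |C2|) ^ k), (K1 + K2) * k, fun y hy => ?_⟩
    rw [norm_mul]
    have hone : 1 ≤ 1 + ‖y‖ := by linarith [norm_nonneg y]
    have hterm : ∀ v ∈ Φ y, ‖eval y f ^ k‖ * ‖H (c0 • v - D y)‖ ≤ |C0| * (‖c0‖ * |C1| + |C2|) ^ k * (1 + ‖y‖) ^ ((K1 + K2) * k) := by
      intro v hv
      have a1 : ‖eval y f‖ * ‖v‖ ≤ |C1| * (1 + ‖y‖) ^ (K1 + K2) := (h1 y hy v hv).trans (by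
        gcongr
        · exact le_abs_self _
        · omega)
      have a2 : ‖eval y f‖ * ‖D y‖ ≤ |C2| * (1 + ‖y‖) ^ (K1 + K2) := (h2 y hy).trans (by
        gcongr
        · exact le_abs_self _
        · omega)
      have a3 : ‖eval y f‖ * ‖c0 • v - D y‖ ≤ (‖c0‖ * |C1| + |C2|) * (1 + ‖y‖) ^ (K1 + K2) := by
        have := norm_sub_le (c0 • v) (D y)
        rw [norm_smul] at this
        calc _ ≤ ‖eval y f‖ * (‖c0‖ * ‖v‖ + ‖D y‖) := by gcongr
          _ = ‖c0‖ * (‖eval y f‖ * ‖v‖) + ‖eval y f‖ * ‖D y‖ := by ring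
          _ ≤ ‖c0‖ * (|C1| * (1 + ‖y‖) ^ (K1 + K2)) + |C2| * (1 + ‖y‖) ^ (K1 + K2) := by gcongr
          _ = _ := by ring
      calc _ ≤ ‖eval y f ^ k‖ * (|C0| * ‖c0 • v - D y‖ ^ k) := by
            gcongr
            exact (hHb _).trans (by gcongr; exact le_abs_self _)
        _ = |C0| * (‖eval y f‖ * ‖c0 • v - D y‖) ^ k := by rw [norm_pow, mul_pow]; ring
        _ ≤ |C0| * ((‖c0‖ * |C1| + |C2|) * (1 + ‖y‖) ^ (K1 + K2)) ^ k := by gcongr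
        _ = _ := by rw [mul_pow, ← pow_mul]; ring
    calc _ ≤ ‖eval y f ^ k‖ * ∑ v ∈ Φ y, ‖H (c0 • v - D y)‖ := by gcongr; exact norm_sum_le _ _
      _ = ∑ v ∈ Φ y, ‖eval y f ^ k‖ * ‖H (c0 • v - D y)‖ := Finset.mul_sum _ _ _
      _ ≤ ∑ v ∈ Φ y, |C0| * (‖c0‖ * |C1| + |C2|) ^ k * (1 + ‖y‖) ^ ((K1 + K2) * k) := Finset.sum_le_sum hterm
      _ = _ := by rw [Finset.sum_const, G.card y hy, nsmul_eq_mul]; ring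
  refine ⟨?_, hdiff, hbound⟩
  obtain ⟨C, K, hC⟩ := hbound
  exact LP.ext f _ k hdiff C K hC
end
end

open MvPolynomial
noncomputable section
section
variable {n : ℕ} {q g : MvPolynomial (Fin (n + 3)) ℂ}
    {F : Fin (n + 1) → MvPolynomial (Fin (n + 3)) ℂ} {lam : (Fin (n + 3) → ℂ) →ₗ[ℂ] ℂ}
    {f : MvPolynomial (Fin n) ℂ} {Φ : (Fin n → ℂ) → Finset (Fin (n + 3) → ℂ)} {δ : ℕ}

theorem Gen.lam_mem (G : Gen q g F lam f Φ δ) {y} (hy : eval y f ≠ 0) {v} (hv : v ∈ Φ y) : lam v = 1 :=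
  ((G.mem y hy v).1 hv).1

theorem Gen.frame0 (G : Gen q g F lam f Φ δ) (hδ : 2 ≤ δ) {ys} (hy : eval ys f ≠ 0) :
    ∃ (S b : (Fin n → ℂ) → (Fin (n + 3) → ℂ)) (N : ℕ), 1 ≤ N ∧
      (∀ i, LP (fun y => eval y f ^ N * S y i)) ∧ (∀ i, LP (fun y => eval y f ^ N * b y i)) ∧
      (∀ y, eval y f ≠ 0 → DifferentiableAt ℂ S y ∧ DifferentiableAt ℂ b y ∧
        S y ∈ Submodule.span ℂ (Φ y : Set (Fin (n + 3) → ℂ)) ∧ b y ∈ Submodule.span ℂ (Φ y : Set (Fin (n + 3) → ℂ)) ∧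
        lam (S y) = δ ∧ lam (b y) = 0) ∧ b ys ≠ 0 := by
  classical
  set S : (Fin n → ℂ) → (Fin (n + 3) → ℂ) := fun y => ∑ v ∈ Φ y, v with hSdef
  have h1 := fun i : Fin (n + 3) => G.sum_lp (fun _ => 0) (fun _ _ => differentiableAt_const _)
    ⟨0, 0, by simp⟩ (fun w => w i) (by fun_prop) 1 1 (fun w => by simpa using norm_le_pi_norm w i) 1
  have hSi : ∀ (i : Fin (n + 3)) y, ∑ v ∈ Φ y, (((1 : ℂ) • v - 0 : Fin (n + 3) → ℂ) i) = S y i := by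
    intro i y; simp [hSdef, Finset.sum_apply]
  simp only [hSi] at h1
  have hSd : ∀ y, eval y f ≠ 0 → DifferentiableAt ℂ S y := fun y hy =>
    differentiableAt_pi.2 fun i => (h1 i).2.1 y hy
  have hSb : ∃ (C : ℝ) (K : ℕ), ∀ y, eval y f ≠ 0 → ‖eval y f‖ * ‖S y‖ ≤ C * (1 + ‖y‖) ^ K := by
    have h2 := fun i => (h1 i).2.2
    choose C K hCK using h2
    refine ⟨∑ i, |C i|, ∑ i, K i, fun y hy => ?_⟩
    rw [← norm_smul]
    refine (pi_norm_le_iff_of_nonneg (by positivity)).2 fun i => ?_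
    have := hCK i y hy
    rw [pow_one] at this
    rw [Pi.smul_apply, smul_eq_mul]
    refine this.trans ?_
    have hone : 1 ≤ 1 + ‖y‖ := by linarith [norm_nonneg y]
    calc _ ≤ |C i| * (1 + ‖y‖) ^ K i := by gcongr; exact le_abs_self _
      _ ≤ (∑ i, |C i|) * (1 + ‖y‖) ^ (∑ i, K i) := by
        have e1 : |C i| ≤ ∑ i, |C i| :=
          Finset.single_le_sum (f := fun i => |C i|) (fun i _ => abs_nonneg _) (Finset.mem_univ i)
        have e2 : K i ≤ ∑ i, K i :=
          Finset.single_le_sum (f := fun i => K i) (fun i _ => Nat.zero_le _) (Finset.mem_univ i)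
        gcongr
  -- a nonzero difference at the base point
  have hcard := G.card ys hy
  have hex : ∃ v ∈ Φ ys, (δ : ℂ) • v - S ys ≠ 0 := by
    by_contra h
    push Not at h
    obtain ⟨v, hv, w, hw, hvw⟩ := Finset.one_lt_card.1 (show 1 < (Φ ys).card by omega)
    have : (δ : ℂ) • v = (δ : ℂ) • w := by
      rw [sub_eq_zero.1 (h v hv), sub_eq_zero.1 (h w hw)]
    exact hvw (smul_right_injective _ (show (δ : ℂ) ≠ 0 by exact_mod_cast (by omega : δ ≠ 0)) this)
  obtain ⟨v0, hv0, hd0⟩ := hex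
  obtain ⟨μ, hμ⟩ := exists_dual hd0
  obtain ⟨k, hk⟩ := exists_powersum' (Φ ys) (fun v => μ ((δ : ℂ) • v - S ys)) v0 hv0 hμ
  set b : (Fin n → ℂ) → (Fin (n + 3) → ℂ) := fun y =>
    ∑ v ∈ Φ y, μ ((δ : ℂ) • v - S y) ^ k • ((δ : ℂ) • v - S y) with hbdef
  have hμc : Continuous μ := μ.continuous_of_finiteDimensional
  obtain ⟨Cμ, hCμ⟩ : ∃ Cμ : ℝ, ∀ w, ‖μ w‖ ≤ Cμ * ‖w‖ :=
    ⟨‖LinearMap.toContinuousLinearMap μ‖, fun w => (LinearMap.toContinuousLinearMap μ).le_opNorm w⟩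
  have h2 := fun i : Fin (n + 3) => G.sum_lp S hSd hSb (fun w => μ w ^ k * w i)
    (by
      have : Differentiable ℂ μ := (LinearMap.toContinuousLinearMap μ).differentiable
      fun_prop) (k + 1) (Cμ ^ k)
    (fun w => by
      rw [norm_mul, norm_pow]
      calc _ ≤ (Cμ * ‖w‖) ^ k * ‖w‖ := by
            gcongr
            · exact pow_nonneg ((norm_nonneg _).trans (hCμ w)) k
            · exact hCμ w
            · exact norm_le_pi_norm w i
        _ = _ := by rw [mul_pow, pow_succ]; ring) δ
  have hbi : ∀ (i : Fin (n + 3)) y,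
      ∑ v ∈ Φ y, (μ ((δ : ℂ) • v - S y) ^ k * (((δ : ℂ) • v - S y) i)) = b y i := by
    intro i y; simp [hbdef, Finset.sum_apply]
  simp only [hbi] at h2
  refine ⟨S, b, k + 1 + 1, by omega, fun i => ?_, fun i => (h2 i).1, fun y hy => ⟨hSd y hy,
    differentiableAt_pi.2 fun i => (h2 i).2.1 y hy, ?_, ?_, ?_, ?_⟩, ?_⟩
  · have := LP.mul (LP.eval (f ^ k)) (h1 i).1
    convert this using 2
    rw [map_pow]; ring
  · exact Submodule.sum_mem _ fun v hv => Submodule.subset_span hv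
  · refine Submodule.sum_mem _ fun v hv => Submodule.smul_mem _ _ (Submodule.sub_mem _
      (Submodule.smul_mem _ _ (Submodule.subset_span hv)) ?_)
    exact Submodule.sum_mem _ fun v hv => Submodule.subset_span hv
  · rw [hSdef]; beta_reduce
    rw [map_sum, Finset.sum_congr rfl fun v hv => G.lam_mem hy hv]
    simp [G.card y hy]
  · have hl : lam (S y) = δ := by
      rw [hSdef]; beta_reduce
      rw [map_sum, Finset.sum_congr rfl fun v hv => G.lam_mem hy hv]
      simp [G.card y hy]
    rw [hbdef]; beta_reduce
    rw [map_sum]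
    refine Finset.sum_eq_zero fun v hv => ?_
    rw [map_smul, lam.map_sub, lam.map_smul, G.lam_mem hy hv, hl]; simp
  · intro h
    apply hk
    have := congrArg μ h
    rw [map_zero, hbdef] at this
    beta_reduce at this
    rw [map_sum] at this
    rw [← this]
    refine Finset.sum_congr rfl fun v _ => ?_
    rw [map_smul, smul_eq_mul, pow_succ]

open Filter Topology in
/-- polynomial frames of the family of lines, adapted to a point -/
theorem Gen.frame (G : Gen q g F lam f Φ δ) (hδ : 2 ≤ δ) (hcol : ∀ y, eval y f ≠ 0 → Col (Φ y))
    {ys} (hy : eval ys f ≠ 0) {x} (hx : x ∈ Φ ys) :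
    ∃ A B : (Fin n → ℂ) → (Fin (n + 3) → ℂ), (∀ i, LP (fun y => A y i)) ∧ (∀ i, LP (fun y => B y i)) ∧
      (∀ y, eval y f = 0 → A y = 0 ∧ B y = 0) ∧
      (∀ y, eval y f ≠ 0 → A y ∈ Submodule.span ℂ (Φ y : Set (Fin (n + 3) → ℂ)) ∧
        B y ∈ Submodule.span ℂ (Φ y : Set (Fin (n + 3) → ℂ))) ∧
      A ys = x ∧ B ys ≠ 0 ∧ lam (B ys) = 0 ∧
      ∀ e, ∃ ξ, dPsi q g F lam x ξ = (0, 0, 0, e) ∧ ∃ p r : ℂ,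
        HasDerivAt (fun s : ℂ => A (ys + s • e)) (ξ + p • x + r • B ys) 0 := by
  obtain ⟨S, b, N, hN, hSL, hbL, hprop, hbne⟩ := G.frame0 hδ hy
  have hδ0 : (δ : ℂ) ≠ 0 := by exact_mod_cast (by omega : δ ≠ 0)
  obtain ⟨ν, hν⟩ := exists_dual hbne
  obtain ⟨cs, hcs⟩ := (hcol ys hy).param lam hx (G.lam_mem hy hx) (hprop ys hy).2.2.2.1 (hprop ys hy).2.2.2.2.2
    hbne (Submodule.smul_mem _ (δ : ℂ)⁻¹ (hprop ys hy).2.2.1)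
  rw [map_smul, (hprop ys hy).2.2.2.2.1, smul_eq_mul, inv_mul_cancel₀ hδ0, one_smul] at hcs
  set a : (Fin n → ℂ) → (Fin (n + 3) → ℂ) := fun y => (δ : ℂ)⁻¹ • S y - cs • b y with ha
  have has : a ys = x := by rw [ha]; beta_reduce; rw [hcs]; abel
  have hfN : eval ys f ^ N ≠ 0 := pow_ne_zero _ hy
  set h : (Fin n → ℂ) → ℂ := fun y => eval y f ^ N / eval ys f ^ N with hh
  have hh1 : h ys = 1 := div_self hfN
  refine ⟨fun y => h y • a y, fun y => h y • b y, fun i => ?_, fun i => ?_, fun y hy0 => ?_, fun y hy0 => ?_, ?_, ?_, ?_, ?_⟩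
  · have := (LP.mul (LP.const ((eval ys f ^ N)⁻¹ * (δ : ℂ)⁻¹)) (hSL i)).add
      (LP.mul (LP.const (-(eval ys f ^ N)⁻¹ * cs)) (hbL i))
    convert this using 2
    simp [hh, ha]; ring
  · have := LP.mul (LP.const ((eval ys f ^ N)⁻¹)) (hbL i)
    convert this using 2
    simp [hh]; ring
  · have : h y = 0 := by simp [hh, hy0]; omega
    simp [this]
  · refine ⟨Submodule.smul_mem _ _ (Submodule.sub_mem _ (Submodule.smul_mem _ _ (hprop y hy0).2.2.1)
      (Submodule.smul_mem _ _ (hprop y hy0).2.2.2.1)), Submodule.smul_mem _ _ (hprop y hy0).2.2.2.1⟩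
  · beta_reduce; rw [hh1, has, one_smul]
  · beta_reduce; rw [hh1, one_smul]; exact hbne
  · beta_reduce; rw [hh1, one_smul]; exact (hprop ys hy).2.2.2.2.2
  · intro e
    obtain ⟨U, hU, hyU, hUD, v, hv, hinj⟩ := G.branched ys hy
    have hx' := hx
    rw [(hinj ys hyU).2] at hx'
    obtain ⟨i0, -, hi0⟩ := Finset.mem_image.1 hx'
    have hvm : ∀ y ∈ U, v i0 y ∈ Φ y := fun y hyy => by
      rw [(hinj y hyy).2]; exact Finset.mem_image_of_mem _ (Finset.mem_univ _)
    have hsd := G.section_deriv hU hUD (hv i0) hvm hyU e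
    rw [hi0] at hsd
    refine ⟨_, hsd, ?_⟩
    set γ : ℂ → (Fin n → ℂ) := fun s => ys + s • e with hγ
    have hγd : HasDerivAt γ e 0 := by
      simpa [hγ] using ((hasDerivAt_id (0 : ℂ)).smul_const e).const_add ys
    have hγ0 : γ 0 = ys := by simp [hγ]
    have comp : ∀ {E : Type} [NormedAddCommGroup E] [NormedSpace ℂ E] (H : (Fin n → ℂ) → E), DifferentiableAt ℂ H ys →
        HasDerivAt (fun s => H (γ s)) (fderiv ℂ H ys e) 0 := by
      intro E _ _ H hH
      have h1 : HasFDerivAt H (fderiv ℂ H ys) (γ 0) := by rw [hγ0]; exact hH.hasFDerivAt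
      exact h1.comp_hasDerivAt 0 hγd
    have dv := comp (v i0) ((hv i0).differentiableAt (hU.mem_nhds hyU))
    have hSd := (hprop ys hy).1
    have hbd := (hprop ys hy).2.1
    have hada : DifferentiableAt ℂ a ys := by
      rw [ha]; exact (hSd.const_smul ((δ : ℂ)⁻¹)).sub (hbd.const_smul cs)
    have da := comp a hada
    have db := comp b hbd
    have dh := comp h (by
      rw [hh]
      have := ((contDiff_eval f).differentiable one_ne_zero) ys
      fun_prop)
    set z : (Fin n → ℂ) → (Fin (n + 3) → ℂ) := fun y => v i0 y - a y with hz
    have dz : HasDerivAt (fun s => z (γ s)) (fderiv ℂ (v i0) ys e - fderiv ℂ a ys e) 0 := dv.sub da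
    set z' := fderiv ℂ (v i0) ys e - fderiv ℂ a ys e with hz'
    set b' := fderiv ℂ b ys e
    have hz0 : z (γ 0) = 0 := by rw [hz, hγ0]; beta_reduce; rw [hi0, has, sub_self]
    have hb0 : b (γ 0) = b ys := by rw [hγ0]
    have hev : (fun s => ν (b (γ s)) • z (γ s)) =ᶠ[𝓝 0] fun s => ν (z (γ s)) • b (γ s) := by
      have : ∀ᶠ s in 𝓝 (0 : ℂ), γ s ∈ U :=
        hγd.continuousAt.eventually (by rw [hγ0]; exact hU.mem_nhds hyU)
      filter_upwards [this] with s hs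
      have hs0 := hUD hs
      have P := hprop _ hs0
      refine (hcol _ hs0).ker lam (hvm _ hs) (G.lam_mem hs0 (hvm _ hs)) ?_ P.2.2.2.1 ?_ P.2.2.2.2.2 ν
      · exact Submodule.sub_mem _ (Submodule.subset_span (hvm _ hs)) (Submodule.sub_mem _ (Submodule.smul_mem _ _ P.2.2.1)
          (Submodule.smul_mem _ _ P.2.2.2.1))
      · rw [hz, ha]; beta_reduce
        rw [map_sub, map_sub, map_smul, map_smul, P.2.2.2.2.1, P.2.2.2.2.2, G.lam_mem hs0 (hvm _ hs)]
        simp [hδ0]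
    have νd : ∀ {c : ℂ → Fin (n + 3) → ℂ} {c'}, HasDerivAt c c' 0 → HasDerivAt (fun s => ν (c s)) (ν c') 0 := by
      intro c c' hc
      exact (LinearMap.toContinuousLinearMap ν).hasFDerivAt.comp_hasDerivAt 0 hc
    have l1 := (νd db).smul dz
    have l2 := (νd dz).smul db
    have l3 := l1.unique (l2.congr_of_eventuallyEq hev)
    rw [hz0, hb0, map_zero, smul_zero, zero_smul, add_zero, zero_add] at l3
    refine ⟨fderiv ℂ h ys e, -(ν z' / ν (b ys)), ?_⟩
    have l4 := dh.smul da
    rw [hγ0, hh1, has, one_smul] at l4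
    beta_reduce
    rw [hh1, one_smul]
    refine l4.congr_deriv ?_
    have l5 : z' = (ν z' / ν (b ys)) • b ys := by
      rw [div_eq_inv_mul, mul_smul, ← l3, smul_smul, inv_mul_cancel₀ hν, one_smul]
    rw [neg_smul, ← l5, hz']
    abel
end
end

open MvPolynomial
noncomputable section

theorem Col.van {ι : Type} [Fintype ι] {S : Finset (ι → ℂ)} (hS : Col S) (lam : (ι → ℂ) →ₗ[ℂ] ℂ)
    (hl : ∀ v ∈ S, lam v = 1) (h2 : 2 ≤ S.card) {p : MvPolynomial ι ℂ} {m : ℕ} (hp : p.IsHomogeneous m)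
    (h0 : ∀ v ∈ S, eval v p = 0)
    (hm : m < S.card ∨ (m < 2 * S.card ∧ ∀ b ∈ Submodule.span ℂ (S : Set (ι → ℂ)), lam b = 0 → b ≠ 0 →
      ∀ v ∈ S, dlin p v b = 0)) {w : ι → ℂ} (hw : w ∈ Submodule.span ℂ (S : Set (ι → ℂ))) : eval w p = 0 := by
  obtain ⟨x, hx, x', hx', hne⟩ := Finset.one_lt_card.1 (show 1 < S.card by omega)
  have hb : x - x' ∈ Submodule.span ℂ (S : Set (ι → ℂ)) :=
    Submodule.sub_mem _ (Submodule.subset_span hx) (Submodule.subset_span hx')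
  have hb0 : lam (x - x') = 0 := by rw [map_sub, hl x hx, hl x' hx', sub_self]
  have hbn : x - x' ≠ 0 := sub_ne_zero.2 hne
  obtain ⟨r, hr⟩ := hS.param lam hx (hl x hx) hb hb0 hbn hw
  rw [hr]
  refine eval_of_lineP hp ?_ _ _
  rcases hm with hm | ⟨hm, h1⟩
  · exact lineP_zero hS lam hl hx hb hb0 hbn hp hm h0
  · exact lineP_zero2 hS lam hl hx hb hb0 hbn hp hm h0 (h1 _ hb hb0 hbn)

theorem tan_of_van {ι : Type} [Fintype ι] {p : MvPolynomial ι ℂ} {α β : ℂ → ι → ℂ} {u v : ι → ℂ}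
    (hα : HasDerivAt α u 0) (hβ : HasDerivAt β v 0) (h : ∀ τ x z : ℂ, eval (x • α τ + z • β τ) p = 0) (x z : ℂ) :
    dlin p (x • α 0 + z • β 0) (x • u + z • v) = 0 := by
  have h1 : HasDerivAt (fun τ => x • α τ + z • β τ) (x • u + z • v) 0 := (hα.const_smul x).add (hβ.const_smul z)
  have h2 := (hasFDerivAt_eval p (x • α 0 + z • β 0)).comp_hasDerivAt 0 h1
  have h3 : ((fun v => eval v p) ∘ fun τ => x • α τ + z • β τ) = fun _ => 0 := by
    funext τ; exact h τ x z
  rw [h3] at h2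
  exact h2.unique (hasDerivAt_const _ _)

theorem LP.deriv {σ κ : Type} [Fintype κ] {A : (σ → ℂ) → κ → ℂ} (hA : ∀ i, LP (fun y => A y i)) (y e : σ → ℂ) :
    ∃ u, HasDerivAt (fun s : ℂ => A (y + s • e)) u 0 := by
  choose K hK using hA
  choose p hp hp' using fun i => hK i y e
  refine ⟨fun i => (p i).derivative.eval 0, hasDerivAt_pi.2 fun i => ?_⟩
  have : (fun s : ℂ => A (y + s • e) i) = fun s => (p i).eval s := funext fun s => hp' i s
  rw [this]
  exact (p i).hasDerivAt 0

theorem minor_of_smooth {ι : Type} [Fintype ι] {q g : MvPolynomial ι ℂ} (hX : IsSmoothCI2 q g) {v : ι → ℂ}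
    (hv : v ≠ 0) (h1 : eval v q = 0) (h2 : eval v g = 0) :
    ∃ w w', dlin q v w * dlin g v w' - dlin q v w' * dlin g v w ≠ 0 := by
  classical
  by_contra h
  push Not at h
  have hs : ∀ (p : MvPolynomial ι ℂ) i, dlin p v (Pi.single i 1) = eval v (pderiv i p) := by
    intro p i; rw [dlin_apply]; simp [Pi.single_apply]
  have h3 : ∀ w, dlin q v w = 0 := by
    intro w
    refine (hX v hv h1 h2 (-dlin g v w) (dlin q v w) fun i => ?_).2
    have := h w (Pi.single i 1)
    rw [hs, hs] at this
    linear_combination this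
  have := (hX v hv h1 h2 1 0 fun i => by rw [← hs, h3]; simp).1
  exact one_ne_zero this

/-- gradient along a line -/
def grL (p : MvPolynomial (Fin 6) ℂ) (a b : Fin 6 → ℂ) : (Fin 6 → Polynomial ℂ) →ₗ[Polynomial ℂ] Polynomial ℂ :=
  ∑ i, lineP a b (pderiv i p) • LinearMap.proj i

theorem grL_apply (p : MvPolynomial (Fin 6) ℂ) (a b : Fin 6 → ℂ) (W : Fin 6 → Polynomial ℂ) :
    grL p a b W = ∑ i, lineP a b (pderiv i p) * W i := by
  simp [grL]

theorem grL_eval (p : MvPolynomial (Fin 6) ℂ) (a b : Fin 6 → ℂ) (W : Fin 6 → Polynomial ℂ) (s : ℂ) :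
    (grL p a b W).eval s = dlin p (a + s • b) (fun i => (W i).eval s) := by
  rw [grL_apply, Polynomial.eval_finsetSum, dlin_apply]
  simp [eval_lineP]

theorem grL_deg {p : MvPolynomial (Fin 6) ℂ} {m : ℕ} (hp : p.IsHomogeneous (m + 1)) (a b w : Fin 6 → ℂ) :
    (grL p a b (FO.cst _ w)).natDegree ≤ m := by
  rw [grL_apply]
  refine Polynomial.natDegree_sum_le_of_forall_le _ _ fun i _ => ?_
  refine (Polynomial.natDegree_mul_le).trans ?_
  have h1 : (lineP a b (pderiv i p)).natDegree ≤ m :=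
    (lineP_natDegree _ _ _).trans (by simpa using (hp.pderiv (i := i)).totalDegree_le)
  have h2 : (FO.cst (Polynomial ℂ) w i).natDegree = 0 := by simp [FO.cst]
  omega

theorem grL_coeff {p : MvPolynomial (Fin 6) ℂ} {m : ℕ} (hp : p.IsHomogeneous (m + 1)) (a b w : Fin 6 → ℂ) :
    (grL p a b (FO.cst _ w)).coeff m = dlin p b w := by
  rw [grL_apply, Polynomial.finsetSum_coeff, dlin_apply]
  refine Finset.sum_congr rfl fun i _ => ?_
  have h2 : FO.cst (Polynomial ℂ) w i = Polynomial.C (w i) := by simp [FO.cst]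
  have h3 : (pderiv i p).IsHomogeneous m := by simpa using hp.pderiv (i := i)
  rw [h2, Polynomial.coeff_mul_C, lineP_coeff a b h3]

theorem dep4 (a b u e : Fin 6 → ℂ) (hab : LinearIndependent ℂ ![a, b]) (h : ∀ w w', vol6 a b w w' u e = 0) :
    ∃ r s α β : ℂ, (r ≠ 0 ∨ s ≠ 0) ∧ r • u + s • e = α • a + β • b := by
  obtain ⟨z, hz⟩ : ∃ z, z ∉ Submodule.span ℂ (Set.range ![a, b, u, e]) := by
    by_contra hcon
    push Not at hcon
    have h1 : Submodule.span ℂ (Set.range ![a, b, u, e]) = ⊤ := by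
      rw [eq_top_iff]; exact fun w _ => hcon w
    have h2 := finrank_range_le_card (R := ℂ) ![a, b, u, e]
    rw [Set.finrank, h1] at h2
    simp at h2
  have hm : ∀ i, ![a, b, u, e] i ∈ Submodule.span ℂ (Set.range ![a, b, u, e]) := fun i =>
    Submodule.subset_span ⟨i, rfl⟩
  obtain ⟨α, β, r, s, t, hne, heq⟩ := dep_of_vol6 a b u e z hab (fun w => h z w)
  have ht : t = 0 := by
    by_contra ht
    apply hz
    have : z = t⁻¹ • (α • a + β • b - r • u - s • e) := by
      rw [← heq, eq_inv_smul_iff₀ ht]; abel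
    rw [this]
    refine Submodule.smul_mem _ _ (Submodule.sub_mem _ (Submodule.sub_mem _ (Submodule.add_mem _ ?_ ?_) ?_) ?_) <;>
      apply Submodule.smul_mem
    exacts [hm 0, hm 1, hm 2, hm 3]
  subst ht
  refine ⟨r, s, α, β, by simpa using hne, by simpa using heq⟩
end

open MvPolynomial
noncomputable section

theorem li_pair {ι : Type} (lam : (ι → ℂ) →ₗ[ℂ] ℂ) {x b : ι → ℂ} (hx : lam x = 1) (hb : lam b = 0) (hbn : b ≠ 0)
    {s t : ℂ} (h : s • x + t • b = 0) : s = 0 ∧ t = 0 := by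
  have h1 := congrArg lam h
  simp only [map_add, map_smul, hx, hb, smul_eq_mul, mul_one, mul_zero, add_zero, map_zero] at h1
  refine ⟨h1, ?_⟩
  rw [h1, zero_smul, zero_add] at h
  exact (smul_eq_zero.1 h).resolve_right hbn

theorem minor_pair {ι : Type} (lam : (ι → ℂ) →ₗ[ℂ] ℂ) {x b : ι → ℂ} (hx : lam x = 1) (hb : lam b = 0) (hbn : b ≠ 0) :
    ∃ i j, x i * b j - x j * b i ≠ 0 := by
  by_contra h
  push Not at h
  apply hbn
  funext j
  have h1 : b j • x = x j • b := by
    funext i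
    simp only [Pi.smul_apply, smul_eq_mul]
    linear_combination h i j
  have h2 := congrArg lam h1
  simpa [hx, hb] using h2

section
variable {n : ℕ} {q g : MvPolynomial (Fin (n + 3)) ℂ}
    {F : Fin (n + 1) → MvPolynomial (Fin (n + 3)) ℂ} {lam : (Fin (n + 3) → ℂ) →ₗ[ℂ] ℂ}
    {f : MvPolynomial (Fin n) ℂ} {Φ : (Fin n → ℂ) → Finset (Fin (n + 3) → ℂ)} {δ : ℕ}

/-- `q` vanishes on the span of each fibre -/
theorem Gen.q_span (G : Gen q g F lam f Φ δ) (hq : q.IsHomogeneous 3) (hδ : 4 ≤ δ)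
    (hcol : ∀ y, eval y f ≠ 0 → Col (Φ y)) {y} (hy : eval y f ≠ 0) {w}
    (hw : w ∈ Submodule.span ℂ (Φ y : Set (Fin (n + 3) → ℂ))) : eval w q = 0 := by
  have hc := G.card y hy
  exact (hcol y hy).van lam (fun v hv => G.lam_mem hy hv) (by omega) hq
    (fun v hv => ((G.mem y hy v).1 hv).2.1) (Or.inl (by omega)) hw

/-- linear combinations of tangent vectors lying in the line -/
theorem Gen.lin_comb (e : Fin n → ℂ) {x b ζ : Fin (n + 3) → ℂ} (hx : lam x = 1) (hb : lam b = 0)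
    (hζ : dPsi q g F lam x ζ = (0, 0, 0, e)) {s t : ℂ} (h : ζ = s • x + t • b) :
    ζ = t • b ∧ (t * dlin g x b = 0) ∧ ∀ j, e j = t * dphi F x j b := by
  rw [dPsi_eq, Prod.mk.injEq, Prod.mk.injEq, Prod.mk.injEq] at hζ
  have h1 : s = 0 := by
    have := hζ.1
    rw [h] at this
    simpa [hx, hb] using this
  rw [h1, zero_smul, zero_add] at h
  refine ⟨h, ?_, fun j => ?_⟩
  · rw [← hζ.2.2.1, h, map_smul, smul_eq_mul]
  · rw [← hζ.2.2.2, h]; simp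
end

section
variable {q g : MvPolynomial (Fin 6) ℂ}
    {F : Fin 4 → MvPolynomial (Fin 6) ℂ} {lam : (Fin 6 → ℂ) →ₗ[ℂ] ℂ}
    {f : MvPolynomial (Fin 3) ℂ} {Φ : (Fin 3 → ℂ) → Finset (Fin 6 → ℂ)} {δ d : ℕ}

/-- threefold case, transversal lines -/
theorem Gen.transversal3 (G : Gen (n := 3) q g F lam f Φ δ) (hq : IsSmoothHyp q 3) (hδ : 4 ≤ δ)
    (hcol : ∀ y, eval y f ≠ 0 → Col (Φ y)) {y} (hy : eval y f ≠ 0) {x} (hx : x ∈ Φ y) {b0 : Fin 6 → ℂ}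
    (hb : b0 ∈ Submodule.span ℂ (Φ y : Set (Fin 6 → ℂ))) (hb0 : lam b0 = 0) : dlin g x b0 = 0 := by
  by_contra htr
  obtain ⟨A, B, hA, hB, hz, hsp, hAx, hBn, hBl, hder⟩ := G.frame (by omega) hcol hy hx
  have hx1 : lam x = 1 := G.lam_mem hy hx
  have htr' : dlin g x (B y) ≠ 0 := by
    obtain ⟨r, hr⟩ := (hcol y hy).param lam hx hx1 (hsp y hy).2 hBl hBn hb
    rw [hb0, zero_smul, zero_add] at hr
    rw [hr, map_smul, smul_eq_mul] at htr
    exact right_ne_zero_of_mul htr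
  obtain ⟨c, hs, hcq, hcd⟩ := exists_tensor hq.1
  have hsmall : ∀ p : Fin 6 → ℂ, p ≠ 0 → ∃ w, tri c p p w ≠ 0 := by
    intro p hp
    by_contra h
    push Not at h
    refine hq.2.2 p hp fun i => ?_
    have := hcd p (Pi.single i 1)
    rw [h, mul_zero, dlin_apply] at this
    simpa [Pi.single_apply] using this
  have hvan : ∀ y (s t : ℂ), tri c (s • A y + t • B y) (s • A y + t • B y) (s • A y + t • B y) = 0 := by
    intro y s t
    rw [← hcq]
    by_cases hy : eval y f = 0
    · rw [(hz y hy).1, (hz y hy).2, hcq]; simp [tri]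
    · exact G.q_span hq.1 hδ hcol hy (Submodule.add_mem _ (Submodule.smul_mem _ _ (hsp y hy).1)
        (Submodule.smul_mem _ _ (hsp y hy).2))
  have hder' := fun i : Fin 3 => hder (Pi.single i 1)
  choose ξ hξ P R hu using hder'
  choose v hv using fun i : Fin 3 => LP.deriv hB y (Pi.single i 1)
  set u : Fin 3 → Fin 6 → ℂ := fun i => ξ i + P i • x + R i • B y with hudef
  have key := fun i j : Fin 3 => FO.plane hs
    (fun s t => A (y + s • Pi.single i 1 + t • Pi.single j 1)) (fun s t => B (y + s • Pi.single i 1 + t • Pi.single j 1))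
    (fun k => LP.plane (hA k) _ _ _) (fun k => LP.plane (hB k) _ _ _) (fun s t x z => hvan _ x z)
    (by simpa [hAx] using minor_pair lam hx1 hBl hBn) (fun _ => ⊤) (fun _ _ => trivial) (fun _ _ => trivial)
    (fun _ p _ hp => hsmall p hp) (us := u i) (ut := u j) (vs := v i) (vt := v j)
    (by simpa using hu i) (by simpa using hu j) (by simpa using hv i) (by simpa using hv j)
  simp only [zero_smul, add_zero, hAx] at key
  refine FO.contra3 hs x (B y) u v (fun i j _ => (key i j).1) ?_ (fun i j _ => (key i j).2) ?_
  · intro s t hst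
    refine hsmall _ fun h => ?_
    obtain ⟨h1, h2⟩ := li_pair lam hx1 hBl hBn h
    rcases hst with h | h
    exacts [h h1, h h2]
  · rw [Fintype.linearIndependent_iff]
    intro k hk
    simp only [Fin.sum_univ_five] at hk
    change k 0 • x + k 1 • B y + k 2 • u 2 + k 3 • u 0 + k 4 • u 1 = 0 at hk
    simp only [hudef] at hk
    set ζ := k 2 • ξ 2 + k 3 • ξ 0 + k 4 • ξ 1 with hζ
    have hζe : dPsi (n := 3) q g F lam x ζ = (0, 0, 0, k 2 • Pi.single 2 1 + k 3 • Pi.single 0 1 + k 4 • Pi.single 1 1) := by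
      rw [hζ]; simp only [map_add, map_smul, hξ]; simp
    have hζ2 : ζ = (-(k 0 + k 2 * P 2 + k 3 * P 0 + k 4 * P 1)) • x +
        (-(k 1 + k 2 * R 2 + k 3 * R 0 + k 4 * R 1)) • B y := by
      rw [hζ, ← sub_eq_zero, ← hk]
      module
    obtain ⟨h1, h2, h3⟩ := Gen.lin_comb (n := 3) _ hx1 hBl hζe hζ2
    have h4 := (mul_eq_zero.1 h2).resolve_right htr'
    rw [h4] at h3
    have e0 := h3 0
    have e1 := h3 1
    have e2 := h3 2
    simp [Pi.single_apply] at e0 e1 e2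
    have h5 : k 0 • x + k 1 • B y = 0 := by
      rw [← hk, e0, e1, e2]; module
    obtain ⟨h6, h7⟩ := li_pair lam hx1 hBl hBn h5
    intro i
    fin_cases i
    exacts [h6, h7, e2, e0, e1]
end
end

open MvPolynomial
noncomputable section
section
variable {q g : MvPolynomial (Fin 6) ℂ}
    {F : Fin 4 → MvPolynomial (Fin 6) ℂ} {lam : (Fin 6 → ℂ) →ₗ[ℂ] ℂ}
    {f : MvPolynomial (Fin 3) ℂ} {Φ : (Fin 3 → ℂ) → Finset (Fin 6 → ℂ)} {δ d : ℕ}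

theorem grL_zero {p : MvPolynomial (Fin 6) ℂ} {a b : Fin 6 → ℂ} {W : Fin 6 → Polynomial ℂ}
    (h : ∀ s : ℂ, dlin p (a + s • b) (fun i => (W i).eval s) = 0) : grL p a b W = 0 :=
  Polynomial.funext fun s => by rw [grL_eval, h]; simp

theorem cst_eval (w : Fin 6 → ℂ) (s : ℂ) : (fun i => (FO.cst (Polynomial ℂ) w i).eval s) = w := by
  funext i; simp [FO.cst]

/-- threefold case -/
theorem Gen.lower3 (G : Gen (n := 3) q g F lam f Φ δ) (hq : IsSmoothHyp q 3) (hg : g.IsHomogeneous d)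
    (hX : IsSmoothCI2 q g) (hd : 2 ≤ d) (hδ : 4 ≤ δ) (hdδ : d < 2 * δ)
    (hcol : ∀ y, eval y f ≠ 0 → Col (Φ y)) : False := by
  obtain ⟨y, hy⟩ := exists_eval_ne G.f_ne
  obtain ⟨x, hx⟩ := Finset.card_pos.1 (show 0 < (Φ y).card by rw [G.card y hy]; omega)
  obtain ⟨A, B, hA, hB, hz, hsp, hAx, hBn, hBl, hder⟩ := G.frame (by omega) hcol hy hx
  have hx1 : lam x = 1 := G.lam_mem hy hx
  obtain ⟨m, rfl⟩ : ∃ m, d = m + 1 := ⟨d - 1, by omega⟩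
  have hvan : ∀ p : MvPolynomial (Fin 6) ℂ, p = q ∨ p = g → ∀ y (s t : ℂ), eval (s • A y + t • B y) p = 0 := by
    intro p hp y s t
    by_cases hy : eval y f = 0
    · rw [(hz y hy).1, (hz y hy).2]
      rcases hp with rfl | rfl
      · have := homog_eval hq.1 0 0
        simpa using this
      · have := homog_eval hg 0 0
        simpa using this
    · have hmem := Submodule.add_mem _ (Submodule.smul_mem _ s (hsp y hy).1) (Submodule.smul_mem _ t (hsp y hy).2)
      rcases hp with rfl | rfl
      · exact G.q_span hq.1 hδ hcol hy hmem
      · have hc := G.card y hy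
        exact (hcol y hy).van lam (fun v hv => G.lam_mem hy hv) (by omega) hg
          (fun v hv => ((G.mem y hy v).1 hv).2.2.1) (Or.inr ⟨by omega, fun b hb hb0 _ v hv =>
            G.transversal3 hq hδ hcol hy hv hb hb0⟩) hmem
  have hder' := fun i : Fin 3 => hder (Pi.single i 1)
  choose ξ hξ P R hu using hder'
  choose v hv using fun i : Fin 3 => LP.deriv hB y (Pi.single i 1)
  set u : Fin 3 → Fin 6 → ℂ := fun i => ξ i + P i • x + R i • B y with hudef
  have htan : ∀ p : MvPolynomial (Fin 6) ℂ, p = q ∨ p = g → ∀ i (s : ℂ), dlin p (x + s • B y) (u i + s • v i) = 0 := by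
    intro p hp i s
    have := tan_of_van (p := p) (hu i) (hv i) (fun τ s t => hvan p hp _ s t) 1 s
    simp only [one_smul, zero_smul, add_zero, hAx] at this
    exact this
  have hline : ∀ p : MvPolynomial (Fin 6) ℂ, p = q ∨ p = g → ∀ s t r : ℂ, dlin p (x + s • B y) (t • x + r • B y) = 0 := by
    intro p hp s t r
    have h1 : HasDerivAt (fun τ : ℂ => A y + τ • (t • A y + r • B y)) (t • A y + r • B y) 0 := by
      simpa using ((hasDerivAt_id (0 : ℂ)).smul_const (t • A y + r • B y)).const_add (A y)
    have := tan_of_van (p := p) h1 (hasDerivAt_const _ (B y)) (fun τ s t' => by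
      have := hvan p hp y (s * (1 + τ * t)) (s * τ * r + t')
      rw [← this]
      congr 2
      module) 1 s
    simpa [hAx] using this
  have hnz : ∀ s : ℂ, x + s • B y ≠ 0 := by
    intro s h
    have := (li_pair lam hx1 hBl hBn (s := 1) (t := s) (by simpa using h)).1
    exact one_ne_zero this
  have hli : LinearIndependent ℂ ![x, B y] := by
    rw [LinearIndependent.pair_iff]
    exact fun s t h => li_pair lam hx1 hBl hBn h
  have hvx : ∀ p : MvPolynomial (Fin 6) ℂ, p = q ∨ p = g → ∀ s t : ℂ, eval (s • x + t • B y) p = 0 := by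
    intro p hp s t
    have := hvan p hp y s t
    rwa [hAx] at this
  have hg' : ∀ p : MvPolynomial (Fin 6) ℂ, p = q ∨ p = g → grL p x (B y) (FO.cst _ x) = 0 ∧ grL p x (B y) (FO.cst _ (B y)) = 0 ∧
      ∀ i, grL p x (B y) (FO.cst _ (u i) + (Polynomial.X : Polynomial ℂ) • FO.cst _ (v i)) = 0 := by
    intro p hp
    refine ⟨grL_zero fun s => ?_, grL_zero fun s => ?_, fun i => grL_zero fun s => ?_⟩
    · rw [cst_eval]; simpa using hline p hp s 1 0
    · rw [cst_eval]; simpa using hline p hp s 0 1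
    · convert htan p hp i s using 1
      congr 1
      funext k
      simp [FO.cst]
      exact mul_comm _ _
  have hpair : ∀ i j : Fin 3, ∃ r s t : ℂ, (r ≠ 0 ∨ s ≠ 0) ∧
      ∀ k, r * (Pi.single i 1 : Fin 3 → ℂ) k + s * (Pi.single j 1 : Fin 3 → ℂ) k = t * dphi (n := 3) F x k (B y) := by
    intro i j
    have hv6 := FO.contra3' x (B y) (u i) (v i) (u j) (v j) m (by omega) (grL q x (B y)) (grL g x (B y))
      (hg' q (Or.inl rfl)).1 (hg' q (Or.inl rfl)).2.1 (hg' g (Or.inr rfl)).1 (hg' g (Or.inr rfl)).2.1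
      ((hg' q (Or.inl rfl)).2.2 i) ((hg' q (Or.inl rfl)).2.2 j) ((hg' g (Or.inr rfl)).2.2 i) ((hg' g (Or.inr rfl)).2.2 j)
      (fun w => grL_deg hq.1 _ _ _) (fun w => grL_deg hg _ _ _)
      (fun r => by
        obtain ⟨w, w', h⟩ := minor_of_smooth hX (hnz r) (by simpa using hvx q (Or.inl rfl) 1 r)
          (by simpa using hvx g (Or.inr rfl) 1 r)
        refine ⟨w, w', ?_⟩
        simpa only [Polynomial.eval_sub, Polynomial.eval_mul, grL_eval, cst_eval] using h)
      (by
        obtain ⟨w, w', h⟩ := minor_of_smooth hX hBn (by simpa using hvx q (Or.inl rfl) 0 1)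
          (by simpa using hvx g (Or.inr rfl) 0 1)
        refine ⟨w, w', ?_⟩
        rw [grL_coeff (m := 2) hq.1, grL_coeff (m := 2) hq.1, grL_coeff hg, grL_coeff hg]
        exact h)
    obtain ⟨r, s, α, β, hne, heq⟩ := dep4 x (B y) (u i) (u j) hli hv6
    have hζe : dPsi (n := 3) q g F lam x (r • ξ i + s • ξ j) = (0, 0, 0, r • Pi.single i 1 + s • Pi.single j 1) := by
      simp only [map_add, map_smul, hξ]; simp
    have hζ2 : r • ξ i + s • ξ j = (α - r * P i - s * P j) • x + (β - r * R i - s * R j) • B y := by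
      have h1 : r • ξ i + s • ξ j = (r • u i + s • u j) - (r * P i + s * P j) • x - (r * R i + s * R j) • B y := by
        rw [hudef]; module
      rw [h1, heq]; module
    obtain ⟨-, -, h3⟩ := Gen.lin_comb (n := 3) _ hx1 hBl hζe hζ2
    refine ⟨r, s, (β - r * R i - s * R j), hne, fun k => ?_⟩
    rw [← h3 k]; simp
  have hD : ∀ i j k : Fin 3, k ≠ i → k ≠ j → i ≠ j → dphi (n := 3) F x k (B y) = 0 := by
    intro i j k hki hkj hij
    obtain ⟨r, s, t, hne, h⟩ := hpair i j
    have e1 := h k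
    simp [Pi.single_apply, hki, hkj] at e1
    rcases e1 with rfl | e1
    · have e2 := h i
      have e3 := h j
      simp [Pi.single_apply, hij, hij.symm] at e2 e3
      simp [e2, e3] at hne
    · exact e1
  obtain ⟨r, s, t, hne, h⟩ := hpair 0 1
  have e2 := h 0
  have e3 := h 1
  rw [hD 1 2 0 (by decide) (by decide) (by decide)] at e2
  rw [hD 0 2 1 (by decide) (by decide) (by decide)] at e3
  simp at e2 e3
  simp [e2, e3] at hne
end
end

open MvPolynomial
noncomputable section

/-- embedding of five-space in six-space -/
def emb : (Fin 5 → ℂ) →ₗ[ℂ] (Fin 6 → ℂ) where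
  toFun v := fun i => if h : i.val < 5 then v ⟨i.val, h⟩ else 0
  map_add' v w := by funext i; simp only [Pi.add_apply]; split <;> simp
  map_smul' r v := by funext i; simp only [Pi.smul_apply, RingHom.id_apply]; split <;> simp

/-- restriction -/
def res6 : (Fin 6 → ℂ) →ₗ[ℂ] (Fin 5 → ℂ) := LinearMap.funLeft ℂ ℂ Fin.castSucc

/-- last basis vector -/
def e6 : Fin 6 → ℂ := Pi.single (Fin.last 5) 1

theorem emb_cast (v : Fin 5 → ℂ) (k : Fin 5) : emb v k.castSucc = v k := by
  simp [emb]

theorem emb_last (v : Fin 5 → ℂ) : emb v (Fin.last 5) = 0 := by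
  simp [emb]

theorem e6_cast (k : Fin 5) : e6 k.castSucc = 0 :=
  Pi.single_eq_of_ne (Fin.castSucc_lt_last k).ne 1

theorem e6_last : e6 (Fin.last 5) = 1 := by simp [e6]

theorem res6_apply (v : Fin 6 → ℂ) (k : Fin 5) : res6 v k = v k.castSucc := rfl

theorem res6_comb (v : Fin 5 → ℂ) (r : ℂ) : res6 (emb v + r • e6) = v := by
  funext k; simp [res6_apply, emb_cast, e6_cast]

theorem last_comb (v : Fin 5 → ℂ) (r : ℂ) : (emb v + r • e6) (Fin.last 5) = r := by
  rw [Pi.add_apply, Pi.smul_apply, emb_last, e6_last, smul_eq_mul, mul_one, zero_add]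

theorem lin_poly {κ : Type} [Fintype κ] (L : (κ → ℂ) →ₗ[ℂ] ℂ) {a : ℂ → κ → ℂ} (p : κ → Polynomial ℂ)
    (ha : ∀ s k, a s k = (p k).eval s) : ∃ P : Polynomial ℂ, ∀ s, L (a s) = P.eval s := by
  classical
  refine ⟨∑ k, Polynomial.C (L (fun j => if k = j then 1 else 0)) * p k, fun s => ?_⟩
  rw [LinearMap.pi_apply_eq_sum_univ L (a s), Polynomial.eval_finsetSum]
  refine Finset.sum_congr rfl fun k _ => ?_
  rw [Polynomial.eval_mul, Polynomial.eval_C, ← ha, smul_eq_mul, mul_comm]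

theorem BP.congr {h k : ℂ → ℂ → ℂ} (hh : BP h) (e : ∀ s t, k s t = h s t) : BP k := by
  have : k = h := funext fun s => funext fun t => e s t
  rw [this]; exact hh

section
variable {q g : MvPolynomial (Fin 5) ℂ}
    {F : Fin 3 → MvPolynomial (Fin 5) ℂ} {lam : (Fin 5 → ℂ) →ₗ[ℂ] ℂ}
    {f : MvPolynomial (Fin 2) ℂ} {Φ : (Fin 2 → ℂ) → Finset (Fin 5 → ℂ)} {δ d : ℕ}

/-- surface case -/
theorem Gen.lower2 (G : Gen (n := 2) q g F lam f Φ δ) (hq : IsSmoothHyp q 3) (hδ : 4 ≤ δ)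
    (hcol : ∀ y, eval y f ≠ 0 → Col (Φ y)) : False := by
  obtain ⟨y, hy⟩ := exists_eval_ne G.f_ne
  obtain ⟨x, hx⟩ := Finset.card_pos.1 (show 0 < (Φ y).card by rw [G.card y hy]; omega)
  obtain ⟨A, B, hA, hB, hz, hsp, hAx, hBn, hBl, hder⟩ := G.frame (by omega) hcol hy hx
  have hx1 : lam x = 1 := G.lam_mem hy hx
  have hvan : ∀ y (s t : ℂ), eval (s • A y + t • B y) q = 0 := by
    intro y s t
    by_cases hy : eval y f = 0
    · rw [(hz y hy).1, (hz y hy).2]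
      have := homog_eval hq.1 0 0
      simpa using this
    · exact G.q_span hq.1 hδ hcol hy (Submodule.add_mem _ (Submodule.smul_mem _ _ (hsp y hy).1)
        (Submodule.smul_mem _ _ (hsp y hy).2))
  have hq6 : (rename Fin.castSucc q).IsHomogeneous 3 := hq.1.rename_isHomogeneous
  obtain ⟨c, hs, hcq, hcd⟩ := exists_tensor hq6
  have hcq' : ∀ v, tri c v v v = eval (res6 v) q := by
    intro v; rw [← hcq, eval_rename]; rfl
  have hsmall : ∀ p : Fin 6 → ℂ, res6 p ≠ 0 → ∃ w, tri c p p w ≠ 0 := by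
    intro p hp
    by_contra h
    push Not at h
    refine hq.2.2 _ hp fun i => ?_
    have := hcd p (Pi.single i.castSucc 1)
    rw [h, mul_zero, dlin_apply] at this
    simp only [Pi.single_apply, mul_ite, mul_one, mul_zero, Finset.sum_ite_eq', Finset.mem_univ, if_true] at this
    rw [pderiv_rename (Fin.castSucc_injective 5), eval_rename] at this
    exact this
  have hli : LinearIndependent ℂ ![emb x, emb (B y)] := by
    rw [LinearIndependent.pair_iff]
    intro s t h
    refine li_pair lam hx1 hBl hBn ?_
    have := congrArg res6 h
    rw [map_zero] at this
    rw [← this]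
    have := res6_comb (s • x + t • B y) 0
    rw [zero_smul, add_zero, map_add, map_smul, map_smul] at this
    exact this.symm
  have key : ∀ e : Fin 2 → ℂ, ∃ t : ℂ, ∀ j, e j = t * dphi (n := 2) F x j (B y) := by
    intro e
    obtain ⟨ξ, hξ, P, R, hu⟩ := hder e
    obtain ⟨v, hv⟩ := LP.deriv hB y e
    set u := ξ + P • x + R • B y with hudef
    have hA' : ∀ i, ∃ p : Polynomial ℂ, ∀ s : ℂ, A (y + s • e) i = p.eval s := fun i => by
      obtain ⟨K, hK⟩ := hA i
      obtain ⟨p, -, hp⟩ := hK y e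
      exact ⟨p, hp⟩
    have hB' : ∀ i, ∃ p : Polynomial ℂ, ∀ s : ℂ, B (y + s • e) i = p.eval s := fun i => by
      obtain ⟨K, hK⟩ := hB i
      obtain ⟨p, -, hp⟩ := hK y e
      exact ⟨p, hp⟩
    choose pA hpA using hA'
    choose pB hpB using hB'
    have main : ∀ α β : ℂ, (⟨emb x, emb (B y), emb u, emb v, α • e6, β • e6⟩ : FO ℂ).Valid c ∧ ∀ w1 w2,
        (⟨emb x, emb (B y), emb u, emb v, α • e6, β • e6⟩ : FO ℂ).den c w1 w2 ≠ 0 →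
        (⟨emb x, emb (B y), emb u, emb v, α • e6, β • e6⟩ : FO ℂ).num c w1 w2 = 0 := by
      intro α β
      obtain ⟨ν, hν⟩ := exists_dual hBn
      obtain ⟨L, hLx, hLb⟩ : ∃ L : (Fin 5 → ℂ) →ₗ[ℂ] ℂ, L x = α ∧ L (B y) = β := by
        refine ⟨α • lam + (β / ν (B y)) • (ν - ν x • lam), ?_, ?_⟩
        · simp [hx1]
        · simp [hBl, hν]
      obtain ⟨PA, hPA⟩ := lin_poly L (a := fun s => A (y + s • e)) pA (fun s k => hpA k s)
      obtain ⟨PB, hPB⟩ := lin_poly L (a := fun s => B (y + s • e)) pB (fun s k => hpB k s)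
      have embc : ∀ {a : ℂ → Fin 5 → ℂ} {a' : Fin 5 → ℂ}, HasDerivAt a a' 0 → HasDerivAt (fun s => emb (a s)) (emb a') 0 :=
        fun h => (LinearMap.toContinuousLinearMap emb).hasFDerivAt.comp_hasDerivAt 0 h
      have := FO.plane hs (fun s t => emb (A (y + s • e)) + (t * L (A (y + s • e))) • e6)
        (fun s t => emb (B (y + s • e)) + (t * L (B (y + s • e))) • e6)
        (fun i => by
          induction i using Fin.lastCases with
          | last => exact (BP.snd.mul (BP.fst PA)).congr fun s t => by rw [last_comb, hPA]
          | cast k => exact (BP.fst (pA k)).congr fun s t =>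
                        (congrFun (res6_comb (A (y + s • e)) _) k).trans (hpA k s))
        (fun i => by
          induction i using Fin.lastCases with
          | last => exact (BP.snd.mul (BP.fst PB)).congr fun s t => by rw [last_comb, hPB]
          | cast k => exact (BP.fst (pB k)).congr fun s t =>
                        (congrFun (res6_comb (B (y + s • e)) _) k).trans (hpB k s))
        (fun s t r z => by
          rw [hcq', map_add, map_smul, map_smul, res6_comb, res6_comb]
          exact hvan _ _ _)
        (by
          obtain ⟨i, j, hij⟩ := minor_pair lam hx1 hBl hBn
          refine ⟨i.castSucc, j.castSucc, ?_⟩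
          simpa [emb_cast, e6_cast, hAx] using hij)
        (fun t => LinearMap.ker (LinearMap.proj (Fin.last 5) - t • (L ∘ₗ res6)))
        (fun s t => by
          rw [LinearMap.mem_ker, LinearMap.sub_apply, LinearMap.proj_apply, last_comb, LinearMap.smul_apply,
            LinearMap.comp_apply, res6_comb, smul_eq_mul, sub_self])
        (fun s t => by
          rw [LinearMap.mem_ker, LinearMap.sub_apply, LinearMap.proj_apply, last_comb, LinearMap.smul_apply,
            LinearMap.comp_apply, res6_comb, smul_eq_mul, sub_self])
        (fun t p hp hp0 => hsmall p fun h => hp0 (by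
          rw [LinearMap.mem_ker, LinearMap.sub_apply, LinearMap.proj_apply, LinearMap.smul_apply,
            LinearMap.comp_apply, h, map_zero, smul_zero, sub_zero] at hp
          funext i
          induction i using Fin.lastCases with
          | last => exact hp
          | cast k => exact congrFun h k))
        (us := emb u) (vs := emb v) (ut := α • e6) (vt := β • e6)
        (by simpa using embc hu)
        (by
          have := (((hasDerivAt_id (0 : ℂ)).mul_const α).smul_const e6).const_add (emb x)
          simpa [hAx, hLx] using this)
        (by simpa using embc hv)
        (by
          have := (((hasDerivAt_id (0 : ℂ)).mul_const β).smul_const e6).const_add (emb (B y))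
          simpa [hLb] using this)
      simpa only [zero_smul, add_zero, zero_mul, hAx] using this
    have hv6 := FO.contra2 hs (emb x) (emb (B y)) (emb u) (emb v) e6 (fun α β => (main α β).1)
      (fun s t hst => hsmall _ fun h => by
        have h1 := res6_comb (s • x + t • B y) 0
        rw [zero_smul, add_zero, map_add, map_smul, map_smul, h] at h1
        obtain ⟨h1, h2⟩ := li_pair lam hx1 hBl hBn h1.symm
        rcases hst with h | h
        exacts [h h1, h h2]) (fun α β => (main α β).2)
    obtain ⟨r, s, α, β, hne, heq⟩ := dep4 _ _ _ _ hli hv6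
    have hs0 : s = 0 := by
      have := congrFun heq (Fin.last 5)
      rw [Pi.add_apply, Pi.add_apply, Pi.smul_apply, Pi.smul_apply, Pi.smul_apply, Pi.smul_apply, emb_last,
        emb_last, emb_last, e6_last] at this
      simpa using this
    subst hs0
    have hr : r ≠ 0 := by simpa using hne
    have heq' : r • u = α • x + β • B y := by
      have h1 := congrArg res6 heq
      have h2 := res6_comb (r • u) 0
      have h3 := res6_comb (α • x + β • B y) 0
      rw [zero_smul, add_zero, map_smul] at h2
      rw [zero_smul, add_zero, map_add, map_smul, map_smul] at h3
      rw [zero_smul, add_zero] at h1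
      rw [← h2, ← h3, h1]
    have hζ : ξ = (r⁻¹ * α - P) • x + (r⁻¹ * β - R) • B y := by
      have h1 : u = r⁻¹ • (α • x + β • B y) := by rw [← heq', smul_smul, inv_mul_cancel₀ hr, one_smul]
      have h2 : ξ = u - P • x - R • B y := by rw [hudef]; module
      rw [h2, h1]; module
    exact ⟨_, (Gen.lin_comb (n := 2) e hx1 hBl hξ hζ).2.2⟩
  obtain ⟨t, ht⟩ := key (Pi.single 0 1)
  obtain ⟨t', ht'⟩ := key (Pi.single 1 1)
  have a0 := ht 0
  have a1 := ht 1
  have b1 := ht' 1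
  simp at a0 a1 b1
  rcases a1 with h | h
  · simp [h] at a0
  · simp [h] at b1
end
end

open MvPolynomial
noncomputable section

theorem lower_bound {n d δ : ℕ} (hn : n = 2 ∨ n = 3) (hd : 5 * n ≤ d + 2)
    {q g : MvPolynomial (Fin (n + 3)) ℂ}
    (hq : IsSmoothHyp q 3) (hg : g.IsHomogeneous d) (hX : IsSmoothCI2 q g)
    {φ : RatMapTo (Fin (n + 3)) n} (hφ : φ.DominantOfDegree (ZeroSet q ∩ ZeroSet g) δ) :
    2 * (d - n) + 2 ≤ δ := by
  by_contra hlt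
  obtain ⟨lam, f, Φ, G⟩ := exists_gen (by omega) hX hq.1 hg φ hφ
  have hw : ∀ y, eval y f ≠ 0 → Col (Φ y) ∧ d - n + 2 ≤ δ := by
    intro y hy
    have h : ∃ c, WCB (d - n) (Φ y) c := by
      rcases hn with rfl | rfl
      · exact ⟨_, Gen.wcb (n := 1) G (by omega) hq.1 hg φ.homog hX hy⟩
      · exact ⟨_, Gen.wcb (n := 2) G (by omega) hq.1 hg φ.homog hX hy⟩
    obtain ⟨c, h⟩ := h
    have hl : ∀ v ∈ Φ y, lam v = 1 := fun v hv => G.lam_mem hy hv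
    have hc := G.card y hy
    refine ⟨WCB.collinear lam _ _ c hl h (by omega), ?_⟩
    rw [← hc]
    exact WCB.card_ge lam _ _ c hl h (Finset.card_pos.1 (by rw [hc]; exact hφ.1))
  obtain ⟨y, hy⟩ := exists_eval_ne G.f_ne
  have h2 := (hw y hy).2
  rcases hn with rfl | rfl
  · exact Gen.lower2 G hq (by omega) fun y hy => (hw y hy).1
  · exact Gen.lower3 G hq hg hX (by omega) (by omega) (by omega) fun y hy => (hw y hy).1
end

open MvPolynomial
noncomputable section

/-- reduction of a form modulo a monic quadratic equation -/
def Red {ι : Type} (b1 b0 : MvPolynomial (Fin 2) ℂ) (a b c : ι → ℂ) (d : ℕ) (g : MvPolynomial ι ℂ) : Prop :=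
  ∃ A B : MvPolynomial (Fin 2) ℂ, A.IsHomogeneous d ∧
    (∀ (l : MvPolynomial (Fin 2) ℂ) k, l.IsHomogeneous (k + 1) → (B * l).IsHomogeneous (d + k)) ∧
    ∀ (z : Fin 2 → ℂ) (r : ℂ), r ^ 2 + eval z b1 * r + eval z b0 = 0 →
      eval (z 0 • a + z 1 • b + r • c) g = eval z A + eval z B * r

theorem Red.mul_X {ι : Type} {b1 b0 : MvPolynomial (Fin 2) ℂ} {a b c : ι → ℂ} {d : ℕ} {g : MvPolynomial ι ℂ}
    (h1 : b1.IsHomogeneous 1) (h0 : b0.IsHomogeneous 2) (h : Red b1 b0 a b c d g) (i : ι) :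
    Red b1 b0 a b c (d + 1) (g * X i) := by
  obtain ⟨A, B, hA, hB, hE⟩ := h
  have hl : (C (a i) * X 0 + C (b i) * X 1 : MvPolynomial (Fin 2) ℂ).IsHomogeneous 1 :=
    ((isHomogeneous_X ℂ 0).C_mul (a i)).add ((isHomogeneous_X ℂ 1).C_mul (b i))
  set l : MvPolynomial (Fin 2) ℂ := C (a i) * X 0 + C (b i) * X 1 with hl'
  refine ⟨A * l - C (c i) * (B * b0), B * l + C (c i) * (A - B * b1), ?_, ?_, ?_⟩
  · exact (hA.mul hl).sub ((hB b0 1 h0).C_mul _)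
  · intro l' k hl'
    rw [add_mul]
    refine IsHomogeneous.add ?_ ?_
    · rw [mul_assoc]
      have := hB (l * l') (k + 1) (by rw [add_comm (k + 1) 1]; exact hl.mul hl')
      rwa [show d + 1 + k = d + (k + 1) by ring]
    · rw [mul_assoc]
      have := ((hA.sub (hB b1 0 h1)).mul hl').C_mul (c i)
      rwa [show d + 1 + k = d + (k + 1) by ring]
  · intro z r hr
    have hX : eval (z 0 • a + z 1 • b + r • c) (X i : MvPolynomial ι ℂ) = eval z l + c i * r := by
      simp [hl']; ring
    rw [map_mul, hE z r hr, hX]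
    simp only [map_sub, map_mul, map_add, eval_C]
    linear_combination c i * eval z B * hr

theorem Red.zero {ι : Type} (b1 b0 : MvPolynomial (Fin 2) ℂ) (a b c : ι → ℂ) (d : ℕ) :
    Red b1 b0 a b c d 0 :=
  ⟨0, 0, isHomogeneous_zero _ _ _, fun l k _ => by rw [zero_mul]; exact isHomogeneous_zero _ _ _, by simp⟩

theorem Red.of_homog {ι : Type} {b1 b0 : MvPolynomial (Fin 2) ℂ} {a b c : ι → ℂ} {d : ℕ} {g : MvPolynomial ι ℂ}
    (h1 : b1.IsHomogeneous 1) (h0 : b0.IsHomogeneous 2) (hg : g.IsHomogeneous d) : Red b1 b0 a b c d g := by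
  classical
  have hm : ∀ (s : ι →₀ ℕ) (t : ℂ), ∃ k, (monomial s t).IsHomogeneous k ∧ Red b1 b0 a b c k (monomial s t) := by
    refine fun s t => induction_on_monomial (motive := fun p => ∃ k, p.IsHomogeneous k ∧ Red b1 b0 a b c k p) ?_ ?_ s t
    · intro t
      refine ⟨0, isHomogeneous_C _ _, C t, 0, isHomogeneous_C _ _, fun l k _ => ?_, by simp⟩
      rw [zero_mul]; exact isHomogeneous_zero _ _ _
    · rintro p i ⟨k, hk, hr⟩
      exact ⟨k + 1, hk.mul (isHomogeneous_X _ _), hr.mul_X h1 h0 i⟩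
  rw [g.as_sum]
  refine Finset.sum_induction _ (Red b1 b0 a b c d) ?_ (Red.zero _ _ _ _ _ _) ?_
  · rintro p p' ⟨A, B, hA, hB, hE⟩ ⟨A', B', hA', hB', hE'⟩
    refine ⟨A + A', B + B', hA.add hA', fun l k hl => ?_, fun z r hr => ?_⟩
    · rw [add_mul]; exact (hB l k hl).add (hB' l k hl)
    · rw [map_add, hE z r hr, hE' z r hr, map_add, map_add]; ring
  · intro s hs
    obtain ⟨k, hk, hr⟩ := hm s (coeff s g)
    have hd : (monomial s (coeff s g)).IsHomogeneous d := by
      refine isHomogeneous_monomial _ ?_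
      have := hg (MvPolynomial.mem_support_iff.1 hs)
      rwa [Pi.one_def, ← Finsupp.degree_eq_weight_one] at this
    have := hk.inj_right hd (by rw [Ne, monomial_eq_zero]; exact MvPolynomial.mem_support_iff.1 hs)
    rwa [this] at hr

/-- a ternary quadratic form -/
def QQ (k : Fin 6 → ℂ) (t s r : ℂ) : ℂ := k 0 * r ^ 2 + (k 1 * t + k 2 * s) * r + (k 3 * t ^ 2 + k 4 * (t * s) + k 5 * s ^ 2)

theorem quad_root (b c : ℂ) : ∃ r : ℂ, r ^ 2 + b * r + c = 0 := by
  obtain ⟨x, hx⟩ := exists_quadratic_eq_zero (a := (1 : ℂ)) (b := b) (c := c) one_ne_zero (by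
    obtain ⟨s, hs⟩ := IsAlgClosed.exists_pow_nat_eq (discrim 1 b c) (n := 2) (by norm_num)
    exact ⟨s, by rw [← hs]; ring⟩)
  exact ⟨x, by rw [← hx]; ring⟩

theorem core_res {ι : Type} {d : ℕ} {g : MvPolynomial ι ℂ} (hg : g.IsHomogeneous d) (k : Fin 6 → ℂ) (hk : k 0 ≠ 0)
    (a b c : ι → ℂ) : ∃ R : MvPolynomial (Fin 2) ℂ, R.IsHomogeneous (2 * d) ∧ ∀ z, eval z R = 0 ↔
      ∃ r, QQ k (z 0) (z 1) r = 0 ∧ eval (z 0 • a + z 1 • b + r • c) g = 0 := by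
  set b1 : MvPolynomial (Fin 2) ℂ := C (k 1 / k 0) * X 0 + C (k 2 / k 0) * X 1 with hb1
  set b0 : MvPolynomial (Fin 2) ℂ := C (k 3 / k 0) * (X 0 * X 0) + C (k 4 / k 0) * (X 0 * X 1) +
    C (k 5 / k 0) * (X 1 * X 1) with hb0
  have h1 : b1.IsHomogeneous 1 :=
    ((isHomogeneous_X ℂ 0).C_mul _).add ((isHomogeneous_X ℂ 1).C_mul _)
  have h0 : b0.IsHomogeneous 2 :=
    ((((isHomogeneous_X ℂ 0).mul (isHomogeneous_X ℂ 0)).C_mul _).add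
      (((isHomogeneous_X ℂ 0).mul (isHomogeneous_X ℂ 1)).C_mul _)).add
      (((isHomogeneous_X ℂ 1).mul (isHomogeneous_X ℂ 1)).C_mul _)
  have hQ : ∀ (z : Fin 2 → ℂ) r, QQ k (z 0) (z 1) r = k 0 * (r ^ 2 + eval z b1 * r + eval z b0) := by
    intro z r
    simp only [QQ, hb1, hb0, map_add, map_mul, eval_C, eval_X]
    field_simp
  have hQ' : ∀ (z : Fin 2 → ℂ) r, QQ k (z 0) (z 1) r = 0 ↔ r ^ 2 + eval z b1 * r + eval z b0 = 0 := by
    intro z r; rw [hQ]; simp [hk]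
  obtain ⟨A, B, hA, hB, hE⟩ := Red.of_homog (a := a) (b := b) (c := c) h1 h0 hg
  have key : ∀ (z : Fin 2 → ℂ) (r : ℂ), r ^ 2 + eval z b1 * r + eval z b0 = 0 →
      eval z (A * A - A * (B * b1) + B * (B * b0)) =
        (eval z A + eval z B * r) * (eval z A + eval z B * (- eval z b1 - r)) := by
    intro z r hr
    simp only [map_sub, map_mul, map_add]
    linear_combination eval z B ^ 2 * hr
  refine ⟨A * A - A * (B * b1) + B * (B * b0), ?_, fun z => ⟨fun h => ?_, ?_⟩⟩
  · rw [two_mul]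
    exact ((hA.mul hA).sub (hA.mul (hB b1 0 h1))).add (hB _ d (hB b0 1 h0))
  · obtain ⟨r, hr⟩ := quad_root (eval z b1) (eval z b0)
    rw [key z r hr] at h
    rcases mul_eq_zero.1 h with h | h
    · exact ⟨r, (hQ' z r).2 hr, by rw [hE z r hr, h]⟩
    · have hr' : (- eval z b1 - r) ^ 2 + eval z b1 * (- eval z b1 - r) + eval z b0 = 0 := by
        rw [← hr]; ring
      exact ⟨_, (hQ' z _).2 hr', by rw [hE z _ hr', h]⟩
  · rintro ⟨r, hr, hgr⟩
    rw [hQ'] at hr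
    rw [key z r hr, ← hE z r hr, hgr, zero_mul]

/-- the binary form is a polynomial of exact degree -/
theorem binary {m : ℕ} {R : MvPolynomial (Fin 2) ℂ} (hR : R.IsHomogeneous m) (h01 : eval ![0, 1] R ≠ 0) :
    ∃ p : Polynomial ℂ, p.natDegree = m ∧ p ≠ 0 ∧ ∀ s, p.eval s = eval ![1, s] R := by
  have hc := lineP_coeff ![1, 0] ![0, 1] hR
  have hne : (lineP ![1, 0] ![0, 1] R).coeff m ≠ 0 := by rw [hc]; exact h01
  refine ⟨lineP ![1, 0] ![0, 1] R, le_antisymm ((lineP_natDegree _ _ _).trans hR.totalDegree_le)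
    (Polynomial.le_natDegree_of_ne_zero hne), fun h => hne (by rw [h]; simp), fun s => ?_⟩
  rw [eval_lineP]
  congr 2
  funext i; fin_cases i <;> simp

theorem binary_root {m : ℕ} (hm : 0 < m) {R : MvPolynomial (Fin 2) ℂ} (hR : R.IsHomogeneous m)
    (h01 : eval ![0, 1] R ≠ 0) : ∃ s, eval ![1, s] R = 0 := by
  obtain ⟨p, hp, hp0, he⟩ := binary hR h01
  obtain ⟨s, hs⟩ := IsAlgClosed.exists_root p (by rw [Polynomial.degree_eq_natDegree hp0, hp]; exact_mod_cast hm.ne')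
  exact ⟨s, by rw [← he]; exact hs⟩

section
variable {ι : Type} {d : ℕ} {g : MvPolynomial ι ℂ} (hg : g.IsHomogeneous d) (k : Fin 6 → ℂ) (hk : k 0 ≠ 0)
    (a b c : ι → ℂ) (hinf : ∀ s r, (s ≠ 0 ∨ r ≠ 0) → QQ k 0 s r = 0 → eval (s • b + r • c) g ≠ 0)

theorem bez_exists (hd : 0 < d) (hg : g.IsHomogeneous d) (k : Fin 6 → ℂ) (hk : k 0 ≠ 0)
    (a b c : ι → ℂ) (hinf : ∀ s r, (s ≠ 0 ∨ r ≠ 0) → QQ k 0 s r = 0 → eval (s • b + r • c) g ≠ 0) :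
    ∃ s r, QQ k 1 s r = 0 ∧ eval (a + s • b + r • c) g = 0 := by
  obtain ⟨R, hR, hz⟩ := core_res hg k hk a b c
  obtain ⟨s, hs⟩ := binary_root (by omega) hR (fun h => by
    obtain ⟨r, hr, hr'⟩ := (hz _).1 h
    exact hinf 1 r (Or.inl one_ne_zero) hr (by simpa using hr'))
  obtain ⟨r, hr, hr'⟩ := (hz _).1 hs
  exact ⟨s, r, hr, by simpa using hr'⟩

theorem sep_exists (S : Finset (ℂ × ℂ)) (bad : Set ℂ) (hbad : bad.Finite) :
    ∃ m, m ∉ bad ∧ Set.InjOn (fun w : ℂ × ℂ => w.1 - m * w.2) S := by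
  classical
  have hf : (bad ∪ ((S ×ˢ S).image fun p => (p.1.1 - p.2.1) / (p.1.2 - p.2.2) : Finset ℂ)).Finite :=
    hbad.union (Finset.finite_toSet _)
  obtain ⟨m, hm⟩ := hf.infinite_compl.nonempty
  rw [Set.mem_compl_iff, Set.mem_union, not_or] at hm
  refine ⟨m, hm.1, fun w hw w' hw' h => ?_⟩
  have h : w.1 - m * w.2 = w'.1 - m * w'.2 := h
  have h2 : w.2 = w'.2 := by
    by_contra hne
    refine hm.2 ?_
    rw [Finset.mem_coe, Finset.mem_image]
    refine ⟨(w, w'), Finset.mk_mem_product hw hw', ?_⟩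
    rw [div_eq_iff (sub_ne_zero.2 hne)]
    linear_combination h
  refine Prod.ext ?_ h2
  rw [h2] at h
  linear_combination h

theorem bez_card (hg : g.IsHomogeneous d) (k : Fin 6 → ℂ) (hk : k 0 ≠ 0)
    (a b c : ι → ℂ) (hinf : ∀ s r, (s ≠ 0 ∨ r ≠ 0) → QQ k 0 s r = 0 → eval (s • b + r • c) g ≠ 0)
    (S : Finset (ℂ × ℂ)) (hS : ∀ w ∈ S, QQ k 1 w.1 w.2 = 0 ∧ eval (a + w.1 • b + w.2 • c) g = 0) :
    S.card ≤ 2 * d := by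
  classical
  set pk : Polynomial ℂ := Polynomial.C (k 0) + Polynomial.C (k 2) * Polynomial.X + Polynomial.C (k 5) * Polynomial.X ^ 2 with hpk
  have hpk0 : pk ≠ 0 := fun h => hk (by
    have := congrArg (Polynomial.eval 0) h
    simpa [hpk] using this)
  obtain ⟨m, hm, hinj⟩ := sep_exists S _ (Polynomial.finite_setOfPred_isRoot hpk0)
  have hm' : k 0 + k 2 * m + k 5 * m ^ 2 ≠ 0 := fun h => hm (by
    rw [Set.mem_ofPred_eq, Polynomial.IsRoot.def, ← h]; simp [hpk])
  set k' : Fin 6 → ℂ := ![k 0 + k 2 * m + k 5 * m ^ 2, k 1 + k 4 * m, k 2 + 2 * k 5 * m, k 3, k 4, k 5] with hk'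
  have hQ : ∀ (t s r : ℂ), QQ k' t s r = QQ k t (s + m * r) r := by
    intro t s r; simp [QQ, hk']; ring
  have hv : ∀ (s r : ℂ), s • b + r • (c + m • b) = (s + m * r) • b + r • c := by
    intro s r; module
  obtain ⟨R, hR, hz⟩ := core_res hg k' hm' a b (c + m • b)
  obtain ⟨p, hp, hp0, he⟩ := binary hR (fun h => by
    obtain ⟨r, hr, hr'⟩ := (hz _).1 h
    have hr : QQ k' 0 1 r = 0 := hr
    rw [hQ] at hr
    refine hinf (1 + m * r) r ?_ hr ?_
    · by_contra hcon
      push Not at hcon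
      rw [hcon.2] at hcon
      simp at hcon
    · rw [← hv]
      simpa using hr')
  rw [← Finset.card_image_of_injOn hinj, ← hp]
  refine le_trans (Finset.card_le_card (t := p.roots.toFinset) fun x hx => ?_)
    ((Multiset.toFinset_card_le _).trans (Polynomial.card_roots' p))
  obtain ⟨w, hw, rfl⟩ := Finset.mem_image.1 hx
  rw [Multiset.mem_toFinset, Polynomial.mem_roots hp0, Polynomial.IsRoot.def, he]
  refine (hz _).2 ⟨w.2, ?_, ?_⟩
  · change QQ k' 1 (w.1 - m * w.2) w.2 = 0
    rw [hQ, sub_add_cancel]; exact (hS w hw).1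
  · change eval ((1 : ℂ) • a + (w.1 - m * w.2) • b + w.2 • (c + m • b)) g = 0
    rw [add_assoc, hv, sub_add_cancel, one_smul, ← add_assoc]
    exact (hS w hw).2
end
end

open MvPolynomial
noncomputable section

theorem finrank_inf_ker {V : Type*} [AddCommGroup V] [Module ℂ V] [FiniteDimensional ℂ V] (K : Submodule ℂ V)
    (ν : V →ₗ[ℂ] ℂ) : Module.finrank ℂ K ≤ Module.finrank ℂ (K ⊓ LinearMap.ker ν : Submodule ℂ V) + 1 := by
  have h1 := Submodule.finrank_sup_add_finrank_inf_eq K (LinearMap.ker ν)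
  have h2 := ν.finrank_range_add_finrank_ker
  have h3 := Submodule.finrank_le (K ⊔ LinearMap.ker ν)
  have h4 := Submodule.finrank_le (LinearMap.range ν)
  rw [Module.finrank_self] at h4
  omega

theorem exists_pair {V : Type*} [AddCommGroup V] [Module ℂ V] (K : Submodule ℂ V)
    (hK : 2 ≤ Module.finrank ℂ K) : ∃ a ∈ K, ∃ b ∈ K, ∀ s t : ℂ, s • a + t • b = 0 → s = 0 ∧ t = 0 := by
  have : Nontrivial K := Module.nontrivial_of_finrank_pos (R := ℂ) (by omega)
  obtain ⟨x, hx⟩ := exists_ne (0 : K)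
  obtain ⟨y, hy⟩ := exists_linearIndependent_pair_of_one_lt_finrank (R := ℂ) (M := K) (by omega) hx
  rw [LinearIndependent.pair_iff] at hy
  exact ⟨x, x.2, y, y.2, fun s t h => hy s t (Subtype.ext (by simpa using h))⟩

theorem pair_zero {ι : Type} [Fintype ι] {m : ℕ} (hm : 0 < m) {q : MvPolynomial ι ℂ} (hq : q.IsHomogeneous m) (K : Submodule ℂ (ι → ℂ))
    (hK : 2 ≤ Module.finrank ℂ K) : ∃ v ∈ K, v ≠ 0 ∧ eval v q = 0 := by
  obtain ⟨a, ha, b, hb, h⟩ := exists_pair K hK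
  by_cases hqb : eval b q = 0
  · refine ⟨b, hb, fun h0 => ?_, hqb⟩
    have := h 0 1 (by rw [h0]; simp)
    simp at this
  · have hc := lineP_coeff a b hq
    have hdeg : (lineP a b q).degree ≠ 0 := fun h0 => by
      rw [Polynomial.eq_C_of_degree_eq_zero h0, Polynomial.coeff_C_of_ne_zero (by omega)] at hc
      exact hqb hc.symm
    obtain ⟨s, hs⟩ := IsAlgClosed.exists_root _ hdeg
    rw [Polynomial.IsRoot.def, eval_lineP] at hs
    refine ⟨a + s • b, K.add_mem ha (K.smul_mem _ hb), fun h0 => ?_, hs⟩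
    have := h 1 s (by rw [one_smul]; exact h0)
    simp at this

/-- the linear form of a tensor -/
def triT {ι : Type} [Fintype ι] (c : ι → ι → ι → ℂ) (p p' : ι → ℂ) : (ι → ℂ) →ₗ[ℂ] ℂ where
  toFun w := tri c p p' w
  map_add' x y := tri_add3 c x y p p'
  map_smul' r x := tri_smul3 c r x p p'

theorem exists_line {ι : Type} [Fintype ι] (hι : 5 ≤ Fintype.card ι) {q : MvPolynomial ι ℂ} (hq : q.IsHomogeneous 3)
    {c : ι → ι → ι → ℂ} (hs : SymT c) (hcq : ∀ v, eval v q = tri c v v v) {x : ι → ℂ} (hx : x ≠ 0) :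
    ∃ v, (∀ s t : ℂ, s • x + t • v = 0 → s = 0 ∧ t = 0) ∧ tri c x x v = 0 ∧ tri c x v v = 0 ∧ tri c v v v = 0 := by
  obtain ⟨ν, hν⟩ := exists_dual hx
  set K : Submodule ℂ (ι → ℂ) := LinearMap.ker ν ⊓ LinearMap.ker (triT c x x) with hK
  have hK3 : 3 ≤ Module.finrank ℂ K := by
    have h1 := finrank_inf_ker (⊤ : Submodule ℂ (ι → ℂ)) ν
    have h2 := finrank_inf_ker (LinearMap.ker ν) (triT c x x)
    rw [top_inf_eq, finrank_top, Module.finrank_fintype_fun_eq_card] at h1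
    rw [← hK] at h2
    omega
  have fin : (∃ v ∈ K, v ≠ 0 ∧ tri c x v v = 0 ∧ eval v q = 0) → ∃ v, (∀ s t : ℂ, s • x + t • v = 0 → s = 0 ∧ t = 0) ∧
      tri c x x v = 0 ∧ tri c x v v = 0 ∧ tri c v v v = 0 := by
    rintro ⟨v, hv, hv0, h1, h2⟩
    have hv1 : ν v = 0 := hv.1
    refine ⟨v, fun s t h => ?_, hv.2, h1, by rw [← hcq]; exact h2⟩
    have := congrArg ν h
    rw [map_add, map_smul, map_smul, hv1, smul_zero, add_zero, map_zero, smul_eq_mul] at this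
    have hs0 := (mul_eq_zero.1 this).resolve_right hν
    rw [hs0, zero_smul, zero_add] at h
    exact ⟨hs0, (smul_eq_zero.1 h).resolve_right hv0⟩
  apply fin
  by_cases hall : ∀ v ∈ K, tri c x v v = 0
  · obtain ⟨v, hv, hv0, hv1⟩ := pair_zero (by norm_num) hq K (by omega)
    exact ⟨v, hv, hv0, hall v hv, hv1⟩
  push Not at hall
  obtain ⟨w, hw, hw1⟩ := hall
  have hw0 : w ≠ 0 := by
    rintro rfl
    exact hw1 ((triT c x 0).map_zero)
  obtain ⟨μ, hμ⟩ := exists_dual hw0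
  obtain ⟨a, ha, b, hb, hab⟩ := exists_pair (K ⊓ LinearMap.ker μ) (by have := finrank_inf_ker K μ; omega)
  have haμ : μ a = 0 := ha.2
  have hbμ : μ b = 0 := hb.2
  set k : Fin 6 → ℂ := ![tri c x w w, 2 * tri c x a w, 2 * tri c x b w, tri c x a a, 2 * tri c x a b, tri c x b b] with hk
  have hQ : ∀ t s r : ℂ, tri c x (t • a + s • b + r • w) (t • a + s • b + r • w) = QQ k t s r := by
    intro t s r
    simp only [tri_add2, tri_add3, tri_smul2, tri_smul3, QQ, hk]
    rw [tri_swap23 hs x b a, tri_swap23 hs x w a, tri_swap23 hs x w b]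
    simp
    ring
  obtain ⟨R, hR, hz⟩ := core_res hq k hw1 a b w
  obtain ⟨z, hz0, hzR⟩ : ∃ z : Fin 2 → ℂ, (z 0 ≠ 0 ∨ z 1 ≠ 0) ∧ eval z R = 0 := by
    by_cases h01 : eval ![0, 1] R = 0
    · exact ⟨_, Or.inr one_ne_zero, h01⟩
    · obtain ⟨s, hs⟩ := binary_root (by norm_num) hR h01
      exact ⟨_, Or.inl one_ne_zero, hs⟩
  obtain ⟨r, hr, hr'⟩ := (hz z).1 hzR
  refine ⟨_, K.add_mem (K.add_mem (K.smul_mem (z 0) ha.1) (K.smul_mem (z 1) hb.1)) (K.smul_mem r hw), fun h => ?_,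
    by rw [hQ]; exact hr, hr'⟩
  have h1 := congrArg μ h
  rw [map_add, map_add, map_smul, map_smul, map_smul, haμ, hbμ, map_zero, smul_zero, smul_zero, zero_add, zero_add,
    smul_eq_mul] at h1
  have hr0 := (mul_eq_zero.1 h1).resolve_right hμ
  rw [hr0, zero_smul, add_zero] at h
  have := hab _ _ h
  rcases hz0 with h | h
  exacts [h this.1, h this.2]

theorem exists_off {ι : Type} [Fintype ι] (hι : 2 ≤ Fintype.card ι) {q g : MvPolynomial ι ℂ}
    (hq : q.IsHomogeneous 3) (hX : IsSmoothCI2 q g) : ∃ x, x ≠ 0 ∧ eval x q = 0 ∧ eval x g ≠ 0 := by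
  obtain ⟨x, -, hx0, hxq⟩ := pair_zero (by norm_num) hq ⊤ (by rw [finrank_top, Module.finrank_fintype_fun_eq_card]; exact hι)
  by_cases hxg : eval x g ≠ 0
  · exact ⟨x, hx0, hxq, hxg⟩
  push Not at hxg
  have hc : ∀ p : MvPolynomial ι ℂ, HasStrictFDerivAt (fun v => eval v p) (LinearMap.toContinuousLinearMap (dlin p x)) x := by
    intro p
    have h1 := (contDiff_eval p).contDiffAt (x := x)
    exact h1.hasStrictFDerivAt' (hasFDerivAt_eval p x) (by simp)
  have hF := (hc q).prodMk (hc g)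
  have hsurj : Function.Surjective (((LinearMap.toContinuousLinearMap (dlin q x)).prod
      (LinearMap.toContinuousLinearMap (dlin g x)) : (ι → ℂ) →L[ℂ] ℂ × ℂ)) := by
    obtain ⟨i, j, hij⟩ := minor_of_smooth hX hx0 hxq hxg
    rintro ⟨α, β⟩
    set D := dlin q x i * dlin g x j - dlin q x j * dlin g x i with hD
    refine ⟨((α * dlin g x j - β * dlin q x j) / D) • i + ((β * dlin q x i - α * dlin g x i) / D) • j, ?_⟩
    rw [ContinuousLinearMap.prod_apply, LinearMap.coe_toContinuousLinearMap', LinearMap.coe_toContinuousLinearMap',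
      map_add, map_add, map_smul, map_smul, map_smul, map_smul]
    simp only [smul_eq_mul]
    refine Prod.ext ?_ ?_
    · field_simp; rw [hD]; ring
    · field_simp; rw [hD]; ring
  have hm := hF.map_nhds_eq_of_surj (LinearMap.range_eq_top.2 hsurj)
  have hev : ∀ᶠ p in nhds (eval x q, eval x g), ∃ v, v ≠ 0 ∧ (eval v q, eval v g) = p := by
    rw [← hm, Filter.eventually_map]
    filter_upwards [isOpen_ne.mem_nhds hx0] with v hv
    exact ⟨v, hv, rfl⟩
  rw [hxq, hxg] at hev
  have ht : Filter.Tendsto (fun e : ℂ => ((0 : ℂ), e)) (nhds 0) (nhds (0, 0)) := by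
    have : Continuous (fun e : ℂ => ((0 : ℂ), e)) := by fun_prop
    exact this.tendsto 0
  have h2 := (ht.eventually hev).filter_mono (nhdsWithin_le_nhds (s := {0}ᶜ))
  obtain ⟨e, ⟨v, hv, hve⟩, he⟩ := (h2.and self_mem_nhdsWithin).exists
  rw [Prod.mk.injEq] at hve
  exact ⟨v, hv, hve.1, by rw [hve.2]; exact he⟩
end

open MvPolynomial
noncomputable section

/-- points of a fibre of the projection -/
def FB {ι κ : Type} (q g : MvPolynomial ι ℂ) (σ : (κ → ℂ) →ₗ[ℂ] (ι → ℂ)) (v x : ι → ℂ) (η : κ → ℂ) (w : ℂ × ℂ) : Prop :=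
  eval (σ η + w.1 • v + w.2 • x) q = 0 ∧ eval (σ η + w.1 • v + w.2 • x) g = 0

theorem linP_ne {σ : Type} [Fintype σ] [DecidableEq σ] {l : (σ → ℂ) →ₗ[ℂ] ℂ} {v : σ → ℂ} (h : l v ≠ 0) : linP l ≠ 0 :=
  fun h0 => h (by rw [← eval_linP, h0, map_zero])

theorem exists_proj {n : ℕ} (v x : Fin (n + 3) → ℂ) (hli : ∀ s t : ℂ, s • v + t • x = 0 → s = 0 ∧ t = 0) :
    ∃ (l : (Fin (n + 3) → ℂ) →ₗ[ℂ] (Fin (n + 1) → ℂ)) (σ : (Fin (n + 1) → ℂ) →ₗ[ℂ] (Fin (n + 3) → ℂ)),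
      (∀ η, l (σ η) = η) ∧ ∀ u, l u = 0 ↔ ∃ s r : ℂ, u = s • v + r • x := by
  set W := Submodule.span ℂ {v, x} with hW
  have hfr : Module.finrank ℂ W = 2 := by
    have h1 : LinearIndependent ℂ ![v, x] := LinearIndependent.pair_iff.2 hli
    have := finrank_span_eq_card h1
    rwa [Matrix.range_cons, Matrix.range_cons, Matrix.range_empty, Set.union_empty, Fintype.card_fin] at this
  have hq := W.finrank_quotient_add_finrank
  rw [hfr, Module.finrank_fintype_fun_eq_card, Fintype.card_fin] at hq
  have e : ((Fin (n + 3) → ℂ) ⧸ W) ≃ₗ[ℂ] (Fin (n + 1) → ℂ) :=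
    LinearEquiv.ofFinrankEq _ _ (by rw [Module.finrank_fintype_fun_eq_card, Fintype.card_fin]; omega)
  set l := e.toLinearMap ∘ₗ W.mkQ with hl
  have hsurj : LinearMap.range l = ⊤ := LinearMap.range_eq_top.2 (e.surjective.comp W.mkQ_surjective)
  obtain ⟨σ, hσ⟩ := l.exists_rightInverse_of_surjective hsurj
  refine ⟨l, σ, fun η => LinearMap.congr_fun hσ η, fun u => ?_⟩
  have h1 : l u = 0 ↔ u ∈ W := by
    rw [hl, LinearMap.comp_apply, LinearEquiv.coe_coe, e.map_eq_zero_iff, Submodule.mkQ_apply, Submodule.Quotient.mk_eq_zero]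
  rw [h1, hW, Submodule.mem_span_pair]
  simp only [eq_comm]

theorem exists_setup {n d : ℕ} (hn : 2 ≤ n) (hd : 0 < d) {q g : MvPolynomial (Fin (n + 3)) ℂ}
    (hq : IsSmoothHyp q 3) (hg : g.IsHomogeneous d) (hX : IsSmoothCI2 q g) :
    ∃ (l : (Fin (n + 3) → ℂ) →ₗ[ℂ] (Fin (n + 1) → ℂ)) (σ : (Fin (n + 1) → ℂ) →ₗ[ℂ] (Fin (n + 3) → ℂ))
      (v x : Fin (n + 3) → ℂ) (f : MvPolynomial (Fin (n + 1)) ℂ), f ≠ 0 ∧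
      (∀ s t : ℂ, s • v + t • x = 0 → s = 0 ∧ t = 0) ∧
      (∀ η, l (σ η) = η) ∧ (∀ u, l u = 0 ↔ ∃ s r : ℂ, u = s • v + r • x) ∧
      ∀ η, eval η f ≠ 0 → (∃ w, FB q g σ v x η w) ∧
        ∀ S : Finset (ℂ × ℂ), (∀ w ∈ S, FB q g σ v x η w) → S.card ≤ 2 * d := by
  classical
  obtain ⟨c, hs, hcq, hcd⟩ := exists_tensor hq.1
  obtain ⟨x, hx0, hxq, hxg⟩ := exists_off (by simp) hq.1 hX
  obtain ⟨v, hli', t1, t2, t3⟩ := exists_line (by simp; omega) hq.1 hs hcq hx0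
  have t0 : tri c x x x = 0 := by rw [← hcq, hxq]
  have hli : ∀ s t : ℂ, s • v + t • x = 0 → s = 0 ∧ t = 0 := fun s t h =>
    (hli' t s (by rw [← h]; exact add_comm _ _)).symm
  obtain ⟨l, σ, hlσ, hl⟩ := exists_proj v x hli
  have s1 : tri c x v x = 0 := by rw [tri_swap23 hs, t1]
  have s2 : tri c v x x = 0 := by rw [tri_swap12 hs, s1]
  have s3 : tri c v x v = 0 := by rw [tri_swap12 hs, t2]
  have s4 : tri c v v x = 0 := by rw [tri_swap23 hs, s3]
  have hT : ∀ s r s' r' : ℂ, tri c (s • v + r • x) (s • v + r • x) (s' • v + r' • x) = 0 := by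
    intro s r s' r'
    simp only [tri_add1, tri_add2, tri_add3, tri_smul1, tri_smul2, tri_smul3, t0, t1, t2, t3, s1, s2, s3, s4, mul_zero, add_zero]
  have hne : ∀ s r : ℂ, (s ≠ 0 ∨ r ≠ 0) → linP (triT c (s • v + r • x) (s • v + r • x) ∘ₗ σ) ≠ 0 := by
    intro s r hsr
    have hp : s • v + r • x ≠ 0 := fun h => by
      have := hli s r h
      rcases hsr with h | h
      exacts [h this.1, h this.2]
    obtain ⟨w, hw⟩ : ∃ w, tri c (s • v + r • x) (s • v + r • x) w ≠ 0 := by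
      by_contra h
      push Not at h
      refine hq.2.2 _ hp fun i => ?_
      have := hcd (s • v + r • x) (Pi.single i 1)
      rw [h, mul_zero, dlin_apply] at this
      simpa [Pi.single_apply] using this
    obtain ⟨s', r', hw'⟩ := (hl (w - σ (l w))).1 (by rw [map_sub, hlσ, sub_self])
    refine linP_ne (v := l w) fun h => hw ?_
    have h : tri c (s • v + r • x) (s • v + r • x) (σ (l w)) = 0 := h
    rw [← sub_add_cancel w (σ (l w)), tri_add3, h, hw', hT, zero_add]
  have hlp : lineP v x g ≠ 0 := fun h => hxg (by
    have := lineP_coeff v x hg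
    rw [h] at this
    simpa using this.symm)
  set f : MvPolynomial (Fin (n + 1)) ℂ := linP (triT c ((0 : ℂ) • v + (1 : ℂ) • x) ((0 : ℂ) • v + (1 : ℂ) • x) ∘ₗ σ) *
    ∏ ρ ∈ (lineP v x g).roots.toFinset, linP (triT c ((1 : ℂ) • v + ρ • x) ((1 : ℂ) • v + ρ • x) ∘ₗ σ) with hf
  refine ⟨l, σ, v, x, f, ?_, hli, hlσ, hl, fun η hη => ?_⟩
  · exact mul_ne_zero (hne 0 1 (Or.inr one_ne_zero)) (Finset.prod_ne_zero_iff.2 fun ρ _ => hne 1 ρ (Or.inl one_ne_zero))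
  rw [hf, map_mul, map_prod] at hη
  have hη0 := left_ne_zero_of_mul hη
  have hη1 := Finset.prod_ne_zero_iff.1 (right_ne_zero_of_mul hη)
  rw [eval_linP, zero_smul, zero_add, one_smul] at hη0
  have hη0 : tri c x x (σ η) ≠ 0 := hη0
  set a := σ η with ha
  set k : Fin 6 → ℂ := ![3 * tri c x x a, 3 * tri c a a x, 6 * tri c v x a, tri c a a a, 3 * tri c a a v, 3 * tri c v v a] with hk
  have e1 : tri c a x x = tri c x x a := by rw [tri_swap12 hs, tri_swap23 hs]
  have e2 : tri c x a x = tri c x x a := by rw [tri_swap23 hs]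
  have e3 : tri c a v v = tri c v v a := by rw [tri_swap12 hs, tri_swap23 hs]
  have e4 : tri c v a v = tri c v v a := by rw [tri_swap23 hs]
  have e5 : tri c a x a = tri c a a x := by rw [tri_swap23 hs]
  have e6 : tri c x a a = tri c a a x := by rw [tri_swap12 hs, tri_swap23 hs]
  have e7 : tri c a v a = tri c a a v := by rw [tri_swap23 hs]
  have e8 : tri c v a a = tri c a a v := by rw [tri_swap12 hs, tri_swap23 hs]
  have e9 : tri c x v a = tri c v x a := by rw [tri_swap12 hs]
  have e10 : tri c v a x = tri c v x a := by rw [tri_swap23 hs]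
  have e11 : tri c x a v = tri c v x a := by rw [tri_swap23 hs, e9]
  have e12 : tri c a x v = tri c v x a := by rw [tri_swap12 hs, e11]
  have e13 : tri c a v x = tri c v x a := by rw [tri_swap12 hs, e10]
  have hQ1 : ∀ s r : ℂ, eval (a + s • v + r • x) q = QQ k 1 s r := by
    intro s r
    rw [hcq]
    simp only [tri_add1, tri_add2, tri_add3, tri_smul1, tri_smul2, tri_smul3, t0, t1, t2, t3, s1, s2, s3, s4,
      e1, e2, e3, e4, e5, e6, e7, e8, e9, e10, e11, e12, e13]
    simp [QQ, hk]
    ring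
  have hQ0 : ∀ s r : ℂ, QQ k 0 s r = 3 * tri c (s • v + r • x) (s • v + r • x) a := by
    intro s r
    simp only [tri_add1, tri_add2, tri_smul1, tri_smul2, e9]
    simp [QQ, hk]
    ring
  have hinf : ∀ s r : ℂ, (s ≠ 0 ∨ r ≠ 0) → QQ k 0 s r = 0 → eval (s • v + r • x) g ≠ 0 := by
    intro s r hsr h0 hg0
    by_cases hs0 : s = 0
    · subst hs0
      rw [zero_smul, zero_add, homog_eval hg] at hg0
      have hr : r ≠ 0 := by simpa using hsr
      exact mul_ne_zero (pow_ne_zero _ hr) hxg hg0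
    · have hsv : s • v + r • x = s • ((1 : ℂ) • v + (r / s) • x) := by
        rw [one_smul, smul_add, smul_smul, mul_div_cancel₀ _ hs0]
      rw [hsv, homog_eval hg, one_smul, ← eval_lineP] at hg0
      have hroot := (mul_eq_zero.1 hg0).resolve_left (pow_ne_zero _ hs0)
      have := hη1 (r / s) (by rw [Multiset.mem_toFinset, Polynomial.mem_roots hlp]; exact hroot)
      rw [eval_linP] at this
      rw [hQ0, hsv, tri_smul1, tri_smul2] at h0
      have h0' : tri c ((1 : ℂ) • v + (r / s) • x) ((1 : ℂ) • v + (r / s) • x) a = 0 := by simpa [hs0] using h0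
      exact this h0'
  have hk0 : k 0 ≠ 0 := mul_ne_zero (by norm_num) hη0
  constructor
  · obtain ⟨s, r, h1, h2⟩ := bez_exists hd hg k hk0 a v x hinf
    exact ⟨(s, r), by rw [hQ1]; exact h1, h2⟩
  · intro S hS
    exact bez_card hg k hk0 a v x hinf S fun w hw => ⟨by rw [← hQ1]; exact (hS w hw).1, (hS w hw).2⟩
end

open MvPolynomial
noncomputable section

/-- the generic point of the family with `k` marked points -/
def mkP {ι κ : Type} [Fintype κ] [DecidableEq κ] (k : ℕ) (σ : (κ → ℂ) →ₗ[ℂ] (ι → ℂ)) (v x : ι → ℂ) (j : Fin k) (i : ι) :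
    MvPolynomial (κ ⊕ (Fin k ⊕ Fin k ⊕ Unit)) ℂ :=
  rename Sum.inl (linP (LinearMap.proj i ∘ₗ σ)) + X (Sum.inr (Sum.inl j)) * C (v i) + X (Sum.inr (Sum.inr (Sum.inl j))) * C (x i)

theorem eval_mkP {ι κ : Type} [Fintype κ] [DecidableEq κ] (k : ℕ) (σ : (κ → ℂ) →ₗ[ℂ] (ι → ℂ)) (v x : ι → ℂ) (j : Fin k)
    (p : MvPolynomial ι ℂ) (η : κ → ℂ) (A B : Fin k → ℂ) (m : ℂ) :
    eval (Sum.elim η (Sum.elim A (Sum.elim B fun _ => m))) (aeval (mkP k σ v x j) p) = eval (σ η + A j • v + B j • x) p := by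
  rw [eval_aeval]
  congr 2
  funext i
  simp only [mkP, map_add, map_mul, eval_X, eval_C, eval_rename, Sum.elim_comp_inl, eval_linP, Sum.elim_inr, Sum.elim_inl]
  rfl

theorem count_dich {ι κ : Type} [Fintype κ] (q g : MvPolynomial ι ℂ) (σ : (κ → ℂ) →ₗ[ℂ] (ι → ℂ)) (v x : ι → ℂ) (k : ℕ) :
    ∃ f : MvPolynomial κ ℂ, f ≠ 0 ∧
      ((∀ η, (∃ S : Finset (ℂ × ℂ), S.card = k ∧ ∀ w ∈ S, FB q g σ v x η w) → eval η f = 0) ∨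
       (∀ η, eval η f ≠ 0 → ∃ S : Finset (ℂ × ℂ), S.card = k ∧ ∀ w ∈ S, FB q g σ v x η w)) := by
  classical
  set P : Set (MvPolynomial (κ ⊕ (Fin k ⊕ Fin k ⊕ Unit)) ℂ) :=
    {p | ∃ j, p = aeval (mkP k σ v x j) q ∨ p = aeval (mkP k σ v x j) g} with hP
  set h : MvPolynomial (κ ⊕ (Fin k ⊕ Fin k ⊕ Unit)) ℂ := ∏ p ∈ Finset.univ.filter (fun p : Fin k × Fin k => p.1 ≠ p.2),
    ((X (Sum.inr (Sum.inl p.1)) - X (Sum.inr (Sum.inr (Sum.inr ()))) * X (Sum.inr (Sum.inr (Sum.inl p.1)))) -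
    (X (Sum.inr (Sum.inl p.2)) - X (Sum.inr (Sum.inr (Sum.inr ()))) * X (Sum.inr (Sum.inr (Sum.inl p.2))))) with hh
  have hev : ∀ (η : κ → ℂ) (A B : Fin k → ℂ) (m : ℂ),
      ((∀ p ∈ P, eval (Sum.elim η (Sum.elim A (Sum.elim B fun _ => m))) p = 0) ∧
        eval (Sum.elim η (Sum.elim A (Sum.elim B fun _ => m))) h ≠ 0) ↔
      (∀ j, FB q g σ v x η (A j, B j)) ∧ Function.Injective (fun j => A j - m * B j) := by
    intro η A B m
    refine and_congr ⟨fun H j => ⟨?_, ?_⟩, ?_⟩ ?_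
    · rw [← eval_mkP (m := m)]; exact H _ ⟨j, Or.inl rfl⟩
    · rw [← eval_mkP (m := m)]; exact H _ ⟨j, Or.inr rfl⟩
    · rintro H p ⟨j, rfl | rfl⟩
      · rw [eval_mkP]; exact (H j).1
      · rw [eval_mkP]; exact (H j).2
    · rw [hh, map_prod, Finset.prod_ne_zero_iff]
      simp only [Finset.mem_filter, Finset.mem_univ, true_and, map_sub, map_mul, eval_X, Sum.elim_inr, Sum.elim_inl,
        sub_ne_zero, Prod.forall]
      exact ⟨fun H i j hij => by_contra fun hne => H i j hne hij, fun H i j hne hij => hne (H hij)⟩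
  have key : ∀ η : κ → ℂ, (∃ z : Fin k ⊕ Fin k ⊕ Unit → ℂ, (∀ p ∈ P, eval (Sum.elim η z) p = 0) ∧ eval (Sum.elim η z) h ≠ 0) ↔
      ∃ S : Finset (ℂ × ℂ), S.card = k ∧ ∀ w ∈ S, FB q g σ v x η w := by
    intro η
    constructor
    · rintro ⟨z, hz⟩
      have hz' : z = Sum.elim (fun j => z (Sum.inl j)) (Sum.elim (fun j => z (Sum.inr (Sum.inl j))) fun _ => z (Sum.inr (Sum.inr ()))) := by
        funext i; rcases i with i | i | i <;> rfl
      rw [hz', hev] at hz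
      refine ⟨Finset.univ.image fun j => (z (Sum.inl j), z (Sum.inr (Sum.inl j))), ?_, ?_⟩
      · rw [Finset.card_image_of_injective, Finset.card_univ, Fintype.card_fin]
        intro i j hij
        obtain ⟨h1, h2⟩ := Prod.mk.inj hij
        exact hz.2 (by beta_reduce; rw [h1, h2])
      · intro w hw
        obtain ⟨j, -, rfl⟩ := Finset.mem_image.1 hw
        exact hz.1 j
    · rintro ⟨S, hS, hF⟩
      obtain ⟨m, -, hm⟩ := sep_exists S ∅ Set.finite_empty
      let e := (Finset.equivFinOfCardEq hS).symm
      refine ⟨_, (hev η (fun j => (e j).1.1) (fun j => (e j).1.2) m).2 ⟨fun j => hF _ (e j).2, fun i j hij => ?_⟩⟩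
      exact e.injective (Subtype.ext (hm (e i).2 (e j).2 hij))
  obtain ⟨f, hf, H⟩ := dichotomy_ne P h
  refine ⟨f, hf, ?_⟩
  simp only [key] at H
  exact H

theorem count_const {ι κ : Type} [Fintype κ] (q g : MvPolynomial ι ℂ) (σ : (κ → ℂ) →ₗ[ℂ] (ι → ℂ)) (v x : ι → ℂ)
    (f : MvPolynomial κ ℂ) (hf : f ≠ 0) (D : ℕ)
    (h : ∀ η, eval η f ≠ 0 → (∃ w, FB q g σ v x η w) ∧
        ∀ S : Finset (ℂ × ℂ), (∀ w ∈ S, FB q g σ v x η w) → S.card ≤ D) :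
    ∃ (f' : MvPolynomial κ ℂ) (N : ℕ), f' ≠ 0 ∧ 0 < N ∧ N ≤ D ∧
      ∀ η, eval η f' ≠ 0 → {w | FB q g σ v x η w}.Finite ∧ {w | FB q g σ v x η w}.ncard = N := by
  classical
  choose fk hfk hd using count_dich q g σ v x
  set f' := f * ∏ k ∈ Finset.range (D + 2), fk k with hf'
  have hf0 : f' ≠ 0 := mul_ne_zero hf (Finset.prod_ne_zero_iff.2 fun k _ => hfk k)
  have hsub : ∀ η, eval η f' ≠ 0 → eval η f ≠ 0 ∧ ∀ k, k ≤ D + 1 → eval η (fk k) ≠ 0 := by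
    intro η hη
    rw [hf', map_mul, map_prod] at hη
    exact ⟨left_ne_zero_of_mul hη, fun k hk => Finset.prod_ne_zero_iff.1 (right_ne_zero_of_mul hη) k (by
      rw [Finset.mem_range]; omega)⟩
  have hfin : ∀ η, eval η f' ≠ 0 → {w | FB q g σ v x η w}.Finite := by
    intro η hη
    by_contra hinf
    obtain ⟨t, ht, htc⟩ := Set.Infinite.exists_subset_card_eq hinf (D + 1)
    have := (h η (hsub η hη).1).2 t fun w hw => ht hw
    omega
  have hle : ∀ η η', eval η f' ≠ 0 → eval η' f' ≠ 0 →
      {w | FB q g σ v x η w}.ncard ≤ {w | FB q g σ v x η' w}.ncard := by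
    intro η η' hη hη'
    rw [Set.ncard_eq_toFinset_card _ (hfin η hη), Set.ncard_eq_toFinset_card _ (hfin η' hη')]
    set S := (hfin η hη).toFinset with hS
    have hSF : ∀ w ∈ S, FB q g σ v x η w := fun w hw => (hfin η hη).mem_toFinset.1 hw
    have hSD := (h η (hsub η hη).1).2 S hSF
    rcases hd S.card with h1 | h1
    · exact absurd (h1 η ⟨S, rfl, hSF⟩) ((hsub η hη).2 _ (by omega))
    · obtain ⟨S', hc, hS'⟩ := h1 η' ((hsub η' hη').2 _ (by omega))
      rw [← hc]
      exact Finset.card_le_card fun w hw => (hfin η' hη').mem_toFinset.2 (hS' w hw)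
  obtain ⟨η, hη⟩ := exists_eval_ne hf0
  refine ⟨f', {w | FB q g σ v x η w}.ncard, hf0, ?_, ?_, fun η' hη' => ⟨hfin η' hη', le_antisymm (hle _ _ hη' hη) (hle _ _ hη hη')⟩⟩
  · exact (Set.ncard_pos (hfin η hη)).2 (h η (hsub η hη).1).1
  · rw [Set.ncard_eq_toFinset_card _ (hfin η hη)]
    exact (h η (hsub η hη).1).2 _ fun w hw => (hfin η hη).mem_toFinset.1 hw
end

open MvPolynomial
noncomputable section

theorem exists_scale {ι : Type} [Fintype ι] (f : MvPolynomial ι ℂ) (v : ι → ℂ) (i : ℕ)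
    (h : eval v (homogeneousComponent i f) ≠ 0) : ∃ t : ℂ, t ≠ 0 ∧ eval (t • v) f ≠ 0 := by
  by_contra hc
  push Not at hc
  set p : Polynomial ℂ := ∑ j ∈ Finset.range (f.totalDegree + 1),
    Polynomial.C (eval v (homogeneousComponent j f)) * Polynomial.X ^ j with hp
  have hev : ∀ t, p.eval t = eval (t • v) f := by
    intro t
    conv_rhs => rw [← sum_homogeneousComponent f]
    rw [map_sum, hp, Polynomial.eval_finsetSum]
    refine Finset.sum_congr rfl fun j _ => ?_
    rw [homog_eval (homogeneousComponent_isHomogeneous j f)]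
    rw [Polynomial.eval_mul, Polynomial.eval_C, Polynomial.eval_pow, Polynomial.eval_X, mul_comm]
  have hp0 : p * Polynomial.X = 0 := by
    refine Polynomial.funext fun t => ?_
    rw [Polynomial.eval_mul, Polynomial.eval_X, Polynomial.eval_zero, hev]
    by_cases ht : t = 0
    · rw [ht, mul_zero]
    · rw [hc t ht, zero_mul]
  have hp1 : p = 0 := (mul_eq_zero.1 hp0).resolve_right Polynomial.X_ne_zero
  have hi : i < f.totalDegree + 1 := by
    by_contra hlt
    exact h (by rw [homogeneousComponent_eq_zero _ _ (by omega), map_zero])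
  have hco : p.coeff i = eval v (homogeneousComponent i f) := by
    rw [hp, Polynomial.finsetSum_coeff]
    simp only [Polynomial.coeff_C_mul_X_pow]
    rw [Finset.sum_ite_eq, if_pos (Finset.mem_range.2 hi)]
  exact h (by rw [← hco, hp1, Polynomial.coeff_zero])

theorem upper_bound {n d : ℕ} (hn : 2 ≤ n) (hd : 0 < d) {q g : MvPolynomial (Fin (n + 3)) ℂ}
    (hq : IsSmoothHyp q 3) (hg : g.IsHomogeneous d) (hX : IsSmoothCI2 q g) :
    ∃ (φ : RatMapTo (Fin (n + 3)) n) (δ : ℕ), φ.DominantOfDegree (ZeroSet q ∩ ZeroSet g) δ ∧ δ ≤ 2 * d := by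
  obtain ⟨l, σ, v, x, f, hf, hli, hσ, hker, hb⟩ := exists_setup hn hd hq hg hX
  obtain ⟨f', N, hf', hN, hND, hcount⟩ := count_const q g σ v x f hf (2 * d) hb
  let φ : RatMapTo (Fin (n + 3)) n :=
    { F := fun j => linP (LinearMap.proj j ∘ₗ l)
      e := 1
      homog := fun j => by
        unfold linP
        refine IsHomogeneous.sum _ _ _ fun i _ => ?_
        simpa using (isHomogeneous_C _ _).mul (isHomogeneous_X ℂ i) }
  have hφ : ∀ u, φ.evalVec u = l u := fun u => by
    funext j
    exact eval_linP _ _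
  have hlv : ∀ s r : ℂ, l (s • v + r • x) = 0 := fun s r => (hker _).2 ⟨s, r, rfl⟩
  have hlu : ∀ (η : Fin (n + 1) → ℂ) (w : ℂ × ℂ), l (σ η + w.1 • v + w.2 • x) = η := fun η w => by
    rw [add_assoc, map_add, hσ, hlv, add_zero]
  have hnz : ∀ (η : Fin (n + 1) → ℂ), η ≠ 0 → ∀ w : ℂ × ℂ, σ η + w.1 • v + w.2 • x ≠ 0 := fun η hη w h0 =>
    hη (by rw [← hlu η w, h0, map_zero])
  refine ⟨φ, N, ⟨hN, {y | ∃ η, ∃ hη : η ≠ 0, Projectivization.mk ℂ η hη = y ∧ eval η f' ≠ 0}, ?_, ?_⟩, hND⟩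
  · refine ⟨{y | ∀ p ∈ Set.range (fun i => homogeneousComponent i f'), PVanish p y}, ⟨_, ?_, rfl⟩, ?_, ?_⟩
    · rintro p ⟨i, rfl⟩
      exact ⟨i, homogeneousComponent_isHomogeneous i f'⟩
    · intro hsub
      obtain ⟨η, hη⟩ := exists_eval_ne (mul_ne_zero hf' (X_ne_zero (R := ℂ) (0 : Fin (n + 1))))
      rw [map_mul, eval_X] at hη
      have h0 : η ≠ 0 := fun h => right_ne_zero_of_mul hη (by rw [h]; rfl)
      refine left_ne_zero_of_mul hη ?_
      rw [← sum_homogeneousComponent f', map_sum]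
      exact Finset.sum_eq_zero fun i _ => hsub (Set.mem_univ (Projectivization.mk ℂ η h0)) _ ⟨i, rfl⟩ η h0 rfl
    · rintro y ⟨-, hy⟩
      have : ∃ i, ¬ PVanish (homogeneousComponent i f') y := by
        by_contra hc
        push Not at hc
        refine hy ?_
        rintro p ⟨i, rfl⟩
        exact hc i
      obtain ⟨i, hi⟩ := this
      unfold PVanish at hi
      push Not at hi
      obtain ⟨u, hu, huy, hne⟩ := hi
      obtain ⟨t, ht, hte⟩ := exists_scale f' u i hne
      refine ⟨t • u, smul_ne_zero ht hu, ?_, hte⟩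
      rw [← huy, Projectivization.mk_eq_mk_iff']
      exact ⟨t, rfl⟩
  · rintro y ⟨η, hη, rfl, hη'⟩
    obtain ⟨hfin, hcard⟩ := hcount η hη'
    let m : ℂ × ℂ → PPt (Fin (n + 3)) := fun w => Projectivization.mk ℂ _ (hnz η hη w)
    have hinj : Function.Injective m := by
      intro w w' h
      obtain ⟨c, hc⟩ := (Projectivization.mk_eq_mk_iff' ℂ _ _ _ _).1 h
      have h1 := congrArg l hc
      rw [map_smul, hlu, hlu] at h1
      have hc1 : c = 1 := by
        have : (c - 1) • η = 0 := by rw [sub_smul, one_smul, h1, sub_self]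
        exact sub_eq_zero.1 ((smul_eq_zero.1 this).resolve_right hη)
      rw [hc1, one_smul] at hc
      have h2 : (w'.1 - w.1) • v + (w'.2 - w.2) • x = 0 := by
        have h3 := sub_eq_zero.2 hc
        rw [← h3]
        module
      obtain ⟨e1, e2⟩ := hli _ _ h2
      exact Prod.ext (sub_eq_zero.1 e1).symm (sub_eq_zero.1 e2).symm
    have hset : φ.fiber (ZeroSet q ∩ ZeroSet g) (Projectivization.mk ℂ η hη) = m '' {w | FB q g σ v x η w} := by
      ext z
      constructor
      · rintro ⟨⟨h1, h2⟩, h3⟩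
        induction z using Projectivization.ind with
        | h u hu =>
          obtain ⟨hw, he⟩ := h3 u hu rfl
          obtain ⟨c, hc⟩ := (Projectivization.mk_eq_mk_iff' ℂ _ _ _ _).1 he
          rw [hφ] at hc hw
          have hc0 : c ≠ 0 := by
            rintro rfl
            exact hw (by rw [← hc, zero_smul])
          have hu1 : l (c⁻¹ • u - σ η) = 0 := by
            rw [map_sub, map_smul, hσ, ← hc, smul_smul, inv_mul_cancel₀ hc0, one_smul, sub_self]
          obtain ⟨s, r, hsr⟩ := (hker _).1 hu1
          have hu2 : σ η + s • v + r • x = c⁻¹ • u := by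
            rw [add_assoc, ← hsr]; abel
          refine ⟨(s, r), ⟨?_, ?_⟩, ?_⟩
          · change eval (σ η + s • v + r • x) q = 0
            rw [hu2, homog_eval hq.1, h1 u hu rfl, mul_zero]
          · change eval (σ η + s • v + r • x) g = 0
            rw [hu2, homog_eval hg, h2 u hu rfl, mul_zero]
          · exact (Projectivization.mk_eq_mk_iff' ℂ _ _ _ _).2 ⟨c⁻¹, hu2.symm⟩
      · rintro ⟨w, ⟨hw1, hw2⟩, rfl⟩
        have key : ∀ (u : Fin (n + 3) → ℂ) (hu : u ≠ 0), Projectivization.mk ℂ u hu = m w →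
            ∃ c : ℂ, c • (σ η + w.1 • v + w.2 • x) = u := fun u hu he =>
          (Projectivization.mk_eq_mk_iff' ℂ _ _ _ _).1 he
        refine ⟨⟨fun u hu he => ?_, fun u hu he => ?_⟩, fun u hu he => ?_⟩
        · obtain ⟨c, rfl⟩ := key u hu he
          rw [homog_eval hq.1, hw1, mul_zero]
        · obtain ⟨c, rfl⟩ := key u hu he
          rw [homog_eval hg, hw2, mul_zero]
        · obtain ⟨c, rfl⟩ := key u hu he
          have hev : φ.evalVec (c • (σ η + w.1 • v + w.2 • x)) = c • η := by
            rw [hφ, map_smul, hlu]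
          have hc0 : c ≠ 0 := by
            rintro rfl
            exact hu (zero_smul _ _)
          refine ⟨by rw [hev]; exact smul_ne_zero hc0 hη, ?_⟩
          rw [Projectivization.mk_eq_mk_iff']
          exact ⟨c, hev.symm⟩
    rw [hset]
    exact ⟨hfin.image m, by rw [Set.ncard_image_of_injective _ hinj, hcard]⟩
end

theorem irr_bounds_divisor_in_cubic
    (n d : ℕ) (hn : n = 2 ∨ n = 3) (hd : 5 * n ≤ d + 2)
    (q g : MvPolynomial (Fin (n + 3)) ℂ)
    (hq : IsSmoothHyp q 3) (hg : g.IsHomogeneous d) (hX : IsSmoothCI2 q g) :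
    2 * (d - n) + 2 ≤ irr n (ZeroSet q ∩ ZeroSet g) ∧
    irr n (ZeroSet q ∩ ZeroSet g) ≤ 2 * d := by
  obtain ⟨φ, δ, hφ, hδ⟩ := upper_bound (by omega) (by omega) hq hg hX
  constructor
  · obtain ⟨ψ, hψ⟩ := Nat.sInf_mem (s := {δ : ℕ | ∃ φ : RatMapTo (Fin (n + 3)) n,
      φ.DominantOfDegree (ZeroSet q ∩ ZeroSet g) δ}) ⟨δ, φ, hφ⟩
    exact lower_bound hn hd hq hg hX hψ
  · exact le_trans (Nat.sInf_le ⟨φ, hφ⟩) hδ
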